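/- Let n ≥ 2 and let c ⊂ ℝ^n be a compact connected smooth embedded hypersurface (an (n−1)-dimensional smooth embedded submanifold of ℝ^n). Then there exist λ > 0, a smooth function f : ℝ^n → ℝ satisfying Δf + f = 0 on ℝ^n, and a diffeomorphism Ψ : ℝ^n → ℝ^n, such that Ψ(λc) is a connected component of the zero set f^{−1}(0) and the gradient ∇f is nonvanishing on Ψ(λc); here λc = { λx : x ∈ c }. In particular, f^{−1}(0) has a connected component diffeomorphic to c. -/

import Mathlib

open MeasureTheory Real

noncomputable section

/-- The Euclidean Laplacian `Δf = Σᵢ ∂²f/∂xᵢ²` of a function on `ℝ^n`. -/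
def laplacian {n : ℕ} (f : EuclideanSpace ℝ (Fin n) → ℝ) (x : EuclideanSpace ℝ (Fin n)) : ℝ :=
  ∑ i : Fin n,
    fderiv ℝ (fun y => fderiv ℝ f y (EuclideanSpace.single i 1)) x (EuclideanSpace.single i 1)

/-- `c` is a smooth embedded hypersurface of `ℝ^n`: near each of its points it is a regular
level set of a smooth function. -/
def IsSmoothHypersurface {n : ℕ} (c : Set (EuclideanSpace ℝ (Fin n))) : Prop :=
  ∀ x ∈ c, ∃ (U : Set (EuclideanSpace ℝ (Fin n))) (F : EuclideanSpace ℝ (Fin n) → ℝ),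
    IsOpen U ∧ x ∈ U ∧ ContDiffOn ℝ (⊤ : ℕ∞) F U ∧ (∀ y ∈ U, fderiv ℝ F y ≠ 0) ∧
    c ∩ U = {y ∈ U | F y = 0}

section
open scoped ContDiff Topology RealInnerProductSpace Convolution
open Set Filter
variable {n : ℕ}

/-- Euclidean `n`-space. -/
abbrev Eu (n : ℕ) := EuclideanSpace ℝ (Fin n)

theorem integral_mul_fderiv_of_hasCompactSupport {H : Type*} [NormedAddCommGroup H]
    [NormedSpace ℝ H] [FiniteDimensional ℝ H] [MeasurableSpace H] [BorelSpace H]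
    (ν : Measure H) [ν.IsAddHaarMeasure] {f g : H → ℝ} (hf : ContDiff ℝ 1 f)
    (hg : ContDiff ℝ 1 g) (hc : HasCompactSupport g) (v : H) :
    ∫ x, f x * fderiv ℝ g x v ∂ν = - ∫ x, fderiv ℝ f x v * g x ∂ν := by
  have hf' : Continuous fun x => fderiv ℝ f x v :=
    (hf.continuous_fderiv one_ne_zero).clm_apply continuous_const
  have hg' : Continuous fun x => fderiv ℝ g x v :=
    (hg.continuous_fderiv one_ne_zero).clm_apply continuous_const
  have hgc' : HasCompactSupport fun x => fderiv ℝ g x v := hc.fderiv_apply ℝ v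
  apply integral_mul_fderiv_eq_neg_fderiv_mul_of_integrable
  · exact (hf'.mul hg.continuous).integrable_of_hasCompactSupport hc.mul_left
  · exact (hf.continuous.mul hg').integrable_of_hasCompactSupport hgc'.mul_left
  · exact (hf.continuous.mul hg.continuous).integrable_of_hasCompactSupport hc.mul_left
  · exact fun x _ => hf.differentiable one_ne_zero x
  · exact fun x _ => hg.differentiable one_ne_zero x


/-- The `i`-th partial derivative. -/
def pd (i : Fin n) (f : Eu n → ℝ) : Eu n → ℝ :=
  fun x => fderiv ℝ f x (EuclideanSpace.single i 1)

theorem laplacian_eq_sum_pd (f : Eu n → ℝ) (x : Eu n) :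
    laplacian f x = ∑ i, pd i (pd i f) x := rfl

theorem ContDiff.pd {f : Eu n → ℝ} (hf : ContDiff ℝ ∞ f) (i : Fin n) :
    ContDiff ℝ ∞ (pd i f) :=
  (hf.fderiv_right (m := ∞) (by simp)).clm_apply contDiff_const

theorem ContDiff.laplacian {f : Eu n → ℝ} (hf : ContDiff ℝ ∞ f) :
    ContDiff ℝ ∞ (laplacian f) :=
  ContDiff.sum fun i _ => (hf.pd i).pd i

theorem tsupport_pd_subset (i : Fin n) (f : Eu n → ℝ) : tsupport (pd i f) ⊆ tsupport f :=
  tsupport_fderiv_apply_subset ℝ _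

theorem HasCompactSupport.pd {f : Eu n → ℝ} (hf : HasCompactSupport f) (i : Fin n) :
    HasCompactSupport (pd i f) := hf.fderiv_apply ℝ _

theorem Filter.EventuallyEq.pd {f g : Eu n → ℝ} {x : Eu n} (h : f =ᶠ[𝓝 x] g) (i : Fin n) :
    pd i f =ᶠ[𝓝 x] pd i g := by
  filter_upwards [h.fderiv (𝕜 := ℝ)] with y hy
  simp only [_root_.pd, hy]

theorem Filter.EventuallyEq.laplacian {f g : Eu n → ℝ} {x : Eu n} (h : f =ᶠ[𝓝 x] g) :
    laplacian f =ᶠ[𝓝 x] laplacian g := by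
  have := fun i => (h.pd i).pd i
  filter_upwards [eventually_all.2 this] with y hy
  simp only [laplacian_eq_sum_pd, hy]

theorem laplacian_eq_zero_of_notMem_tsupport {f : Eu n → ℝ} {x : Eu n} (hx : x ∉ tsupport f) :
    laplacian f x = 0 := by
  have h : f =ᶠ[𝓝 x] fun _ => 0 := notMem_tsupport_iff_eventuallyEq.1 hx
  rw [h.laplacian.eq_of_nhds]
  simp [_root_.laplacian]

theorem HasCompactSupport.laplacian {f : Eu n → ℝ} (hf : HasCompactSupport f) :
    HasCompactSupport (laplacian f) :=
  hf.of_isClosed_subset (isClosed_tsupport _) (closure_minimal (fun x hx => by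
    by_contra h
    exact hx (laplacian_eq_zero_of_notMem_tsupport h)) (isClosed_tsupport _))

theorem pd_add {f g : Eu n → ℝ} {x : Eu n} (hf : DifferentiableAt ℝ f x)
    (hg : DifferentiableAt ℝ g x) (i : Fin n) :
    pd i (fun y => f y + g y) x = pd i f x + pd i g x := by
  simp [pd, fderiv_fun_add hf hg]

theorem pd_mul {f g : Eu n → ℝ} {x : Eu n} (hf : DifferentiableAt ℝ f x)
    (hg : DifferentiableAt ℝ g x) (i : Fin n) :
    pd i (fun y => f y * g y) x = f x * pd i g x + pd i f x * g x := by
  simp [pd, fderiv_fun_mul hf hg]; ring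

theorem pd_const_mul {f : Eu n → ℝ} {x : Eu n} (hf : DifferentiableAt ℝ f x) (c : ℝ)
    (i : Fin n) : pd i (fun y => c * f y) x = c * pd i f x := by
  simp [pd, fderiv_const_mul hf]

theorem ContDiffOn.contDiffAt_of_isOpen {f : Eu n → ℝ} {U : Set (Eu n)} {x : Eu n}
    (hf : ContDiffOn ℝ ∞ f U) (hU : IsOpen U) (hx : x ∈ U) : ContDiffAt ℝ ∞ f x :=
  hf.contDiffAt (hU.mem_nhds hx)

theorem ContDiffAt.pd {f : Eu n → ℝ} {x : Eu n} (hf : ContDiffAt ℝ ∞ f x) (i : Fin n) :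
    ContDiffAt ℝ ∞ (pd i f) x :=
  (hf.fderiv_right (m := ∞) (by simp)).clm_apply contDiffAt_const

theorem ContDiffAt.eventually_differentiableAt {f : Eu n → ℝ} {x : Eu n}
    (hf : ContDiffAt ℝ ∞ f x) : ∀ᶠ y in 𝓝 x, DifferentiableAt ℝ f y := by
  filter_upwards [(hf.of_le (m := 1) (by norm_cast)).eventually (by simp)] with y hy
  exact hy.differentiableAt one_ne_zero

theorem laplacian_add {f g : Eu n → ℝ} {x : Eu n} (hf : ContDiffAt ℝ ∞ f x)
    (hg : ContDiffAt ℝ ∞ g x) :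
    laplacian (fun y => f y + g y) x = laplacian f x + laplacian g x := by
  simp only [laplacian_eq_sum_pd, ← Finset.sum_add_distrib]
  refine Finset.sum_congr rfl fun i _ => ?_
  have : pd i (fun y => f y + g y) =ᶠ[𝓝 x] fun y => pd i f y + pd i g y := by
    filter_upwards [hf.eventually_differentiableAt, hg.eventually_differentiableAt] with y h1 h2
    exact pd_add h1 h2 i
  rw [(this.pd i).eq_of_nhds, pd_add ((hf.pd i).differentiableAt (by simp))
    ((hg.pd i).differentiableAt (by simp))]

theorem laplacian_const_mul {f : Eu n → ℝ} {x : Eu n} (hf : ContDiffAt ℝ ∞ f x) (c : ℝ) :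
    laplacian (fun y => c * f y) x = c * laplacian f x := by
  simp only [laplacian_eq_sum_pd, Finset.mul_sum]
  refine Finset.sum_congr rfl fun i _ => ?_
  have : pd i (fun y => c * f y) =ᶠ[𝓝 x] fun y => c * pd i f y := by
    filter_upwards [hf.eventually_differentiableAt] with y h1
    exact pd_const_mul h1 c i
  rw [(this.pd i).eq_of_nhds, pd_const_mul ((hf.pd i).differentiableAt (by simp))]

theorem laplacian_const (c : ℝ) (x : Eu n) : laplacian (fun _ : Eu n => c) x = 0 := by
  simp [laplacian]

theorem laplacian_mul {f g : Eu n → ℝ} {x : Eu n} (hf : ContDiffAt ℝ ∞ f x)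
    (hg : ContDiffAt ℝ ∞ g x) :
    laplacian (fun y => f y * g y) x =
      f x * laplacian g x + 2 * ∑ i, pd i f x * pd i g x + laplacian f x * g x := by
  simp only [laplacian_eq_sum_pd, Finset.mul_sum, Finset.sum_mul, ← Finset.sum_add_distrib]
  refine Finset.sum_congr rfl fun i _ => ?_
  have : pd i (fun y => f y * g y) =ᶠ[𝓝 x] fun y => f y * pd i g y + pd i f y * g y := by
    filter_upwards [hf.eventually_differentiableAt, hg.eventually_differentiableAt] with y h1 h2
    exact pd_mul h1 h2 i
  have hf1 := hf.differentiableAt (n := ∞) (by simp)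
  have hg1 := hg.differentiableAt (n := ∞) (by simp)
  have hf2 := (hf.pd i).differentiableAt (n := ∞) (by simp)
  have hg2 := (hg.pd i).differentiableAt (n := ∞) (by simp)
  rw [(this.pd i).eq_of_nhds, pd_add (hf1.fun_mul hg2) (hf2.fun_mul hg1), pd_mul hf1 hg2, pd_mul hf2 hg1]
  ring

theorem pd_comp {β : ℝ → ℝ} {f : Eu n → ℝ} {x : Eu n} (hβ : DifferentiableAt ℝ β (f x))
    (hf : DifferentiableAt ℝ f x) (i : Fin n) :
    pd i (fun y => β (f y)) x = deriv β (f x) * pd i f x := by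
  have := (hβ.hasDerivAt.comp_hasFDerivAt x hf.hasFDerivAt).fderiv
  simp only [Function.comp_def] at this
  simp [pd, this]

theorem laplacian_comp {β : ℝ → ℝ} {f : Eu n → ℝ} {x : Eu n} (hβ : ContDiff ℝ ∞ β)
    (hf : ContDiffAt ℝ ∞ f x) :
    laplacian (fun y => β (f y)) x =
      deriv (deriv β) (f x) * ∑ i, pd i f x ^ 2 + deriv β (f x) * laplacian f x := by
  simp only [laplacian_eq_sum_pd, Finset.mul_sum, ← Finset.sum_add_distrib]
  refine Finset.sum_congr rfl fun i _ => ?_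
  have hβ' : ContDiff ℝ ∞ (deriv β) := by
    exact (contDiff_infty_iff_deriv.1 hβ).2
  have : pd i (fun y => β (f y)) =ᶠ[𝓝 x] fun y => deriv β (f y) * pd i f y := by
    filter_upwards [hf.eventually_differentiableAt] with y h1
    exact pd_comp (hβ.differentiable (by simp) _) h1 i
  have hf1 := hf.differentiableAt (n := ∞) (by simp)
  have hf2 := (hf.pd i).differentiableAt (n := ∞) (by simp)
  have hb := hβ'.differentiable (by simp) (f x)
  rw [(this.pd i).eq_of_nhds, pd_mul (f := fun y => deriv β (f y)) (hb.comp x hf1) hf2, pd_comp hb hf1]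
  ring

/-- Smooth functions with compact support inside `U`. -/
structure IsTest (U : Set (Eu n)) (ψ : Eu n → ℝ) : Prop where
  contDiff : ContDiff ℝ ∞ ψ
  hasCompactSupport : HasCompactSupport ψ
  tsupport_subset : tsupport ψ ⊆ U

theorem IsTest.mono {U V : Set (Eu n)} {ψ : Eu n → ℝ} (h : IsTest U ψ) (hUV : U ⊆ V) :
    IsTest V ψ := ⟨h.1, h.2, h.3.trans hUV⟩

theorem IsTest.pd {U : Set (Eu n)} {ψ : Eu n → ℝ} (h : IsTest U ψ) (i : Fin n) :
    IsTest U (pd i ψ) := ⟨h.1.pd i, h.2.pd i, (tsupport_pd_subset i ψ).trans h.3⟩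

theorem integral_mul_pd {f ψ : Eu n → ℝ} (hf : ContDiff ℝ ∞ f) (hψ : ContDiff ℝ ∞ ψ)
    (hc : HasCompactSupport ψ) (i : Fin n) :
    ∫ x, f x * pd i ψ x = - ∫ x, pd i f x * ψ x :=
  integral_mul_fderiv_of_hasCompactSupport volume (hf.of_le (by norm_cast))
    (hψ.of_le (by norm_cast)) hc _

theorem integrable_mul_of_hasCompactSupport {f ψ : Eu n → ℝ} (hf : Continuous f)
    (hψ : Continuous ψ) (hc : HasCompactSupport ψ) : Integrable fun x => f x * ψ x :=
  (hf.mul hψ).integrable_of_hasCompactSupport hc.mul_left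

theorem integral_mul_laplacian {f ψ : Eu n → ℝ} (hf : ContDiff ℝ ∞ f) (hψ : ContDiff ℝ ∞ ψ)
    (hc : HasCompactSupport ψ) :
    ∫ x, f x * laplacian ψ x = - ∑ i, ∫ x, pd i f x * pd i ψ x := by
  simp only [laplacian_eq_sum_pd, Finset.mul_sum]
  rw [integral_finsetSum _ fun i _ => integrable_mul_of_hasCompactSupport hf.continuous
    ((hψ.pd i).pd i).continuous ((hc.pd i).pd i), ← Finset.sum_neg_distrib]
  exact Finset.sum_congr rfl fun i _ => integral_mul_pd hf (hψ.pd i) (hc.pd i) i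

theorem integral_laplacian_mul {f ψ : Eu n → ℝ} (hf : ContDiff ℝ ∞ f) (hψ : ContDiff ℝ ∞ ψ)
    (hc : HasCompactSupport ψ) :
    ∫ x, laplacian f x * ψ x = - ∑ i, ∫ x, pd i f x * pd i ψ x := by
  simp only [laplacian_eq_sum_pd, Finset.sum_mul]
  rw [integral_finsetSum _ fun i _ => integrable_mul_of_hasCompactSupport
    ((hf.pd i).pd i).continuous hψ.continuous hc, ← Finset.sum_neg_distrib]
  refine Finset.sum_congr rfl fun i _ => ?_
  rw [integral_mul_pd (hf.pd i) hψ hc i, neg_neg]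

theorem hasDerivAt_integral_of_contDiff {H : Type*} [NormedAddCommGroup H]
    [NormedSpace ℝ H] [FiniteDimensional ℝ H] [MeasurableSpace H] [BorelSpace H]
    (ν : Measure H) [IsFiniteMeasureOnCompacts ν] {g : ℝ × H → ℝ} (hg : ContDiff ℝ 1 g)
    {k : Set H} (hk : IsCompact k) (h0 : ∀ t, ∀ Y ∉ k, g (t, Y) = 0) (t₀ : ℝ) :
    HasDerivAt (fun t => ∫ Y, g (t, Y) ∂ν) (∫ Y, deriv (fun t => g (t, Y)) t₀ ∂ν) t₀ := by
  have hder : ∀ t Y, HasDerivAt (fun t => g (t, Y)) (fderiv ℝ g (t, Y) (1, 0)) t := fun t Y =>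
    ((hg.differentiable one_ne_zero (t, Y)).hasFDerivAt).comp_hasDerivAt t
      ((hasDerivAt_id t).prodMk (hasDerivAt_const t Y))
  have hcont : Continuous fun p : ℝ × H => fderiv ℝ g p (1, 0) :=
    (hg.continuous_fderiv one_ne_zero).clm_apply continuous_const
  obtain ⟨C, hC⟩ := ((isCompact_Icc (a := t₀ - 1) (b := t₀ + 1)).prod hk).exists_bound_of_continuousOn
    hcont.continuousOn
  have hd0 : ∀ t, ∀ Y ∉ k, fderiv ℝ g (t, Y) (1, 0) = 0 := fun t Y hY => by
    have h1 := hder t Y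
    have h2 : (fun t => g (t, Y)) = fun _ => 0 := funext fun t => h0 t Y hY
    rw [h2] at h1
    exact h1.unique (hasDerivAt_const t 0)
  have hcs : ∀ t, HasCompactSupport fun Y => g (t, Y) := fun t =>
    HasCompactSupport.intro hk (h0 t)
  have hintg : ∀ t, Integrable (fun Y => g (t, Y)) ν := fun t =>
    (hg.continuous.comp (by fun_prop)).integrable_of_hasCompactSupport (hcs t)
  have hmeas : AEStronglyMeasurable (fun Y => fderiv ℝ g (t₀, Y) (1, 0)) ν :=
    (hcont.comp (by fun_prop : Continuous fun Y : H => (t₀, Y))).aestronglyMeasurable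
  have := (hasDerivAt_integral_of_dominated_loc_of_deriv_le (μ := ν)
    (F := fun t Y => g (t, Y)) (F' := fun t Y => fderiv ℝ g (t, Y) (1, 0)) (x₀ := t₀)
    (bound := k.indicator fun _ => C) (s := Metric.closedBall t₀ 1)
    (Metric.closedBall_mem_nhds t₀ one_pos)
    (Eventually.of_forall fun t => (hintg t).aestronglyMeasurable) (hintg t₀) hmeas
    (Eventually.of_forall fun Y t ht => ?_) ?_ (Eventually.of_forall fun Y t _ => hder t Y)).2
  · simpa only [(hder t₀ _).deriv] using this
  · by_cases hY : Y ∈ k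
    · rw [indicator_of_mem hY]
      refine hC (t, Y) ⟨?_, hY⟩
      rwa [Real.closedBall_eq_Icc] at ht
    · rw [indicator_of_notMem hY, hd0 t Y hY, norm_zero]
  · exact (integrable_indicator_iff hk.measurableSet).2
      (integrableOn_const hk.measure_lt_top.ne)

/-- The profile of the averaging kernel: smooth, positive on `(-∞, 1)` and zero on `[1, ∞)`. -/
def profile (q : ℝ) : ℝ := expNegInvGlue (1 - q)

theorem contDiff_profile : ContDiff ℝ ∞ profile :=
  expNegInvGlue.contDiff.comp (contDiff_const.sub contDiff_id)

theorem profile_nonneg (q : ℝ) : 0 ≤ profile q := expNegInvGlue.nonneg _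

theorem profile_pos {q : ℝ} (hq : q < 1) : 0 < profile q :=
  expNegInvGlue.pos_of_pos (sub_pos.2 hq)

theorem profile_eq_zero {q : ℝ} (hq : 1 ≤ q) : profile q = 0 :=
  expNegInvGlue.zero_of_nonpos (sub_nonpos.2 hq)

/-- The primitive of `-profile / 2` that vanishes on `[1, ∞)`. -/
def profilePrimitive (q : ℝ) : ℝ := -(1 / 2) * ∫ t in (1)..q, profile t

theorem hasDerivAt_profilePrimitive (q : ℝ) :
    HasDerivAt profilePrimitive (-(1 / 2) * profile q) q :=
  (intervalIntegral.integral_hasDerivAt_right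
    (contDiff_profile.continuous.intervalIntegrable _ _)
    contDiff_profile.continuous.stronglyMeasurable.stronglyMeasurableAtFilter
    contDiff_profile.continuous.continuousAt).const_mul _

theorem contDiff_profilePrimitive : ContDiff ℝ ∞ profilePrimitive := by
  rw [contDiff_infty_iff_deriv]
  refine ⟨fun q => (hasDerivAt_profilePrimitive q).differentiableAt, ?_⟩
  rw [funext fun q => (hasDerivAt_profilePrimitive q).deriv]
  exact contDiff_const.mul contDiff_profile

theorem profilePrimitive_eq_zero {q : ℝ} (hq : 1 ≤ q) : profilePrimitive q = 0 := by
  have : ∫ t in (1)..q, profile t = ∫ t in (1)..q, (0 : ℝ) :=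
    intervalIntegral.integral_congr fun t ht => profile_eq_zero (by
      rw [uIcc_of_le hq] at ht; exact ht.1)
  simp [profilePrimitive, this]

/-- The squared Euclidean norm on `ℝ^n × ℝ`. -/
def sqNorm (Y : Eu n × ℝ) : ℝ := ‖Y.1‖ ^ 2 + Y.2 ^ 2

theorem contDiff_sqNorm : ContDiff ℝ ∞ (sqNorm (n := n)) :=
  (contDiff_fst.norm_sq ℝ).add (contDiff_snd.pow 2)

theorem one_le_sqNorm {Y : Eu n × ℝ}
    (hY : Y ∉ Metric.closedBall (0 : Eu n) 1 ×ˢ Metric.closedBall (0 : ℝ) 1) : 1 ≤ sqNorm Y := by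
  rw [mem_prod, not_and_or] at hY
  simp only [mem_closedBall_zero_iff, not_le, Real.norm_eq_abs] at hY
  unfold sqNorm
  rcases hY with h | h
  · nlinarith [sq_nonneg Y.2]
  · nlinarith [sq_nonneg ‖Y.1‖, sq_abs Y.2]

theorem fderiv_shift_mul {u : Eu n → ℝ} {c : ℝ → ℝ} (hu : ContDiff ℝ ∞ u) (hc : ContDiff ℝ ∞ c)
    (x : Eu n) (σ : ℝ) (Y h : Eu n × ℝ) :
    fderiv ℝ (fun Y : Eu n × ℝ => u (x + σ • Y.1) * c Y.2) Y h =
      σ * fderiv ℝ u (x + σ • Y.1) h.1 * c Y.2 + u (x + σ • Y.1) * (deriv c Y.2 * h.2) := by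
  have h1 : HasFDerivAt (fun Y : Eu n × ℝ => u (x + σ • Y.1))
      ((fderiv ℝ u (x + σ • Y.1)).comp (σ • ContinuousLinearMap.fst ℝ (Eu n) ℝ)) Y :=
    ((hu.differentiable (by simp) _).hasFDerivAt).comp Y
      ((hasFDerivAt_fst.const_smul σ).const_add x)
  have h2 : HasFDerivAt (fun Y : Eu n × ℝ => c Y.2)
      (deriv c Y.2 • ContinuousLinearMap.snd ℝ (Eu n) ℝ) Y :=
    ((hc.differentiable (by simp) Y.2).hasDerivAt).comp_hasFDerivAt Y hasFDerivAt_snd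
  rw [(h1.fun_mul h2).fderiv]
  simp
  ring

theorem fderiv_profilePrimitive_sqNorm (Y h : Eu n × ℝ) :
    fderiv ℝ (fun Y => profilePrimitive (sqNorm Y)) Y h =
      - profile (sqNorm Y) * (⟪Y.1, h.1⟫ + Y.2 * h.2) := by
  have h1 : HasFDerivAt (fun Y : Eu n × ℝ => ‖Y.1‖ ^ 2)
      ((2 • (innerSL ℝ Y.1)).comp (ContinuousLinearMap.fst ℝ (Eu n) ℝ)) Y :=
    ((hasStrictFDerivAt_norm_sq Y.1).hasFDerivAt).comp Y hasFDerivAt_fst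
  have h2 : HasFDerivAt (fun Y : Eu n × ℝ => Y.2 ^ 2)
      ((2 * Y.2) • ContinuousLinearMap.snd ℝ (Eu n) ℝ) Y := by
    have := (hasDerivAt_pow 2 Y.2).comp_hasFDerivAt Y
      (hasFDerivAt_snd : HasFDerivAt (𝕜 := ℝ) (fun Y : Eu n × ℝ => Y.2) _ Y)
    simpa [Function.comp_def] using this
  have h3 : HasFDerivAt (sqNorm (n := n)) _ Y := h1.add h2
  have := ((hasDerivAt_profilePrimitive (sqNorm Y)).comp_hasFDerivAt Y h3).fderiv
  rw [show (fun Y : Eu n × ℝ => profilePrimitive (sqNorm Y)) = profilePrimitive ∘ sqNorm from rfl,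
    this]
  simp
  ring

theorem fderiv_eq_sum_pd (f : Eu n → ℝ) (x y : Eu n) :
    fderiv ℝ f x y = ∑ i, y i * pd i f x := by
  conv_lhs => rw [← (EuclideanSpace.basisFun (Fin n) ℝ).sum_repr y]
  simp [pd, map_sum, map_smul]

/-- The mean value property for `Δv + om²v = 0`, from adding one variable. -/
theorem integral_shift_profile {v : Eu n → ℝ} (hv : ContDiff ℝ ∞ v) {om R r : ℝ} {x : Eu n}
    (hr : 0 < r) (hrR : r < R)
    (hH : ∀ y ∈ Metric.ball x R, laplacian v y + om ^ 2 * v y = 0) :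
    ∫ Y : Eu n × ℝ, v (x + r • Y.1) * cosh (om * (r * Y.2)) * profile (sqNorm Y) =
      v x * ∫ Y : Eu n × ℝ, profile (sqNorm Y) := by
  have : (volume : Measure (Eu n × ℝ)).IsAddHaarMeasure :=
    inferInstanceAs ((volume : Measure (Eu n)).prod (volume : Measure ℝ)).IsAddHaarMeasure
  have hη : ContDiff ℝ ∞ fun Y : Eu n × ℝ => profile (sqNorm Y) :=
    contDiff_profile.comp contDiff_sqNorm
  have hZ : ContDiff ℝ ∞ fun Y : Eu n × ℝ => profilePrimitive (sqNorm Y) :=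
    contDiff_profilePrimitive.comp contDiff_sqNorm
  have hk : IsCompact (Metric.closedBall (0 : Eu n) 1 ×ˢ Metric.closedBall (0 : ℝ) 1) :=
    (isCompact_closedBall _ _).prod (isCompact_closedBall _ _)
  have hZc : HasCompactSupport fun Y : Eu n × ℝ => profilePrimitive (sqNorm Y) :=
    HasCompactSupport.intro hk fun Y hY => profilePrimitive_eq_zero (one_le_sqNorm hY)
  have hcosh : ∀ a : ℝ, ContDiff ℝ ∞ fun s => cosh (a * s) := fun a =>
    Real.contDiff_cosh.comp (contDiff_const.mul contDiff_id)
  have hsinh : ∀ a : ℝ, ContDiff ℝ ∞ fun s => sinh (a * s) := fun a =>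
    Real.contDiff_sinh.comp (contDiff_const.mul contDiff_id)
  have hdcosh : ∀ a s : ℝ, deriv (fun s => cosh (a * s)) s = a * sinh (a * s) := fun a s => by
    have := ((hasDerivAt_id s).const_mul a).cosh.deriv
    simpa [mul_comm] using this
  have hdsinh : ∀ a s : ℝ, deriv (fun s => sinh (a * s)) s = a * cosh (a * s) := fun a s => by
    have := ((hasDerivAt_id s).const_mul a).sinh.deriv
    simpa [mul_comm] using this
  set J : ℝ → ℝ := fun σ =>
    ∫ Y : Eu n × ℝ, v (x + σ • Y.1) * cosh (om * (σ * Y.2)) * profile (sqNorm Y) with hJ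
  have hJd : ∀ σ ∈ Ico (0 : ℝ) R, HasDerivAt J 0 σ := by
    intro σ hσ
    have hg : ContDiff ℝ ∞ fun p : ℝ × (Eu n × ℝ) =>
        v (x + p.1 • p.2.1) * cosh (om * (p.1 * p.2.2)) * profile (sqNorm p.2) := by
      refine ((hv.comp (contDiff_const.add (contDiff_fst.smul (contDiff_fst.comp contDiff_snd)))).mul
        (Real.contDiff_cosh.comp (contDiff_const.mul
          (contDiff_fst.mul (contDiff_snd.comp contDiff_snd))))).mul (hη.comp contDiff_snd)
    have h1 := hasDerivAt_integral_of_contDiff (volume : Measure (Eu n × ℝ))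
      (hg.of_le (by norm_cast)) hk (fun t Y hY => by
        simp [profile_eq_zero (one_le_sqNorm hY)]) σ
    convert h1 using 1
    have hpt : ∀ Y : Eu n × ℝ,
        deriv (fun t => v (x + t • Y.1) * cosh (om * (t * Y.2)) * profile (sqNorm Y)) σ =
        - ∑ i, (pd i v (x + σ • Y.1) * cosh (om * σ * Y.2)) *
            fderiv ℝ (fun Y => profilePrimitive (sqNorm Y)) Y (EuclideanSpace.single i 1, 0)
        - (v (x + σ • Y.1) * (om * sinh (om * σ * Y.2))) *
            fderiv ℝ (fun Y => profilePrimitive (sqNorm Y)) Y (0, 1) := by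
      intro Y
      have d1 : HasDerivAt (fun t : ℝ => v (x + t • Y.1)) (fderiv ℝ v (x + σ • Y.1) Y.1) σ := by
        have := (hv.differentiable (by simp) (x + σ • Y.1)).hasFDerivAt.comp_hasDerivAt σ
          (((hasDerivAt_id σ).smul_const Y.1).const_add x)
        simpa [Function.comp_def] using this
      have d2 : HasDerivAt (fun t : ℝ => cosh (om * (t * Y.2)))
          (sinh (om * (σ * Y.2)) * (om * (1 * Y.2))) σ :=
        (((hasDerivAt_id σ).mul_const Y.2).const_mul om).cosh
      have d3 := (((d1.mul d2).mul_const (profile (sqNorm Y))).deriv)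
      simp only [Pi.mul_apply] at d3
      rw [d3]
      simp only [fderiv_profilePrimitive_sqNorm, fderiv_eq_sum_pd v]
      have e1 : ∀ i, ⟪Y.1, EuclideanSpace.single i (1 : ℝ)⟫ = Y.1 i := fun i => by
        simp [EuclideanSpace.inner_single_right]
      simp only [e1, inner_zero_right, mul_zero, add_zero, zero_add, mul_one, one_mul,
        Finset.sum_mul, ← mul_assoc, add_mul, sub_eq_add_neg, ← Finset.sum_neg_distrib]
      congr 1
      · exact Finset.sum_congr rfl fun i _ => by ring
      · ring
    have hf : ∀ i, ContDiff ℝ ∞ fun Y : Eu n × ℝ => pd i v (x + σ • Y.1) * cosh (om * σ * Y.2) :=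
      fun i => ((hv.pd i).comp (contDiff_const.add (contDiff_fst.const_smul σ))).mul
        ((hcosh _).comp contDiff_snd)
    have hf' : ContDiff ℝ ∞ fun Y : Eu n × ℝ => v (x + σ • Y.1) * (om * sinh (om * σ * Y.2)) :=
      (hv.comp (contDiff_const.add (contDiff_fst.const_smul σ))).mul
        (contDiff_const.mul ((hsinh _).comp contDiff_snd))
    have hintg : ∀ (f : Eu n × ℝ → ℝ) (b : Eu n × ℝ), Continuous f →
        Integrable fun Y => f Y * fderiv ℝ (fun Y => profilePrimitive (sqNorm Y)) Y b :=
      fun f b hf => (hf.mul ((hZ.continuous_fderiv (by simp)).clm_apply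
        continuous_const)).integrable_of_hasCompactSupport (hZc.fderiv_apply ℝ b).mul_left
    simp_rw [hpt]
    have hle : (1 : WithTop ℕ∞) ≤ ∞ := by norm_cast
    rw [integral_sub (Integrable.fun_neg (integrable_finsetSum _ fun i _ =>
      hintg _ _ (hf i).continuous))
      (hintg _ _ hf'.continuous), integral_neg,
      integral_finsetSum _ fun i _ => hintg _ _ (hf i).continuous,
      integral_mul_fderiv_of_hasCompactSupport volume (hf'.of_le hle) (hZ.of_le hle) hZc]
    simp_rw [fun i => integral_mul_fderiv_of_hasCompactSupport volume ((hf i).of_le hle)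
      (hZ.of_le hle) hZc (EuclideanSpace.single i 1, 0)]
    have hintgZ : ∀ (f : Eu n × ℝ → ℝ) (b : Eu n × ℝ), ContDiff ℝ ∞ f →
        Integrable fun Y => fderiv ℝ f Y b * profilePrimitive (sqNorm Y) :=
      fun f b hf => (((hf.continuous_fderiv (by simp)).clm_apply
        continuous_const).mul hZ.continuous).integrable_of_hasCompactSupport hZc.mul_left
    rw [Finset.sum_neg_distrib, neg_neg, sub_neg_eq_add,
      ← integral_finsetSum _ fun i _ => hintgZ _ _ (hf i),
      ← integral_add (integrable_finsetSum _ fun i _ => hintgZ _ _ (hf i)) (hintgZ _ _ hf')]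
    symm
    apply integral_eq_zero_of_ae
    refine Eventually.of_forall fun Y => ?_
    by_cases hY : Y ∈ Metric.closedBall (0 : Eu n) 1 ×ˢ Metric.closedBall (0 : ℝ) 1
    · have hmem : x + σ • Y.1 ∈ Metric.ball x R := by
        have : ‖Y.1‖ ≤ 1 := by simpa using hY.1
        rw [Metric.mem_ball, dist_eq_norm, add_sub_cancel_left, norm_smul, Real.norm_eq_abs,
          abs_of_nonneg hσ.1]
        nlinarith [hσ.2, hσ.1]
      have := hH _ hmem
      have e2 : ∀ Y : Eu n × ℝ, deriv (fun s => om * sinh (om * σ * s)) Y.2 =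
          om * (om * σ * cosh (om * σ * Y.2)) := fun Y => by
        rw [deriv_const_mul _ ((hsinh _).differentiable (by simp) _), hdsinh]
      simp only [fun i => fderiv_shift_mul (hv.pd i) (hcosh (om * σ)) x σ Y,
        fderiv_shift_mul hv (contDiff_const.mul (hsinh (om * σ))) x σ Y, e2, Pi.zero_apply,
        mul_zero, add_zero, map_zero, zero_mul, zero_add, mul_one]
      rw [laplacian_eq_sum_pd] at this
      have e3 : ∑ i, σ * fderiv ℝ (pd i v) (x + σ • Y.1) (EuclideanSpace.single i 1) *
          cosh (om * σ * Y.2) * profilePrimitive (sqNorm Y) =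
          σ * cosh (om * σ * Y.2) * profilePrimitive (sqNorm Y) *
            ∑ i, pd i (pd i v) (x + σ • Y.1) := by
        rw [Finset.mul_sum]
        exact Finset.sum_congr rfl fun i _ => by unfold pd; ring
      rw [e3]
      linear_combination (σ * cosh (om * σ * Y.2) * profilePrimitive (sqNorm Y)) * this
    · simp [profilePrimitive_eq_zero (one_le_sqNorm hY)]
  have hconst : J r = J 0 := by
    have hsub : Icc 0 r ⊆ Ico (0 : ℝ) R := fun t ht => ⟨ht.1, ht.2.trans_lt hrR⟩
    refine constant_of_has_deriv_right_zero
      (fun t ht => (hJd t (hsub ht)).continuousAt.continuousWithinAt)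
      (fun t ht => (hJd t (hsub (Ico_subset_Icc_self ht))).hasDerivWithinAt) r ⟨hr.le, le_rfl⟩
  have h0 : J 0 = v x * ∫ Y : Eu n × ℝ, profile (sqNorm Y) := by
    simp [hJ, integral_const_mul]
  rw [← h0, ← hconst]

/-- The unscaled averaging kernel of `Δ + τ²`. -/
def baseKernel (τ : ℝ) (y : Eu n) : ℝ := ∫ s : ℝ, cosh (τ * s) * profile (‖y‖ ^ 2 + s ^ 2)

theorem profile_sq_eq_zero {y : Eu n} {s : ℝ} (hs : s ∉ Metric.closedBall (0 : ℝ) 1) :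
    profile (‖y‖ ^ 2 + s ^ 2) = 0 := by
  apply profile_eq_zero
  simp only [mem_closedBall_zero_iff, not_le, Real.norm_eq_abs] at hs
  nlinarith [sq_nonneg ‖y‖, sq_abs s]

theorem contDiff_baseKernel :
    ContDiff ℝ ∞ fun p : ℝ × Eu n => baseKernel p.1 p.2 := by
  have := contDiffOn_convolution_right_with_param (𝕜 := ℝ) (n := ⊤) (μ := (volume : Measure ℝ))
    (ContinuousLinearMap.mul ℝ ℝ) (f := fun _ : ℝ => (1 : ℝ)) (s := (univ : Set (ℝ × Eu n)))
    (g := fun p s => cosh (p.1 * s) * profile (‖p.2‖ ^ 2 + s ^ 2)) isOpen_univ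
    (isCompact_closedBall (0 : ℝ) 1) (fun p s _ hs => by rw [profile_sq_eq_zero hs, mul_zero])
    (locallyIntegrable_const 1) (by
      apply ContDiff.contDiffOn
      exact (Real.contDiff_cosh.comp ((contDiff_fst.comp contDiff_fst).mul contDiff_snd)).mul
        (contDiff_profile.comp (((contDiff_snd.comp contDiff_fst).norm_sq ℝ).add
          (contDiff_snd.pow 2))))
  rw [univ_prod_univ, contDiffOn_univ] at this
  have h2 := this.comp ((contDiff_id (E := ℝ × Eu n)).prodMk (contDiff_const (c := (0 : ℝ))))
  convert h2 using 1
  ext p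
  simp only [Function.comp_def, convolution, ContinuousLinearMap.mul_apply', one_mul, id]
  rw [← integral_neg_eq_self]
  simp [baseKernel]

theorem continuous_baseKernel_integrand (τ : ℝ) (y : Eu n) :
    Continuous fun s : ℝ => cosh (τ * s) * profile (‖y‖ ^ 2 + s ^ 2) :=
  (Real.continuous_cosh.comp (continuous_const.mul continuous_id)).mul
    (contDiff_profile.continuous.comp (by fun_prop))

theorem hasCompactSupport_baseKernel_integrand (τ : ℝ) (y : Eu n) :
    HasCompactSupport fun s : ℝ => cosh (τ * s) * profile (‖y‖ ^ 2 + s ^ 2) :=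
  HasCompactSupport.intro (isCompact_closedBall (0 : ℝ) 1) fun s hs => by
    rw [profile_sq_eq_zero hs, mul_zero]

theorem baseKernel_nonneg (τ : ℝ) (y : Eu n) : 0 ≤ baseKernel τ y :=
  integral_nonneg fun _ => mul_nonneg (Real.cosh_pos _).le (profile_nonneg _)

theorem baseKernel_pos (τ : ℝ) {y : Eu n} (hy : ‖y‖ < 1) : 0 < baseKernel τ y := by
  apply (continuous_baseKernel_integrand τ y).integral_pos_of_hasCompactSupport_nonneg_nonzero
    (hasCompactSupport_baseKernel_integrand τ y)
    (fun _ => mul_nonneg (Real.cosh_pos _).le (profile_nonneg _)) (x := 0)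
  have : 0 < profile (‖y‖ ^ 2 + 0 ^ 2) := profile_pos (by nlinarith [norm_nonneg y])
  exact (mul_pos (Real.cosh_pos _) this).ne'

theorem baseKernel_eq_zero (τ : ℝ) {y : Eu n} (hy : 1 ≤ ‖y‖) : baseKernel τ y = 0 := by
  unfold baseKernel
  rw [integral_eq_zero_of_ae]
  refine Eventually.of_forall fun s => ?_
  simp only [Pi.zero_apply]
  rw [profile_eq_zero, mul_zero]
  nlinarith [sq_nonneg s]

theorem baseKernel_neg (τ : ℝ) (y : Eu n) : baseKernel τ (-y) = baseKernel τ y := by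
  simp [baseKernel]

theorem contDiff_baseKernel_right (τ : ℝ) : ContDiff ℝ ∞ (baseKernel (n := n) τ) :=
  contDiff_baseKernel.comp (contDiff_const.prodMk contDiff_id)

theorem hasCompactSupport_baseKernel (τ : ℝ) : HasCompactSupport (baseKernel (n := n) τ) :=
  HasCompactSupport.intro (isCompact_closedBall 0 1) fun y hy =>
    baseKernel_eq_zero τ (by simpa using (not_le.1 (by simpa using hy)).le)

variable (n) in
/-- The normalising constant of the averaging kernels. -/
def kernelMass : ℝ := ∫ y : Eu n, baseKernel 0 y

theorem kernelMass_pos : 0 < kernelMass n := by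
  apply (contDiff_baseKernel_right 0).continuous.integral_pos_of_hasCompactSupport_nonneg_nonzero
    (hasCompactSupport_baseKernel 0) (baseKernel_nonneg 0) (x := 0)
  exact (baseKernel_pos 0 (by simp)).ne'

theorem integral_baseKernel_mul {u : Eu n → ℝ} (hu : Continuous u) (τ : ℝ) :
    ∫ Y : Eu n × ℝ, u Y.1 * cosh (τ * Y.2) * profile (sqNorm Y) =
      ∫ y, u y * baseKernel τ y := by
  rw [Measure.volume_eq_prod, integral_prod]
  · refine integral_congr_ae (Eventually.of_forall fun y => ?_)
    simp only [mul_assoc, baseKernel, sqNorm]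
    rw [integral_const_mul]
  · have hc : Continuous fun Y : Eu n × ℝ => u Y.1 * cosh (τ * Y.2) * profile (sqNorm Y) :=
      ((hu.comp continuous_fst).mul (Real.continuous_cosh.comp (by fun_prop))).mul
        (contDiff_profile.continuous.comp contDiff_sqNorm.continuous)
    rw [← Measure.volume_eq_prod]
    exact hc.integrable_of_hasCompactSupport (HasCompactSupport.intro
      ((isCompact_closedBall (0 : Eu n) 1).prod (isCompact_closedBall (0 : ℝ) 1)) fun Y hY => by
        rw [profile_eq_zero (one_le_sqNorm hY), mul_zero])

/-- The averaging kernel at scale `r` that reproduces solutions of `Δv + μv = 0`. -/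
def avgKernel (μ r : ℝ) (y : Eu n) : ℝ :=
  (kernelMass n * r ^ n)⁻¹ * baseKernel (√μ * r) (r⁻¹ • y)

theorem contDiff_avgKernel (μ r : ℝ) : ContDiff ℝ ∞ (avgKernel (n := n) μ r) :=
  contDiff_const.mul ((contDiff_baseKernel_right _).comp (contDiff_const_smul _))

theorem avgKernel_nonneg (μ : ℝ) {r : ℝ} (hr : 0 < r) (y : Eu n) : 0 ≤ avgKernel μ r y :=
  mul_nonneg (inv_nonneg.2 (mul_nonneg kernelMass_pos.le (by positivity))) (baseKernel_nonneg _ _)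

theorem avgKernel_pos (μ : ℝ) {r : ℝ} (hr : 0 < r) {y : Eu n} (hy : ‖y‖ < r) :
    0 < avgKernel μ r y := by
  refine mul_pos (inv_pos.2 (mul_pos kernelMass_pos (by positivity))) (baseKernel_pos _ ?_)
  rw [norm_smul, norm_inv, Real.norm_of_nonneg hr.le, inv_mul_lt_iff₀ hr]
  simpa using hy

theorem avgKernel_eq_zero (μ : ℝ) {r : ℝ} (hr : 0 < r) {y : Eu n} (hy : r ≤ ‖y‖) :
    avgKernel μ r y = 0 := by
  unfold avgKernel
  rw [baseKernel_eq_zero, mul_zero]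
  rw [norm_smul, norm_inv, Real.norm_of_nonneg hr.le, le_inv_mul_iff₀ hr]
  simpa using hy

theorem avgKernel_neg (μ r : ℝ) (y : Eu n) : avgKernel μ r (-y) = avgKernel μ r y := by
  simp [avgKernel, baseKernel_neg]

theorem support_avgKernel_subset (μ : ℝ) {r : ℝ} (hr : 0 < r) :
    Function.support (avgKernel (n := n) μ r) ⊆ Metric.ball 0 r := fun y hy => by
  by_contra h
  exact hy (avgKernel_eq_zero μ hr (by simpa using h))

theorem tsupport_avgKernel_subset (μ : ℝ) {r : ℝ} (hr : 0 < r) :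
    tsupport (avgKernel (n := n) μ r) ⊆ Metric.closedBall 0 r :=
  closure_minimal ((support_avgKernel_subset μ hr).trans Metric.ball_subset_closedBall)
    Metric.isClosed_closedBall

theorem hasCompactSupport_avgKernel (μ : ℝ) {r : ℝ} (hr : 0 < r) :
    HasCompactSupport (avgKernel (n := n) μ r) :=
  (isCompact_closedBall 0 r).of_isClosed_subset (isClosed_tsupport _)
    (tsupport_avgKernel_subset μ hr)

/-- Convolution of real functions on `ℝ^n`. -/
def conv (k u : Eu n → ℝ) : Eu n → ℝ := k ⋆[ContinuousLinearMap.mul ℝ ℝ, volume] u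

theorem conv_apply (k u : Eu n → ℝ) (x : Eu n) : conv k u x = ∫ t, k t * u (x - t) := rfl

theorem conv_apply' (k u : Eu n → ℝ) (x : Eu n) : conv k u x = ∫ z, u z * k (x - z) := by
  rw [conv_apply, ← integral_sub_left_eq_self _ _ x]
  simp [mul_comm]

theorem conv_avgKernel_eq {v : Eu n → ℝ} (hv : ContDiff ℝ ∞ v) {μ R r : ℝ} (hμ : 0 ≤ μ)
    {x : Eu n} (hr : 0 < r) (hrR : r < R)
    (hH : ∀ y ∈ Metric.ball x R, laplacian v y + μ * v y = 0) :
    conv (avgKernel μ r) v x = v x := by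
  have h1 := integral_shift_profile hv (om := √μ) hr hrR (by rwa [Real.sq_sqrt hμ])
  have h2 := integral_baseKernel_mul (u := fun _ : Eu n => (1 : ℝ)) continuous_const 0
  simp only [zero_mul, cosh_zero, one_mul] at h2
  have h3 := integral_baseKernel_mul (u := fun y => v (x + r • y))
    (hv.continuous.comp (by fun_prop)) (√μ * r)
  simp only [mul_assoc] at h1 h3
  rw [h3, h2] at h1
  change _ = v x * kernelMass n at h1
  rw [conv_apply, ← integral_neg_eq_self]
  simp only [avgKernel_neg, sub_neg_eq_add]
  have h4 := Measure.integral_comp_smul (volume : Measure (Eu n))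
    (fun z => avgKernel μ r z * v (x + z)) r
  simp only [avgKernel, smul_smul, inv_mul_cancel₀ hr.ne', one_smul, finrank_euclideanSpace,
    Fintype.card_fin] at h4
  have h5 : ∀ y : Eu n, (kernelMass n * r ^ n)⁻¹ * baseKernel (√μ * r) y * v (x + r • y) =
      (kernelMass n * r ^ n)⁻¹ * (v (x + r • y) * baseKernel (√μ * r) y) := fun y => by ring
  simp only [h5] at h4
  rw [integral_const_mul, h1, abs_of_pos (by positivity), smul_eq_mul] at h4
  have hm := kernelMass_pos (n := n)
  have hrn : 0 < r ^ n := by positivity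
  have h6 : (kernelMass n * r ^ n)⁻¹ * (v x * kernelMass n) = (r ^ n)⁻¹ * v x := by
    field_simp
  rw [h6] at h4
  exact (mul_left_cancel₀ (inv_pos.2 hrn).ne' h4).symm

/-- A smooth function with compact support. -/
abbrev IsTestFn (k : Eu n → ℝ) : Prop := IsTest univ k

theorem IsTest.isTestFn {U : Set (Eu n)} {k : Eu n → ℝ} (h : IsTest U k) : IsTestFn k :=
  h.mono (subset_univ _)

theorem isTestFn_avgKernel (μ : ℝ) {r : ℝ} (hr : 0 < r) : IsTestFn (avgKernel (n := n) μ r) :=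
  ⟨contDiff_avgKernel μ r, hasCompactSupport_avgKernel μ hr, subset_univ _⟩

theorem contDiff_conv {k u : Eu n → ℝ} (hk : IsTestFn k) (hu : LocallyIntegrable u) :
    ContDiff ℝ ∞ (conv k u) :=
  hk.hasCompactSupport.contDiff_convolution_left _ hk.contDiff hu

theorem conv_eq_swap (k u : Eu n → ℝ) : conv k u = conv u k := by
  ext x
  rw [conv_apply', conv_apply]

theorem fderiv_conv {k u : Eu n → ℝ} (hk : IsTestFn k) (hu : LocallyIntegrable u) (x y : Eu n) :
    fderiv ℝ (conv k u) x y = conv (fun z => fderiv ℝ k z y) u x := by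
  rw [conv_eq_swap k, conv_eq_swap _ u]
  have h1 := hk.contDiff.of_le (m := 1) (by norm_cast)
  change fderiv ℝ (u ⋆[ContinuousLinearMap.mul ℝ ℝ, volume] k) x y = _
  rw [(hk.hasCompactSupport.hasFDerivAt_convolution_right (ContinuousLinearMap.mul ℝ ℝ) hu
    h1 x).fderiv, convolution_precompR_apply _ hu (hk.hasCompactSupport.fderiv ℝ)
    (h1.continuous_fderiv one_ne_zero)]
  rfl

theorem pd_conv {k u : Eu n → ℝ} (hk : IsTestFn k) (hu : LocallyIntegrable u) (i : Fin n) :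
    pd i (conv k u) = conv (pd i k) u := funext fun x => fderiv_conv hk hu x _

theorem integrable_conv {k u : Eu n → ℝ} (hk : IsTestFn k) (hu : LocallyIntegrable u) (x : Eu n) :
    Integrable fun z => u z * k (x - z) := by
  refine (hu.integrable_smul_right_of_hasCompactSupport (g := fun z => k (x - z))
    (hk.contDiff.continuous.comp (by fun_prop)) ?_)
  exact hk.hasCompactSupport.comp_homeomorph (Homeomorph.subLeft x)

theorem laplacian_conv {k u : Eu n → ℝ} (hk : IsTestFn k) (hu : LocallyIntegrable u) :
    laplacian (conv k u) = conv (laplacian k) u := by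
  ext x
  simp only [laplacian_eq_sum_pd, pd_conv hk hu, pd_conv (hk.pd _) hu, conv_apply']
  rw [← integral_finsetSum _ fun i _ => integrable_conv ((hk.pd i).pd i) hu x]
  simp only [← Finset.mul_sum]

theorem pd_comp_const_sub {k : Eu n → ℝ} (hk : IsTestFn k) (x z : Eu n) (i : Fin n) :
    pd i (fun z => k (x - z)) z = - pd i k (x - z) := by
  have h1 : HasFDerivAt k (fderiv ℝ k (x - z)) (x - z) :=
    (hk.contDiff.differentiable (by simp)).differentiableAt.hasFDerivAt
  have := (h1.comp z ((hasFDerivAt_const x z).sub (hasFDerivAt_id z))).fderiv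
  simp only [Function.comp_def] at this
  simp [pd, this]

theorem laplacian_comp_const_sub {k : Eu n → ℝ} (hk : IsTestFn k) (x z : Eu n) :
    laplacian (fun z => k (x - z)) z = laplacian k (x - z) := by
  simp only [laplacian_eq_sum_pd]
  refine Finset.sum_congr rfl fun i _ => ?_
  have : pd i (fun z => k (x - z)) = fun z => - pd i k (x - z) :=
    funext fun z => pd_comp_const_sub hk x z i
  rw [this, pd, fderiv_fun_neg]
  have := pd_comp_const_sub (hk.pd i) x z i
  rw [pd] at this
  simp [this]

theorem IsTest.comp_const_sub {k : Eu n → ℝ} (hk : IsTestFn k) (x : Eu n) :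
    IsTest ((fun z => x - z) ⁻¹' tsupport k) fun z => k (x - z) :=
  ⟨hk.contDiff.comp (contDiff_const.sub contDiff_id),
    hk.hasCompactSupport.comp_homeomorph (Homeomorph.subLeft x),
    tsupport_comp_subset_preimage k (by fun_prop)⟩

/-- `u` solves `Δu + μu = h` in `U` in the sense of distributions. -/
def WeakSol (μ : ℝ) (U : Set (Eu n)) (u h : Eu n → ℝ) : Prop :=
  ∀ ψ, IsTest U ψ → ∫ x, u x * (laplacian ψ x + μ * ψ x) = ∫ x, h x * ψ x

/-- `u` solves `Δu + μu = 0` in `U` in the sense of distributions. -/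
abbrev WeakHelm (μ : ℝ) (U : Set (Eu n)) (u : Eu n → ℝ) : Prop := WeakSol μ U u 0

theorem IsTest.laplacian {U : Set (Eu n)} {ψ : Eu n → ℝ} (h : IsTest U ψ) :
    IsTest U (laplacian ψ) := ⟨h.1.laplacian, h.2.laplacian,
  (closure_minimal (fun x hx => by
    by_contra h'
    exact hx (laplacian_eq_zero_of_notMem_tsupport h')) (isClosed_tsupport _)).trans h.3⟩

theorem WeakHelm.conv {μ : ℝ} {U : Set (Eu n)} {u k : Eu n → ℝ} (hw : WeakHelm μ U u)
    (hu : LocallyIntegrable u) (hk : IsTestFn k) {x : Eu n}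
    (hx : ∀ z, x - z ∈ tsupport k → z ∈ U) :
    laplacian (conv k u) x + μ * _root_.conv k u x = 0 := by
  rw [laplacian_conv hk hu, conv_apply', conv_apply']
  have := hw _ ((IsTest.comp_const_sub hk x).mono hx)
  simp only [laplacian_comp_const_sub hk, Pi.zero_apply, zero_mul, integral_zero, mul_add] at this
  rw [integral_add (integrable_conv (IsTest.laplacian hk) hu x)] at this
  · rw [← this, ← integral_const_mul]
    congr 2
    ext; ring
  · simpa [mul_left_comm] using (integrable_conv hk hu x).const_mul μ

theorem conv_conv {k ρ u : Eu n → ℝ} (hk : IsTestFn k) (hρ : IsTestFn ρ)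
    (hu : LocallyIntegrable u) : conv k (conv ρ u) = conv ρ (conv k u) := by
  have hu' : LocallyIntegrable fun x => ‖u x‖ := fun x => (hu x).norm
  have key : ∀ k ρ : Eu n → ℝ, IsTestFn k → IsTestFn ρ →
      conv (conv k ρ) u = conv k (conv ρ u) := fun k ρ hk hρ => by
    ext x
    refine convolution_assoc _ _ _ _ (fun a b c => mul_assoc a b c)
      hk.contDiff.continuous.aestronglyMeasurable hρ.contDiff.continuous.aestronglyMeasurable
      hu.aestronglyMeasurable (Eventually.of_forall fun y =>
        hk.hasCompactSupport.convolutionExists_left _ hk.contDiff.continuous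
          hρ.contDiff.continuous.locallyIntegrable y) (Eventually.of_forall fun y =>
        hρ.hasCompactSupport.norm.convolutionExists_left _ hρ.contDiff.continuous.norm
          hu' y) ?_
    refine hk.hasCompactSupport.norm.convolutionExists_left _ hk.contDiff.continuous.norm ?_ x
    exact (hρ.hasCompactSupport.norm.continuous_convolution_left _
      hρ.contDiff.continuous.norm hu').locallyIntegrable
  rw [← key k ρ hk hρ, conv_eq_swap k ρ, key ρ k hρ hk]

variable (n) in
/-- A standard sequence of mollifiers. -/
def molliBump (j : ℕ) : ContDiffBump (0 : Eu n) where
  rIn := 1 / (2 * (j + 1))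
  rOut := 1 / (j + 1)
  rIn_pos := by positivity
  rIn_lt_rOut := by
    rw [div_lt_div_iff₀ (by positivity) (by positivity)]
    linarith [(Nat.cast_nonneg j : (0 : ℝ) ≤ j)]

variable (n) in
/-- The standard mollifiers. -/
def molli (j : ℕ) : Eu n → ℝ := (molliBump n j).normed volume

theorem isTestFn_molli (j : ℕ) : IsTestFn (molli n j) :=
  ⟨ContDiffBump.contDiff_normed _, ContDiffBump.hasCompactSupport_normed _, subset_univ _⟩

theorem tendsto_molli_rOut : Tendsto (fun j => (molliBump n j).rOut) atTop (𝓝 0) :=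
  tendsto_one_div_add_atTop_nhds_zero_nat

theorem tsupport_molli (j : ℕ) : tsupport (molli n j) = Metric.closedBall 0 (1 / (j + 1)) :=
  ContDiffBump.tsupport_normed_eq _

theorem tendsto_conv_molli {u : Eu n → ℝ} (hu : Continuous u) (x : Eu n) :
    Tendsto (fun j => conv (molli n j) u x) atTop (𝓝 (u x)) :=
  ContDiffBump.convolution_tendsto_right_of_continuous tendsto_molli_rOut hu x

theorem ae_tendsto_conv_molli {u : Eu n → ℝ} (hu : LocallyIntegrable u) :
    ∀ᵐ x, Tendsto (fun j => conv (molli n j) u x) atTop (𝓝 (u x)) := by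
  refine ContDiffBump.ae_convolution_tendsto_right_of_locallyIntegrable (K := 2)
    tendsto_molli_rOut (Eventually.of_forall fun j => ?_) hu
  simp only [molliBump]
  apply le_of_eq
  field_simp

/-- At points well inside `U`, mollifications of a weak solution converge to its kernel average. -/
theorem WeakHelm.tendsto_molli {μ : ℝ} (hμ : 0 ≤ μ) {U : Set (Eu n)} {u : Eu n → ℝ}
    (hw : WeakHelm μ U u) (hu : LocallyIntegrable u) {x : Eu n} {r R : ℝ} (hr : 0 < r)
    (hrR : r < R) (hx : Metric.ball x R ⊆ U) :
    Tendsto (fun j => _root_.conv (molli n j) u x) atTop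
      (𝓝 (_root_.conv (avgKernel μ r) u x)) := by
  have hk := isTestFn_avgKernel (n := n) μ hr
  have h1 := tendsto_conv_molli (contDiff_conv hk hu).continuous x
  refine h1.congr' ?_
  have h2 : ∀ᶠ j in atTop, (molliBump n j).rOut < (R - r) / 2 :=
    tendsto_molli_rOut.eventually_lt_const (by linarith)
  filter_upwards [h2] with j hj
  rw [← conv_conv hk (isTestFn_molli j) hu]
  refine conv_avgKernel_eq (contDiff_conv (isTestFn_molli j) hu) (R := (R + r) / 2) hμ hr
    (by linarith) fun y hy => ?_
  refine hw.conv hu (isTestFn_molli j) fun z hz => hx ?_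
  rw [tsupport_molli, mem_closedBall_zero_iff] at hz
  have : 1 / ((j : ℝ) + 1) < (R - r) / 2 := hj
  rw [Metric.mem_ball, dist_eq_norm] at *
  have : ‖z - x‖ ≤ ‖y - z‖ + ‖y - x‖ := by
    rw [norm_sub_rev y z]
    simpa using norm_add_le (z - y) (y - x)
  linarith

theorem WeakHelm.conv_avgKernel_eq {μ : ℝ} (hμ : 0 ≤ μ) {U : Set (Eu n)} {u : Eu n → ℝ}
    (hw : WeakHelm μ U u) (hu : LocallyIntegrable u) {x : Eu n} {r₁ r₂ R : ℝ} (hr₁ : 0 < r₁)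
    (hr₂ : 0 < r₂) (h₁ : r₁ < R) (h₂ : r₂ < R) (hx : Metric.ball x R ⊆ U) :
    _root_.conv (avgKernel μ r₁) u x = _root_.conv (avgKernel μ r₂) u x :=
  tendsto_nhds_unique (hw.tendsto_molli hμ hu hr₁ h₁ hx) (hw.tendsto_molli hμ hu hr₂ h₂ hx)

/-- A smooth representative of a weak solution. -/
theorem WeakHelm.exists_contDiffOn {μ : ℝ} (hμ : 0 ≤ μ) {U : Set (Eu n)} (hU : IsOpen U)
    {u : Eu n → ℝ} (hw : WeakHelm μ U u) (hu : LocallyIntegrable u) :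
    ∃ v : Eu n → ℝ, ContDiffOn ℝ ∞ v U ∧ (∀ x ∈ U, laplacian v x + μ * v x = 0) ∧
      (∀ x r, 0 < r → Metric.closedBall x r ⊆ U → v x = _root_.conv (avgKernel μ r) u x) ∧
      ∀ᵐ x, x ∈ U → u x = v x := by
  have hex : ∀ x, x ∈ U → ∃ R > 0, Metric.ball x R ⊆ U := fun x hx => Metric.isOpen_iff.1 hU x hx
  choose! ρ hρ hρU using hex
  let v : Eu n → ℝ := fun x => _root_.conv (avgKernel μ (ρ x / 2)) u x
  have key : ∀ x R r, 0 < r → r < R → Metric.ball x R ⊆ U →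
      v x = _root_.conv (avgKernel μ r) u x := fun x R r hr hrR hx => by
    have hxU : x ∈ U := hx (Metric.mem_ball_self (hr.trans hrR))
    have h1 := hρ x hxU
    rcases le_total R (ρ x) with h | h
    · exact hw.conv_avgKernel_eq hμ hu (by linarith) hr (R := ρ x) (by linarith) (by linarith)
        (hρU x hxU)
    · exact hw.conv_avgKernel_eq hμ hu (by linarith) hr (R := R) (by linarith) (by linarith) hx
  have hloc : ∀ x ∈ U, v =ᶠ[𝓝 x] _root_.conv (avgKernel μ (ρ x / 2)) u := fun x hx => by
    have h1 := hρ x hx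
    filter_upwards [Metric.ball_mem_nhds x (ε := ρ x / 4) (by linarith)] with y hy
    refine key y (3 * ρ x / 4) _ (by linarith) (by linarith) fun z hz => hρU x hx ?_
    rw [Metric.mem_ball] at *
    linarith [dist_triangle z y x]
  have hsm : ContDiffOn ℝ ∞ v U := fun x hx =>
    ((contDiff_conv (isTestFn_avgKernel μ (by linarith [hρ x hx])) hu).contDiffAt.congr_of_eventuallyEq
      (hloc x hx)).contDiffWithinAt
  refine ⟨v, hsm, fun x hx => ?_, fun x r hr hxr => ?_, ?_⟩
  · have h1 := hρ x hx
    rw [(hloc x hx).laplacian.eq_of_nhds, (hloc x hx).eq_of_nhds]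
    refine hw.conv hu (isTestFn_avgKernel μ (by linarith)) fun z hz => hρU x hx ?_
    have := tsupport_avgKernel_subset μ (by linarith) hz
    rw [mem_closedBall_zero_iff, ← dist_eq_norm, dist_comm] at this
    rw [Metric.mem_ball]
    linarith
  · obtain ⟨δ, hδ, h⟩ := (isCompact_closedBall x r).exists_thickening_subset_open hU hxr
    rw [thickening_closedBall hδ hr.le] at h
    exact key x (δ + r) r hr (by linarith) h
  · filter_upwards [ae_tendsto_conv_molli hu] with x hx hxU
    exact tendsto_nhds_unique hx
      (hw.tendsto_molli hμ hu (by linarith [hρ x hxU]) (by linarith [hρ x hxU]) (hρU x hxU))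

theorem IsTest.mul_contDiffOn {U : Set (Eu n)} {χ v : Eu n → ℝ} (hχ : IsTest U χ) (hU : IsOpen U)
    (hv : ContDiffOn ℝ ∞ v U) : IsTest U fun x => χ x * v x := by
  have hsupp : tsupport (fun x => χ x * v x) ⊆ tsupport χ := tsupport_mul_subset_left
  refine ⟨contDiff_iff_contDiffAt.2 fun x => ?_, hχ.hasCompactSupport.mul_right,
    hsupp.trans hχ.tsupport_subset⟩
  by_cases hx : x ∈ tsupport χ
  · exact hχ.contDiff.contDiffAt.mul (hv.contDiffAt (hU.mem_nhds (hχ.tsupport_subset hx)))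
  · have : (fun x => χ x * v x) =ᶠ[𝓝 x] fun _ => 0 := by
      filter_upwards [notMem_tsupport_iff_eventuallyEq.1 hx] with y hy
      simp [hy]
    exact contDiffAt_const.congr_of_eventuallyEq this

/-- A cut-off function that equals one near a compact subset of an open set. -/
theorem exists_cutoff {K U : Set (Eu n)} (hK : IsCompact K) (hU : IsOpen U) (hKU : K ⊆ U) :
    ∃ χ : Eu n → ℝ, IsTest U χ ∧ (∀ x, 0 ≤ χ x) ∧ (∀ x, χ x ≤ 1) ∧
      ∃ V, IsOpen V ∧ K ⊆ V ∧ V ⊆ U ∧ ∀ x ∈ V, χ x = 1 := by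
  obtain ⟨L, hL, hKL, hLU⟩ := exists_compact_between hK hU hKU
  obtain ⟨f, h1, h2, h3⟩ := exists_contMDiffMap_one_nhds_of_subset_interior
    (modelWithCornersSelf ℝ (Eu n)) (n := ⊤) hK.isClosed hKL
  have hsupp : tsupport f ⊆ L := closure_minimal (fun x hx => by
    by_contra h
    exact hx (h2 x h)) hL.isClosed
  obtain ⟨V, hV, hKV, hV1⟩ := eventually_nhdsSet_iff_exists.1 h1
  exact ⟨f, ⟨f.contMDiff.contDiff, hL.of_isClosed_subset (isClosed_tsupport _) hsupp,
    hsupp.trans hLU⟩, fun x => (h3 x).1, fun x => (h3 x).2, V ∩ U, hV.inter hU,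
    subset_inter hKV hKU, inter_subset_right, fun x hx => hV1 x hx.1⟩

/-- `v` is a classical solution of `Δv + μv = 0` in the open set `U`. -/
structure Helm (μ : ℝ) (U : Set (Eu n)) (v : Eu n → ℝ) : Prop where
  isOpen : IsOpen U
  nonneg : 0 ≤ μ
  contDiffOn : ContDiffOn ℝ ∞ v U
  eq_zero : ∀ x ∈ U, laplacian v x + μ * v x = 0

theorem Helm.mono {μ : ℝ} {U V : Set (Eu n)} {v : Eu n → ℝ} (h : Helm μ U v) (hV : IsOpen V)
    (hVU : V ⊆ U) : Helm μ V v :=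
  ⟨hV, h.nonneg, h.contDiffOn.mono hVU, fun x hx => h.eq_zero x (hVU hx)⟩

theorem Helm.congr {μ : ℝ} {U : Set (Eu n)} {v w : Eu n → ℝ} (h : Helm μ U v)
    (hw : ∀ x ∈ U, w x = v x) : Helm μ U w := by
  refine ⟨h.isOpen, h.nonneg, h.contDiffOn.congr hw, fun x hx => ?_⟩
  have : w =ᶠ[𝓝 x] v := by filter_upwards [h.isOpen.mem_nhds hx] with y hy using hw y hy
  rw [this.laplacian.eq_of_nhds, this.eq_of_nhds, h.eq_zero x hx]

theorem Helm.continuousOn {μ : ℝ} {U : Set (Eu n)} {v : Eu n → ℝ} (h : Helm μ U v) :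
    ContinuousOn v U := h.contDiffOn.continuousOn

/-- A compactly supported smooth function agreeing with `v` near a compact subset of `U`. -/
theorem Helm.exists_isTest {μ : ℝ} {U K : Set (Eu n)} {v : Eu n → ℝ} (h : Helm μ U v)
    (hK : IsCompact K) (hKU : K ⊆ U) :
    ∃ u, IsTest U u ∧ ∃ V, IsOpen V ∧ K ⊆ V ∧ V ⊆ U ∧ ∀ x ∈ V, u x = v x := by
  obtain ⟨χ, hχ, -, -, V, hV, hKV, hVU, h1⟩ := exists_cutoff hK h.isOpen hKU
  exact ⟨_, hχ.mul_contDiffOn h.isOpen h.contDiffOn, V, hV, hKV, hVU, fun x hx => by simp [h1 x hx]⟩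

theorem conv_avgKernel_congr {μ r : ℝ} (hr : 0 < r) {u v : Eu n → ℝ} {x : Eu n}
    (h : ∀ y ∈ Metric.closedBall x r, u y = v y) :
    conv (avgKernel μ r) u x = conv (avgKernel μ r) v x := by
  rw [conv_apply', conv_apply']
  congr 1
  ext z
  by_cases hz : z ∈ Metric.closedBall x r
  · rw [h z hz]
  · rw [avgKernel_eq_zero μ hr (y := x - z), mul_zero, mul_zero]
    rw [← dist_eq_norm, dist_comm]
    simpa using (not_le.1 hz).le

theorem Helm.conv_eq {μ : ℝ} {U : Set (Eu n)} {v : Eu n → ℝ} (h : Helm μ U v) {x : Eu n} {r : ℝ}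
    (hr : 0 < r) (hx : Metric.closedBall x r ⊆ U) : conv (avgKernel μ r) v x = v x := by
  obtain ⟨u, hu, V, hV, hKV, hVU, huv⟩ := h.exists_isTest (isCompact_closedBall x r) hx
  obtain ⟨δ, hδ, hδV⟩ := (isCompact_closedBall x r).exists_thickening_subset_open hV hKV
  rw [thickening_closedBall hδ hr.le] at hδV
  rw [← conv_avgKernel_congr hr fun y hy => huv y (hKV hy),
    conv_avgKernel_eq hu.contDiff h.nonneg hr (R := δ + r) (by linarith),
    huv x (hKV (Metric.mem_closedBall_self hr.le))]
  exact fun y hy => ((h.mono hV hVU).congr huv).eq_zero y (hδV hy)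

/-- Local representation of a solution as the average of a test function. -/
theorem Helm.exists_eventuallyEq_conv {μ : ℝ} {U : Set (Eu n)} {v : Eu n → ℝ} (h : Helm μ U v)
    {x : Eu n} {r : ℝ} (hr : 0 < r) (hx : Metric.closedBall x r ⊆ U) :
    ∃ u, IsTestFn u ∧ (∀ y ∈ Metric.closedBall x r, u y = v y) ∧
      v =ᶠ[𝓝 x] conv (avgKernel μ r) u := by
  obtain ⟨u, hu, V, hV, hKV, hVU, huv⟩ := h.exists_isTest (isCompact_closedBall x r) hx
  obtain ⟨δ, hδ, hδV⟩ := (isCompact_closedBall x r).exists_thickening_subset_open hV hKV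
  rw [thickening_closedBall hδ hr.le] at hδV
  refine ⟨u, hu.isTestFn, fun y hy => huv y (hKV hy), ?_⟩
  filter_upwards [Metric.ball_mem_nhds x hδ] with y hy
  have hy' : Metric.closedBall y r ⊆ V := fun z hz => hδV (by
    rw [Metric.mem_ball] at *
    rw [Metric.mem_closedBall] at hz
    linarith [dist_triangle z y x])
  rw [conv_avgKernel_congr hr (fun z hz => huv z (hy' hz)), h.conv_eq hr (hy'.trans hVU)]

theorem Helm.conv_fderiv_eq {μ : ℝ} {U : Set (Eu n)} {v : Eu n → ℝ} (h : Helm μ U v)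
    {x : Eu n} {r : ℝ} (hr : 0 < r) (hx : Metric.closedBall x r ⊆ U) (e : Eu n) (b : ℝ) :
    fderiv ℝ v x e =
      ∫ z in Metric.closedBall x r, (v z - b) * fderiv ℝ (avgKernel μ r) (x - z) e := by
  obtain ⟨u, hu, huv, he⟩ := h.exists_eventuallyEq_conv hr hx
  have hk := isTestFn_avgKernel (n := n) μ hr
  have hk' : IsTestFn fun z => fderiv ℝ (avgKernel (n := n) μ r) z e :=
    ⟨(hk.1.fderiv_right (m := ∞) (by simp)).clm_apply contDiff_const,
      hk.2.fderiv_apply ℝ _, subset_univ _⟩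
  have hz : ∫ z, fderiv ℝ (avgKernel (n := n) μ r) (x - z) e = 0 := by
    rw [integral_sub_left_eq_self (fun z => fderiv ℝ (avgKernel (n := n) μ r) z e) volume x]
    have := integral_mul_fderiv_of_hasCompactSupport (volume : Measure (Eu n))
      (f := fun _ => 1) contDiff_const (hk.1.of_le (by norm_cast)) hk.2 e
    simpa using this
  rw [he.fderiv_eq, fderiv_conv hk hu.contDiff.continuous.locallyIntegrable, conv_apply']
  have h1 : ∫ z, u z * fderiv ℝ (avgKernel (n := n) μ r) (x - z) e =
      ∫ z, (u z - b) * fderiv ℝ (avgKernel (n := n) μ r) (x - z) e := by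
    simp only [sub_mul]
    rw [integral_sub (integrable_conv hk' hu.contDiff.continuous.locallyIntegrable x)
      (integrable_conv hk' (continuous_const (y := b)).locallyIntegrable x),
      integral_const_mul, hz]
    simp
  rw [h1, ← setIntegral_eq_integral_of_forall_compl_eq_zero
    (s := Metric.closedBall x r)]
  · refine setIntegral_congr_fun measurableSet_closedBall fun z hz => ?_
    simp only [huv z hz]
  · intro z hz
    have : x - z ∉ tsupport (avgKernel (n := n) μ r) := fun h' => hz (by
      have := tsupport_avgKernel_subset μ hr h'
      rwa [mem_closedBall_zero_iff, ← dist_eq_norm, dist_comm] at this)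
    rw [image_eq_zero_of_notMem_tsupport (fun h' => this (tsupport_fderiv_apply_subset ℝ e h')),
      mul_zero]

theorem exists_baseKernel_bound (M : ℝ) :
    ∃ C > 0, ∀ τ, 0 ≤ τ → τ ≤ M → ∀ y : Eu n, baseKernel τ y ≤ C ∧
      ∀ e, |fderiv ℝ (baseKernel τ) y e| ≤ C * ‖e‖ := by
  have hcomp : IsCompact (Icc 0 M ×ˢ Metric.closedBall (0 : Eu n) 1) :=
    isCompact_Icc.prod (isCompact_closedBall _ _)
  have hB := contDiff_baseKernel (n := n)
  obtain ⟨C₁, hC₁⟩ := hcomp.exists_bound_of_continuousOn hB.continuous.continuousOn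
  obtain ⟨C₂, hC₂⟩ := hcomp.exists_bound_of_continuousOn
    (hB.continuous_fderiv (by simp)).continuousOn
  refine ⟨max 1 (max C₁ C₂), by positivity, fun τ h0 hM y => ?_⟩
  have hm1 : C₁ ≤ max 1 (max C₁ C₂) := (le_max_left _ _).trans (le_max_right _ _)
  have hm2 : C₂ ≤ max 1 (max C₁ C₂) := (le_max_right _ _).trans (le_max_right _ _)
  by_cases hy : y ∈ Metric.closedBall (0 : Eu n) 1
  · have hmem : (τ, y) ∈ Icc 0 M ×ˢ Metric.closedBall (0 : Eu n) 1 := ⟨⟨h0, hM⟩, hy⟩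
    refine ⟨(le_abs_self _).trans ((hC₁ _ hmem).trans hm1), fun e => ?_⟩
    have h1 : HasFDerivAt (fun p : ℝ × Eu n => baseKernel p.1 p.2)
        (fderiv ℝ (fun p : ℝ × Eu n => baseKernel p.1 p.2) (τ, y)) (τ, y) :=
      (hB.differentiable (by simp)).differentiableAt.hasFDerivAt
    have h2 := (h1.comp y (hasFDerivAt_prodMk_right (𝕜 := ℝ) τ y)).fderiv
    simp only [Function.comp_def] at h2
    change |fderiv ℝ (fun x => baseKernel τ x) y e| ≤ _
    rw [h2]
    simp only [ContinuousLinearMap.comp_apply, ContinuousLinearMap.inr_apply]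
    refine ((fderiv ℝ (fun p : ℝ × Eu n => baseKernel p.1 p.2) (τ, y)).le_opNorm (0, e)).trans ?_
    rw [Prod.norm_mk, norm_zero, max_eq_right (norm_nonneg _)]
    exact mul_le_mul_of_nonneg_right ((hC₂ _ hmem).trans hm2) (norm_nonneg _)
  · have hy' : 1 ≤ ‖y‖ := by simpa using (not_le.1 (by simpa using hy)).le
    refine ⟨by rw [baseKernel_eq_zero τ hy']; positivity, fun e => ?_⟩
    have : y ∉ tsupport (baseKernel (n := n) τ) := fun h => hy
      (closure_minimal (fun z hz => by
        by_contra h'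
        exact hz (baseKernel_eq_zero τ (by simpa using (not_le.1 (by simpa using h')).le)))
        Metric.isClosed_closedBall h)
    rw [image_eq_zero_of_notMem_tsupport (fun h' => this (tsupport_fderiv_apply_subset ℝ e h'))]
    simp only [abs_zero]
    positivity

/-- Uniform bounds for the averaging kernels. -/
theorem exists_avgKernel_bound (M : ℝ) :
    ∃ C > 0, ∀ μ, 0 ≤ μ → μ ≤ M → ∀ r, 0 < r → r ≤ 1 → ∀ y : Eu n,
      avgKernel μ r y ≤ C / r ^ n ∧
      ∀ e, |fderiv ℝ (avgKernel μ r) y e| ≤ C / r ^ (n + 1) * ‖e‖ := by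
  obtain ⟨C, hC, h⟩ := exists_baseKernel_bound (n := n) √M
  have hm := kernelMass_pos (n := n)
  refine ⟨C / kernelMass n, by positivity, fun μ h0 hM r hr hr1 y => ?_⟩
  obtain ⟨h1, h2⟩ := h (√μ * r) (by positivity)
    ((mul_le_of_le_one_right (by positivity) hr1).trans (Real.sqrt_le_sqrt hM)) (r⁻¹ • y)
  refine ⟨?_, fun e => ?_⟩
  · rw [avgKernel, div_div, inv_mul_eq_div]
    gcongr
  · have h3 : HasFDerivAt (baseKernel (n := n) (√μ * r))
        (fderiv ℝ (baseKernel (√μ * r)) (r⁻¹ • y)) (r⁻¹ • y) :=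
      ((contDiff_baseKernel_right _).differentiable (by simp)).differentiableAt.hasFDerivAt
    have h5 : fderiv ℝ (avgKernel μ r) y e = (kernelMass n * r ^ n)⁻¹ *
        (r⁻¹ * fderiv ℝ (baseKernel (√μ * r)) (r⁻¹ • y) e) := by
      have h6 : HasFDerivAt (fun y : Eu n => r⁻¹ • y)
          (r⁻¹ • ContinuousLinearMap.id ℝ (Eu n)) y := (hasFDerivAt_id y).const_smul r⁻¹
      have h4 : HasFDerivAt (avgKernel μ r) _ y :=
        (HasFDerivAt.comp y h3 h6).const_mul (kernelMass n * r ^ n)⁻¹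
      rw [h4.fderiv]
      simp
    rw [h5, abs_mul, abs_mul, abs_of_pos (by positivity : 0 < r⁻¹),
      abs_of_pos (by positivity : 0 < (kernelMass n * r ^ n)⁻¹)]
    calc _ ≤ (kernelMass n * r ^ n)⁻¹ * (r⁻¹ * (C * ‖e‖)) := by gcongr; exact h2 e
      _ = _ := by field_simp; ring

theorem conv_avgKernel_eq_setIntegral (μ : ℝ) {r : ℝ} (hr : 0 < r) (v : Eu n → ℝ) (x : Eu n) :
    conv (avgKernel μ r) v x = ∫ z in Metric.closedBall x r, v z * avgKernel μ r (x - z) := by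
  rw [conv_apply', ← setIntegral_eq_integral_of_forall_compl_eq_zero
    (s := Metric.closedBall x r)]
  intro z hz
  rw [avgKernel_eq_zero μ hr (y := x - z), mul_zero]
  rw [← dist_eq_norm, dist_comm]
  simpa using (not_le.1 hz).le

/-- Interior estimates for solutions in terms of the `L¹` norm. -/
theorem exists_helm_estimate (n : ℕ) (M : ℝ) :
    ∃ C > 0, ∀ (μ : ℝ) (U : Set (Eu n)) (v : Eu n → ℝ), Helm μ U v → μ ≤ M →
      ∀ (x : Eu n) (r : ℝ), 0 < r → r ≤ 1 → Metric.closedBall x r ⊆ U →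
        |v x| ≤ C / r ^ n * (∫ z in Metric.closedBall x r, |v z|) ∧
        ∀ b e, |fderiv ℝ v x e| ≤
          C / r ^ (n + 1) * ‖e‖ * ∫ z in Metric.closedBall x r, |v z - b| := by
  obtain ⟨C, hC, h⟩ := exists_avgKernel_bound (n := n) M
  refine ⟨C, hC, fun μ U v hv hM x r hr hr1 hx => ?_⟩
  have hintg : ∀ b, IntegrableOn (fun z => |v z - b|) (Metric.closedBall x r) := fun b =>
    (((hv.continuousOn.mono hx).sub continuousOn_const).abs).integrableOn_compact
      (isCompact_closedBall x r)
  refine ⟨?_, fun b e => ?_⟩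
  · rw [← hv.conv_eq hr hx, conv_avgKernel_eq_setIntegral μ hr, ← integral_const_mul,
      ← Real.norm_eq_abs]
    refine norm_integral_le_of_norm_le (by simpa using (hintg 0).const_mul (C / r ^ n))
      (Eventually.of_forall fun z => ?_)
    rw [norm_mul, Real.norm_eq_abs, Real.norm_of_nonneg (avgKernel_nonneg μ hr _), mul_comm]
    exact mul_le_mul_of_nonneg_right (h μ hv.nonneg hM r hr hr1 _).1 (abs_nonneg _)
  · rw [hv.conv_fderiv_eq hr hx e b, ← integral_const_mul, ← Real.norm_eq_abs]
    refine norm_integral_le_of_norm_le ((hintg b).const_mul _) (Eventually.of_forall fun z => ?_)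
    rw [norm_mul, Real.norm_eq_abs, Real.norm_eq_abs, mul_comm]
    exact mul_le_mul_of_nonneg_right ((h μ hv.nonneg hM r hr hr1 _).2 e) (abs_nonneg _)

theorem integral_closedBall_le {g : Eu n → ℝ} {x : Eu n} {r S : ℝ} (hr : 0 < r)
    (hg : ∀ z ∈ Metric.closedBall x r, |g z| ≤ S) :
    ∫ z in Metric.closedBall x r, |g z| ≤
      S * ((volume : Measure (Eu n)).real (Metric.closedBall 0 1) * r ^ n) := by
  have h1 : (volume : Measure (Eu n)).real (Metric.closedBall x r) =
      r ^ n * (volume : Measure (Eu n)).real (Metric.closedBall 0 1) := by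
    rw [Measure.addHaar_real_closedBall' volume x hr.le, finrank_euclideanSpace, Fintype.card_fin]
  have := norm_setIntegral_le_of_norm_le_const (μ := (volume : Measure (Eu n)))
    (s := Metric.closedBall x r) (f := fun z => |g z|) (C := S)
    measure_closedBall_lt_top (fun z hz => by simpa using hg z hz)
  rw [h1] at this
  calc _ ≤ _ := le_abs_self _
    _ ≤ _ := this
    _ = _ := by ring

/-- Interior gradient estimate in terms of the oscillation. -/
theorem exists_helm_gradient_estimate (n : ℕ) (M : ℝ) :
    ∃ C > 0, ∀ (μ : ℝ) (U : Set (Eu n)) (v : Eu n → ℝ), Helm μ U v → μ ≤ M →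
      ∀ (x : Eu n) (r : ℝ), 0 < r → r ≤ 1 → Metric.closedBall x r ⊆ U → ∀ b S,
        (∀ z ∈ Metric.closedBall x r, |v z - b| ≤ S) → ∀ e,
          |fderiv ℝ v x e| ≤ C / r * ‖e‖ * S := by
  obtain ⟨C, hC, h⟩ := exists_helm_estimate n M
  have hvol : 0 < (volume : Measure (Eu n)).real (Metric.closedBall 0 1) :=
    ENNReal.toReal_pos (Metric.measure_closedBall_pos _ _ one_pos).ne'
      measure_closedBall_lt_top.ne
  refine ⟨C * (volume : Measure (Eu n)).real (Metric.closedBall 0 1), by positivity,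
    fun μ U v hv hM x r hr hr1 hx b S hS e => ?_⟩
  refine ((h μ U v hv hM x r hr hr1 hx).2 b e).trans ?_
  refine (mul_le_mul_of_nonneg_left (integral_closedBall_le hr hS) (by positivity)).trans ?_
  apply le_of_eq
  field_simp
  ring

/-- Strong minimum principle. -/
theorem Helm.eq_zero_of_nonneg {μ : ℝ} {U : Set (Eu n)} {v : Eu n → ℝ} (hv : Helm μ U v)
    (hU : IsPreconnected U) (h0 : ∀ x ∈ U, 0 ≤ v x) {x₀ : Eu n} (hx₀ : x₀ ∈ U) (hvx : v x₀ = 0) :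
    ∀ x ∈ U, v x = 0 := by
  have hopen : ∀ x ∈ U, v x = 0 → ∀ᶠ y in 𝓝 x, v y = 0 := fun x hx hvx => by
    obtain ⟨r, hr, hrU⟩ := Metric.nhds_basis_closedBall.mem_iff.1 (hv.isOpen.mem_nhds hx)
    have h1 := hv.conv_eq hr hrU
    rw [conv_avgKernel_eq_setIntegral μ hr, hvx] at h1
    filter_upwards [Metric.ball_mem_nhds x hr] with y hy
    by_contra hne
    have hpos : 0 < v y := lt_of_le_of_ne (h0 y (hrU (Metric.ball_subset_closedBall hy)))
      (Ne.symm hne)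
    have hk := (contDiff_avgKernel (n := n) μ r).continuous
    have hcont : ContinuousOn (fun z => v z * avgKernel μ r (x - z)) (Metric.closedBall x r) :=
      (hv.continuousOn.mono hrU).mul (hk.comp (by fun_prop)).continuousOn
    have hintg := hcont.integrableOn_compact (μ := volume) (isCompact_closedBall x r)
    have h2 : 0 < ∫ z in Metric.closedBall x r, v z * avgKernel μ r (x - z) := by
      rw [setIntegral_pos_iff_support_of_nonneg_ae _ hintg]
      · refine lt_of_lt_of_le ?_ (measure_mono (s := {z | v z ≠ 0} ∩ Metric.ball x r) ?_)
        · have : {z | v z ≠ 0} ∩ Metric.ball x r ∈ 𝓝 y := by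
            refine Filter.inter_mem ?_ (Metric.isOpen_ball.mem_nhds hy)
            exact (hv.continuousOn.continuousAt (hv.isOpen.mem_nhds
              (hrU (Metric.ball_subset_closedBall hy)))).eventually_ne hpos.ne'
          exact Measure.measure_pos_of_mem_nhds _ this
        · rintro z ⟨hz1, hz2⟩
          refine ⟨mul_ne_zero hz1 (avgKernel_pos μ hr ?_).ne', Metric.ball_subset_closedBall hz2⟩
          rwa [← dist_eq_norm, dist_comm]
      · filter_upwards [self_mem_ae_restrict measurableSet_closedBall] with z hz
        exact mul_nonneg (h0 z (hrU hz)) (avgKernel_nonneg μ hr _)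
    exact h2.ne' h1
  have hsub : U ⊆ {x | ∀ᶠ y in 𝓝 x, v y = 0} := by
    refine hU.subset_of_closure_inter_subset isOpen_setOfPred_eventually_nhds
      ⟨x₀, hx₀, hopen x₀ hx₀ hvx⟩ ?_
    rintro x ⟨hx, hxU⟩
    refine hopen x hxU ?_
    have hc := (hv.continuousOn.continuousAt (hv.isOpen.mem_nhds hxU))
    by_contra hne
    obtain ⟨y, hy1, hy2⟩ := mem_closure_iff_nhds.1 hx _ (hc.eventually_ne hne)
    exact hy1 (Eventually.self_of_nhds (p := fun z => v z = 0) hy2)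
  exact fun x hx => Eventually.self_of_nhds (p := fun z => v z = 0) (hsub hx)

theorem two_le_infty : (2 : WithTop ℕ∞) ≤ ∞ := by norm_cast

theorem fderiv_fderiv_comm {f : Eu n → ℝ} {x : Eu n} (hf : ContDiffAt ℝ ∞ f x) (a b : Eu n) :
    fderiv ℝ (fun z => fderiv ℝ f z a) x b = fderiv ℝ (fun z => fderiv ℝ f z b) x a := by
  have h1 : DifferentiableAt ℝ (fderiv ℝ f) x :=
    (hf.fderiv_right (m := ∞) (by simp)).differentiableAt (by simp)
  have h2 : ∀ a b, fderiv ℝ (fun z => fderiv ℝ f z a) x b = fderiv ℝ (fderiv ℝ f) x b a :=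
    fun a b => by
      rw [fderiv_clm_apply h1 (differentiableAt_const a)]
      simp
  rw [h2, h2]
  exact (hf.isSymmSndFDerivAt (by simpa using two_le_infty)) b a

/-- Directional derivatives of solutions are solutions. -/
theorem Helm.fderiv_apply {μ : ℝ} {U : Set (Eu n)} {v : Eu n → ℝ} (hv : Helm μ U v) (e : Eu n) :
    Helm μ U fun x => fderiv ℝ v x e := by
  have hU := hv.isOpen
  refine ⟨hU, hv.nonneg, (hv.contDiffOn.fderiv_of_isOpen hU (m := ∞) (by simp)).clm_apply
    contDiffOn_const, fun x hx => ?_⟩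
  have hvx : ∀ y ∈ U, ContDiffAt ℝ ∞ v y := fun y hy => hv.contDiffOn.contDiffAt (hU.mem_nhds hy)
  have h1 : laplacian (fun x => fderiv ℝ v x e) x = fderiv ℝ (laplacian v) x e := by
    have h2 : ∀ i, pd i (pd i fun x => fderiv ℝ v x e) x = fderiv ℝ (pd i (pd i v)) x e := fun i => by
      have h3 : (pd i fun x => fderiv ℝ v x e) =ᶠ[𝓝 x] fun x => fderiv ℝ (pd i v) x e := by
        filter_upwards [hU.mem_nhds hx] with y hy
        exact fderiv_fderiv_comm (hvx y hy) e _
      rw [(h3.pd i).eq_of_nhds]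
      exact fderiv_fderiv_comm ((hvx x hx).pd i) e _
    simp only [laplacian_eq_sum_pd, h2]
    have : laplacian v = fun x => ∑ i, pd i (pd i v) x := rfl
    rw [this, fderiv_fun_sum fun i _ => (((hvx x hx).pd i).pd i).differentiableAt (by simp)]
    simp
  have h2 : laplacian v =ᶠ[𝓝 x] fun y => -μ * v y := by
    filter_upwards [hU.mem_nhds hx] with y hy
    linarith [hv.eq_zero y hy]
  rw [h1, h2.fderiv_eq, fderiv_const_mul ((hvx x hx).differentiableAt (by simp))]
  simp

theorem abs_le_of_derivatives_bounded {g : ℕ → ℝ → ℝ} {m : ℕ} {A : ℝ}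
    (hg : ∀ j < m, ∀ t ∈ Icc (0 : ℝ) 1, HasDerivAt (g j) (g (j + 1) t) t)
    (h0 : ∀ j < m, g j 0 = 0) (hA : ∀ t ∈ Icc (0 : ℝ) 1, |g m t| ≤ A) :
    |g 0 1| ≤ A / m.factorial := by
  have key : ∀ k ≤ m, ∀ t ∈ Icc (0 : ℝ) 1, |g (m - k) t| ≤ A * t ^ k / k.factorial := by
    intro k
    induction k with
    | zero => simpa using hA
    | succ k ih =>
      intro hk
      have hj : m - (k + 1) < m := by omega
      have hj' : m - (k + 1) + 1 = m - k := by omega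
      have hd := hg _ hj
      rw [hj'] at hd
      refine image_norm_le_of_norm_deriv_right_le_deriv_boundary
        (f' := g (m - k)) (B' := fun t => A * t ^ k / k.factorial)
        (fun t ht => (hd t ht).continuousAt.continuousWithinAt)
        (fun t ht => (hd t (Ico_subset_Icc_self ht)).hasDerivWithinAt) (by simp [h0 _ hj])
        (fun t => ?_) (fun t ht => ih (by omega) t (Ico_subset_Icc_self ht))
      have := ((hasDerivAt_pow (k + 1) t).const_mul A).div_const ((k + 1).factorial : ℝ)
      have h2 : A * t ^ k / k.factorial =
          A * (↑(k + 1) * t ^ (k + 1 - 1)) / (k + 1).factorial := by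
        rw [Nat.factorial_succ, Nat.add_sub_cancel]
        push_cast
        field_simp
      rw [h2]
      exact this
  simpa using key m le_rfl 1 (by simp)

/-- Iterated directional derivatives. -/
def iterDir (e : Eu n) (v : Eu n → ℝ) : ℕ → Eu n → ℝ
  | 0 => v
  | m + 1 => fun x => fderiv ℝ (iterDir e v m) x e

theorem Helm.iterDir {μ : ℝ} {U : Set (Eu n)} {v : Eu n → ℝ} (hv : Helm μ U v) (e : Eu n)
    (m : ℕ) : Helm μ U (iterDir e v m) := by
  induction m with
  | zero => exact hv
  | succ m ih => exact ih.fderiv_apply e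

theorem iterDir_eq_zero {v : Eu n → ℝ} {y : Eu n} (h : ∀ᶠ z in 𝓝 y, v z = 0) (e : Eu n) (m : ℕ) :
    iterDir e v m =ᶠ[𝓝 y] fun _ => 0 := by
  induction m with
  | zero => exact h
  | succ m ih =>
    filter_upwards [ih.fderiv (𝕜 := ℝ)] with z hz
    simp [iterDir, hz]

/-- Unique continuation. -/
theorem Helm.eq_zero_of_eventually {μ : ℝ} {U : Set (Eu n)} {v : Eu n → ℝ} (hv : Helm μ U v)
    (hU : IsPreconnected U) {x₀ : Eu n} (hx₀ : x₀ ∈ U) (hvx : ∀ᶠ y in 𝓝 x₀, v y = 0) :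
    ∀ x ∈ U, v x = 0 := by
  have hsub : U ⊆ {x | ∀ᶠ y in 𝓝 x, v y = 0} := by
    refine hU.subset_of_closure_inter_subset isOpen_setOfPred_eventually_nhds ⟨x₀, hx₀, hvx⟩ ?_
    rintro x ⟨hx, hxU⟩
    obtain ⟨C, hC, hest⟩ := exists_helm_gradient_estimate n μ
    obtain ⟨ρ', hρ', hρU'⟩ := Metric.nhds_basis_closedBall.mem_iff.1 (hv.isOpen.mem_nhds hxU)
    obtain ⟨ρ, hρ, hρ1, hρU⟩ : ∃ ρ > 0, ρ ≤ 1 ∧ Metric.closedBall x (3 * ρ) ⊆ U :=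
      ⟨min 1 (ρ' / 3), by positivity, min_le_left _ _, (Metric.closedBall_subset_closedBall (by
        linarith [min_le_right 1 (ρ' / 3)])).trans hρU'⟩
    obtain ⟨S, hS⟩ := (isCompact_closedBall x (3 * ρ)).exists_bound_of_continuousOn
      (hv.continuousOn.mono hρU)
    have hbound : ∀ (e : Eu n) (m : ℕ), 0 < m → ∀ j ≤ m,
        ∀ z ∈ Metric.closedBall x (3 * ρ - j * (ρ / m)),
          |_root_.iterDir e v j z| ≤ (C / (ρ / m) * ‖e‖) ^ j * S := by
      intro e m hm j
      have hm' : (0 : ℝ) < m := by exact_mod_cast hm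
      have hm1 : (1 : ℝ) ≤ m := by exact_mod_cast hm
      have hρm : 0 < ρ / m := by positivity
      induction j with
      | zero => intro _ z hz; simpa [_root_.iterDir] using hS z (by simpa using hz)
      | succ j ih =>
        intro hj z hz
        have hsub : Metric.closedBall z (ρ / m) ⊆
            Metric.closedBall x (3 * ρ - j * (ρ / m)) := by
          refine Metric.closedBall_subset_closedBall' ?_
          rw [Metric.mem_closedBall] at hz
          push_cast at hz
          linarith
        have := hest μ U _ (hv.iterDir e j) le_rfl z (ρ / m) hρm
          ((div_le_self hρ.le hm1).trans hρ1)
          (hsub.trans ((Metric.closedBall_subset_closedBall (by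
            have : 0 ≤ j * (ρ / m) := by positivity
            linarith)).trans hρU)) 0 _
          (fun w hw => by simpa using ih (by omega) w (hsub hw)) e
        rw [← mul_assoc, ← pow_succ'] at this
        exact this
    set δ := ρ / (4 * (C * exp 1 + 1)) with hδ
    have hCe : 0 < C * exp 1 := by positivity
    have hδ0 : 0 < δ := by positivity
    have hδρ : δ ≤ ρ := div_le_self hρ.le (by linarith)
    obtain ⟨y, hy1, hy2⟩ := mem_closure_iff_nhds.1 hx _ (Metric.ball_mem_nhds x hδ0)
    filter_upwards [Metric.ball_mem_nhds x hδ0] with z hz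
    set e := z - y with he
    rw [Metric.mem_ball] at hy1 hz
    have hen : ‖e‖ ≤ 2 * δ := by
      rw [he, ← dist_eq_norm]
      linarith [dist_triangle_right z y x]
    have hseg : ∀ t ∈ Icc (0 : ℝ) 1, y + t • e ∈ Metric.closedBall x (2 * ρ) := fun t ht => by
      have : y + t • e ∈ Metric.ball x δ := by
        have hconv := convex_ball x δ
        have := hconv.add_smul_sub_mem (x := y) (y := z) hy1 hz ht
        simpa [he] using this
      exact Metric.ball_subset_closedBall (Metric.ball_subset_ball (by linarith) this)
    have hfin : ∀ m : ℕ, 0 < m → |v z| ≤ (1 / 2) ^ m * S := fun m hm => by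
      have hm' : (0 : ℝ) < m := by exact_mod_cast hm
      have h2 : 3 * ρ - m * (ρ / m) = 2 * ρ := by field_simp; ring
      have h1 := abs_le_of_derivatives_bounded (g := fun j t => _root_.iterDir e v j (y + t • e))
        (m := m) (A := (C / (ρ / m) * ‖e‖) ^ m * S) (fun j _ t ht => ?_) (fun j _ => ?_)
        (fun t ht => hbound e m hm m le_rfl _ (by rw [h2]; exact hseg t ht))
      · have hS0 : 0 ≤ S := (norm_nonneg _).trans (hS x (Metric.mem_closedBall_self (by positivity)))
        have h3 : (C / (ρ / m) * ‖e‖) ^ m * S / m.factorial =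
            (C / ρ * ‖e‖) ^ m * ((m : ℝ) ^ m / m.factorial) * S := by
          rw [show C / (ρ / m) * ‖e‖ = (C / ρ * ‖e‖) * m by field_simp, mul_pow]
          ring
        have h4 : (m : ℝ) ^ m / m.factorial ≤ exp 1 ^ m := by
          rw [← Real.exp_nat_mul, mul_one]
          exact Real.pow_div_factorial_le_exp _ hm'.le m
        have h5 : C / ρ * ‖e‖ * exp 1 ≤ 1 / 2 := by
          calc C / ρ * ‖e‖ * exp 1 ≤ C / ρ * (2 * δ) * exp 1 := by gcongr
            _ = (C * exp 1) / (C * exp 1 + 1) * (1 / 2) := by rw [hδ]; field_simp; ring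
            _ ≤ 1 * (1 / 2) := by gcongr; rw [div_le_one (by positivity)]; linarith
            _ = 1 / 2 := one_mul _
        have h6 : y + (1 : ℝ) • e = z := by simp [he]
        simp only [h6, _root_.iterDir] at h1
        calc |v z| ≤ _ := h1
          _ = _ := h3
          _ ≤ (C / ρ * ‖e‖) ^ m * exp 1 ^ m * S := by gcongr
          _ = (C / ρ * ‖e‖ * exp 1) ^ m * S := by rw [← mul_pow]
          _ ≤ (1 / 2) ^ m * S := by gcongr
      · have hU' : y + t • e ∈ U := hρU (Metric.closedBall_subset_closedBall (by linarith) (hseg t ht))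
        have h1 : HasFDerivAt (_root_.iterDir e v j) _ (y + t • e) :=
          (((hv.iterDir e j).contDiffOn.contDiffAt (hv.isOpen.mem_nhds hU')).differentiableAt
            (by simp)).hasFDerivAt
        have h2 : HasDerivAt (fun t : ℝ => y + t • e) e t := by
          simpa using ((hasDerivAt_id t).smul_const e).const_add y
        exact h1.comp_hasDerivAt t h2
      · simpa using (iterDir_eq_zero hy2 e j).eq_of_nhds
    have hlim : Tendsto (fun m : ℕ => (1 / 2 : ℝ) ^ m * S) atTop (𝓝 0) := by
      simpa using (tendsto_pow_atTop_nhds_zero_of_lt_one (r := (1 / 2 : ℝ)) (by norm_num)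
        (by norm_num)).mul_const S
    have := ge_of_tendsto hlim ((eventually_gt_atTop 0).mono hfin)
    exact abs_eq_zero.1 (le_antisymm this (abs_nonneg _))
  exact fun x hx => Eventually.self_of_nhds (p := fun z => v z = 0) (hsub hx)

theorem IsTest.integrable_mul {U : Set (Eu n)} {f ψ : Eu n → ℝ} (hψ : IsTest U ψ) (hf : Continuous f) :
    Integrable fun x => f x * ψ x :=
  integrable_mul_of_hasCompactSupport hf hψ.contDiff.continuous hψ.hasCompactSupport

theorem IsTest.mul_left {U : Set (Eu n)} {f ψ : Eu n → ℝ} (hψ : IsTest U ψ)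
    (hf : ContDiff ℝ ∞ f) : IsTest U fun x => f x * ψ x :=
  ⟨hf.mul hψ.contDiff, hψ.hasCompactSupport.mul_left,
    (tsupport_mul_subset_right (f := f)).trans hψ.tsupport_subset⟩

theorem IsTest.integrable {U : Set (Eu n)} {ψ : Eu n → ℝ} (hψ : IsTest U ψ) : Integrable ψ :=
  hψ.contDiff.continuous.integrable_of_hasCompactSupport hψ.hasCompactSupport

theorem ContDiff.differentiableAt_infty {f : Eu n → ℝ} (hf : ContDiff ℝ ∞ f) (x : Eu n) :
    DifferentiableAt ℝ f x := (hf.differentiable (by simp)).differentiableAt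

theorem integral_mul_mul_pd {q w : Eu n → ℝ} (hq : ContDiff ℝ ∞ q) (hw : IsTestFn w) (i : Fin n) :
    ∫ x, q x * (w x * pd i w x) = -(1 / 2) * ∫ x, pd i q x * w x ^ 2 := by
  have h1 := integral_mul_pd (hq.mul hw.contDiff) hw.contDiff hw.hasCompactSupport i
  have h2 : ∀ x, pd i (fun x => q x * w x) x = q x * pd i w x + pd i q x * w x := fun x =>
    pd_mul (hq.differentiableAt_infty x) (hw.contDiff.differentiableAt_infty x) i
  simp only [h2, add_mul] at h1
  rw [integral_add] at h1
  · have e1 : ∀ x, q x * w x * pd i w x = q x * (w x * pd i w x) := fun x => by ring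
    have e2 : ∀ x, q x * pd i w x * w x = q x * (w x * pd i w x) := fun x => by ring
    have e3 : ∀ x, pd i q x * w x * w x = pd i q x * w x ^ 2 := fun x => by ring
    simp only [e1, e2, e3] at h1
    linarith
  · exact hw.integrable_mul (hq.continuous.mul (hw.contDiff.pd i).continuous)
  · exact hw.integrable_mul ((hq.pd i).continuous.mul hw.contDiff.continuous)

/-- The shifted coordinate function. -/
def coordShift (i : Fin n) (τ : ℝ) (x : Eu n) : ℝ := x i + τ

theorem contDiff_coordShift (i : Fin n) (τ : ℝ) : ContDiff ℝ ∞ (coordShift i τ) :=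
  (contDiff_piLp_apply 2).add contDiff_const

theorem pd_coordShift (i j : Fin n) (τ : ℝ) (x : Eu n) :
    pd j (coordShift i τ) x = if j = i then 1 else 0 := by
  have h : HasFDerivAt (coordShift i τ) (EuclideanSpace.proj i : Eu n →L[ℝ] ℝ) x :=
    (EuclideanSpace.proj i : Eu n →L[ℝ] ℝ).hasFDerivAt.add_const τ
  rw [pd, h.fderiv]
  simp [eq_comm]

theorem pd_pd_comm {f : Eu n → ℝ} (hf : ContDiff ℝ ∞ f) (i j : Fin n) :
    pd i (pd j f) = pd j (pd i f) :=
  funext fun _ => fderiv_fderiv_comm hf.contDiffAt _ _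

/-- Rellich's identity in one direction. -/
theorem rellich_identity {v : Eu n → ℝ} (hv : IsTestFn v) (i : Fin n) (μ τ : ℝ) :
    ∫ x, (laplacian v x + μ * v x) * (coordShift i τ x * pd i v x + 1 / 2 * v x) =
      - ∫ x, pd i v x ^ 2 := by
  set t := coordShift (n := n) i τ
  have ht : ContDiff ℝ ∞ t := contDiff_coordShift i τ
  have hc := hv.contDiff
  have hpd : ∀ j x, pd j t x = if j = i then 1 else 0 := fun j x => pd_coordShift i j τ x
  have h1 : ∀ w, IsTestFn w → ∫ x, t x * (w x * pd i w x) = -(1 / 2) * ∫ x, w x ^ 2 :=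
    fun w hw => by simpa [hpd] using integral_mul_mul_pd ht hw i
  have h2 : ∫ x, (t x * pd i v x) * laplacian v x =
      -(∫ x, pd i v x ^ 2) + 1 / 2 * ∑ j, ∫ x, pd j v x ^ 2 := by
    have := integral_mul_laplacian (ht.mul (hc.pd i)) hc hv.hasCompactSupport
    rw [this, Finset.mul_sum]
    have h3 : ∀ j, ∫ x, pd j (fun x => t x * pd i v x) x * pd j v x =
        (if j = i then ∫ x, pd i v x ^ 2 else 0) - 1 / 2 * ∫ x, pd j v x ^ 2 := fun j => by
      have h4 : ∀ x, pd j (fun x => t x * pd i v x) x * pd j v x =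
          t x * (pd j v x * pd i (pd j v) x) + (if j = i then pd i v x ^ 2 else 0) := fun x => by
        rw [pd_mul (ht.differentiableAt_infty x) ((hc.pd i).differentiableAt_infty x), hpd,
          pd_pd_comm hc j i]
        split_ifs with h
        · subst h; ring
        · ring
      simp only [h4]
      rw [integral_add]
      · rw [h1 _ (hv.pd j)]
        split_ifs
        · ring
        · simp
      · have := (hv.pd j).integrable_mul (ht.continuous.mul ((hc.pd j).pd i).continuous)
        exact this.congr (Eventually.of_forall fun x => by simp only [Pi.mul_apply]; ring)
      · split_ifs
        · simpa [sq] using (hv.pd i).integrable_mul (hc.pd i).continuous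
        · exact integrable_zero _ _ _
    simp only [h3, Finset.sum_sub_distrib, Finset.sum_ite_eq', Finset.mem_univ, if_true]
    ring
  have h3 : ∫ x, v x * laplacian v x = - ∑ j, ∫ x, pd j v x ^ 2 := by
    simpa [sq] using integral_mul_laplacian hc hc hv.hasCompactSupport
  have h4 := h1 v hv
  have e : ∀ x, (laplacian v x + μ * v x) * (t x * pd i v x + 1 / 2 * v x) =
      (t x * pd i v x) * laplacian v x + 1 / 2 * (v x * laplacian v x) +
      (μ * (t x * (v x * pd i v x)) + μ / 2 * v x ^ 2) := fun x => by ring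
  have hcv := hc.continuous
  have i1 : Integrable fun x => (t x * pd i v x) * laplacian v x :=
    (IsTest.laplacian hv).integrable_mul (ht.continuous.mul (hc.pd i).continuous)
  have i2 : Integrable fun x => v x * laplacian v x := (IsTest.laplacian hv).integrable_mul hcv
  have i3 : Integrable fun x => t x * (v x * pd i v x) :=
    ((hv.pd i).integrable_mul (ht.continuous.mul hcv)).congr
      (Eventually.of_forall fun x => by simp only [Pi.mul_apply]; ring)
  have i4 : Integrable fun x => v x ^ 2 := by simpa [sq] using hv.integrable_mul hcv
  have j1 : Integrable fun x => (t x * pd i v x) * laplacian v x + 1 / 2 * (v x * laplacian v x) :=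
    i1.add (i2.const_mul _)
  have j2 : Integrable fun x => μ * (t x * (v x * pd i v x)) + μ / 2 * v x ^ 2 :=
    (i3.const_mul _).add (i4.const_mul _)
  simp only [e]
  rw [integral_add j1 j2,
    integral_add i1 (i2.const_mul _), integral_add (i3.const_mul _) (i4.const_mul _),
    integral_const_mul, integral_const_mul, integral_const_mul, h2, h3, h4]
  ring

/-- A Carleman estimate with a quadratic weight, in conjugated form. -/
theorem carleman_conjugated {v : Eu n → ℝ} (hv : IsTestFn v) (i : Fin n) (μ τ : ℝ) :
    4 * ∫ x, v x ^ 2 ≤ ∫ x, (laplacian v x + μ * v x - 2 * coordShift i τ x * pd i v x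
      + (coordShift i τ x ^ 2 - 1) * v x) ^ 2 := by
  have h0 := rellich_identity hv i μ τ
  have ht : ContDiff ℝ ∞ (coordShift (n := n) i τ) := contDiff_coordShift i τ
  have hpd : ∀ x, pd i (coordShift i τ) x = 1 := fun x => by simp [pd_coordShift]
  generalize coordShift (n := n) i τ = t at *
  have hc := hv.contDiff
  have hcv := hc.continuous
  have h1 : ∫ x, t x * (v x * pd i v x) = -(1 / 2) * ∫ x, v x ^ 2 := by
    simpa [hpd] using integral_mul_mul_pd ht hv i
  have h3 : ∫ x, t x ^ 3 * (v x * pd i v x) = -(3 / 2) * ∫ x, t x ^ 2 * v x ^ 2 := by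
    rw [integral_mul_mul_pd (ht.pow 3) hv i]
    have : ∀ x, pd i (fun x => t x ^ 3) x = 3 * t x ^ 2 := fun x => by
      rw [pd_comp (β := fun s => s ^ 3) (differentiableAt_pow 3) (ht.differentiableAt_infty x),
        hpd]
      simp
    simp only [this, mul_assoc]
    rw [integral_const_mul]
    ring
  have hp := (hv.pd i)
  have i1 : Integrable fun x => (laplacian v x + μ * v x) * (t x * pd i v x + 1 / 2 * v x) := by
    have := (hp.integrable_mul (f := fun x => (laplacian v x + μ * v x) * t x)
      ((hc.laplacian.continuous.add (continuous_const.mul hcv)).mul ht.continuous)).add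
      (hv.integrable_mul (f := fun x => (laplacian v x + μ * v x) * (1 / 2))
      ((hc.laplacian.continuous.add (continuous_const.mul hcv)).mul continuous_const))
    exact this.congr (Eventually.of_forall fun x => by simp only [Pi.add_apply]; ring)
  have i2 : Integrable fun x => t x ^ 3 * (v x * pd i v x) :=
    (hp.integrable_mul ((ht.continuous.pow 3).mul hcv)).congr
      (Eventually.of_forall fun x => by simp only [Pi.mul_apply, Pi.pow_apply]; ring)
  have i3 : Integrable fun x => t x ^ 2 * v x ^ 2 :=
    (hv.integrable_mul ((ht.continuous.pow 2).mul hcv)).congr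
      (Eventually.of_forall fun x => by simp only [Pi.mul_apply, Pi.pow_apply]; ring)
  have i4 : Integrable fun x => pd i v x ^ 2 := by
    simpa [sq] using hp.integrable_mul (hc.pd i).continuous
  have i5 : Integrable fun x => t x * (v x * pd i v x) :=
    (hp.integrable_mul (ht.continuous.mul hcv)).congr
      (Eventually.of_forall fun x => by simp only [Pi.mul_apply]; ring)
  have i6 : Integrable fun x => (laplacian v x + μ * v x - 2 * t x * pd i v x
      + (t x ^ 2 - 1) * v x) ^ 2 := by
    have hcp := (hc.pd i).continuous
    have hL := hc.laplacian.continuous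
    have hct := ht.continuous
    refine Continuous.integrable_of_hasCompactSupport (by fun_prop)
      (hv.hasCompactSupport.of_isClosed_subset (isClosed_tsupport _)
      (closure_minimal (fun x hx => ?_) (isClosed_tsupport _)))
    by_contra h
    apply hx
    simp only [laplacian_eq_zero_of_notMem_tsupport h, image_eq_zero_of_notMem_tsupport h,
      image_eq_zero_of_notMem_tsupport (fun h' => h (tsupport_pd_subset i v h'))]
    simp
  have h4 : ∫ x, (-4 * ((laplacian v x + μ * v x) * (t x * pd i v x + 1 / 2 * v x)) +
      (-4 * (t x ^ 3 * (v x * pd i v x)) + -2 * (t x ^ 2 * v x ^ 2))) ≤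
      ∫ x, (laplacian v x + μ * v x - 2 * t x * pd i v x + (t x ^ 2 - 1) * v x) ^ 2 := by
    refine integral_mono ((i1.const_mul _).add ((i2.const_mul _).add (i3.const_mul _))) i6
      fun x => ?_
    nlinarith [sq_nonneg (laplacian v x + μ * v x + t x ^ 2 * v x + 2 * t x * pd i v x + v x),
      sq_nonneg (laplacian v x + μ * v x + t x ^ 2 * v x), sq_nonneg (2 * t x * pd i v x + v x)]
  have j1 : Integrable fun x => -4 * (t x ^ 3 * (v x * pd i v x)) + -2 * (t x ^ 2 * v x ^ 2) :=
    (i2.const_mul _).add (i3.const_mul _)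
  rw [integral_add (i1.const_mul _) j1,
    integral_add (i2.const_mul _) (i3.const_mul _), integral_const_mul, integral_const_mul,
    integral_const_mul, h0, h3] at h4
  have h5 : ∫ x, -2 * (t x * (v x * pd i v x)) ≤ ∫ x, (t x ^ 2 * v x ^ 2 + pd i v x ^ 2) :=
    integral_mono (i5.const_mul _) (i3.add i4) fun x => by
      nlinarith [sq_nonneg (t x * v x + pd i v x)]
  rw [integral_const_mul, h1, integral_add i3 i4] at h5
  linarith

/-- Carleman estimate with a quadratic weight. -/
theorem carleman {ψ : Eu n → ℝ} (hψ : IsTestFn ψ) (i : Fin n) (μ τ : ℝ) :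
    4 * ∫ x, exp ((x i + τ) ^ 2) * ψ x ^ 2 ≤
      ∫ x, exp ((x i + τ) ^ 2) * (laplacian ψ x + μ * ψ x) ^ 2 := by
  set t := coordShift (n := n) i τ
  have ht : ContDiff ℝ ∞ t := contDiff_coordShift i τ
  have htx : ∀ x, x i + τ = t x := fun x => rfl
  set E : Eu n → ℝ := fun x => exp (t x ^ 2 / 2) with hE
  have hEc : ContDiff ℝ ∞ E := Real.contDiff_exp.comp ((ht.pow 2).div_const 2)
  have hβ : ContDiff ℝ ∞ fun s : ℝ => exp (s ^ 2 / 2) :=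
    Real.contDiff_exp.comp ((contDiff_id.pow 2).div_const 2)
  have hβ' : ∀ s : ℝ, HasDerivAt (fun s : ℝ => exp (s ^ 2 / 2)) (s * exp (s ^ 2 / 2)) s := fun s => by
    have := ((hasDerivAt_pow 2 s).div_const 2).exp
    convert this using 1
    simp; ring
  have hpE : ∀ j x, pd j E x = if j = i then t x * E x else 0 := fun j x => by
    rw [hE, pd_comp (β := fun s => exp (s ^ 2 / 2)) (hβ' _).differentiableAt
      (ht.differentiableAt_infty x), (hβ' _).deriv, pd_coordShift]
    split_ifs <;> simp
  have hLE : ∀ x, laplacian E x = (t x ^ 2 + 1) * E x := fun x => by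
    rw [laplacian_eq_sum_pd, Finset.sum_eq_single i]
    · have : pd i E = fun x => t x * E x := funext fun x => by simp [hpE]
      rw [this, pd_mul (ht.differentiableAt_infty x) (hEc.differentiableAt_infty x), hpE,
        pd_coordShift]
      simp; ring
    · intro j _ hj
      have : pd j E = fun _ => 0 := funext fun x => by simp [hpE, hj]
      rw [this]
      simp [pd]
    · simp
  have hv : IsTestFn fun x => E x * ψ x := IsTest.mul_left hψ hEc
  have := carleman_conjugated hv i μ τ
  have h1 : ∀ x, E x ^ 2 = exp (t x ^ 2) := fun x => by
    rw [hE, ← Real.exp_nat_mul]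
    congr 1
    push_cast; ring
  convert this using 3
  · ext x
    rw [htx, ← h1]; ring
  · rw [htx, ← h1, ← mul_pow]
    congr 1
    rw [laplacian_mul hEc.contDiffAt hψ.contDiff.contDiffAt, hLE,
      pd_mul (hEc.differentiableAt_infty _) (hψ.contDiff.differentiableAt_infty _)]
    simp only [hpE, ite_mul, zero_mul, Finset.sum_ite_eq', Finset.mem_univ, if_true]
    change _ = _ - 2 * t _ * _ + (t _ ^ 2 - 1) * _
    ring

/-- The Hilbert space of square integrable functions on `ℝ^n`. -/
abbrev L2 (n : ℕ) := Lp ℝ 2 (volume : Measure (Eu n))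

theorem L2.inner_eq (u w : L2 n) : ⟪u, w⟫ = ∫ x, u x * w x := by
  rw [MeasureTheory.L2.inner_def]
  simp [mul_comm]

theorem L2.norm_sq_eq (u : L2 n) : ‖u‖ ^ 2 = ∫ x, u x ^ 2 := by
  rw [← real_inner_self_eq_norm_sq, L2.inner_eq]
  simp [sq]

theorem L2.integrable_mul (u w : L2 n) : Integrable fun x => u x * w x :=
  (Lp.memLp u).integrable_mul (Lp.memLp w)

theorem L2.integrable_sq (u : L2 n) : Integrable fun x => u x ^ 2 := by
  simpa [sq] using L2.integrable_mul u u

theorem L2.locallyIntegrable (u : L2 n) : LocallyIntegrable (u : Eu n → ℝ) :=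
  (Lp.memLp u).locallyIntegrable (by norm_num)

theorem IsTest.memLp {U : Set (Eu n)} {ψ : Eu n → ℝ} (h : IsTest U ψ) : MemLp ψ 2 :=
  h.contDiff.continuous.memLp_of_hasCompactSupport h.hasCompactSupport

/-- A test function as an element of `L²`. -/
def IsTest.toL2 {U : Set (Eu n)} {ψ : Eu n → ℝ} (h : IsTest U ψ) : L2 n := h.memLp.toLp ψ

theorem IsTest.coeFn_toL2 {U : Set (Eu n)} {ψ : Eu n → ℝ} (h : IsTest U ψ) : h.toL2 =ᵐ[volume] ψ :=
  h.memLp.coeFn_toLp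

theorem IsTest.inner_toL2 {U : Set (Eu n)} {ψ : Eu n → ℝ} (h : IsTest U ψ) (u : L2 n) :
    ⟪u, h.toL2⟫ = ∫ x, u x * ψ x := by
  rw [L2.inner_eq]
  exact integral_congr_ae (h.coeFn_toL2.mono fun x hx => by simp [hx])

theorem L2.norm_sq_eq_of_ae {u : L2 n} {w : Eu n → ℝ} (h : u =ᵐ[volume] w) :
    ‖u‖ ^ 2 = ∫ x, w x ^ 2 := by
  rw [L2.norm_sq_eq]
  exact integral_congr_ae (h.mono fun x hx => by simp [hx])

theorem IsTest.add {U : Set (Eu n)} {ψ φ : Eu n → ℝ} (h : IsTest U ψ) (h' : IsTest U φ) :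
    IsTest U fun x => ψ x + φ x :=
  ⟨h.contDiff.add h'.contDiff, h.hasCompactSupport.add h'.hasCompactSupport,
    (tsupport_add ψ φ).trans (union_subset h.tsupport_subset h'.tsupport_subset)⟩

theorem IsTest.const_mul {U : Set (Eu n)} {ψ : Eu n → ℝ} (h : IsTest U ψ) (c : ℝ) :
    IsTest U fun x => c * ψ x :=
  h.mul_left contDiff_const

theorem IsTest.helm {U : Set (Eu n)} {ψ : Eu n → ℝ} (h : IsTest U ψ) (μ : ℝ) :
    IsTest U fun x => _root_.laplacian ψ x + μ * ψ x :=
  h.laplacian.add (h.const_mul μ)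

/-- A rapidly growing smooth weight. -/
def growthWeight (x : Eu n) : ℝ := exp ((‖x‖ ^ 2) ^ 2)

theorem contDiff_growthWeight : ContDiff ℝ ∞ (growthWeight (n := n)) :=
  Real.contDiff_exp.comp ((contDiff_norm_sq ℝ).pow 2)

theorem growthWeight_pos (x : Eu n) : 0 < growthWeight x := exp_pos _

theorem growthWeight_ne_zero (x : Eu n) : growthWeight x ≠ 0 := (growthWeight_pos x).ne'

theorem contDiff_growthWeight_inv : ContDiff ℝ ∞ fun x : Eu n => (growthWeight x)⁻¹ :=
  contDiff_growthWeight.inv growthWeight_ne_zero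

theorem exp_shift_le_growthWeight (i : Fin n) (τ : ℝ) (x : Eu n) :
    exp ((x i + τ) ^ 2) ≤ exp (1 / 2 + 2 * τ ^ 2) * growthWeight x ^ 2 := by
  rw [growthWeight, ← Real.exp_nat_mul, ← Real.exp_add]
  refine exp_le_exp.2 ?_
  have h : x i ^ 2 ≤ ‖x‖ ^ 2 := by
    rw [← sq_abs]
    exact pow_le_pow_left₀ (abs_nonneg _) (by simpa using PiLp.norm_apply_le x i) 2
  push_cast
  nlinarith [sq_nonneg (x i - τ), sq_nonneg (‖x‖ ^ 2 - 1 / 2)]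

/-- `ω (Δψ + μψ)` as an element of `L²`. -/
theorem IsTest.weighted {U : Set (Eu n)} {ψ : Eu n → ℝ} (h : IsTest U ψ) (μ : ℝ) :
    IsTest U fun x => growthWeight x * (_root_.laplacian ψ x + μ * ψ x) :=
  (h.helm μ).mul_left contDiff_growthWeight

theorem helm_add {ψ φ : Eu n → ℝ} (hψ : ContDiff ℝ ∞ ψ) (hφ : ContDiff ℝ ∞ φ) (μ : ℝ) (x : Eu n) :
    laplacian (fun x => ψ x + φ x) x + μ * (ψ x + φ x) =
      (laplacian ψ x + μ * ψ x) + (laplacian φ x + μ * φ x) := by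
  rw [laplacian_add hψ.contDiffAt hφ.contDiffAt]; ring

theorem helm_const_mul {ψ : Eu n → ℝ} (hψ : ContDiff ℝ ∞ ψ) (μ c : ℝ) (x : Eu n) :
    laplacian (fun x => c * ψ x) x + μ * (c * ψ x) = c * (laplacian ψ x + μ * ψ x) := by
  rw [laplacian_const_mul hψ.contDiffAt]; ring

/-- The range of the weighted Helmholtz operator on test functions. -/
def helmRange (n : ℕ) (μ : ℝ) : Submodule ℝ (L2 n) where
  carrier := {u | ∃ ψ, IsTestFn ψ ∧
    u =ᵐ[volume] fun x => growthWeight x * (laplacian ψ x + μ * ψ x)}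
  zero_mem' := ⟨fun _ => 0, ⟨contDiff_const, HasCompactSupport.zero, subset_univ _⟩, by
    filter_upwards [Lp.coeFn_zero ℝ 2 (volume : Measure (Eu n))] with x hx
    rw [hx, laplacian_const]; simp⟩
  add_mem' := by
    rintro u w ⟨ψ, hψ, h1⟩ ⟨φ, hφ, h2⟩
    refine ⟨_, hψ.add hφ, ?_⟩
    filter_upwards [Lp.coeFn_add u w, h1, h2] with x hx h1 h2
    rw [hx, Pi.add_apply, h1, h2, helm_add hψ.contDiff hφ.contDiff]; ring
  smul_mem' := by
    rintro c u ⟨ψ, hψ, h1⟩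
    refine ⟨_, hψ.const_mul c, ?_⟩
    filter_upwards [Lp.coeFn_smul c u, h1] with x hx h1
    rw [hx, Pi.smul_apply, h1, helm_const_mul hψ.contDiff, smul_eq_mul]; ring

/-- Square integrable functions vanishing on `K`. -/
def vanishingOn (K : Set (Eu n)) : Submodule ℝ (L2 n) where
  carrier := {u | ∀ᵐ x, x ∈ K → u x = 0}
  zero_mem' := by
    filter_upwards [Lp.coeFn_zero ℝ 2 (volume : Measure (Eu n))] with x hx _
    rw [hx]; rfl
  add_mem' := by
    intro u w h1 h2
    simp only [mem_ofPred_eq] at *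
    filter_upwards [Lp.coeFn_add u w, h1, h2] with x hx h1 h2 h
    rw [hx, Pi.add_apply, h1 h, h2 h, add_zero]
  smul_mem' := by
    intro c u h1
    simp only [mem_ofPred_eq] at *
    filter_upwards [Lp.coeFn_smul c u, h1] with x hx h1 h
    rw [hx, Pi.smul_apply, h1 h, smul_zero]

theorem ae_eq_zero_of_mem_vanishingOn_orthogonal {K : Set (Eu n)} (hK : MeasurableSet K) {g : L2 n}
    (hg : g ∈ (vanishingOn K)ᗮ) : ∀ᵐ x, x ∉ K → g x = 0 := by
  have hm : MemLp (Kᶜ.indicator g) 2 := (Lp.memLp g).indicator hK.compl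
  have h1 : hm.toLp _ ∈ vanishingOn K := by
    filter_upwards [hm.coeFn_toLp] with x hx h
    rw [hx]; simp [h]
  have h2 := hg _ h1
  have h3 : ‖hm.toLp _‖ ^ 2 = 0 := by
    rw [L2.norm_sq_eq, ← h2, L2.inner_eq]
    refine integral_congr_ae ?_
    filter_upwards [hm.coeFn_toLp] with x hx
    by_cases h : x ∈ K <;> simp [hx, h, sq]
  have h4 : hm.toLp _ = 0 := norm_eq_zero.1 (pow_eq_zero_iff two_ne_zero |>.1 h3)
  filter_upwards [hm.coeFn_toLp, Lp.coeFn_zero ℝ 2 (volume : Measure (Eu n))] with x hx h0 h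
  rw [h4, h0] at hx
  simpa [h] using hx.symm

theorem weakHelm_of_mem_helmRange_orthogonal {μ : ℝ} {u : L2 n} (hu : u ∈ (helmRange n μ)ᗮ) :
    WeakHelm μ univ fun x => growthWeight x * u x := by
  intro ψ hψ
  have h1 : (hψ.weighted μ).toL2 ∈ helmRange n μ := ⟨ψ, hψ, (hψ.weighted μ).coeFn_toL2⟩
  have h2 := hu _ h1
  rw [real_inner_comm, IsTest.inner_toL2] at h2
  simp only [Pi.zero_apply, zero_mul, integral_zero]
  rw [← h2]
  congr 1; ext x; ring

theorem helm_sub {ψ φ : Eu n → ℝ} (hψ : ContDiff ℝ ∞ ψ) (hφ : ContDiff ℝ ∞ φ) (μ : ℝ) (x : Eu n) :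
    laplacian (fun x => ψ x - φ x) x + μ * (ψ x - φ x) =
      (laplacian ψ x + μ * ψ x) - (laplacian φ x + μ * φ x) := by
  have h1 := helm_add hψ (contDiff_const.mul hφ) μ x (φ := fun x => (-1) * φ x)
  have h2 := helm_const_mul hφ μ (-1) x
  simp only [h2] at h1
  have : (fun x => ψ x - φ x) = fun x => ψ x + -1 * φ x := by ext; ring
  rw [this]
  linarith

theorem IsTest.sub {U : Set (Eu n)} {ψ φ : Eu n → ℝ} (h : IsTest U ψ) (h' : IsTest U φ) :
    IsTest U fun x => ψ x - φ x := by
  have := h.add (h'.const_mul (-1))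
  simpa [sub_eq_add_neg] using this

theorem IsTest.integral_helm_symm {U V : Set (Eu n)} {ψ φ : Eu n → ℝ} (h : IsTest U ψ)
    (h' : IsTest V φ) (μ : ℝ) :
    ∫ x, ψ x * (_root_.laplacian φ x + μ * φ x) = ∫ x, (_root_.laplacian ψ x + μ * ψ x) * φ x := by
  have h1 := integral_laplacian_mul h.contDiff h'.contDiff h'.hasCompactSupport
  have i1 : Integrable fun x => ψ x * _root_.laplacian φ x :=
    h'.laplacian.integrable_mul h.contDiff.continuous
  have i2 : Integrable fun x => ψ x * φ x := h'.integrable_mul h.contDiff.continuous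
  have i3 : Integrable fun x => _root_.laplacian ψ x * φ x :=
    h'.integrable_mul h.laplacian.contDiff.continuous
  have e1 : ∀ x, ψ x * (_root_.laplacian φ x + μ * φ x) =
    ψ x * _root_.laplacian φ x + μ * (ψ x * φ x) := fun x => by ring
  have e2 : ∀ x, (_root_.laplacian ψ x + μ * ψ x) * φ x =
    _root_.laplacian ψ x * φ x + μ * (ψ x * φ x) := fun x => by ring
  simp only [e1, e2]
  rw [integral_add i1 (i2.const_mul _), integral_add i3 (i2.const_mul _), h1,
    integral_mul_laplacian h.contDiff h'.contDiff h'.hasCompactSupport]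

theorem IsTest.integrable_exp_mul_sq {U : Set (Eu n)} {φ : Eu n → ℝ} (h : IsTest U φ) (i : Fin n)
    (τ : ℝ) : Integrable fun x => exp ((x i + τ) ^ 2) * φ x ^ 2 := by
  have hc : Continuous fun x : Eu n => exp ((x i + τ) ^ 2) := by fun_prop
  refine (h.integrable_mul (hc.mul h.contDiff.continuous)).congr (Eventually.of_forall fun x => ?_)
  simp only [Pi.mul_apply]; ring

theorem norm_toL2_le_weighted {U : Set (Eu n)} {ψ : Eu n → ℝ} (h : IsTest U ψ) (i : Fin n) (μ : ℝ) :
    ‖h.toL2‖ ^ 2 ≤ exp (1 / 2) * ‖(h.weighted μ).toL2‖ ^ 2 := by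
  have h1 := carleman h.isTestFn i μ 0
  rw [L2.norm_sq_eq_of_ae h.coeFn_toL2, L2.norm_sq_eq_of_ae (h.weighted μ).coeFn_toL2]
  have h2 : ∫ x, ψ x ^ 2 ≤ ∫ x, exp ((x i + 0) ^ 2) * ψ x ^ 2 := by
    refine integral_mono ?_ (h.integrable_exp_mul_sq i 0) fun x => ?_
    · simpa [sq] using h.integrable_mul h.contDiff.continuous
    · exact le_mul_of_one_le_left (sq_nonneg _) (one_le_exp (sq_nonneg _))
  have h3 : ∫ x, exp ((x i + 0) ^ 2) * (laplacian ψ x + μ * ψ x) ^ 2 ≤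
      ∫ x, exp (1 / 2) * (growthWeight x * (laplacian ψ x + μ * ψ x)) ^ 2 := by
    refine integral_mono ((h.helm μ).integrable_exp_mul_sq i 0) ?_ fun x => ?_
    · have := (h.weighted μ).integrable_mul (h.weighted μ).contDiff.continuous
      simpa [sq] using this.const_mul (exp (1 / 2))
    · have := exp_shift_le_growthWeight i 0 x
      simp only [mul_pow, ← mul_assoc]
      refine mul_le_mul_of_nonneg_right ?_ (sq_nonneg _)
      simpa using this
  rw [integral_const_mul] at h3
  have : 0 ≤ ∫ x, exp ((x i + 0) ^ 2) * ψ x ^ 2 := integral_nonneg fun x => by positivity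
  linarith

theorem IsTest.toL2_sub {U : Set (Eu n)} {ψ φ : Eu n → ℝ} (h : IsTest U ψ) (h' : IsTest U φ) :
    (h.sub h').toL2 = h.toL2 - h'.toL2 := by
  rw [IsTest.toL2, IsTest.toL2, IsTest.toL2, ← MemLp.toLp_sub]
  rfl

theorem norm_toL2_sub_le {ψ φ : Eu n → ℝ} (h : IsTestFn ψ) (h' : IsTestFn φ) (i : Fin n) (μ : ℝ) :
    ‖h.toL2 - h'.toL2‖ ^ 2 ≤ exp (1 / 2) * ‖(h.weighted μ).toL2 - (h'.weighted μ).toL2‖ ^ 2 := by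
  have := norm_toL2_le_weighted (h.sub h') i μ
  rw [← IsTest.toL2_sub h h']
  refine this.trans (le_of_eq ?_)
  rw [← IsTest.toL2_sub]
  congr 3
  unfold IsTest.toL2
  congr 1
  ext x
  rw [helm_sub h.contDiff h'.contDiff]; ring

/-- Elements of the closure of the range have preimages in `L²`. -/
theorem exists_limit {μ : ℝ} (i : Fin n) {g : L2 n} (hg : g ∈ (helmRange n μ).topologicalClosure) :
    ∃ (ψ : ℕ → Eu n → ℝ) (hψ : ∀ j, IsTestFn (ψ j)) (W : L2 n),
      Tendsto (fun j => ((hψ j).weighted μ).toL2) atTop (𝓝 g) ∧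
      Tendsto (fun j => (hψ j).toL2) atTop (𝓝 W) := by
  obtain ⟨a, ha, hlim⟩ := mem_closure_iff_seq_limit.1 hg
  choose ψ hψ hψa using ha
  have e : ∀ j, ((hψ j).weighted μ).toL2 = a j := fun j =>
    Lp.ext ((((hψ j).weighted μ).coeFn_toL2).trans (hψa j).symm)
  have hc : CauchySeq fun j => (hψ j).toL2 := by
    rw [Metric.cauchySeq_iff]
    intro ε hε
    obtain ⟨N, hN⟩ := Metric.cauchySeq_iff.1 hlim.cauchySeq (ε / exp (1 / 2)) (by positivity)
    refine ⟨N, fun j hj k hk => ?_⟩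
    have h1 := hN j hj k hk
    have h2 := norm_toL2_sub_le (hψ j) (hψ k) i μ
    rw [dist_eq_norm] at h1 ⊢
    rw [e, e] at h2
    rw [lt_div_iff₀ (exp_pos _)] at h1
    have h3 : (1 : ℝ) ≤ exp (1 / 2) := one_le_exp (by norm_num)
    refine lt_of_pow_lt_pow_left₀ 2 hε.le (h2.trans_lt ?_)
    calc exp (1 / 2) * ‖a j - a k‖ ^ 2 ≤ exp (1 / 2) * exp (1 / 2) * ‖a j - a k‖ ^ 2 := by
          gcongr; exact le_mul_of_one_le_left (exp_pos _).le h3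
      _ = (‖a j - a k‖ * exp (1 / 2)) ^ 2 := by ring
      _ < ε ^ 2 := by gcongr
  obtain ⟨W, hW⟩ := cauchySeq_tendsto_of_complete hc
  exact ⟨ψ, hψ, W, by simpa only [e] using hlim, hW⟩

theorem limit_weak {μ : ℝ} {g W : L2 n} {ψ : ℕ → Eu n → ℝ} (hψ : ∀ j, IsTestFn (ψ j))
    (hg : Tendsto (fun j => ((hψ j).weighted μ).toL2) atTop (𝓝 g))
    (hW : Tendsto (fun j => (hψ j).toL2) atTop (𝓝 W)) :
    WeakSol μ univ W fun x => (growthWeight x)⁻¹ * g x := by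
  intro φ hφ
  have hφ' : IsTestFn fun x => (growthWeight x)⁻¹ * φ x := hφ.mul_left contDiff_growthWeight_inv
  have h1 : Tendsto (fun j => ⟪(hψ j).toL2, (hφ.helm μ).toL2⟫) atTop (𝓝 ⟪W, (hφ.helm μ).toL2⟫) :=
    hW.inner tendsto_const_nhds
  have h2 : Tendsto (fun j => ⟪((hψ j).weighted μ).toL2, hφ'.toL2⟫) atTop (𝓝 ⟪g, hφ'.toL2⟫) :=
    hg.inner tendsto_const_nhds
  have h3 : ∀ j, ⟪(hψ j).toL2, (hφ.helm μ).toL2⟫ = ⟪((hψ j).weighted μ).toL2, hφ'.toL2⟫ := fun j => by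
    rw [IsTest.inner_toL2, IsTest.inner_toL2]
    rw [integral_congr_ae ((hψ j).coeFn_toL2.mono fun x hx => by
      show _ = ψ j x * (laplacian φ x + μ * φ x)
      simp only [hx]), (hψ j).integral_helm_symm hφ]
    refine integral_congr_ae (((hψ j).weighted μ).coeFn_toL2.mono fun x hx => ?_)
    simp only [hx]
    field_simp [growthWeight_ne_zero x]
  simp only [h3] at h1
  have h4 := tendsto_nhds_unique h1 h2
  rw [IsTest.inner_toL2, IsTest.inner_toL2] at h4
  rw [h4]
  congr 1; ext x; ring

theorem integral_sq_le_two_mul {g u : L2 n} {B : Set (Eu n)} {w : Eu n → ℝ}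
    (hu : u =ᵐ[volume] w) (hw : Integrable fun x => w x ^ 2) :
    ∫ x in B, g x ^ 2 ≤ 2 * ‖u - g‖ ^ 2 + 2 * ∫ x in B, w x ^ 2 := by
  have i1 := L2.integrable_sq (u - g)
  have h1 : ∫ x in B, (u - g : L2 n) x ^ 2 ≤ ‖u - g‖ ^ 2 := by
    rw [L2.norm_sq_eq]
    exact setIntegral_le_integral i1 (Eventually.of_forall fun x => sq_nonneg _)
  have h2 : ∫ x in B, g x ^ 2 ≤ ∫ x in B, (2 * (u - g : L2 n) x ^ 2 + 2 * w x ^ 2) := by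
    refine integral_mono_ae (L2.integrable_sq g).integrableOn
      ((i1.const_mul 2).add (hw.const_mul 2)).integrableOn (ae_restrict_of_ae ?_)
    filter_upwards [hu, Lp.coeFn_sub u g] with x hx h'
    rw [h', Pi.sub_apply, hx]
    nlinarith [sq_nonneg (2 * w x - g x)]
  rw [integral_add (i1.const_mul 2).integrableOn (hw.const_mul 2).integrableOn,
    integral_const_mul, integral_const_mul] at h2
  linarith

/-- The Carleman estimate forces vanishing in a half space away from the right-hand side. -/
theorem limit_eq_zero {μ m : ℝ} {i : Fin n} {g W : L2 n} {ψ : ℕ → Eu n → ℝ}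
    (hψ : ∀ j, IsTestFn (ψ j))
    (hg : Tendsto (fun j => ((hψ j).weighted μ).toL2) atTop (𝓝 g))
    (hW : Tendsto (fun j => (hψ j).toL2) atTop (𝓝 W))
    (hgm : ∀ᵐ x, m < |x i| → g x = 0) {B : Set (Eu n)} {δ : ℝ} (hδ : 0 < δ)
    (hB : ∀ x ∈ B, m + δ ≤ x i) (hBm : MeasurableSet B) :
    ∫ x in B, W x ^ 2 = 0 := by
  set G := ∫ x, g x ^ 2
  have key : ∀ τ : ℝ, |m| ≤ τ → ∫ x in B, W x ^ 2 ≤ exp (-(δ * (2 * (m + τ)))) * G := by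
    intro τ hτ
    have hmτ : 0 ≤ m + τ := by linarith [neg_abs_le m]
    set C := exp (1 / 2 + 2 * τ ^ 2)
    have hj : ∀ j, ∫ x in B, W x ^ 2 ≤ 2 * ‖(hψ j).toL2 - W‖ ^ 2 +
        exp (-(m + δ + τ) ^ 2) * (C * ‖((hψ j).weighted μ).toL2 - g‖ ^ 2
          + exp ((m + τ) ^ 2) * G) := by
      intro j
      refine (integral_sq_le_two_mul (B := B) (hψ j).coeFn_toL2
        (by simpa [sq] using (hψ j).integrable_mul (hψ j).contDiff.continuous)).trans ?_
      refine add_le_add le_rfl ?_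
      have i0 := (hψ j).integrable_exp_mul_sq i τ
      have h1 : exp ((m + δ + τ) ^ 2) * ∫ x in B, ψ j x ^ 2 ≤
          ∫ x, exp ((x i + τ) ^ 2) * ψ j x ^ 2 := by
        rw [← integral_const_mul]
        refine le_trans (setIntegral_mono_on ?_ i0.integrableOn hBm fun x hx => ?_)
          (setIntegral_le_integral i0 (Eventually.of_forall fun x => by positivity))
        · exact (Integrable.const_mul (by
            simpa [sq] using (hψ j).integrable_mul (hψ j).contDiff.continuous) _).integrableOn
        · have := hB x hx
          gcongr
          linarith
      have h2 := carleman (hψ j) i μ τ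
      have i2 := L2.integrable_sq (((hψ j).weighted μ).toL2 - g)
      have i3 := L2.integrable_sq g
      have h3 : ∫ x, exp ((x i + τ) ^ 2) * (laplacian (ψ j) x + μ * ψ j x) ^ 2 ≤
          ∫ x, (2 * C * (((hψ j).weighted μ).toL2 - g : L2 n) x ^ 2
            + 2 * exp ((m + τ) ^ 2) * g x ^ 2) := by
        refine integral_mono_ae (((hψ j).helm μ).integrable_exp_mul_sq i τ)
          ((i2.const_mul _).add (i3.const_mul _)) ?_
        filter_upwards [((hψ j).weighted μ).coeFn_toL2,
          Lp.coeFn_sub ((hψ j).weighted μ).toL2 g, hgm] with x h4 h5 h6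
        rw [h5, Pi.sub_apply, h4]
        have h7 := exp_shift_le_growthWeight i τ x
        have hω := growthWeight_pos x
        set p := laplacian (ψ j) x + μ * ψ j x
        set q := exp ((x i + τ) ^ 2)
        set a := growthWeight x * p - g x
        have hq : 0 < q := exp_pos _
        have h9 : 1 ≤ growthWeight x ^ 2 := one_le_pow₀ (one_le_exp (by positivity))
        set r := q / growthWeight x ^ 2
        have hr : 0 ≤ r := by positivity
        have hrC : r ≤ C := (div_le_iff₀ (by positivity)).2 h7
        have hrq : r ≤ q := div_le_self hq.le h9
        have e1 : q * p ^ 2 = r * (growthWeight x * p) ^ 2 := by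
          simp only [r]; field_simp
        have h10 : (growthWeight x * p) ^ 2 ≤ 2 * a ^ 2 + 2 * g x ^ 2 := by
          have : growthWeight x * p = a + g x := by simp [a]
          rw [this]
          nlinarith [sq_nonneg (a - g x)]
        have h11 : r * g x ^ 2 ≤ exp ((m + τ) ^ 2) * g x ^ 2 := by
          by_cases hx : m < |x i|
          · simp [h6 hx]
          · have h8 : q ≤ exp ((m + τ) ^ 2) := by
              refine exp_le_exp.2 (sq_le_sq' ?_ ?_)
              · linarith [neg_abs_le (x i), neg_abs_le m, le_abs_self m]
              · linarith [le_abs_self (x i)]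
            gcongr
            exact hrq.trans h8
        have h12 : r * a ^ 2 ≤ C * a ^ 2 := by gcongr
        rw [e1]
        nlinarith [mul_le_mul_of_nonneg_left h10 hr]
      rw [integral_add (i2.const_mul _) (i3.const_mul _), integral_const_mul, integral_const_mul,
        ← L2.norm_sq_eq] at h3
      have h4 : exp ((m + δ + τ) ^ 2) * (2 * ∫ x in B, ψ j x ^ 2) ≤
          C * ‖((hψ j).weighted μ).toL2 - g‖ ^ 2 + exp ((m + τ) ^ 2) * G := by linarith
      rw [exp_neg, inv_mul_eq_div, le_div_iff₀ (exp_pos _)]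
      linarith
    have hlim : Tendsto (fun j => 2 * ‖(hψ j).toL2 - W‖ ^ 2 +
        exp (-(m + δ + τ) ^ 2) * (C * ‖((hψ j).weighted μ).toL2 - g‖ ^ 2
          + exp ((m + τ) ^ 2) * G)) atTop (𝓝 (2 * 0 ^ 2 +
        exp (-(m + δ + τ) ^ 2) * (C * 0 ^ 2 + exp ((m + τ) ^ 2) * G))) := by
      have t1 := tendsto_iff_norm_sub_tendsto_zero.1 hW
      have t2 := tendsto_iff_norm_sub_tendsto_zero.1 hg
      exact ((t1.pow 2).const_mul 2).add
        ((((t2.pow 2).const_mul C).add tendsto_const_nhds).const_mul _)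
    refine (ge_of_tendsto' hlim hj).trans ?_
    have hG : 0 ≤ G := integral_nonneg fun x => sq_nonneg _
    have e2 : 2 * (0 : ℝ) ^ 2 + exp (-(m + δ + τ) ^ 2) * (C * 0 ^ 2 + exp ((m + τ) ^ 2) * G) =
        exp (-(m + δ + τ) ^ 2 + (m + τ) ^ 2) * G := by rw [exp_add]; ring
    rw [e2]
    gcongr
    nlinarith
  have hlim : Tendsto (fun τ : ℝ => exp (-(δ * (2 * (m + τ)))) * G) atTop (𝓝 (0 * G)) := by
    refine Tendsto.mul_const G (tendsto_exp_atBot.comp (tendsto_neg_atTop_atBot.comp ?_))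
    exact Tendsto.const_mul_atTop hδ (Tendsto.const_mul_atTop two_pos
      (tendsto_atTop_add_const_left _ _ tendsto_id))
  refine le_antisymm ?_ (integral_nonneg fun x => sq_nonneg _)
  have := ge_of_tendsto hlim ((eventually_ge_atTop |m|).mono key)
  simpa using this

/-- Preimages under the Helmholtz operator vanish outside the support of the right-hand side. -/
theorem limit_eq_zero_compl {μ : ℝ} (hμ : 0 ≤ μ) {i : Fin n} {g W : L2 n} {ψ : ℕ → Eu n → ℝ}
    {K : Set (Eu n)} (hK : IsCompact K) (hKc : IsPreconnected Kᶜ)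
    (hψ : ∀ j, IsTestFn (ψ j))
    (hg : Tendsto (fun j => ((hψ j).weighted μ).toL2) atTop (𝓝 g))
    (hW : Tendsto (fun j => (hψ j).toL2) atTop (𝓝 W))
    (hgK : ∀ᵐ x, x ∉ K → g x = 0) : ∀ᵐ x, x ∉ K → W x = 0 := by
  have hw : WeakHelm μ Kᶜ W := by
    intro φ hφ
    rw [limit_weak hψ hg hW φ hφ.isTestFn]
    refine integral_congr_ae ?_
    filter_upwards [hgK] with x hx
    by_cases h : x ∈ K
    · have : φ x = 0 := image_eq_zero_of_notMem_tsupport fun h' => hφ.tsupport_subset h' h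
      simp [this]
    · simp [hx h]
  obtain ⟨v, hv, hv0, -, hae⟩ :=
    hw.exists_contDiffOn hμ hK.isClosed.isOpen_compl (L2.locallyIntegrable W)
  have hH : Helm μ Kᶜ v := ⟨hK.isClosed.isOpen_compl, hμ, hv, hv0⟩
  obtain ⟨m, hm⟩ := hK.isBounded.subset_closedBall (0 : Eu n)
  have hm' : ∀ x : Eu n, m < |x i| → x ∉ K := fun x hx hxK => by
    have h1 := hm hxK
    rw [mem_closedBall_zero_iff] at h1
    have h2 : |x i| ≤ ‖x‖ := by simpa using PiLp.norm_apply_le x i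
    linarith
  set B : Set (Eu n) := {x | m + 1 < x i}
  have hBo : IsOpen B := isOpen_lt continuous_const (by fun_prop)
  have hBK : B ⊆ Kᶜ := fun x hx => hm' x (lt_of_lt_of_le
    (by have : m + 1 < x i := hx; linarith) (le_abs_self _))
  have h0 : ∫ x in B, W x ^ 2 = 0 := limit_eq_zero hψ hg hW (i := i) (m := m)
    (hgK.mono fun x h1 h2 => h1 (hm' x h2)) one_pos (fun x hx => le_of_lt hx) hBo.measurableSet
  rw [integral_eq_zero_iff_of_nonneg (fun x => sq_nonneg _) (L2.integrable_sq W).integrableOn] at h0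
  have h1 : EqOn v (fun _ => 0) B := by
    refine Measure.eqOn_open_of_ae_eq (μ := volume) ?_ hBo (hv.continuousOn.mono hBK)
      continuousOn_const
    rw [EventuallyEq, ae_restrict_iff' hBo.measurableSet] at h0 ⊢
    filter_upwards [h0, hae] with x h2 h3 h4
    rw [← h3 (hBK h4)]
    simpa using h2 h4
  have h2 : EuclideanSpace.single i (m + 2) ∈ B := by
    show m + 1 < (EuclideanSpace.single i (m + 2) : Eu n) i
    simp
  have h3 := hH.eq_zero_of_eventually hKc (hBK h2)
    (Filter.mem_of_superset (hBo.mem_nhds h2) fun y hy => h1 hy)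
  filter_upwards [hae] with x hx hxK
  rw [hx hxK, h3 x hxK]

/-- Runge approximation: solutions near a compact set with connected complement are
approximated in mean square by global solutions. -/
theorem exists_global_approx {μ : ℝ} (i : Fin n) {U K : Set (Eu n)} {f : Eu n → ℝ}
    (hf : Helm μ U f) (hK : IsCompact K) (hKU : K ⊆ U) (hKc : IsPreconnected Kᶜ) {ε : ℝ}
    (hε : 0 < ε) : ∃ v, Helm μ univ v ∧ ∫ x in K, (f x - v x) ^ 2 ≤ ε := by
  obtain ⟨χ, hχ, -, -, V, hV, hKV, -, hχ1⟩ := exists_cutoff hK hf.isOpen hKU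
  have hF : IsTest U fun x => χ x * f x := hχ.mul_contDiffOn hf.isOpen hf.contDiffOn
  have hF1 : IsTest U fun x => (growthWeight x)⁻¹ * (χ x * f x) :=
    hF.mul_left contDiff_growthWeight_inv
  have hm : MemLp (K.indicator fun x => (growthWeight x)⁻¹ * (χ x * f x)) 2 :=
    hF1.memLp.indicator hK.isClosed.measurableSet
  set S := (helmRange n μ)ᗮ ⊔ vanishingOn K
  have hmem : hm.toLp _ ∈ S.topologicalClosure := by
    rw [← Submodule.orthogonal_orthogonal_eq_closure, Submodule.mem_orthogonal]
    intro g hg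
    rw [← Submodule.inf_orthogonal, Submodule.mem_inf,
      Submodule.orthogonal_orthogonal_eq_closure] at hg
    have hgK := ae_eq_zero_of_mem_vanishingOn_orthogonal hK.isClosed.measurableSet hg.2
    obtain ⟨ψ, hψ, W, h1, h2⟩ := exists_limit i hg.1
    have hWK := limit_eq_zero_compl hf.nonneg (i := i) hK hKc hψ h1 h2 hgK
    have h3 := limit_weak hψ h1 h2 _ hF.isTestFn
    have h4 : ∫ x, W x * (laplacian (fun x => χ x * f x) x + μ * (χ x * f x)) = 0 := by
      rw [integral_eq_zero_of_ae]
      filter_upwards [hWK] with x hx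
      by_cases h : x ∈ K
      · have h5 : (fun x => χ x * f x) =ᶠ[𝓝 x] f := by
          filter_upwards [hV.mem_nhds (hKV h)] with y hy
          rw [hχ1 y hy, one_mul]
        rw [h5.laplacian.self_of_nhds, hχ1 x (hKV h), one_mul, hf.eq_zero x (hKU h)]
        simp
      · simp [hx h]
    rw [h4] at h3
    rw [L2.inner_eq, h3]
    refine integral_congr_ae ?_
    filter_upwards [hm.coeFn_toLp, hgK] with x hx hx'
    rw [hx]
    by_cases h : x ∈ K
    · simp only [indicator_of_mem h]; ring
    · simp [hx' h]
  obtain ⟨C, hC⟩ := hK.exists_bound_of_continuousOn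
    (f := growthWeight) contDiff_growthWeight.continuous.continuousOn
  obtain ⟨s, hs, hsd⟩ := Metric.mem_closure_iff.1 hmem (√ε / (|C| + 1)) (by positivity)
  obtain ⟨a, ha, b, hb, rfl⟩ := Submodule.mem_sup.1 hs
  have hw := weakHelm_of_mem_helmRange_orthogonal ha
  have hloc : LocallyIntegrable fun x => growthWeight x * a x :=
    (L2.locallyIntegrable a).continuous_mul contDiff_growthWeight.continuous
  obtain ⟨v, hv, hv0, -, hae⟩ := hw.exists_contDiffOn hf.nonneg isOpen_univ hloc
  refine ⟨v, ⟨isOpen_univ, hf.nonneg, hv, hv0⟩, ?_⟩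
  set d := hm.toLp _ - (a + b)
  have hd : ∀ᵐ x, x ∈ K → f x - v x = growthWeight x * d x := by
    filter_upwards [hm.coeFn_toLp, hae, hb, Lp.coeFn_sub (hm.toLp _) (a + b),
      Lp.coeFn_add a b] with x h1 h2 h3 h4 h5 hx
    rw [h4, Pi.sub_apply, h1, h5, Pi.add_apply, h3 hx, ← h2 (mem_univ _), indicator_of_mem hx,
      hχ1 x (hKV hx)]
    field_simp [growthWeight_ne_zero x]
    ring
  have id := L2.integrable_sq d
  calc ∫ x in K, (f x - v x) ^ 2 = ∫ x in K, (growthWeight x * d x) ^ 2 :=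
        setIntegral_congr_ae hK.isClosed.measurableSet (hd.mono fun x hx h => by rw [hx h])
    _ ≤ ∫ x in K, (|C| + 1) ^ 2 * d x ^ 2 := by
        refine setIntegral_mono_on ?_ (id.const_mul _).integrableOn hK.isClosed.measurableSet
          fun x hx => ?_
        · have : IntegrableOn (fun x => d x ^ 2 * growthWeight x ^ 2) K :=
            id.integrableOn.mul_continuousOn
              (contDiff_growthWeight.continuous.pow 2).continuousOn hK
          exact this.congr_fun (fun x _ => by ring) hK.isClosed.measurableSet
        · rw [mul_pow]
          have := hC x hx
          rw [Real.norm_eq_abs, abs_of_pos (growthWeight_pos x)] at this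
          have h2 := growthWeight_pos x
          gcongr
          linarith [le_abs_self C]
    _ ≤ ∫ x, (|C| + 1) ^ 2 * d x ^ 2 :=
        setIntegral_le_integral (id.const_mul _) (Eventually.of_forall fun x => by positivity)
    _ = (|C| + 1) ^ 2 * ‖d‖ ^ 2 := by rw [integral_const_mul, L2.norm_sq_eq]
    _ ≤ (|C| + 1) ^ 2 * (√ε / (|C| + 1)) ^ 2 := by
        rw [dist_eq_norm] at hsd
        gcongr
    _ = ε := by rw [div_pow, sq_sqrt hε.le]; field_simp

theorem Helm.sub {μ : ℝ} {U : Set (Eu n)} {v w : Eu n → ℝ} (hv : Helm μ U v) (hw : Helm μ U w) :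
    Helm μ U fun x => v x - w x := by
  refine ⟨hv.isOpen, hv.nonneg, hv.contDiffOn.sub hw.contDiffOn, fun x hx => ?_⟩
  have h1 := hv.contDiffOn.contDiffAt_of_isOpen hv.isOpen hx
  have h2 := hw.contDiffOn.contDiffAt_of_isOpen hv.isOpen hx
  have e : (fun x => v x - w x) = fun x => v x + -1 * w x := by ext; ring
  rw [e, laplacian_add h1 (contDiffAt_const.mul h2), laplacian_const_mul h2]
  have e1 := hv.eq_zero x hx
  have e2 := hw.eq_zero x hx
  linarith

/-- Runge approximation in the `C¹` sense. -/
theorem exists_global_approx_fderiv {μ : ℝ} (i : Fin n) {U K K' : Set (Eu n)} {f : Eu n → ℝ}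
    (hf : Helm μ U f) (hK : IsCompact K) (hKU : K ⊆ U) (hKc : IsPreconnected Kᶜ) {r : ℝ}
    (hr : 0 < r) (hK' : ∀ x ∈ K', Metric.closedBall x r ⊆ K) {ε : ℝ} (hε : 0 < ε) :
    ∃ v, Helm μ univ v ∧ ∀ x ∈ K', |f x - v x| ≤ ε ∧ ‖fderiv ℝ f x - fderiv ℝ v x‖ ≤ ε := by
  wlog hr1 : r ≤ 1 generalizing r
  · exact this one_pos
      (fun x hx => (Metric.closedBall_subset_closedBall (le_of_not_ge hr1)).trans (hK' x hx)) le_rfl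
  obtain ⟨C, hC, hest⟩ := exists_helm_estimate n μ
  set A := C / r ^ n + C / r ^ (n + 1)
  have hA : 0 < A := by positivity
  set M := volume.real K
  have hM : 0 ≤ M := measureReal_nonneg
  set δ := ε / (A * (M + 1))
  have hδ : 0 < δ := by positivity
  obtain ⟨v, hv, hvK⟩ := exists_global_approx i hf hK hKU hKc (ε := δ * (ε / A)) (by positivity)
  have hd := hf.sub (hv.mono hf.isOpen (subset_univ _))
  have hc : ContinuousOn (fun x => f x - v x) K := hd.continuousOn.mono hKU
  have key : ∀ x ∈ K', ∫ z in Metric.closedBall x r, |f z - v z| ≤ ε / A := by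
    intro x hx
    have i1 : IntegrableOn (fun x => |f x - v x|) K := hc.abs.integrableOn_compact hK
    have i2 : IntegrableOn (fun x => (f x - v x) ^ 2) K := (hc.pow 2).integrableOn_compact hK
    have i3 : IntegrableOn (fun x : Eu n => δ / 2) K := integrableOn_const hK.measure_lt_top.ne
    calc ∫ z in Metric.closedBall x r, |f z - v z| ≤ ∫ z in K, |f z - v z| :=
          setIntegral_mono_set i1 (Eventually.of_forall fun _ => abs_nonneg _)
            (Eventually.of_forall (hK' x hx))
      _ ≤ ∫ z in K, (1 / (2 * δ) * (f z - v z) ^ 2 + δ / 2) := by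
          refine integral_mono i1 ((i2.const_mul _).add i3) fun z => ?_
          rw [← sq_abs]
          set a := |f z - v z|
          have : 1 / (2 * δ) * a ^ 2 + δ / 2 - a = (a - δ) ^ 2 / (2 * δ) := by field_simp; ring
          have h2 : 0 ≤ (a - δ) ^ 2 / (2 * δ) := by positivity
          show a ≤ 1 / (2 * δ) * a ^ 2 + δ / 2
          linarith
      _ = 1 / (2 * δ) * (∫ z in K, (f z - v z) ^ 2) + M * (δ / 2) := by
          rw [integral_add (i2.const_mul _) i3, integral_const_mul, setIntegral_const, smul_eq_mul]
      _ ≤ 1 / (2 * δ) * (δ * (ε / A)) + (M + 1) * (δ / 2) := by gcongr; linarith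
      _ = ε / A := by
          simp only [δ]; field_simp; norm_num
  refine ⟨v, hv, fun x hx => ?_⟩
  have hxU : Metric.closedBall x r ⊆ U := (hK' x hx).trans hKU
  obtain ⟨e1, e2⟩ := hest μ U _ hd le_rfl x r hr hr1 hxU
  have hI : 0 ≤ ∫ z in Metric.closedBall x r, |f z - v z| := integral_nonneg fun _ => abs_nonneg _
  have hxm : x ∈ U := hxU (Metric.mem_closedBall_self hr.le)
  constructor
  · calc _ ≤ C / r ^ n * ∫ z in Metric.closedBall x r, |f z - v z| := e1
      _ ≤ A * (ε / A) := by
          gcongr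
          · simp only [A]; linarith [show 0 < C / r ^ (n + 1) by positivity]
          · exact key x hx
      _ = ε := by field_simp
  · have hfd : fderiv ℝ (fun x => f x - v x) x = fderiv ℝ f x - fderiv ℝ v x :=
      fderiv_fun_sub ((hf.contDiffOn.contDiffAt_of_isOpen hf.isOpen hxm).differentiableAt (by simp))
        ((hv.contDiffOn.contDiffAt_of_isOpen isOpen_univ (mem_univ x)).differentiableAt (by simp))
    rw [← hfd]
    refine ContinuousLinearMap.opNorm_le_bound _ hε.le fun e => ?_
    have e3 := e2 0 e
    simp only [sub_zero] at e3
    calc _ ≤ C / r ^ (n + 1) * ‖e‖ * ∫ z in Metric.closedBall x r, |f z - v z| := e3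
      _ ≤ A * ‖e‖ * (ε / A) := by
          gcongr
          · simp only [A]; linarith [show 0 < C / r ^ n by positivity]
          · exact key x hx
      _ = ε * ‖e‖ := by field_simp

/-- Pairs of a square integrable function and a square integrable gradient. -/
abbrev Energy (n : ℕ) := PiLp 2 (fun _ : Option (Fin n) => L2 n)

/-- A test function together with its gradient. -/
def IsTest.energy {U : Set (Eu n)} {ψ : Eu n → ℝ} (h : IsTest U ψ) : Energy n :=
  WithLp.toLp 2 fun o => o.elim h.toL2 fun i => (h.pd i).toL2

theorem IsTest.energy_none {U : Set (Eu n)} {ψ : Eu n → ℝ} (h : IsTest U ψ) :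
    h.energy none = h.toL2 := rfl

theorem IsTest.energy_some {U : Set (Eu n)} {ψ : Eu n → ℝ} (h : IsTest U ψ) (i : Fin n) :
    h.energy (some i) = (h.pd i).toL2 := rfl

theorem IsTest.zero {U : Set (Eu n)} : IsTest U fun _ : Eu n => 0 :=
  ⟨contDiff_const, HasCompactSupport.zero, by simp [tsupport, Function.support]⟩

theorem IsTest.toL2_congr {U V : Set (Eu n)} {ψ φ : Eu n → ℝ} (h : IsTest U ψ) (h' : IsTest V φ)
    (e : ∀ x, ψ x = φ x) : h.toL2 = h'.toL2 := by
  obtain rfl : ψ = φ := funext e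
  rfl

theorem IsTest.toL2_add {U : Set (Eu n)} {ψ φ : Eu n → ℝ} (h : IsTest U ψ) (h' : IsTest U φ) :
    (h.add h').toL2 = h.toL2 + h'.toL2 := by
  rw [IsTest.toL2, IsTest.toL2, IsTest.toL2, ← MemLp.toLp_add]
  rfl

theorem IsTest.toL2_const_mul {U : Set (Eu n)} {ψ : Eu n → ℝ} (h : IsTest U ψ) (c : ℝ) :
    (h.const_mul c).toL2 = c • h.toL2 := by
  rw [IsTest.toL2, IsTest.toL2, ← MemLp.toLp_const_smul]
  rfl

theorem IsTest.toL2_zero {U : Set (Eu n)} : (IsTest.zero (U := U)).toL2 = 0 :=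
  MemLp.toLp_zero _

theorem IsTest.energy_add {U : Set (Eu n)} {ψ φ : Eu n → ℝ} (h : IsTest U ψ) (h' : IsTest U φ) :
    (h.add h').energy = h.energy + h'.energy := by
  ext1 o
  rw [PiLp.add_apply]
  cases o with
  | none => exact h.toL2_add h'
  | some i =>
    simp only [IsTest.energy_some]
    rw [← IsTest.toL2_add]
    exact IsTest.toL2_congr _ _ fun x => pd_add (h.contDiff.differentiableAt_infty x)
      (h'.contDiff.differentiableAt_infty x) i

theorem IsTest.energy_const_mul {U : Set (Eu n)} {ψ : Eu n → ℝ} (h : IsTest U ψ) (c : ℝ) :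
    (h.const_mul c).energy = c • h.energy := by
  ext1 o
  rw [PiLp.smul_apply]
  cases o with
  | none => exact h.toL2_const_mul c
  | some i =>
    simp only [IsTest.energy_some]
    rw [← IsTest.toL2_const_mul]
    exact IsTest.toL2_congr _ _ fun x => pd_const_mul (h.contDiff.differentiableAt_infty x) c i

theorem IsTest.energy_zero {U : Set (Eu n)} : (IsTest.zero (U := U)).energy = 0 := by
  ext1 o
  cases o with
  | none => exact IsTest.toL2_zero (U := U)
  | some i =>
    exact (IsTest.toL2_congr (IsTest.zero (U := U) |>.pd i) (IsTest.zero (U := U)) fun x => by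
      simp [_root_.pd]).trans IsTest.toL2_zero

/-- Test functions as a subspace of the energy space. -/
def testEnergy (U : Set (Eu n)) : Submodule ℝ (Energy n) where
  carrier := {k | ∃ ψ, ∃ h : IsTest U ψ, k = h.energy}
  zero_mem' := ⟨_, IsTest.zero, IsTest.energy_zero.symm⟩
  add_mem' := by
    rintro _ _ ⟨ψ, h, rfl⟩ ⟨φ, h', rfl⟩
    exact ⟨_, h.add h', (h.energy_add h').symm⟩
  smul_mem' := by
    rintro c _ ⟨ψ, h, rfl⟩
    exact ⟨_, h.const_mul c, (h.energy_const_mul c).symm⟩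

/-- The Sobolev space `H₀¹(U)` as a closed subspace of the energy space. -/
def H01 (U : Set (Eu n)) : Submodule ℝ (Energy n) := (testEnergy U).topologicalClosure

instance (U : Set (Eu n)) : CompleteSpace (H01 U) :=
  (testEnergy U).isClosed_topologicalClosure.completeSpace_coe

theorem IsTest.energy_mem {U : Set (Eu n)} {ψ : Eu n → ℝ} (h : IsTest U ψ) : h.energy ∈ H01 U :=
  (testEnergy U).le_topologicalClosure ⟨ψ, h, rfl⟩

theorem H01.exists_seq {U : Set (Eu n)} {k : Energy n} (hk : k ∈ H01 U) :
    ∃ (ψ : ℕ → Eu n → ℝ) (hψ : ∀ j, IsTest U (ψ j)),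
      Tendsto (fun j => (hψ j).energy) atTop (𝓝 k) := by
  obtain ⟨a, ha, hlim⟩ := mem_closure_iff_seq_limit.1 hk
  choose ψ hψ e using ha
  exact ⟨ψ, hψ, by simpa only [← e] using hlim⟩

theorem Energy.inner_eq (k l : Energy n) :
    ⟪k, l⟫ = ⟪k none, l none⟫ + ∑ i, ⟪k (some i), l (some i)⟫ := by
  rw [PiLp.inner_apply, Fintype.sum_option]

theorem Energy.norm_apply_le (k : Energy n) (o : Option (Fin n)) : ‖k o‖ ≤ ‖k‖ :=
  PiLp.norm_apply_le k o

theorem Energy.tendsto_apply {k : ℕ → Energy n} {l : Energy n} (h : Tendsto k atTop (𝓝 l))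
    (o : Option (Fin n)) : Tendsto (fun j => k j o) atTop (𝓝 (l o)) :=
  ((PiLp.continuous_apply 2 _ o).tendsto l).comp h

/-- The restriction of `H₀¹` to its function component. -/
def H01.fst (U : Set (Eu n)) : H01 U →L[ℝ] L2 n :=
  (PiLp.proj 2 (fun _ : Option (Fin n) => L2 n) none : Energy n →L[ℝ] L2 n) ∘L (H01 U).subtypeL

theorem H01.norm_fst_le (U : Set (Eu n)) (k : H01 U) : ‖H01.fst U k‖ ≤ ‖k‖ :=
  Energy.norm_apply_le (k : Energy n) none

/-- The solution operator of `-Δw + w = g` in `H₀¹(U)`. -/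
def solve (U : Set (Eu n)) : L2 n →L[ℝ] H01 U := ContinuousLinearMap.adjoint (H01.fst U)

theorem inner_solve {U : Set (Eu n)} (g : L2 n) (k : H01 U) :
    ⟪solve U g, k⟫ = ⟪g, (k : Energy n) none⟫ :=
  ContinuousLinearMap.adjoint_inner_left _ _ _

/-- The Green operator of `-Δ + 1` with Dirichlet boundary conditions. -/
def green (U : Set (Eu n)) : L2 n →L[ℝ] L2 n := H01.fst U ∘L solve U

theorem green_eq {U : Set (Eu n)} (g : L2 n) : green U g = (solve U g : Energy n) none := rfl

theorem inner_green {U : Set (Eu n)} (g h : L2 n) : ⟪green U g, h⟫ = ⟪solve U g, solve U h⟫ := by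
  rw [real_inner_comm (solve U h), inner_solve, real_inner_comm]; rfl

theorem inner_green_symm {U : Set (Eu n)} (g h : L2 n) : ⟪green U g, h⟫ = ⟪g, green U h⟫ := by
  rw [real_inner_comm (green U h) g, inner_green, inner_green, real_inner_comm]

theorem norm_solve_le {U : Set (Eu n)} (g : L2 n) : ‖solve U g‖ ≤ ‖g‖ := by
  have h : ‖solve U g‖ ^ 2 ≤ ‖g‖ * ‖solve U g‖ := by
    rw [← real_inner_self_eq_norm_sq, inner_solve]
    exact (real_inner_le_norm _ _).trans
      (mul_le_mul_of_nonneg_left (H01.norm_fst_le U _) (norm_nonneg _))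
  by_contra! h'
  nlinarith [norm_nonneg g]

theorem norm_green_le {U : Set (Eu n)} (g : L2 n) : ‖green U g‖ ≤ ‖g‖ :=
  (H01.norm_fst_le U _).trans (norm_solve_le g)

theorem solve_eq_of_forall {U : Set (Eu n)} {g : L2 n} {k : Energy n} (hk : k ∈ H01 U)
    (h : ∀ ψ (hψ : IsTest U ψ), ⟪k, hψ.energy⟫ = ⟪g, hψ.toL2⟫) : (solve U g : Energy n) = k := by
  have h1 : ∀ l ∈ H01 U, ⟪(solve U g : Energy n) - k, l⟫ = 0 := by
    intro l hl
    obtain ⟨ψ, hψ, hlim⟩ := H01.exists_seq hl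
    have h2 : Tendsto (fun j => ⟪(solve U g : Energy n) - k, (hψ j).energy⟫) atTop
        (𝓝 ⟪(solve U g : Energy n) - k, l⟫) := tendsto_const_nhds.inner hlim
    refine tendsto_nhds_unique h2 ?_
    have h3 : ∀ j, ⟪(solve U g : Energy n) - k, (hψ j).energy⟫ = 0 := fun j => by
      rw [inner_sub_left, h _ (hψ j), sub_eq_zero]
      exact inner_solve g ⟨_, (hψ j).energy_mem⟩
    simp only [h3, tendsto_const_nhds]
  have := h1 _ ((H01 U).sub_mem (solve U g).2 hk)
  rw [inner_self_eq_zero (𝕜 := ℝ)] at this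
  exact sub_eq_zero.1 this

theorem IsTest.inner_pd {U V : Set (Eu n)} {ψ φ : Eu n → ℝ} (hψ : IsTest U ψ) (hφ : IsTest V φ)
    (i : Fin n) : ⟪(hψ.pd i).toL2, hφ.toL2⟫ = -⟪hψ.toL2, (hφ.pd i).toL2⟫ := by
  have e1 : ∫ x, (hψ.pd i).toL2 x * φ x = ∫ x, _root_.pd i ψ x * φ x :=
    integral_congr_ae ((hψ.pd i).coeFn_toL2.mono fun x hx => by simp only; rw [hx])
  have e2 : ∫ x, hψ.toL2 x * _root_.pd i φ x = ∫ x, ψ x * _root_.pd i φ x :=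
    integral_congr_ae (hψ.coeFn_toL2.mono fun x hx => by simp only; rw [hx])
  rw [IsTest.inner_toL2, IsTest.inner_toL2, e1, e2,
    integral_mul_pd hψ.contDiff hφ.contDiff hφ.hasCompactSupport, neg_neg]

/-- The gradient components of elements of `H₀¹` are weak derivatives. -/
theorem H01.inner_some {U V : Set (Eu n)} {k : Energy n} (hk : k ∈ H01 U) {φ : Eu n → ℝ}
    (hφ : IsTest V φ) (i : Fin n) :
    ⟪(k (some i) : L2 n), hφ.toL2⟫ = -⟪(k none : L2 n), (hφ.pd i).toL2⟫ := by
  obtain ⟨ψ, hψ, hlim⟩ := H01.exists_seq hk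
  have h1 := (Energy.tendsto_apply hlim (some i)).inner (𝕜 := ℝ) (tendsto_const_nhds (x := hφ.toL2))
  have h2 := ((Energy.tendsto_apply hlim none).inner (𝕜 := ℝ)
    (tendsto_const_nhds (x := (hφ.pd i).toL2))).neg
  exact tendsto_nhds_unique h1 (h2.congr fun j => ((hψ j).inner_pd hφ i).symm)

theorem L2.coeFn_sum {ι : Type*} (s : Finset ι) (u : ι → L2 n) :
    ∀ᵐ x, (∑ i ∈ s, u i : L2 n) x = ∑ i ∈ s, u i x := by
  classical
  induction s using Finset.induction_on with
  | empty => simp only [Finset.sum_empty]; exact Lp.coeFn_zero ℝ 2 (volume : Measure (Eu n))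
  | insert a s ha ih =>
    rw [Finset.sum_insert ha]
    filter_upwards [ih, Lp.coeFn_add (u a) (∑ i ∈ s, u i)] with x h1 h2
    rw [h2, Finset.sum_insert ha, Pi.add_apply, h1]

theorem IsTest.toL2_laplacian {U : Set (Eu n)} {ψ : Eu n → ℝ} (h : IsTest U ψ) :
    h.laplacian.toL2 = ∑ i, ((h.pd i).pd i).toL2 := by
  have h1 : ((∑ i, ((h.pd i).pd i).toL2 : L2 n) : Eu n → ℝ) =ᵐ[volume] _root_.laplacian ψ := by
    have h2 := L2.coeFn_sum Finset.univ fun i => ((h.pd i).pd i).toL2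
    have h3 : ∀ᵐ x, ∀ i, ((h.pd i).pd i).toL2 x = _root_.pd i (_root_.pd i ψ) x :=
      ae_all_iff.2 fun i => ((h.pd i).pd i).coeFn_toL2
    filter_upwards [h2, h3] with x h2 h3
    rw [h2, laplacian_eq_sum_pd]
    exact Finset.sum_congr rfl fun i _ => h3 i
  exact Lp.ext (h.laplacian.coeFn_toL2.trans h1.symm)

theorem H01.inner_energy {U V : Set (Eu n)} {k : Energy n} (hk : k ∈ H01 U) {φ : Eu n → ℝ}
    (hφ : IsTest V φ) : ⟪k, hφ.energy⟫ = ⟪k none, hφ.toL2⟫ - ⟪k none, hφ.laplacian.toL2⟫ := by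
  rw [Energy.inner_eq, hφ.toL2_laplacian, inner_sum]
  have e : ∀ i, ⟪(k (some i) : L2 n), hφ.energy (some i)⟫ =
      -⟪(k none : L2 n), ((hφ.pd i).pd i).toL2⟫ := fun i => H01.inner_some hk (hφ.pd i) i
  simp only [e, IsTest.energy_none, Finset.sum_neg_distrib]
  ring

theorem weakSol_of_inner {U : Set (Eu n)} {g w : L2 n}
    (h : ∀ ψ (hψ : IsTest U ψ), ⟪w, hψ.toL2⟫ - ⟪w, hψ.laplacian.toL2⟫ = ⟪g, hψ.toL2⟫) :
    WeakSol (-1) U w fun x => -g x := by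
  intro ψ hψ
  have h1 := h ψ hψ
  simp only [IsTest.inner_toL2] at h1
  have i1 : Integrable fun x => w x * laplacian ψ x := (Lp.memLp w).integrable_mul hψ.laplacian.memLp
  have i2 : Integrable fun x => w x * ψ x := (Lp.memLp w).integrable_mul hψ.memLp
  have e : ∀ x, w x * (laplacian ψ x + -1 * ψ x) = w x * laplacian ψ x - w x * ψ x :=
    fun x => by ring
  simp only [e]
  simp only [neg_mul]
  rw [integral_sub i1 i2, integral_neg]
  linarith

theorem green_weakSol {U : Set (Eu n)} (g : L2 n) : WeakSol (-1) U (green U g) fun x => -g x :=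
  weakSol_of_inner fun ψ hψ => by
    rw [green_eq, ← H01.inner_energy (solve U g).2]
    exact inner_solve g ⟨_, hψ.energy_mem⟩

theorem H01.ae_eq_zero {U : Set (Eu n)} (hU : MeasurableSet U) {k : Energy n} (hk : k ∈ H01 U) :
    ∀ᵐ x, x ∉ U → (k none) x = 0 := by
  obtain ⟨ψ, hψ, hlim⟩ := H01.exists_seq hk
  have h1 : ∀ j, ∫ x in Uᶜ, (k none) x ^ 2 ≤ 2 * ‖(hψ j).toL2 - k none‖ ^ 2 := fun j => by
    refine (integral_sq_le_two_mul (B := Uᶜ) (hψ j).coeFn_toL2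
      (by simpa [sq] using (hψ j).integrable_mul (hψ j).contDiff.continuous)).trans ?_
    rw [setIntegral_eq_zero_of_forall_eq_zero (t := Uᶜ), mul_zero, add_zero]
    intro x hx
    rw [image_eq_zero_of_notMem_tsupport fun h => hx ((hψ j).tsupport_subset h)]
    simp
  have h2 : Tendsto (fun j => 2 * ‖(hψ j).toL2 - k none‖ ^ 2) atTop (𝓝 (2 * 0 ^ 2)) :=
    ((tendsto_iff_norm_sub_tendsto_zero.1 (Energy.tendsto_apply hlim none)).pow 2).const_mul 2
  have h3 := ge_of_tendsto' h2 h1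
  have h4 : ∫ x in Uᶜ, (k none) x ^ 2 = 0 :=
    le_antisymm (by simpa using h3) (integral_nonneg fun x => sq_nonneg _)
  rw [integral_eq_zero_iff_of_nonneg (fun x => sq_nonneg _) (L2.integrable_sq _).integrableOn,
    EventuallyEq, ae_restrict_iff' hU.compl] at h4
  filter_upwards [h4] with x hx h
  simpa using hx h

theorem green_ae_eq_zero {U : Set (Eu n)} (hU : MeasurableSet U) (g : L2 n) :
    ∀ᵐ x, x ∉ U → green U g x = 0 :=
  H01.ae_eq_zero hU (solve U g).2

/-- A smooth approximation of the absolute value vanishing at `0`. -/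
def smoothAbs (ε t : ℝ) : ℝ := √(t ^ 2 + ε ^ 2) - ε

theorem smoothAbs_nonneg {ε : ℝ} (t : ℝ) : 0 ≤ smoothAbs ε t :=
  sub_nonneg.2 (Real.le_sqrt_of_sq_le (by nlinarith [sq_nonneg t]))

theorem smoothAbs_le {ε : ℝ} (hε : 0 ≤ ε) (t : ℝ) : smoothAbs ε t ≤ |t| := by
  rw [smoothAbs, sub_le_iff_le_add, Real.sqrt_le_left (by positivity)]
  nlinarith [sq_abs t, mul_nonneg (abs_nonneg t) hε]

theorem sub_le_smoothAbs (ε t : ℝ) : t - smoothAbs ε t ≤ ε := by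
  have : t ≤ √(t ^ 2 + ε ^ 2) := Real.le_sqrt_of_sq_le (by nlinarith [sq_nonneg ε])
  rw [smoothAbs]; linarith

theorem contDiff_smoothAbs {ε : ℝ} (hε : 0 < ε) : ContDiff ℝ ∞ (smoothAbs ε) :=
  (((contDiff_id.pow 2).add contDiff_const).sqrt fun t => by
    have : 0 < t ^ 2 + ε ^ 2 := by positivity
    exact this.ne').sub contDiff_const

theorem hasDerivAt_smoothAbs {ε : ℝ} (hε : 0 < ε) (t : ℝ) :
    HasDerivAt (smoothAbs ε) (t / √(t ^ 2 + ε ^ 2)) t := by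
  have h0 : t ^ 2 + ε ^ 2 ≠ 0 := by positivity
  have h := (((hasDerivAt_id t).pow 2).add_const (ε ^ 2)).sqrt (by simpa using h0)
  refine (h.sub_const ε).congr_deriv ?_
  simp
  field_simp

theorem abs_deriv_smoothAbs_le {ε : ℝ} (hε : 0 < ε) (t : ℝ) : |deriv (smoothAbs ε) t| ≤ 1 := by
  rw [(hasDerivAt_smoothAbs hε t).deriv, abs_div, abs_of_nonneg (Real.sqrt_nonneg _)]
  refine div_le_one_of_le₀ (Real.abs_le_sqrt ?_) (Real.sqrt_nonneg _)
  nlinarith [sq_nonneg ε]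

theorem IsTest.comp {U : Set (Eu n)} {ψ : Eu n → ℝ} (h : IsTest U ψ) {θ : ℝ → ℝ}
    (hθ : ContDiff ℝ ∞ θ) (h0 : θ 0 = 0) : IsTest U fun x => θ (ψ x) :=
  ⟨hθ.comp h.contDiff, h.hasCompactSupport.comp_left h0,
    (closure_mono (Function.support_comp_subset h0 ψ)).trans h.tsupport_subset⟩

theorem IsTest.norm_toL2_le {U V : Set (Eu n)} {ψ φ : Eu n → ℝ} (h : IsTest U ψ) (h' : IsTest V φ)
    (hle : ∀ x, |ψ x| ≤ |φ x|) : ‖h.toL2‖ ≤ ‖h'.toL2‖ :=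
  Lp.norm_le_norm_of_ae_le (by
    filter_upwards [h.coeFn_toL2, h'.coeFn_toL2] with x h1 h2
    rw [h1, h2]; exact hle x)

theorem IsTest.norm_energy_smoothAbs_le {U : Set (Eu n)} {ψ : Eu n → ℝ} (h : IsTest U ψ) {ε : ℝ}
    (hε : 0 < ε) (h' : IsTest U fun x => smoothAbs ε (ψ x)) : ‖h'.energy‖ ≤ ‖h.energy‖ := by
  rw [PiLp.norm_eq_of_L2, PiLp.norm_eq_of_L2]
  refine Real.sqrt_le_sqrt (Finset.sum_le_sum fun o _ => ?_)
  gcongr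
  cases o with
  | none =>
    exact h'.norm_toL2_le h fun x => by
      rw [abs_of_nonneg (smoothAbs_nonneg _)]; exact smoothAbs_le hε.le _
  | some i =>
    refine (h'.pd i).norm_toL2_le (h.pd i) fun x => ?_
    rw [pd_comp ((contDiff_smoothAbs hε).differentiable (by simp) _)
      (h.contDiff.differentiableAt_infty x), abs_mul]
    exact mul_le_of_le_one_left (abs_nonneg _) (abs_deriv_smoothAbs_le hε _)

theorem H01.exists_nonneg_seq {U : Set (Eu n)} {g : L2 n} (hg : ∀ᵐ x, x ∈ U → 0 ≤ g x) :
    ∃ (ψ : ℕ → Eu n → ℝ) (hψ : ∀ j, IsTest U (ψ j)), (∀ j x, 0 ≤ ψ j x) ∧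
      Tendsto (fun j => (hψ j).energy) atTop (𝓝 (solve U g : Energy n)) := by
  obtain ⟨ψ, hψ, hlim⟩ := H01.exists_seq (solve U g).2
  have key : ∀ j : ℕ, ∃ ε > 0, ∀ (h' : IsTest U fun x => smoothAbs ε (ψ j x)),
      ⟪g, (hψ j).toL2⟫ - ⟪g, h'.toL2⟫ ≤ 1 / (j + 1 : ℝ) := by
    intro j
    have hintg : IntegrableOn (fun x => |g x|) (tsupport (ψ j)) :=
      (L2.locallyIntegrable g).integrableOn_isCompact (hψ j).hasCompactSupport |>.abs
    set I := ∫ x in tsupport (ψ j), |g x|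
    have hI : 0 ≤ I := integral_nonneg fun x => abs_nonneg _
    have hj : (0 : ℝ) < 1 / (j + 1) := by positivity
    obtain ⟨ε, hεd⟩ : ∃ ε : ℝ, ε = 1 / (j + 1) / (I + 1) := ⟨_, rfl⟩
    have hε : 0 < ε := by rw [hεd]; positivity
    refine ⟨ε, hε, fun h' => ?_⟩
    have i1 : Integrable fun x => g x * ψ j x := (Lp.memLp g).integrable_mul (hψ j).memLp
    have i2 : Integrable fun x => g x * smoothAbs ε (ψ j x) := (Lp.memLp g).integrable_mul h'.memLp
    rw [IsTest.inner_toL2, IsTest.inner_toL2, ← integral_sub i1 i2]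
    have hle : ∫ x, (g x * ψ j x - g x * smoothAbs ε (ψ j x)) ≤
        ∫ x, ε * (tsupport (ψ j)).indicator (fun x => |g x|) x := by
      refine integral_mono_ae (i1.sub i2)
        ((hintg.integrable_indicator (isClosed_tsupport _).measurableSet).const_mul ε) ?_
      filter_upwards [hg] with x hx
      by_cases hxs : x ∈ tsupport (ψ j)
      · rw [indicator_of_mem hxs, abs_of_nonneg (hx ((hψ j).tsupport_subset hxs))]
        have := mul_le_mul_of_nonneg_left (sub_le_smoothAbs ε (ψ j x))
          (hx ((hψ j).tsupport_subset hxs))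
        linarith
      · rw [indicator_of_notMem hxs, image_eq_zero_of_notMem_tsupport hxs]
        simp [smoothAbs, Real.sqrt_sq hε.le]
    refine hle.trans ?_
    rw [integral_const_mul, integral_indicator (isClosed_tsupport _).measurableSet]
    have : ε * (I + 1) = 1 / (j + 1) := by
      rw [hεd]; exact div_mul_cancel₀ _ (by positivity)
    nlinarith
  choose ε hε hle using key
  have h0 : ∀ j, smoothAbs (ε j) 0 = 0 := fun j => by simp [smoothAbs, Real.sqrt_sq (hε j).le]
  have hT : ∀ j, IsTest U fun x => smoothAbs (ε j) (ψ j x) := fun j =>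
    (hψ j).comp (contDiff_smoothAbs (hε j)) (h0 j)
  refine ⟨_, hT, fun j x => smoothAbs_nonneg _, ?_⟩
  have hb : ∀ j : ℕ, ‖(hT j).energy - (solve U g : Energy n)‖ ^ 2 ≤
      ‖(hψ j).energy‖ ^ 2 + ‖(solve U g : Energy n)‖ ^ 2 -
        2 * (⟪g, (hψ j).toL2⟫ - 1 / (j + 1 : ℝ)) := by
    intro j
    have e1 : ⟪(solve U g : Energy n), (hT j).energy⟫ = ⟪g, (hT j).toL2⟫ :=
      inner_solve g ⟨_, (hT j).energy_mem⟩
    rw [norm_sub_sq_real, real_inner_comm, e1]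
    have h2 : ‖(hT j).energy‖ ^ 2 ≤ ‖(hψ j).energy‖ ^ 2 := by
      gcongr
      exact (hψ j).norm_energy_smoothAbs_le (hε j) _
    linarith [hle j (hT j)]
  have hlim0 : Tendsto (fun j : ℕ => ‖(hψ j).energy‖ ^ 2 + ‖(solve U g : Energy n)‖ ^ 2 -
        2 * (⟪g, (hψ j).toL2⟫ - 1 / (j + 1 : ℝ))) atTop (𝓝 0) := by
    have h1 : Tendsto (fun j => ⟪g, (hψ j).toL2⟫) atTop (𝓝 ⟪g, green U g⟫) :=
      tendsto_const_nhds.inner (Energy.tendsto_apply hlim none)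
    have h2 := ((hlim.norm.pow 2).add_const (‖(solve U g : Energy n)‖ ^ 2)).sub
      ((h1.sub tendsto_one_div_add_atTop_nhds_zero_nat).const_mul 2)
    convert h2 using 2
    have e : ⟪g, green U g⟫ = ‖(solve U g : Energy n)‖ ^ 2 := by
      rw [real_inner_comm, inner_green, real_inner_self_eq_norm_sq]; rfl
    rw [e]; ring
  have hsq := squeeze_zero (fun j => sq_nonneg _) hb hlim0
  rw [tendsto_iff_norm_sub_tendsto_zero]
  have := hsq.sqrt
  simpa [Real.sqrt_sq (norm_nonneg _)] using this

theorem green_nonneg {U : Set (Eu n)} {g : L2 n} (hg : ∀ᵐ x, x ∈ U → 0 ≤ g x) :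
    ∀ᵐ x, 0 ≤ green U g x := by
  obtain ⟨ψ, hψ, hψ0, hlim⟩ := H01.exists_nonneg_seq hg
  have h : (0 : L2 n) ≤ green U g := by
    refine ge_of_tendsto' (Energy.tendsto_apply hlim none) fun j => ?_
    rw [← Lp.coeFn_nonneg]
    filter_upwards [(hψ j).coeFn_toL2] with x hx
    have e : ((hψ j).energy none) x = ψ j x := hx
    rw [e]; exact hψ0 j x
  exact (Lp.coeFn_nonneg _).2 h

theorem green_mono {U : Set (Eu n)} {g h : L2 n} (hgh : ∀ᵐ x, x ∈ U → g x ≤ h x) :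
    ∀ᵐ x, green U g x ≤ green U h x := by
  have h1 : ∀ᵐ x, x ∈ U → 0 ≤ (h - g) x := by
    filter_upwards [hgh, Lp.coeFn_sub h g] with x hx e hxU
    rw [e]; exact sub_nonneg.2 (hx hxU)
  have h2 := green_nonneg h1
  rw [map_sub] at h2
  filter_upwards [h2, Lp.coeFn_sub (green U h) (green U g)] with x hx e
  rw [e] at hx; exact sub_nonneg.1 hx

theorem L2.tendsto_of_dominated {u : ℕ → L2 n} {v : L2 n} (B : Eu n → ℝ) (hB : Integrable B)
    (hle : ∀ j, ∀ᵐ x, (u j x - v x) ^ 2 ≤ B x)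
    (hlim : ∀ᵐ x, Tendsto (fun j => u j x) atTop (𝓝 (v x))) : Tendsto u atTop (𝓝 v) := by
  have e : ∀ j, ‖u j - v‖ ^ 2 = ∫ x, (u j x - v x) ^ 2 := fun j =>
    L2.norm_sq_eq_of_ae (Lp.coeFn_sub (u j) v)
  have h : Tendsto (fun j => ∫ x, (u j x - v x) ^ 2) atTop (𝓝 (∫ _ : Eu n, (0 : ℝ))) := by
    refine tendsto_integral_of_dominated_convergence B (fun j => ?_) hB (fun j => ?_) ?_
    · exact ((Lp.aestronglyMeasurable (u j)).sub (Lp.aestronglyMeasurable v)).pow 2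
    · filter_upwards [hle j] with x hx
      rw [Real.norm_of_nonneg (sq_nonneg _)]; exact hx
    · filter_upwards [hlim] with x hx
      have := (hx.sub_const (v x)).pow 2
      simpa using this
  simp only [← e, integral_zero] at h
  rw [tendsto_iff_norm_sub_tendsto_zero]
  simpa [Real.sqrt_sq (norm_nonneg _)] using h.sqrt

theorem memLp_indicator {Ω : Set (Eu n)} (hm : MeasurableSet Ω) (hb : Bornology.IsBounded Ω)
    {f : Eu n → ℝ} (hf : Continuous f) : MemLp (Ω.indicator f) 2 := by
  obtain ⟨C, hC⟩ := (hb.isCompact_closure.image hf).isBounded.exists_norm_le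
  rw [memLp_indicator_iff_restrict hm]
  have : IsFiniteMeasure (volume.restrict Ω) := ⟨by
    rw [Measure.restrict_apply_univ]; exact hb.measure_lt_top⟩
  refine MemLp.of_bound hf.aestronglyMeasurable C ?_
  rw [ae_restrict_iff' hm]
  exact ae_of_all _ fun x hx => hC _ ⟨x, subset_closure hx, rfl⟩

theorem integrable_indicator_sq {Ω : Set (Eu n)} (hm : MeasurableSet Ω)
    (hb : Bornology.IsBounded Ω) {f : Eu n → ℝ} (hf : Continuous f) :
    Integrable (Ω.indicator fun x => f x ^ 2) := by
  have h := (memLp_indicator hm hb hf).integrable_sq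
  refine h.congr (ae_of_all _ fun x => ?_)
  by_cases hx : x ∈ Ω <;> simp [hx]

/-- The restriction of a continuous function to a bounded set as an element of `L²`. -/
def cutL2 {Ω : Set (Eu n)} (hm : MeasurableSet Ω) (hb : Bornology.IsBounded Ω)
    {f : Eu n → ℝ} (hf : Continuous f) : L2 n := (memLp_indicator hm hb hf).toLp _

theorem coeFn_cutL2 {Ω : Set (Eu n)} (hm : MeasurableSet Ω) (hb : Bornology.IsBounded Ω)
    {f : Eu n → ℝ} (hf : Continuous f) : cutL2 hm hb hf =ᵐ[volume] Ω.indicator f :=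
  (memLp_indicator hm hb hf).coeFn_toLp

theorem IsTest.inner_cutL2 {Ω : Set (Eu n)} (hm : MeasurableSet Ω) (hb : Bornology.IsBounded Ω)
    {f : Eu n → ℝ} (hf : Continuous f) {ψ : Eu n → ℝ} (h : IsTest Ω ψ) :
    ⟪cutL2 hm hb hf, h.toL2⟫ = ∫ x, f x * ψ x := by
  rw [h.inner_toL2]
  refine integral_congr_ae ((coeFn_cutL2 hm hb hf).mono fun x hx => ?_)
  simp only
  rw [hx]
  by_cases hxΩ : x ∈ Ω
  · rw [indicator_of_mem hxΩ]
  · rw [image_eq_zero_of_notMem_tsupport fun h' => hxΩ (h.tsupport_subset h')]; simp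

/-- A smooth function vanishing below `1` and equal to the identity above `2`. -/
def softPart (t : ℝ) : ℝ := t * Real.smoothTransition (t - 1)

theorem contDiff_softPart : ContDiff ℝ ∞ softPart :=
  contDiff_id.mul (Real.smoothTransition.contDiff.comp (contDiff_id.sub contDiff_const))

theorem softPart_of_le {t : ℝ} (ht : t ≤ 1) : softPart t = 0 := by
  rw [softPart, Real.smoothTransition.zero_of_nonpos (by linarith), mul_zero]

theorem softPart_of_ge {t : ℝ} (ht : 2 ≤ t) : softPart t = t := by
  rw [softPart, Real.smoothTransition.one_of_one_le (by linarith), mul_one]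

theorem abs_softPart_le (t : ℝ) : |softPart t| ≤ |t| := by
  rw [softPart, abs_mul, abs_of_nonneg (Real.smoothTransition.nonneg _)]
  exact mul_le_of_le_one_right (abs_nonneg _) (Real.smoothTransition.le_one _)

theorem deriv_softPart_of_lt {t : ℝ} (ht : t < 1) : deriv softPart t = 0 := by
  have : softPart =ᶠ[𝓝 t] fun _ => 0 :=
    (eventually_lt_nhds ht).mono fun s hs => softPart_of_le hs.le
  rw [this.deriv_eq, deriv_const]

theorem deriv_softPart_of_gt {t : ℝ} (ht : 2 < t) : deriv softPart t = 1 := by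
  have : softPart =ᶠ[𝓝 t] fun s => s :=
    (eventually_gt_nhds ht).mono fun s hs => softPart_of_ge hs.le
  rw [this.deriv_eq, deriv_id'']

theorem exists_abs_deriv_softPart_le : ∃ C, ∀ t, |deriv softPart t| ≤ C := by
  have hc : Continuous (deriv softPart) := contDiff_softPart.continuous_deriv (by simp)
  obtain ⟨C, hC⟩ := (isCompact_Icc (a := (1 : ℝ)) (b := 2)).image hc |>.isBounded.exists_norm_le
  refine ⟨max C 1, fun t => ?_⟩
  rcases lt_or_ge t 1 with h1 | h1
  · rw [deriv_softPart_of_lt h1]; simp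
  rcases lt_or_ge 2 t with h2 | h2
  · rw [deriv_softPart_of_gt h2]; simp
  · exact (hC _ ⟨t, ⟨h1, h2⟩, rfl⟩).trans (le_max_left _ _)

/-- Positive parts of smooth functions solve the Dirichlet problem. -/
theorem green_cutL2 {B : Eu n → ℝ} (hB : ContDiff ℝ ∞ B) (hm : MeasurableSet {x | 0 < B x})
    (hb : Bornology.IsBounded {x | 0 < B x}) (hΘ : Continuous fun x => -laplacian B x + B x) :
    green {x | 0 < B x} (cutL2 hm hb hΘ) = cutL2 hm hb hB.continuous := by
  set Ω := {x | 0 < B x}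
  have hΩ : ∀ {x}, x ∈ Ω ↔ 0 < B x := Iff.rfl
  let θ : ℕ → ℝ → ℝ := fun j t => (j + 1 : ℝ)⁻¹ * softPart ((j + 1) * t)
  have hj : ∀ j : ℕ, (0 : ℝ) < j + 1 := fun j => by positivity
  have hθ : ∀ j, ContDiff ℝ ∞ (θ j) := fun j =>
    contDiff_const.mul (contDiff_softPart.comp (contDiff_const.mul contDiff_id))
  have hT : ∀ j, IsTest Ω fun x => θ j (B x) := by
    intro j
    have hsub : tsupport (fun x => θ j (B x)) ⊆ {x | (j + 1 : ℝ)⁻¹ ≤ B x} := by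
      refine closure_minimal (fun x hx => ?_) (isClosed_le continuous_const hB.continuous)
      by_contra h
      rw [mem_ofPred_eq, not_le] at h
      have h1 : (j + 1 : ℝ) * B x ≤ 1 := by
        have := mul_le_mul_of_nonneg_left h.le (hj j).le
        rwa [mul_inv_cancel₀ (hj j).ne'] at this
      exact hx (by simp only [θ, softPart_of_le h1, mul_zero])
    have hsub' : {x | (j + 1 : ℝ)⁻¹ ≤ B x} ⊆ Ω := fun x hx => (inv_pos.2 (hj j)).trans_le hx
    exact ⟨(hθ j).comp hB, (Metric.isCompact_of_isClosed_isBounded (isClosed_tsupport _)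
      (hb.subset (hsub.trans hsub'))), hsub.trans hsub'⟩
  have hpd : ∀ i j x, pd i (fun x => θ j (B x)) x = deriv softPart ((j + 1) * B x) * pd i B x := by
    intro i j x
    rw [pd_comp ((hθ j).differentiable (by simp) _) (hB.differentiableAt_infty x)]
    congr 1
    have h1 : HasDerivAt softPart (deriv softPart ((j + 1) * B x)) ((j + 1) * B x) :=
      (contDiff_softPart.differentiable (by simp) _).hasDerivAt
    have h2 : HasDerivAt (fun t : ℝ => (j + 1 : ℝ) * t) (j + 1) (B x) := by
      simpa using (hasDerivAt_id (B x)).const_mul (j + 1 : ℝ)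
    have h3 : HasDerivAt (θ j) _ (B x) := (h1.comp (B x) h2).const_mul (j + 1 : ℝ)⁻¹
    rw [h3.deriv]
    have := (hj j).ne'
    field_simp
  let k : Energy n := WithLp.toLp 2 fun o => o.elim (cutL2 hm hb hB.continuous)
    fun i => cutL2 hm hb (hB.pd i).continuous
  obtain ⟨C, hC⟩ := exists_abs_deriv_softPart_le
  have hlim : Tendsto (fun j => (hT j).energy) atTop (𝓝 k) := by
    have hout : ∀ x, x ∉ Ω → ∀ j : ℕ, (j + 1 : ℝ) * B x < 1 := fun x hx j => by
      have := mul_nonpos_of_nonneg_of_nonpos (hj j).le (not_lt.1 hx)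
      linarith
    have hin : ∀ x ∈ Ω, ∀ᶠ j : ℕ in atTop, 2 < (j + 1 : ℝ) * B x := fun x hx => by
      have h1 : Tendsto (fun j : ℕ => (j + 1 : ℝ) * B x) atTop atTop :=
        (tendsto_natCast_atTop_atTop.atTop_add tendsto_const_nhds).atTop_mul_const hx
      exact h1.eventually_gt_atTop 2
    have hcomp : ∀ o, Tendsto (fun j => (hT j).energy o) atTop (𝓝 (k o)) := by
      intro o
      cases o with
      | none =>
        refine L2.tendsto_of_dominated (Ω.indicator fun x => (2 * B x) ^ 2)
          (integrable_indicator_sq hm hb (hB.continuous.const_mul 2))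
          (fun j => ?_) ?_
        · filter_upwards [(hT j).coeFn_toL2, coeFn_cutL2 hm hb hB.continuous] with x h1 h2
          have h1' : ((hT j).energy none) x = θ j (B x) := h1
          have h2' : (k none) x = Ω.indicator B x := h2
          rw [h1', h2']
          by_cases hx : x ∈ Ω
          · rw [indicator_of_mem hx, indicator_of_mem hx]
            have : |θ j (B x)| ≤ |B x| := by
              rw [abs_mul, abs_of_pos (inv_pos.2 (hj j))]
              have := mul_le_mul_of_nonneg_left (abs_softPart_le ((j + 1) * B x))
                (inv_pos.2 (hj j)).le
              rwa [abs_mul, abs_of_pos (hj j), inv_mul_cancel_left₀ (hj j).ne'] at this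
            have h3 := abs_sub (θ j (B x)) (B x)
            refine sq_le_sq.2 (h3.trans ?_)
            rw [abs_mul 2, abs_two]
            linarith
          · rw [indicator_of_notMem hx, indicator_of_notMem hx]
            simp [θ, softPart_of_le (hout x hx j).le]
        · filter_upwards [ae_all_iff.2 fun j => (hT j).coeFn_toL2,
            coeFn_cutL2 hm hb hB.continuous] with x h1 h2
          have h2' : (k none) x = Ω.indicator B x := h2
          rw [h2']
          refine Tendsto.congr (fun j => (h1 j).symm) ?_
          by_cases hx : x ∈ Ω
          · rw [indicator_of_mem hx]
            refine tendsto_const_nhds.congr' ((hin x hx).mono fun j hj' => ?_)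
            simp only [θ, softPart_of_ge hj'.le]
            rw [inv_mul_cancel_left₀ (hj j).ne']
          · rw [indicator_of_notMem hx]
            simp [θ, softPart_of_le (hout x hx _).le]
      | some i =>
        refine L2.tendsto_of_dominated (Ω.indicator fun x => ((C + 1) * pd i B x) ^ 2)
          (integrable_indicator_sq hm hb ((hB.pd i).continuous.const_mul (C + 1)))
          (fun j => ?_) ?_
        · filter_upwards [((hT j).pd i).coeFn_toL2, coeFn_cutL2 hm hb (hB.pd i).continuous]
            with x h1 h2
          have h1' : ((hT j).energy (some i)) x = pd i (fun x => θ j (B x)) x := h1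
          have h2' : (k (some i)) x = Ω.indicator (pd i B) x := h2
          rw [h1', h2', hpd]
          by_cases hx : x ∈ Ω
          · rw [indicator_of_mem hx, indicator_of_mem hx, ← sub_one_mul, mul_pow, mul_pow]
            refine mul_le_mul_of_nonneg_right ?_ (sq_nonneg _)
            obtain ⟨h3, h4⟩ := abs_le.1 (hC ((j + 1) * B x))
            nlinarith
          · rw [indicator_of_notMem hx, indicator_of_notMem hx, deriv_softPart_of_lt (hout x hx j)]
            simp
        · filter_upwards [ae_all_iff.2 fun j => ((hT j).pd i).coeFn_toL2,
            coeFn_cutL2 hm hb (hB.pd i).continuous] with x h1 h2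
          have h2' : (k (some i)) x = Ω.indicator (pd i B) x := h2
          rw [h2']
          refine Tendsto.congr (fun j => (h1 j).symm) ?_
          simp only [hpd]
          by_cases hx : x ∈ Ω
          · rw [indicator_of_mem hx]
            refine tendsto_const_nhds.congr' ((hin x hx).mono fun j hj' => ?_)
            simp only [deriv_softPart_of_gt hj', one_mul]
          · rw [indicator_of_notMem hx]
            simp [deriv_softPart_of_lt (hout x hx _)]
    have := ((PiLp.continuous_toLp 2 _).tendsto _).comp (tendsto_pi_nhds.2 hcomp)
    exact this
  have hk : k ∈ H01 Ω := (testEnergy Ω).isClosed_topologicalClosure.mem_of_tendsto hlim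
    (Eventually.of_forall fun j => (hT j).energy_mem)
  have := solve_eq_of_forall hk (g := cutL2 hm hb hΘ) fun ψ hψ => by
    rw [Energy.inner_eq, hψ.inner_cutL2]
    have e0 : ⟪(k none : L2 n), hψ.energy none⟫ = ∫ x, B x * ψ x := hψ.inner_cutL2 hm hb hB.continuous
    have e1 : ∀ i, ⟪(k (some i) : L2 n), hψ.energy (some i)⟫ = ∫ x, pd i B x * pd i ψ x :=
      fun i => (hψ.pd i).inner_cutL2 hm hb (hB.pd i).continuous
    have e2 := integral_laplacian_mul hB hψ.contDiff hψ.hasCompactSupport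
    have i1 := integrable_mul_of_hasCompactSupport hB.laplacian.continuous
      hψ.contDiff.continuous hψ.hasCompactSupport
    have i2 := integrable_mul_of_hasCompactSupport hB.continuous
      hψ.contDiff.continuous hψ.hasCompactSupport
    simp only [e0, e1, add_mul, neg_mul]
    have i3 : Integrable fun x => -(laplacian B x * ψ x) := i1.neg
    rw [integral_add i3 i2, integral_neg, e2]
    ring
  rw [green_eq, this]
  rfl

theorem sq_integral_mul_le {X : Type*} [MeasurableSpace X] {ν : Measure X} {w f : X → ℝ}
    (hw : ∀ x, 0 ≤ w x) (hi : Integrable w ν) (h1 : ∫ x, w x ∂ν = 1)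
    (hf : Integrable (fun x => w x * f x) ν) (hf2 : Integrable (fun x => w x * f x ^ 2) ν) :
    (∫ x, w x * f x ∂ν) ^ 2 ≤ ∫ x, w x * f x ^ 2 ∂ν := by
  set m := ∫ x, w x * f x ∂ν
  have h : 0 ≤ ∫ x, (w x * f x ^ 2 - 2 * m * (w x * f x) + m ^ 2 * w x) ∂ν :=
    integral_nonneg fun x => by
      have : w x * f x ^ 2 - 2 * m * (w x * f x) + m ^ 2 * w x = w x * (f x - m) ^ 2 := by ring
      simp only [this]
      exact mul_nonneg (hw x) (sq_nonneg _)
  have i1 : Integrable (fun x => w x * f x ^ 2 - 2 * m * (w x * f x)) ν :=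
    hf2.sub (hf.const_mul (2 * m))
  rw [integral_add i1 (hi.const_mul _), integral_sub hf2 (hf.const_mul _), integral_const_mul,
    integral_const_mul, h1] at h
  change 0 ≤ _ - 2 * m * m + _ at h
  nlinarith

/-- A continuous cutoff on the line. -/
def tent (t : ℝ) : ℝ := max 0 (2 - |t|)

theorem continuous_tent : Continuous tent := by unfold tent; fun_prop

theorem tent_nonneg (t : ℝ) : 0 ≤ tent t := le_max_left _ _

theorem tent_eq_zero {t : ℝ} (ht : 2 ≤ |t|) : tent t = 0 := max_eq_left (by linarith)

theorem hasCompactSupport_tent : HasCompactSupport tent :=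
  HasCompactSupport.of_support_subset_isCompact (isCompact_Icc (a := (-2 : ℝ)) (b := 2))
    fun t ht => by
      by_contra h
      refine ht (tent_eq_zero ?_)
      by_contra! h'
      exact h ⟨by linarith [(abs_lt.1 h').1], by linarith [(abs_lt.1 h').2]⟩

theorem sq_sub_shift_le {ψ : Eu n → ℝ} (hψ : ContDiff ℝ ∞ ψ) (x z : Eu n) :
    (ψ x - ψ (x - z)) ^ 2 ≤ ∫ t, tent t * fderiv ℝ ψ (x - t • z) z ^ 2 := by
  have hc : Continuous fun t : ℝ => fderiv ℝ ψ (x - t • z) z :=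
    ((hψ.continuous_fderiv (by simp)).comp (by fun_prop)).clm_apply continuous_const
  have hc2 : Continuous fun t : ℝ => fderiv ℝ ψ (x - t • z) z ^ 2 := hc.pow 2
  have hd : ∀ t : ℝ, HasDerivAt (fun t : ℝ => -ψ (x - t • z)) (fderiv ℝ ψ (x - t • z) z) t := by
    intro t
    have h1 : HasDerivAt (fun t : ℝ => x - t • z) (-z) t := by
      simpa using ((hasDerivAt_id t).smul_const z).const_sub x
    have := ((hψ.differentiableAt_infty (x - t • z)).hasFDerivAt.comp_hasDerivAt t h1).neg
    rw [map_neg, neg_neg] at this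
    exact this
  have h1 : ∫ t in (0 : ℝ)..1, fderiv ℝ ψ (x - t • z) z = ψ x - ψ (x - z) := by
    rw [intervalIntegral.integral_eq_sub_of_hasDerivAt (fun t _ => hd t)
      (hc.intervalIntegrable _ _)]
    simp; ring
  rw [← h1, intervalIntegral.integral_of_le zero_le_one]
  have h2 := sq_integral_mul_le (ν := volume.restrict (Ioc (0 : ℝ) 1)) (w := fun _ => 1)
    (f := fun t : ℝ => fderiv ℝ ψ (x - t • z) z) (fun _ => zero_le_one) (integrable_const _)
    (by simp)
    (by simp only [one_mul]
        exact (hc.integrableOn_Icc (a := 0) (b := 1)).mono_set Ioc_subset_Icc_self)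
    (by simp only [one_mul]; exact (hc2.integrableOn_Icc (a := 0) (b := 1)).mono_set Ioc_subset_Icc_self)
  simp only [one_mul] at h2
  refine h2.trans ?_
  have hi : Integrable fun t => tent t * fderiv ℝ ψ (x - t • z) z ^ 2 :=
    (continuous_tent.mul (hc.pow 2)).integrable_of_hasCompactSupport
      hasCompactSupport_tent.mul_right
  refine le_trans ?_ (setIntegral_le_integral (s := Ioc 0 1) hi
    (ae_of_all _ fun t => mul_nonneg (tent_nonneg t) (sq_nonneg _)))
  refine setIntegral_mono_on (((hc.pow 2).integrableOn_Icc).mono_set Ioc_subset_Icc_self)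
    hi.integrableOn measurableSet_Ioc fun t ht => ?_
  refine le_mul_of_one_le_left (sq_nonneg _) (le_max_of_le_right ?_)
  rw [abs_of_pos ht.1]; linarith [ht.2]

theorem hasCompactSupport_uncurry {X Y : Type*} [TopologicalSpace X] [TopologicalSpace Y]
    [T2Space X] [T2Space Y] {K : Set X} {L : Set Y} (hK : IsCompact K) (hL : IsCompact L)
    {f : X → Y → ℝ} (h : ∀ x y, f x y ≠ 0 → x ∈ K ∧ y ∈ L) : HasCompactSupport f.uncurry :=
  HasCompactSupport.of_support_subset_isCompact (hK.prod hL) fun p hp => h p.1 p.2 hp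

/-- The `L²` norm of the gradient of a test function. -/
def gradSq (ψ : Eu n → ℝ) : ℝ := ∫ x, ‖fderiv ℝ ψ x‖ ^ 2

theorem IsTest.integrable_gradSq {U : Set (Eu n)} {ψ : Eu n → ℝ} (h : IsTest U ψ) :
    Integrable fun x => ‖fderiv ℝ ψ x‖ ^ 2 := by
  have hc : Continuous fun x => ‖fderiv ℝ ψ x‖ ^ 2 :=
    (h.contDiff.continuous_fderiv (by simp)).norm.pow 2
  refine hc.integrable_of_hasCompactSupport
    (HasCompactSupport.of_support_subset_isCompact h.hasCompactSupport.isCompact fun x hx => ?_)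
  by_contra h'
  refine hx ?_
  simp only
  rw [image_eq_zero_of_notMem_tsupport fun h'' => h' (tsupport_fderiv_subset ℝ h''), norm_zero]
  norm_num

theorem IsTest.integral_sq_sub_shift_le {U : Set (Eu n)} {ψ : Eu n → ℝ} (h : IsTest U ψ)
    (z : Eu n) : ∫ x, (ψ x - ψ (x - z)) ^ 2 ≤ (∫ t, tent t) * (‖z‖ ^ 2 * gradSq ψ) := by
  have hfc : Continuous (fderiv ℝ ψ) := h.contDiff.continuous_fderiv (by simp)
  have hcont : Continuous (Function.uncurry fun (x : Eu n) (t : ℝ) =>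
      tent t * fderiv ℝ ψ (x - t • z) z ^ 2) := by
    refine (continuous_tent.comp continuous_snd).mul (Continuous.pow ?_ 2)
    exact (hfc.comp (by fun_prop)).clm_apply continuous_const
  have hcs : HasCompactSupport (Function.uncurry fun (x : Eu n) (t : ℝ) =>
      tent t * fderiv ℝ ψ (x - t • z) z ^ 2) := by
    have hK : IsCompact ((fun p : Eu n × ℝ => p.1 + p.2 • z) ''
        (tsupport ψ ×ˢ Icc (-2 : ℝ) 2)) :=
      (h.hasCompactSupport.isCompact.prod isCompact_Icc).image (by fun_prop)
    refine hasCompactSupport_uncurry hK (isCompact_Icc (a := (-2 : ℝ)) (b := 2)) fun x t hxt => ?_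
    have ht : t ∈ Icc (-2 : ℝ) 2 := by
      by_contra h'
      refine hxt ?_
      rw [tent_eq_zero, zero_mul]
      by_contra! h''
      exact h' ⟨by linarith [(abs_lt.1 h'').1], by linarith [(abs_lt.1 h'').2]⟩
    refine ⟨⟨(x - t • z, t), ⟨?_, ht⟩, by simp⟩, ht⟩
    by_contra h'
    refine hxt ?_
    have : fderiv ℝ ψ (x - t • z) = 0 :=
      image_eq_zero_of_notMem_tsupport fun h'' => h' (tsupport_fderiv_subset ℝ h'')
    simp [this]
  have hi : Integrable (Function.uncurry fun (x : Eu n) (t : ℝ) =>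
      tent t * fderiv ℝ ψ (x - t • z) z ^ 2) (volume.prod volume) :=
    hcont.integrable_of_hasCompactSupport hcs
  calc ∫ x, (ψ x - ψ (x - z)) ^ 2
      ≤ ∫ x, ∫ t, tent t * fderiv ℝ ψ (x - t • z) z ^ 2 :=
        integral_mono_of_nonneg (ae_of_all _ fun x => sq_nonneg _) hi.integral_prod_left
          (ae_of_all _ fun x => sq_sub_shift_le h.contDiff x z)
    _ = ∫ t, ∫ x, tent t * fderiv ℝ ψ (x - t • z) z ^ 2 := integral_integral_swap hi
    _ = ∫ t, tent t * ∫ x, fderiv ℝ ψ x z ^ 2 := by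
        refine integral_congr_ae (ae_of_all _ fun t => ?_)
        simp only
        rw [integral_const_mul, integral_sub_right_eq_self (fun x => fderiv ℝ ψ x z ^ 2)]
    _ = (∫ t, tent t) * ∫ x, fderiv ℝ ψ x z ^ 2 := integral_mul_const _ _
    _ ≤ _ := by
        refine mul_le_mul_of_nonneg_left ?_ (integral_nonneg tent_nonneg)
        rw [gradSq, ← integral_const_mul]
        refine integral_mono_of_nonneg (ae_of_all _ fun x => sq_nonneg _)
          (h.integrable_gradSq.const_mul _) (ae_of_all _ fun x => ?_)
        simp only
        rw [← sq_abs, ← mul_pow, mul_comm]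
        gcongr
        exact (fderiv ℝ ψ x).le_opNorm z

theorem IsTest.integral_sq_sub_conv_le {U : Set (Eu n)} {ψ : Eu n → ℝ} (h : IsTest U ψ) (j : ℕ) :
    ∫ x, (ψ x - _root_.conv (molli n j) ψ x) ^ 2 ≤
      (∫ t, tent t) * ((1 / (j + 1 : ℝ)) ^ 2 * gradSq ψ) := by
  have hρ := isTestFn_molli (n := n) j
  have hρ0 : ∀ z, 0 ≤ molli n j z := ContDiffBump.nonneg_normed _
  have hρ1 : ∫ z, molli n j z = 1 := ContDiffBump.integral_normed _
  have hρi : Integrable (molli n j) := hρ.integrable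
  have hψc := h.contDiff.continuous
  have hρc := hρ.contDiff.continuous
  have hcont : Continuous (Function.uncurry fun (x z : Eu n) =>
      molli n j z * (ψ x - ψ (x - z)) ^ 2) := by
    simp only [Function.uncurry_def]; fun_prop
  have hcs : HasCompactSupport (Function.uncurry fun (x z : Eu n) =>
      molli n j z * (ψ x - ψ (x - z)) ^ 2) := by
    have hK : IsCompact (tsupport ψ ∪ (fun p : Eu n × Eu n => p.1 + p.2) ''
        (tsupport ψ ×ˢ tsupport (molli n j))) :=
      h.hasCompactSupport.isCompact.union
        ((h.hasCompactSupport.isCompact.prod hρ.hasCompactSupport.isCompact).image (by fun_prop))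
    refine hasCompactSupport_uncurry hK hρ.hasCompactSupport.isCompact fun x z hxz => ?_
    have hz : z ∈ tsupport (molli n j) := by
      by_contra h'
      exact hxz (by rw [image_eq_zero_of_notMem_tsupport h', zero_mul])
    refine ⟨?_, hz⟩
    by_contra h'
    rw [mem_union, not_or] at h'
    refine hxz ?_
    have h1 : ψ (x - z) = 0 := image_eq_zero_of_notMem_tsupport fun h'' =>
      h'.2 ⟨(x - z, z), ⟨h'', hz⟩, by simp⟩
    rw [image_eq_zero_of_notMem_tsupport h'.1, h1]
    simp
  have hi : Integrable (Function.uncurry fun (x z : Eu n) =>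
      molli n j z * (ψ x - ψ (x - z)) ^ 2) (volume.prod volume) :=
    hcont.integrable_of_hasCompactSupport hcs
  have hpt : ∀ x, (ψ x - _root_.conv (molli n j) ψ x) ^ 2 ≤
      ∫ z, molli n j z * (ψ x - ψ (x - z)) ^ 2 := by
    intro x
    have c1 : Integrable fun z => molli n j z * ψ (x - z) :=
      (show Continuous fun z => molli n j z * ψ (x - z) by fun_prop).integrable_of_hasCompactSupport
        hρ.hasCompactSupport.mul_right
    have c2 : Integrable fun z => molli n j z * (ψ x - ψ (x - z)) :=
      (show Continuous fun z => molli n j z * (ψ x - ψ (x - z)) by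
        fun_prop).integrable_of_hasCompactSupport hρ.hasCompactSupport.mul_right
    have c3 : Integrable fun z => molli n j z * (ψ x - ψ (x - z)) ^ 2 :=
      (show Continuous fun z => molli n j z * (ψ x - ψ (x - z)) ^ 2 by
        fun_prop).integrable_of_hasCompactSupport hρ.hasCompactSupport.mul_right
    have e : ψ x - _root_.conv (molli n j) ψ x = ∫ z, molli n j z * (ψ x - ψ (x - z)) := by
      simp only [mul_sub]
      rw [integral_sub (hρi.mul_const _) c1, integral_mul_const, hρ1, one_mul, conv_apply]
    rw [e]
    exact sq_integral_mul_le hρ0 hρi hρ1 c2 c3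
  calc ∫ x, (ψ x - _root_.conv (molli n j) ψ x) ^ 2
      ≤ ∫ x, ∫ z, molli n j z * (ψ x - ψ (x - z)) ^ 2 :=
        integral_mono_of_nonneg (ae_of_all _ fun x => sq_nonneg _) hi.integral_prod_left
          (ae_of_all _ hpt)
    _ = ∫ z, ∫ x, molli n j z * (ψ x - ψ (x - z)) ^ 2 := integral_integral_swap hi
    _ ≤ ∫ z, molli n j z * ((∫ t, tent t) * ((1 / (j + 1 : ℝ)) ^ 2 * gradSq ψ)) := by
        refine integral_mono_of_nonneg (ae_of_all _ fun z => integral_nonneg fun x =>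
          mul_nonneg (hρ0 z) (sq_nonneg _)) (hρi.mul_const _) (ae_of_all _ fun z => ?_)
        simp only
        rw [integral_const_mul]
        by_cases hz : z ∈ tsupport (molli n j)
        · refine mul_le_mul_of_nonneg_left ((h.integral_sq_sub_shift_le z).trans ?_) (hρ0 z)
          rw [tsupport_molli, mem_closedBall_zero_iff] at hz
          refine mul_le_mul_of_nonneg_left ?_ (integral_nonneg tent_nonneg)
          refine mul_le_mul_of_nonneg_right ?_ (integral_nonneg fun x => sq_nonneg _)
          gcongr
        · rw [image_eq_zero_of_notMem_tsupport hz]; simp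
    _ = _ := by rw [integral_mul_const, hρ1, one_mul]

theorem norm_fderiv_sq_le (f : Eu n → ℝ) (x : Eu n) :
    ‖fderiv ℝ f x‖ ^ 2 ≤ ∑ i, pd i f x ^ 2 := by
  have h : ‖fderiv ℝ f x‖ ≤ √(∑ i, pd i f x ^ 2) := by
    refine ContinuousLinearMap.opNorm_le_bound _ (sqrt_nonneg _) fun y => ?_
    rw [fderiv_eq_sum_pd, Real.norm_eq_abs]
    have h2 : (∑ i, y i * pd i f x) ^ 2 ≤ (∑ i, pd i f x ^ 2) * ‖y‖ ^ 2 := by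
      rw [EuclideanSpace.norm_sq_eq]
      simp only [Real.norm_eq_abs, sq_abs]
      rw [mul_comm]
      exact Finset.sum_mul_sq_le_sq_mul_sq _ _ _
    refine (Real.abs_le_sqrt h2).trans_eq ?_
    rw [sqrt_mul (Finset.sum_nonneg fun i _ => sq_nonneg _), sqrt_sq (norm_nonneg _)]
  calc ‖fderiv ℝ f x‖ ^ 2 ≤ √(∑ i, pd i f x ^ 2) ^ 2 := by gcongr
    _ = _ := sq_sqrt (Finset.sum_nonneg fun i _ => sq_nonneg _)

theorem IsTest.gradSq_le {U : Set (Eu n)} {ψ : Eu n → ℝ} (h : IsTest U ψ) :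
    gradSq ψ ≤ ‖h.energy‖ ^ 2 := by
  have hi : ∀ i : Fin n, Integrable fun x => _root_.pd i ψ x ^ 2 := fun i => by
    simpa only [sq] using (h.pd i).integrable_mul (h.pd i).contDiff.continuous
  calc gradSq ψ ≤ ∫ x, ∑ i, _root_.pd i ψ x ^ 2 :=
        integral_mono h.integrable_gradSq (integrable_finsetSum _ fun i _ => hi i)
          fun x => norm_fderiv_sq_le ψ x
    _ = ∑ i, ‖(h.pd i).toL2‖ ^ 2 := by
        rw [integral_finsetSum _ fun i _ => hi i]
        exact Finset.sum_congr rfl fun i _ => (L2.norm_sq_eq_of_ae (h.pd i).coeFn_toL2).symm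
    _ ≤ ‖h.energy‖ ^ 2 := by
        rw [← real_inner_self_eq_norm_sq, Energy.inner_eq]
        simp only [real_inner_self_eq_norm_sq, IsTest.energy_some]
        linarith [sq_nonneg ‖h.energy none‖]

theorem IsTest.conv_eq_inner {U : Set (Eu n)} {ψ : Eu n → ℝ} (h : IsTest U ψ) (j : ℕ) (x : Eu n) :
    _root_.conv (molli n j) ψ x =
      ⟪h.toL2, (IsTest.comp_const_sub (isTestFn_molli j) x).toL2⟫ := by
  rw [conv_apply', real_inner_comm, h.inner_toL2]
  refine integral_congr_ae ?_
  filter_upwards [(IsTest.comp_const_sub (isTestFn_molli (n := n) j) x).coeFn_toL2] with z hz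
  rw [hz, mul_comm]

theorem norm_toL2_comp_const_sub {k : Eu n → ℝ} (hk : IsTestFn k) (x : Eu n) :
    ‖(IsTest.comp_const_sub hk x).toL2‖ = ‖hk.toL2‖ := by
  rw [← sq_eq_sq₀ (norm_nonneg _) (norm_nonneg _),
    L2.norm_sq_eq_of_ae (IsTest.comp_const_sub hk x).coeFn_toL2,
    L2.norm_sq_eq_of_ae hk.coeFn_toL2]
  exact integral_sub_left_eq_self (fun z => k z ^ 2) _ x

theorem tendsto_integral_conv_sq {U : Set (Eu n)} (hb : Bornology.IsBounded U)
    {ψ : ℕ → Eu n → ℝ} (hψ : ∀ k, IsTest U (ψ k)) {M : ℝ} (hM : ∀ k, ‖(hψ k).toL2‖ ≤ M)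
    (hw : ∀ v : L2 n, Tendsto (fun k => ⟪(hψ k).toL2, v⟫) atTop (𝓝 0)) (j : ℕ) :
    Tendsto (fun k => ∫ x, conv (molli n j) (ψ k) x ^ 2) atTop (𝓝 0) := by
  obtain ⟨R, hR⟩ := hb.subset_closedBall 0
  have hρ := isTestFn_molli (n := n) j
  set B : ℝ := (M * ‖hρ.toL2‖) ^ 2
  have hzero : ∀ k x, x ∉ Metric.closedBall (0 : Eu n) (R + 1) →
      conv (molli n j) (ψ k) x = 0 := by
    intro k x hx
    rw [conv_apply]
    refine integral_eq_zero_of_ae (ae_of_all _ fun t => ?_)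
    by_cases ht : t ∈ tsupport (molli n j)
    · rw [tsupport_molli, mem_closedBall_zero_iff] at ht
      have : x - t ∉ tsupport (ψ k) := fun h' => by
        have h1 := hR ((hψ k).tsupport_subset h')
        rw [mem_closedBall_zero_iff] at h1 hx
        refine hx ?_
        have h2 : ‖x‖ ≤ ‖x - t‖ + ‖t‖ := by simpa using norm_add_le (x - t) t
        have h3 : (1 : ℝ) / (j + 1) ≤ 1 := by
          rw [div_le_one (by positivity)]; linarith [(Nat.cast_nonneg j : (0 : ℝ) ≤ j)]
        linarith
      simp [image_eq_zero_of_notMem_tsupport this]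
    · simp [image_eq_zero_of_notMem_tsupport ht]
  have hlim : ∀ x, Tendsto (fun k => conv (molli n j) (ψ k) x ^ 2) atTop (𝓝 0) := by
    intro x
    simp only [(hψ _).conv_eq_inner]
    simpa using (hw (IsTest.comp_const_sub hρ x).toL2).pow 2
  have := tendsto_integral_of_dominated_convergence (μ := volume)
    (F := fun k x => conv (molli n j) (ψ k) x ^ 2) (f := fun _ => 0)
    ((Metric.closedBall (0 : Eu n) (R + 1)).indicator fun _ => B)
    (fun k => ((contDiff_conv hρ
      (hψ k).contDiff.continuous.locallyIntegrable).continuous.pow 2).aestronglyMeasurable)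
    ((integrable_indicator_iff measurableSet_closedBall).2
      (integrableOn_const (measure_closedBall_lt_top.ne)))
    (fun k => ae_of_all _ fun x => ?_) (ae_of_all _ hlim)
  · simpa using this
  · by_cases hx : x ∈ Metric.closedBall (0 : Eu n) (R + 1)
    · rw [indicator_of_mem hx, norm_pow, (hψ k).conv_eq_inner]
      refine pow_le_pow_left₀ (norm_nonneg _) ((norm_inner_le_norm _ _).trans ?_) 2
      rw [norm_toL2_comp_const_sub]
      exact mul_le_mul_of_nonneg_right (hM k) (norm_nonneg _)
    · rw [indicator_of_notMem hx, hzero k x hx]; simp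

/-- A form of the Rellich theorem: weakly null sequences in `H₀¹` are strongly null in `L²`. -/
theorem tendsto_toL2_of_weak {U : Set (Eu n)} (hb : Bornology.IsBounded U)
    {ψ : ℕ → Eu n → ℝ} (hψ : ∀ k, IsTest U (ψ k)) {M : ℝ} (hM : ∀ k, ‖(hψ k).energy‖ ≤ M)
    (hw : ∀ v : L2 n, Tendsto (fun k => ⟪(hψ k).toL2, v⟫) atTop (𝓝 0)) :
    Tendsto (fun k => (hψ k).toL2) atTop (𝓝 0) := by
  have hM' : ∀ k, ‖(hψ k).toL2‖ ≤ M := fun k => ((hψ k).energy.norm_apply_le none).trans (hM k)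
  set T : ℝ := ∫ t, tent t
  have hT : 0 ≤ T := integral_nonneg tent_nonneg
  have key : ∀ (j : ℕ) k, ‖(hψ k).toL2‖ ^ 2 ≤
      2 * (T * ((1 / (j + 1 : ℝ)) ^ 2 * M ^ 2)) + 2 * ∫ x, conv (molli n j) (ψ k) x ^ 2 := by
    intro j k
    have hρ := isTestFn_molli (n := n) j
    have hcc : Continuous (conv (molli n j) (ψ k)) :=
      (contDiff_conv hρ (hψ k).contDiff.continuous.locallyIntegrable).continuous
    have hcs : HasCompactSupport (conv (molli n j) (ψ k)) :=
      hρ.hasCompactSupport.convolution _ (hψ k).hasCompactSupport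
    have m1 := hcc.memLp_of_hasCompactSupport (p := 2) (μ := volume) hcs
    have i1 : Integrable fun x => conv (molli n j) (ψ k) x ^ 2 := m1.integrable_sq
    have i2 : Integrable fun x => (ψ k x - conv (molli n j) (ψ k) x) ^ 2 :=
      ((hψ k).memLp.sub m1).integrable_sq
    have i3 : Integrable fun x => ψ k x ^ 2 := (hψ k).memLp.integrable_sq
    have h1 : ∫ x, ψ k x ^ 2 ≤ ∫ x, (2 * (ψ k x - conv (molli n j) (ψ k) x) ^ 2 +
        2 * conv (molli n j) (ψ k) x ^ 2) :=
      integral_mono i3 ((i2.const_mul 2).add (i1.const_mul 2)) fun x => by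
        simp only
        nlinarith [sq_nonneg (ψ k x - 2 * conv (molli n j) (ψ k) x)]
    rw [integral_add (i2.const_mul 2) (i1.const_mul 2), integral_const_mul,
      integral_const_mul] at h1
    rw [L2.norm_sq_eq_of_ae (hψ k).coeFn_toL2]
    have h2 := (hψ k).integral_sq_sub_conv_le j
    have h3 : gradSq (ψ k) ≤ M ^ 2 :=
      (hψ k).gradSq_le.trans (pow_le_pow_left₀ (norm_nonneg _) (hM k) 2)
    have h4 : T * ((1 / (j + 1 : ℝ)) ^ 2 * gradSq (ψ k)) ≤ T * ((1 / (j + 1 : ℝ)) ^ 2 * M ^ 2) := by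
      gcongr
    linarith
  rw [tendsto_zero_iff_norm_tendsto_zero]
  have hsq : Tendsto (fun k => ‖(hψ k).toL2‖ ^ 2) atTop (𝓝 0) := by
    rw [Metric.tendsto_atTop]
    intro ε hε
    have ht : Tendsto (fun j : ℕ => 2 * (T * ((1 / (j + 1 : ℝ)) ^ 2 * M ^ 2))) atTop (𝓝 0) := by
      have := ((((tendsto_one_div_add_atTop_nhds_zero_nat (𝕜 := ℝ)).pow 2).mul_const
        (M ^ 2)).const_mul T).const_mul 2
      simpa using this
    obtain ⟨j, hj⟩ := (ht.eventually (gt_mem_nhds (half_pos hε))).exists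
    have hc := (tendsto_integral_conv_sq hb hψ hM' hw j).const_mul 2
    rw [mul_zero] at hc
    obtain ⟨N, hN⟩ := eventually_atTop.1 (hc.eventually (gt_mem_nhds (half_pos hε)))
    refine ⟨N, fun k hk => ?_⟩
    rw [dist_zero_right, Real.norm_of_nonneg (sq_nonneg _)]
    linarith [key j k, hN k hk]
  have := hsq.sqrt
  simpa [sqrt_sq (norm_nonneg _)] using this

theorem green_tendsto_zero {U : Set (Eu n)} (hb : Bornology.IsBounded U) {y : ℕ → L2 n} {M : ℝ}
    (hM : ∀ k, ‖y k‖ ≤ M) (hy : ∀ v : L2 n, Tendsto (fun k => ⟪y k, v⟫) atTop (𝓝 0)) :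
    Tendsto (fun k => green U (y k)) atTop (𝓝 0) := by
  have hex : ∀ k : ℕ, ∃ (ψ : Eu n → ℝ) (hψ : IsTest U ψ),
      ‖hψ.energy - (solve U (y k) : Energy n)‖ ≤ 1 / (k + 1 : ℝ) := fun k => by
    obtain ⟨ψ, hψ, hlim⟩ := H01.exists_seq (solve U (y k)).2
    obtain ⟨j, hj⟩ := ((tendsto_iff_norm_sub_tendsto_zero.1 hlim).eventually
      (gt_mem_nhds (show (0 : ℝ) < 1 / (k + 1 : ℝ) by positivity))).exists
    exact ⟨ψ j, hψ j, hj.le⟩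
  choose ψ hψ hd using hex
  have h1 : ∀ k : ℕ, (1 : ℝ) / (k + 1) ≤ 1 := fun k => by
    rw [div_le_one (by positivity)]; linarith [(Nat.cast_nonneg k : (0 : ℝ) ≤ k)]
  have hE : ∀ k, ‖(hψ k).energy‖ ≤ 1 + M := fun k => by
    have h2 : ‖(solve U (y k) : Energy n)‖ ≤ M := (norm_solve_le (y k)).trans (hM k)
    have h3 := norm_add_le ((hψ k).energy - (solve U (y k) : Energy n)) (solve U (y k) : Energy n)
    rw [sub_add_cancel] at h3
    linarith [hd k, h1 k]
  have hdiff : ∀ k, ‖(hψ k).toL2 - green U (y k)‖ ≤ 1 / (k + 1 : ℝ) := fun k =>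
    (((hψ k).energy - (solve U (y k) : Energy n)).norm_apply_le none).trans (hd k)
  have hdt : Tendsto (fun k => (hψ k).toL2 - green U (y k)) atTop (𝓝 0) :=
    squeeze_zero_norm hdiff tendsto_one_div_add_atTop_nhds_zero_nat
  have hw : ∀ v : L2 n, Tendsto (fun k => ⟪(hψ k).toL2, v⟫) atTop (𝓝 0) := fun v => by
    have h2 := (hdt.inner (tendsto_const_nhds (x := v))).add (hy (green U v))
    rw [inner_zero_left, add_zero] at h2
    refine h2.congr fun k => ?_
    rw [← inner_green_symm, inner_sub_left, sub_add_cancel]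
  have h3 := (tendsto_toL2_of_weak hb hψ hE hw).sub hdt
  simpa using h3

theorem exists_weak_subseq {x : ℕ → L2 n} {M : ℝ} (hM : ∀ k, ‖x k‖ ≤ M) :
    ∃ (v : L2 n) (φ : ℕ → ℕ), ‖v‖ ≤ M ∧ StrictMono φ ∧
      ∀ w : L2 n, Tendsto (fun k => ⟪x (φ k), w⟫) atTop (𝓝 ⟪v, w⟫) := by
  have : Fact ((1 : ENNReal) ≤ 2) := ⟨by norm_num⟩
  have : Fact ((2 : ENNReal) ≠ ⊤) := ⟨by norm_num⟩
  have : SecondCountableTopology (L2 n) := inferInstance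
  have hseq := WeakDual.isSeqCompact_closedBall (𝕜 := ℝ) (E := L2 n) 0 M
  obtain ⟨a, ha, φ, hφ, hlim⟩ := @hseq
    (fun k => StrongDual.toWeakDual (InnerProductSpace.toDual ℝ (L2 n) (x k)))
    (fun k => by simpa using hM k)
  refine ⟨(InnerProductSpace.toDual ℝ (L2 n)).symm (WeakDual.toStrongDual a), φ, ?_, hφ,
    fun w => ?_⟩
  · rw [LinearIsometryEquiv.norm_map]
    simpa using ha
  · have := ((WeakDual.eval_continuous w).tendsto a).comp hlim
    simpa [Function.comp_def] using this

theorem exists_green_subseq {U : Set (Eu n)} (hb : Bornology.IsBounded U) {x : ℕ → L2 n} {M : ℝ}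
    (hM : ∀ k, ‖x k‖ ≤ M) :
    ∃ (v : L2 n) (φ : ℕ → ℕ), ‖v‖ ≤ M ∧ StrictMono φ ∧
      (∀ w : L2 n, Tendsto (fun k => ⟪x (φ k), w⟫) atTop (𝓝 ⟪v, w⟫)) ∧
      Tendsto (fun k => green U (x (φ k))) atTop (𝓝 (green U v)) := by
  obtain ⟨v, φ, hv, hφ, hw⟩ := exists_weak_subseq hM
  refine ⟨v, φ, hv, hφ, hw, ?_⟩
  have h := green_tendsto_zero hb (y := fun k => x (φ k) - v) (M := M + M)
    (fun k => (norm_sub_le _ _).trans (add_le_add (hM _) hv)) fun w => by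
      simpa [inner_sub_left] using (hw w).sub_const ⟪v, w⟫
  simp only [map_sub] at h
  simpa using h.add_const (green U v)

/-- The quadratic form of a rank one perturbation of the Green operator. -/
def pertForm (U : Set (Eu n)) (h : L2 n) (s : ℝ) (x : L2 n) : ℝ :=
  ⟪green U x, x⟫ - s * ⟪h, x⟫ ^ 2

theorem pertForm_smul (U : Set (Eu n)) (h : L2 n) (s t : ℝ) (x : L2 n) :
    pertForm U h s (t • x) = t ^ 2 * pertForm U h s x := by
  simp only [pertForm, map_smul, inner_smul_left, inner_smul_right, RCLike.conj_to_real]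
  ring

theorem pertForm_add_smul (U : Set (Eu n)) (h : L2 n) (s t : ℝ) (x y : L2 n) :
    pertForm U h s (x + t • y) = pertForm U h s x +
      2 * t * ⟪green U x - (s * ⟪h, x⟫) • h, y⟫ + t ^ 2 * pertForm U h s y := by
  have e : ⟪green U y, x⟫ = ⟪green U x, y⟫ := by rw [inner_green_symm, real_inner_comm]
  simp only [pertForm, map_add, map_smul, inner_smul_left, inner_smul_right, inner_add_left,
    inner_add_right, inner_sub_left, RCLike.conj_to_real, e]
  ring

theorem pertForm_le {U : Set (Eu n)} {h : L2 n} {s : ℝ} (hs : 0 ≤ s) (x : L2 n) :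
    pertForm U h s x ≤ pertForm U h 0 x := by
  simp only [pertForm]
  nlinarith [mul_nonneg hs (sq_nonneg ⟪h, x⟫)]

theorem pertForm_le_norm {U : Set (Eu n)} {h : L2 n} {s : ℝ} (hs : 0 ≤ s) (x : L2 n) :
    pertForm U h s x ≤ ‖x‖ ^ 2 := by
  refine (pertForm_le hs x).trans ?_
  rw [pertForm, zero_mul, sub_zero, sq]
  exact (real_inner_le_norm _ _).trans
    (mul_le_mul_of_nonneg_right (norm_green_le x) (norm_nonneg _))

theorem eigen_of_pertForm_max {U : Set (Eu n)} {h v : L2 n} {s κ : ℝ}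
    (hmax : ∀ x, pertForm U h s x ≤ κ * ‖x‖ ^ 2) (hv : pertForm U h s v = κ * ‖v‖ ^ 2) :
    green U v - (s * ⟪h, v⟫) • h = κ • v := by
  set d := green U v - (s * ⟪h, v⟫) • h - κ • v with hd
  have key : ∀ t : ℝ, 2 * t * ‖d‖ ^ 2 ≤ t ^ 2 * (κ * ‖d‖ ^ 2 - pertForm U h s d) := by
    intro t
    have h1 := hmax (v + t • d)
    rw [pertForm_add_smul, hv, norm_add_sq_real, norm_smul, inner_smul_right, mul_pow,
      Real.norm_eq_abs, sq_abs] at h1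
    have h2 : ⟪green U v - (s * ⟪h, v⟫) • h, d⟫ = ‖d‖ ^ 2 + κ * ⟪v, d⟫ := by
      have : green U v - (s * ⟪h, v⟫) • h = d + κ • v := by rw [hd]; abel
      rw [this, inner_add_left, real_inner_smul_left, real_inner_self_eq_norm_sq]
    rw [h2] at h1
    nlinarith
  have hd0 : ‖d‖ ^ 2 ≤ 0 := by
    by_contra! hpos
    set A := κ * ‖d‖ ^ 2 - pertForm U h s d
    have hA : 0 ≤ A := by have := key 1; nlinarith
    have h1 := key (‖d‖ ^ 2 / (A + 1))
    have h2 : 2 * (‖d‖ ^ 2 / (A + 1)) * ‖d‖ ^ 2 = 2 * (A + 1) * (‖d‖ ^ 2 / (A + 1)) ^ 2 := by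
      field_simp
    rw [h2] at h1
    have h3 : 0 < (‖d‖ ^ 2 / (A + 1)) ^ 2 := by positivity
    nlinarith
  have : d = 0 := by
    rw [← norm_eq_zero]
    exact pow_eq_zero_iff (two_ne_zero) |>.1 (le_antisymm hd0 (sq_nonneg _))
  rwa [hd, sub_eq_zero] at this

theorem exists_pertForm_max {U : Set (Eu n)} (hb : Bornology.IsBounded U) (h : L2 n) {s : ℝ}
    (hs : 0 ≤ s) {x₀ : L2 n} (h₀ : 0 < pertForm U h s x₀) :
    ∃ (κ : ℝ) (v : L2 n), 0 < κ ∧ ‖v‖ = 1 ∧ pertForm U h s v = κ ∧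
      ∀ x, pertForm U h s x ≤ κ * ‖x‖ ^ 2 := by
  set S := pertForm U h s '' Metric.closedBall 0 1
  have hbdd : BddAbove S := ⟨1, by
    rintro _ ⟨x, hx, rfl⟩
    rw [mem_closedBall_zero_iff] at hx
    exact (pertForm_le_norm hs x).trans (pow_le_one₀ (norm_nonneg _) hx)⟩
  have hscale : ∀ x, pertForm U h s x ≤ sSup S * ‖x‖ ^ 2 := by
    intro x
    rcases eq_or_ne x 0 with rfl | hx
    · simp [pertForm]
    have hx' : 0 < ‖x‖ := norm_pos_iff.2 hx
    have h1 : pertForm U h s (‖x‖⁻¹ • x) ≤ sSup S :=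
      le_csSup hbdd ⟨_, by simp [norm_smul, hx'.ne'], rfl⟩
    rw [pertForm_smul] at h1
    calc pertForm U h s x = (‖x‖⁻¹ ^ 2 * pertForm U h s x) * ‖x‖ ^ 2 := by field_simp
      _ ≤ _ := by gcongr
  have hpos : 0 < sSup S := by
    by_contra! hneg
    have := hscale x₀
    nlinarith [sq_nonneg ‖x₀‖]
  obtain ⟨u, -, hu, hmem⟩ := exists_seq_tendsto_sSup
    (show S.Nonempty from ⟨_, 0, by simp, rfl⟩) hbdd
  choose x hx hxu using hmem
  obtain ⟨v, φ, hv, hφ, hw, hg⟩ := exists_green_subseq hb (x := x) (M := 1)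
    fun k => by simpa using hx k
  have hlim : Tendsto (fun k => pertForm U h s (x (φ k))) atTop (𝓝 (pertForm U h s v)) := by
    refine Tendsto.sub ?_ ((Tendsto.pow ?_ 2).const_mul s)
    · have h1 : Tendsto (fun k => ⟪green U (x (φ k)) - green U v, x (φ k)⟫) atTop (𝓝 0) := by
        refine squeeze_zero_norm (a := fun k => ‖green U (x (φ k)) - green U v‖) (fun k => ?_)
          (tendsto_iff_norm_sub_tendsto_zero.1 hg)
        refine (norm_inner_le_norm _ _).trans (mul_le_of_le_one_right (norm_nonneg _) ?_)
        simpa using hx (φ k)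
      have h2 := h1.add (hw (green U v))
      rw [zero_add, real_inner_comm] at h2
      refine h2.congr fun k => ?_
      rw [inner_sub_left, real_inner_comm (green U v) (x (φ k)), sub_add_cancel]
    · simpa only [real_inner_comm] using hw h
  have hval : pertForm U h s v = sSup S :=
    tendsto_nhds_unique hlim (by
      simpa only [hxu, Function.comp_def] using hu.comp hφ.tendsto_atTop)
  have h1 : 1 ≤ ‖v‖ ^ 2 := by
    have := hscale v
    rw [hval] at this
    nlinarith
  have hv1 : ‖v‖ = 1 := by nlinarith [norm_nonneg v]
  exact ⟨sSup S, v, hpos, hv1, hval, hscale⟩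

theorem exists_green_pos {U : Set (Eu n)} (hU : IsOpen U) (hne : U.Nonempty) (h : L2 n) :
    ∃ x : L2 n, 0 < pertForm U h 0 x := by
  obtain ⟨p, hp⟩ := hne
  obtain ⟨χ, hχ, -, -, V, -, hpV, -, hV⟩ := exists_cutoff (isCompact_singleton (x := p)) hU
    (singleton_subset_iff.2 hp)
  refine ⟨hχ.toL2, ?_⟩
  rw [pertForm, zero_mul, sub_zero, inner_green, real_inner_self_eq_norm_sq]
  have h1 : solve U hχ.toL2 ≠ 0 := by
    intro h0
    have h2 := inner_solve hχ.toL2 (⟨hχ.energy, hχ.energy_mem⟩ : H01 U)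
    rw [h0, inner_zero_left] at h2
    have h3 : hχ.toL2 = 0 := (inner_self_eq_zero (𝕜 := ℝ)).1 h2.symm
    have h4 : χ =ᵐ[volume] fun _ => 0 := by
      filter_upwards [hχ.coeFn_toL2, Lp.coeFn_zero ℝ 2 (volume : Measure (Eu n))] with x e1 e2
      rw [← e1, h3, e2]; rfl
    have h5 := (hχ.contDiff.continuous.ae_eq_iff_eq volume continuous_const).1 h4
    have h6 := hV p (hpV rfl)
    rw [congrFun h5 p] at h6
    exact zero_ne_one h6
  have := norm_pos_iff.2 h1
  positivity

theorem integral_laplacian_eq_zero {U : Set (Eu n)} {ψ : Eu n → ℝ} (h : IsTest U ψ) :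
    ∫ x, laplacian ψ x = 0 := by
  have := integral_mul_laplacian (f := fun _ => (1 : ℝ)) contDiff_const h.contDiff
    h.hasCompactSupport
  simpa [pd] using this

theorem L2.integrable_mul_isTest {U : Set (Eu n)} {ψ : Eu n → ℝ} (h : IsTest U ψ) (u : L2 n) :
    Integrable fun x => u x * ψ x := by
  refine (L2.integrable_mul u h.toL2).congr ?_
  filter_upwards [h.coeFn_toL2] with x hx
  rw [hx]

/-- Weyl's lemma for eigenfunctions of the Green operator, possibly with a constant source. -/
theorem exists_helm_of_green_eq {U : Set (Eu n)} (hU : IsOpen U) {w c : L2 n} {κ s a : ℝ}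
    (hκ : 0 < κ) (hκ1 : κ ≤ 1) (hc : ∀ᵐ x, x ∈ U → c x = s) (ha : (1 - κ) * a = s)
    (h : green U (w - c) = κ • w) :
    ∃ f : Eu n → ℝ, Helm (1 / κ - 1) U f ∧ ∀ᵐ x, x ∈ U → w x = f x + a := by
  have hμ : 0 ≤ 1 / κ - 1 := by rw [sub_nonneg, le_div_iff₀ hκ]; linarith
  have hw : WeakHelm (1 / κ - 1) U fun x => w x - a := by
    intro ψ hψ
    have h1 := green_weakSol (U := U) (w - c) ψ hψ
    rw [h] at h1
    have iw := L2.integrable_mul_isTest hψ w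
    have iΔ := L2.integrable_mul_isTest hψ.laplacian w
    have iψ := hψ.integrable
    have jΔ := hψ.laplacian.integrable
    have e1 : ∫ x, (κ • w : L2 n) x * (laplacian ψ x + -1 * ψ x) =
        κ * (∫ x, w x * laplacian ψ x) - κ * ∫ x, w x * ψ x := by
      rw [← integral_const_mul, ← integral_const_mul,
        ← integral_sub (iΔ.const_mul _) (iw.const_mul _)]
      refine integral_congr_ae ?_
      filter_upwards [Lp.coeFn_smul κ w] with x hx
      rw [hx, Pi.smul_apply, smul_eq_mul]; ring
    have e2 : ∫ x, -((w - c : L2 n) x) * ψ x = s * (∫ x, ψ x) - ∫ x, w x * ψ x := by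
      rw [← integral_const_mul, ← integral_sub (iψ.const_mul _) iw]
      refine integral_congr_ae ?_
      filter_upwards [Lp.coeFn_sub w c, hc] with x hx hcx
      rw [hx, Pi.sub_apply]
      by_cases hxU : x ∈ U
      · rw [hcx hxU]; ring
      · rw [image_eq_zero_of_notMem_tsupport fun h' => hxU (hψ.tsupport_subset h')]; simp
    rw [e1, e2] at h1
    have e3 : ∫ x, (w x - a) * (laplacian ψ x + (1 / κ - 1) * ψ x) =
        (∫ x, w x * laplacian ψ x) + (1 / κ - 1) * (∫ x, w x * ψ x) -
          (a * (∫ x, laplacian ψ x) + a * (1 / κ - 1) * ∫ x, ψ x) := by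
      rw [← integral_const_mul, ← integral_const_mul, ← integral_const_mul]
      have i1 : Integrable fun x => w x * laplacian ψ x + (1 / κ - 1) * (w x * ψ x) :=
        iΔ.add (iw.const_mul _)
      have i2 : Integrable fun x => a * laplacian ψ x + a * (1 / κ - 1) * ψ x :=
        (jΔ.const_mul _).add (iψ.const_mul _)
      rw [← integral_add iΔ (iw.const_mul _), ← integral_add (jΔ.const_mul _) (iψ.const_mul _),
        ← integral_sub i1 i2]
      exact integral_congr_ae (ae_of_all _ fun x => by simp only; ring)
    rw [e3, integral_laplacian_eq_zero hψ]
    have e4 : κ * (1 / κ - 1) = 1 - κ := by field_simp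
    have e5 : κ * ((∫ x, w x * laplacian ψ x) + (1 / κ - 1) * (∫ x, w x * ψ x) -
        (a * 0 + a * (1 / κ - 1) * ∫ x, ψ x)) = 0 := by
      subst ha
      linear_combination h1 + ((∫ x, w x * ψ x) - a * ∫ x, ψ x) * e4
    rw [(mul_eq_zero.1 e5).resolve_left hκ.ne']
    simp
  obtain ⟨v, hv, hv0, -, hvw⟩ := hw.exists_contDiffOn hμ hU
    ((L2.locallyIntegrable w).sub (locallyIntegrable_const a))
  exact ⟨v, ⟨hU, hμ, hv, hv0⟩, hvw.mono fun x hx hxU => by linarith [hx hxU]⟩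

theorem L2.inner_nonneg {u v : L2 n} (hu : ∀ᵐ x, 0 ≤ u x) (hv : ∀ᵐ x, 0 ≤ v x) : 0 ≤ ⟪u, v⟫ := by
  rw [L2.inner_eq]
  refine integral_nonneg_of_ae ?_
  filter_upwards [hu, hv] with x h1 h2 using mul_nonneg h1 h2

theorem L2.inner_mono {u u' v v' : L2 n} (hu : ∀ᵐ x, |u x| ≤ u' x) (hv : ∀ᵐ x, |v x| ≤ v' x) :
    ⟪u, v⟫ ≤ ⟪u', v'⟫ := by
  rw [L2.inner_eq, L2.inner_eq]
  refine integral_mono_ae (L2.integrable_mul _ _) (L2.integrable_mul _ _) ?_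
  filter_upwards [hu, hv] with x h1 h2
  calc u x * v x ≤ |u x * v x| := le_abs_self _
    _ = |u x| * |v x| := abs_mul _ _
    _ ≤ u' x * v' x := mul_le_mul h1 h2 (abs_nonneg _) ((abs_nonneg _).trans h1)

theorem L2.coeFn_abs (u : L2 n) : ∀ᵐ x, (|u| : L2 n) x = |u x| := Lp.coeFn_abs u

/-- The absolute value of a top eigenvector is a top eigenvector. -/
theorem green_abs_eq {U : Set (Eu n)} {v : L2 n} {g : ℝ}
    (hmax : ∀ x, pertForm U 0 0 x ≤ g * ‖x‖ ^ 2) (hv : pertForm U 0 0 v = g * ‖v‖ ^ 2) :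
    green U |v| = g • |v| := by
  have hG : ∀ᵐ x, |green U v x| ≤ green U |v| x := by
    have h1 := green_mono (U := U) (g := v) (h := |v|)
      ((L2.coeFn_abs v).mono fun x hx _ => by rw [hx]; exact le_abs_self _)
    have h2 := green_mono (U := U) (g := -v) (h := |v|) (by
      filter_upwards [L2.coeFn_abs v, Lp.coeFn_neg v] with x hx hx' _
      rw [hx, hx']; exact neg_le_abs _)
    rw [map_neg] at h2
    filter_upwards [h1, h2, Lp.coeFn_neg (green U v)] with x h1 h2 h3
    rw [h3] at h2
    exact abs_le'.2 ⟨h1, h2⟩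
  have h1 : pertForm U 0 0 v ≤ pertForm U 0 0 |v| := by
    simp only [pertForm, zero_mul, sub_zero]
    exact L2.inner_mono hG ((L2.coeFn_abs v).mono fun x hx => hx.ge)
  have h2 : pertForm U 0 0 |v| = g * ‖(|v| : L2 n)‖ ^ 2 :=
    le_antisymm (hmax _) (by rw [norm_abs_eq_norm, ← hv]; exact h1)
  simpa using eigen_of_pertForm_max hmax h2

/-- The first eigenfunction does not change sign. -/
theorem exists_pos_of_top_eigen {U : Set (Eu n)} (hU : IsOpen U) (hc : IsPreconnected U)
    {v : L2 n} {g : ℝ} (hg : 0 < g) (hg1 : g ≤ 1)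
    (hmax : ∀ x, pertForm U 0 0 x ≤ g * ‖x‖ ^ 2) (hv : pertForm U 0 0 v = g * ‖v‖ ^ 2)
    (hv0 : v ≠ 0) :
    ∃ (σ : ℝ) (p : Eu n → ℝ), (σ = 1 ∨ σ = -1) ∧ Helm (1 / g - 1) U p ∧ (∀ x ∈ U, 0 < p x) ∧
      ∀ᵐ x, x ∈ U → (σ • v) x = p x := by
  have hgv : green U v = g • v := by simpa using eigen_of_pertForm_max hmax hv
  have hga := green_abs_eq hmax hv
  have hae := green_ae_eq_zero hU.measurableSet v
  -- a nonzero nonnegative eigenvector is positive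
  have key : ∀ w : L2 n, green U w = g • w → (∀ᵐ x, 0 ≤ w x) → w ≠ 0 →
      ∃ p, Helm (1 / g - 1) U p ∧ (∀ x ∈ U, 0 < p x) ∧ ∀ᵐ x, x ∈ U → w x = p x := by
    intro w hw hw0 hne
    obtain ⟨p, hp, hwp⟩ := exists_helm_of_green_eq (c := 0) (s := 0) (a := 0) hU hg hg1
      ((Lp.coeFn_zero ℝ 2 (volume : Measure (Eu n))).mono fun x hx _ => by rw [hx]; rfl)
      (mul_zero _) (by rwa [sub_zero])
    simp only [add_zero] at hwp
    have hp0 : ∀ x ∈ U, 0 ≤ p x := by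
      by_contra! hcon
      obtain ⟨x, hx, hpx⟩ := hcon
      have ho : IsOpen {y ∈ U | p y < 0} := hp.continuousOn.isOpen_inter_preimage hU isOpen_Iio
      have hpos := ho.measure_pos volume ⟨x, hx, hpx⟩
      refine hpos.ne' (measure_mono_null (fun y hy => ?_)
        (ae_iff.1 (hwp.and hw0)))
      intro h
      have h2 : p y < 0 := hy.2
      linarith [h.1 hy.1, h.2]
    refine ⟨p, hp, fun x hx => lt_of_le_of_ne (hp0 x hx) fun h0 => hne ?_, hwp⟩
    have hz := hp.eq_zero_of_nonneg hc hp0 hx h0.symm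
    have hz' := green_ae_eq_zero hU.measurableSet w
    rw [hw] at hz'
    refine Lp.ext ?_
    filter_upwards [hwp, hz', Lp.coeFn_smul g w,
      Lp.coeFn_zero ℝ 2 (volume : Measure (Eu n))] with y h1 h2 h3 h4
    rw [h4]
    by_cases hy : y ∈ U
    · rw [h1 hy, hz y hy]; rfl
    · have := h2 hy
      rw [h3, Pi.smul_apply, smul_eq_mul] at this
      exact (mul_eq_zero.1 this).resolve_left hg.ne'
  by_cases h0 : |v| + v = 0
  · have e : (-1 : ℝ) • v = |v| := by rw [neg_one_smul]; exact neg_eq_of_add_eq_zero_left h0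
    obtain ⟨p, h1, h2, h3⟩ := key |v| hga
      ((L2.coeFn_abs v).mono fun x hx => by rw [hx]; exact abs_nonneg _)
      (by rwa [Ne, ← norm_eq_zero, norm_abs_eq_norm, norm_eq_zero])
    exact ⟨-1, p, Or.inr rfl, h1, h2, by rwa [e]⟩
  · obtain ⟨p, h1, h2, h3⟩ := key (|v| + v) (by rw [map_add, hga, hgv, smul_add])
      (by
        filter_upwards [L2.coeFn_abs v, Lp.coeFn_add |v| v] with x e1 e2
        rw [e2, Pi.add_apply, e1]
        linarith [neg_le_abs (v x)]) h0
    refine ⟨1, fun x => 1 / 2 * p x, Or.inl rfl, ?_, fun x hx => by linarith [h2 x hx], ?_⟩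
    · refine ⟨hU, h1.nonneg, contDiffOn_const.mul h1.contDiffOn, fun x hx => ?_⟩
      rw [laplacian_const_mul (h1.contDiffOn.contDiffAt_of_isOpen hU hx)]
      linear_combination 1 / 2 * h1.eq_zero x hx
    · filter_upwards [h3, L2.coeFn_abs v, Lp.coeFn_add |v| v] with x e0 e1 e2 hx
      have e3 := e0 hx
      have e4 := h2 x hx
      rw [one_smul]
      rw [← e3, e2, Pi.add_apply, e1] at *
      rcases le_total 0 (v x) with h | h
      · rw [abs_of_nonneg h]; ring
      · rw [abs_of_nonpos h] at e4; linarith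

theorem top_eigen_lt_one [NeZero n] {U : Set (Eu n)} (hU : IsOpen U)
    (hb : Bornology.IsBounded U) {v : L2 n} {g : ℝ} (hg1 : g ≤ 1) (hgv : green U v = g • v)
    (hintg : 0 < ∫ x in U, v x) : g < 1 := by
  refine lt_of_le_of_ne hg1 fun h1 => ?_
  subst h1
  rw [one_smul] at hgv
  set k : Energy n := ((solve U v : H01 U) : Energy n)
  have hk0 : k none = v := hgv
  have hE : ⟪k, k⟫ = ⟪v, v⟫ := by
    have := inner_solve v (solve U v)
    rw [show ((solve U v : H01 U) : Energy n) none = v from hgv] at this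
    exact this
  rw [Energy.inner_eq, hk0, add_eq_left] at hE
  have hi : ∀ i, k (some i) = 0 := fun i => by
    have := (Finset.sum_eq_zero_iff_of_nonneg fun j _ =>
      real_inner_self_nonneg (x := k (some j))).1 hE i (Finset.mem_univ i)
    exact (inner_self_eq_zero (𝕜 := ℝ)).1 this
  obtain ⟨χ, hχ, -, -, V, hVo, hKV, -, hV⟩ := exists_cutoff hb.isCompact_closure isOpen_univ
    (subset_univ _)
  set i₀ : Fin n := 0
  have hx : ContDiff ℝ ∞ fun x : Eu n => x i₀ := contDiff_euclidean.1 contDiff_id i₀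
  have hψ : IsTest univ fun x : Eu n => x i₀ * χ x := hχ.mul_left hx
  have h2 := H01.inner_some (U := U) (k := k) (solve U v).2 hψ i₀
  have h4 : ∀ x ∈ U, pd i₀ (fun x : Eu n => x i₀ * χ x) x = 1 := by
    intro x hx
    have : (fun x : Eu n => x i₀ * χ x) =ᶠ[𝓝 x] fun x => x i₀ := by
      filter_upwards [hVo.mem_nhds (hKV (subset_closure hx))] with y hy
      rw [hV y hy, mul_one]
    rw [(this.pd i₀).eq_of_nhds]
    simp only [pd]
    have e : (fun y : Eu n => y i₀) = EuclideanSpace.proj (𝕜 := ℝ) i₀ := rfl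
    rw [e, ContinuousLinearMap.fderiv]
    simp
  have h5 : ⟪v, (hψ.pd i₀).toL2⟫ = ∫ x in U, v x := by
    rw [(hψ.pd i₀).inner_toL2, ← integral_indicator hU.measurableSet]
    refine integral_congr_ae ?_
    have hz := green_ae_eq_zero hU.measurableSet v
    rw [hgv] at hz
    filter_upwards [hz] with x hx
    by_cases hxU : x ∈ U
    · rw [indicator_of_mem hxU, h4 x hxU, mul_one]
    · rw [indicator_of_notMem hxU, hx hxU, zero_mul]
  rw [hi, inner_zero_left, hk0, h5] at h2
  linarith

/-- The indicator function of a bounded measurable set. -/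
def oneL2 {Ω : Set (Eu n)} (hm : MeasurableSet Ω) (hb : Bornology.IsBounded Ω) : L2 n :=
  cutL2 hm hb (continuous_const (y := (1 : ℝ)))

theorem coeFn_oneL2 {Ω : Set (Eu n)} (hm : MeasurableSet Ω) (hb : Bornology.IsBounded Ω) :
    oneL2 hm hb =ᵐ[volume] Ω.indicator fun _ => (1 : ℝ) := coeFn_cutL2 hm hb _

theorem inner_oneL2 {Ω : Set (Eu n)} (hm : MeasurableSet Ω) (hb : Bornology.IsBounded Ω)
    (u : L2 n) : ⟪oneL2 hm hb, u⟫ = ∫ x in Ω, u x := by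
  rw [L2.inner_eq, ← integral_indicator hm]
  refine integral_congr_ae ((coeFn_oneL2 hm hb).mono fun x hx => ?_)
  simp only
  rw [hx]
  by_cases h : x ∈ Ω <;> simp [h]

theorem inner_oneL2_pos {Ω : Set (Eu n)} (hm : MeasurableSet Ω) (hb : Bornology.IsBounded Ω)
    {u : L2 n} (h0 : ∀ᵐ x, x ∈ Ω → 0 ≤ u x) (hz : ∀ᵐ x, x ∉ Ω → u x = 0) (hu : u ≠ 0) :
    0 < ⟪oneL2 hm hb, u⟫ := by
  have hprod : ∀ᵐ x, (0 : Eu n → ℝ) x ≤ oneL2 hm hb x * u x := by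
    filter_upwards [coeFn_oneL2 hm hb, h0] with x e h1
    rw [e]
    by_cases h : x ∈ Ω
    · simpa [h] using h1 h
    · simp [h]
  rw [L2.inner_eq]
  refine lt_of_le_of_ne (integral_nonneg_of_ae hprod) fun h => hu ?_
  have h2 := (integral_eq_zero_iff_of_nonneg_ae hprod (L2.integrable_mul _ _)).1 h.symm
  refine Lp.ext ?_
  filter_upwards [h2, hz, coeFn_oneL2 hm hb,
    Lp.coeFn_zero ℝ 2 (volume : Measure (Eu n))] with x h3 h4 e e0
  rw [e0, Pi.zero_apply]
  by_cases h : x ∈ Ω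
  · rw [e] at h3; simpa [h] using h3
  · exact h4 h

theorem pertForm_zero (U : Set (Eu n)) (h : L2 n) (x : L2 n) :
    pertForm U h 0 x = pertForm U 0 0 x := by simp [pertForm]

/-- Solutions of `κ w = G (w - s)` with `s → 0`, converging to the first eigenfunction. -/
theorem exists_near_resonant [NeZero n] {Ω : Set (Eu n)} (hU : IsOpen Ω)
    (hb : Bornology.IsBounded Ω) (hc : IsPreconnected Ω) (hne : Ω.Nonempty) :
    ∃ (g : ℝ) (p : Eu n → ℝ) (φ : L2 n) (w : ℕ → L2 n) (κ s : ℕ → ℝ), 0 < g ∧ g < 1 ∧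
      Helm (1 / g - 1) Ω p ∧ (∀ x ∈ Ω, 0 < p x) ∧ (∀ᵐ x, x ∈ Ω → φ x = p x) ∧
      Tendsto w atTop (𝓝 φ) ∧ (∀ k, ‖w k‖ = 1) ∧ (∀ k, g / 2 ≤ κ k ∧ κ k ≤ g) ∧
      (∀ k, 0 < s k) ∧ Tendsto s atTop (𝓝 0) ∧
      ∀ k, green Ω (w k - s k • oneL2 hU.measurableSet hb) = κ k • w k := by
  set one := oneL2 hU.measurableSet hb
  set h := green Ω one with hh
  obtain ⟨x₀, hx₀⟩ := exists_green_pos hU hne h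
  obtain ⟨g, v₀, hg, hv₀, hgv, hgmax⟩ := exists_pertForm_max hb h le_rfl hx₀
  have hg1 : g ≤ 1 := by
    have := pertForm_le_norm (U := Ω) (h := h) le_rfl v₀
    rwa [hgv, hv₀, one_pow] at this
  set s₀ : ℝ := g / (2 * (‖h‖ ^ 2 + 1))
  have hs₀ : 0 < s₀ := by positivity
  set t : ℕ → ℝ := fun k => s₀ * (1 / (k + 1 : ℝ)) with ht
  have ht0 : ∀ k, 0 < t k := fun k => by positivity
  have ht1 : ∀ k, t k ≤ s₀ := fun k => mul_le_of_le_one_right hs₀.le (by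
    rw [div_le_one (by positivity)]; linarith [(Nat.cast_nonneg k : (0 : ℝ) ≤ k)])
  have htl : Tendsto t atTop (𝓝 0) := by
    have := (tendsto_one_div_add_atTop_nhds_zero_nat (𝕜 := ℝ)).const_mul s₀
    rwa [mul_zero] at this
  have hin : ⟪h, v₀⟫ ^ 2 ≤ ‖h‖ ^ 2 := by
    rw [← sq_abs]
    refine pow_le_pow_left₀ (abs_nonneg _) ((abs_real_inner_le_norm _ _).trans ?_) 2
    rw [hv₀, mul_one]
  have hlow : ∀ k, pertForm Ω h (t k) v₀ = g - t k * ⟪h, v₀⟫ ^ 2 := fun k => by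
    rw [← hgv]; simp [pertForm]
  have hhalf : ∀ k, g / 2 ≤ pertForm Ω h (t k) v₀ := fun k => by
    rw [hlow]
    have h1 : t k * ⟪h, v₀⟫ ^ 2 ≤ s₀ * (‖h‖ ^ 2 + 1) :=
      mul_le_mul (ht1 k) (by linarith) (sq_nonneg _) hs₀.le
    have h2 : s₀ * (‖h‖ ^ 2 + 1) = g / 2 := by
      simp only [s₀]; field_simp
    linarith
  choose κ v hκ hv hval hmax using fun k =>
    exists_pertForm_max hb h (ht0 k).le (x₀ := v₀) ((half_pos hg).trans_le (hhalf k))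
  have hκl : ∀ k, pertForm Ω h (t k) v₀ ≤ κ k := fun k => by simpa [hv₀] using hmax k v₀
  have hκg : ∀ k, κ k ≤ g := fun k => by
    rw [← hval]
    refine (pertForm_le (ht0 k).le (v k)).trans ?_
    rw [pertForm_zero, ← pertForm_zero Ω h]
    simpa [hv] using hgmax (v k)
  have hκt : Tendsto κ atTop (𝓝 g) := by
    refine tendsto_of_tendsto_of_tendsto_of_le_of_le (g := fun k => g - t k * ⟪h, v₀⟫ ^ 2) ?_
      tendsto_const_nhds (fun k => by simpa only [hlow] using hκl k) hκg
    simpa using (htl.mul_const (⟪h, v₀⟫ ^ 2)).const_sub g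
  have heig : ∀ k, green Ω (v k) - (t k * ⟪h, v k⟫) • h = κ k • v k := fun k =>
    eigen_of_pertForm_max (hmax k) (by rw [hval, hv]; ring)
  obtain ⟨u, σ, -, hσ, hweak, hgreen⟩ := exists_green_subseq hb (x := v) (M := 1) fun k => (hv k).le
  have hσt := hσ.tendsto_atTop
  have hstrong : Tendsto (fun k => v (σ k)) atTop (𝓝 (g⁻¹ • green Ω u)) := by
    have h1 : Tendsto (fun k => (t (σ k) * ⟪h, v (σ k)⟫) • h) atTop (𝓝 0) := by
      simpa using ((htl.comp hσt).mul
        ((hweak h).congr fun k => real_inner_comm _ _)).smul_const h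
    have h2 := (((hκt.comp hσt).inv₀ hg.ne')).smul (hgreen.sub h1)
    rw [sub_zero] at h2
    refine h2.congr fun k => ?_
    simp only [Function.comp_apply]
    rw [heig, inv_smul_smul₀ (hκ _).ne']
  have hu : g⁻¹ • green Ω u = u := ext_inner_right ℝ fun y =>
    tendsto_nhds_unique (hstrong.inner tendsto_const_nhds) (hweak y)
  rw [hu] at hstrong
  have hu1 : ‖u‖ = 1 := tendsto_nhds_unique hstrong.norm (by simp [hv])
  have hgu : green Ω u = g • u := by
    nth_rw 2 [← hu]; rw [smul_inv_smul₀ hg.ne']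
  have hmax0 : ∀ x, pertForm Ω 0 0 x ≤ g * ‖x‖ ^ 2 := fun x => by
    rw [← pertForm_zero Ω h]; exact hgmax x
  have hQu : pertForm Ω 0 0 u = g * ‖u‖ ^ 2 := by
    rw [pertForm, hgu, zero_mul, sub_zero, real_inner_smul_left, real_inner_self_eq_norm_sq]
  have hu0 : u ≠ 0 := by
    rintro rfl; simp at hu1
  obtain ⟨τ, p, hτ, hp, hp0, hup⟩ := exists_pos_of_top_eigen hU hc hg hg1 hmax0 hQu hu0
  have hτ0 : τ ≠ 0 := by rcases hτ with rfl | rfl <;> norm_num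
  have hτ1 : ‖τ‖ = 1 := by rcases hτ with rfl | rfl <;> norm_num
  have hgτ : green Ω (τ • u) = g • (τ • u) := by rw [map_smul, hgu, smul_comm]
  have hz : ∀ᵐ x, x ∉ Ω → (τ • u : L2 n) x = 0 := by
    have h1 := green_ae_eq_zero hU.measurableSet (τ • u)
    rw [hgτ] at h1
    filter_upwards [h1, Lp.coeFn_smul g (τ • u)] with x h2 h3 hx
    have := h2 hx
    rw [h3, Pi.smul_apply, smul_eq_mul] at this
    exact (mul_eq_zero.1 this).resolve_left hg.ne'
  have hpos : 0 < ⟪one, τ • u⟫ := inner_oneL2_pos _ _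
    (hup.mono fun x h1 hx => by rw [h1 hx]; exact (hp0 x hx).le) hz (smul_ne_zero hτ0 hu0)
  have hg1' : g < 1 := top_eigen_lt_one hU hb hg1 hgτ (by rwa [← inner_oneL2 hU.measurableSet hb])
  have hposh : 0 < ⟪h, τ • u⟫ := by
    rw [hh, inner_green_symm, hgτ, real_inner_smul_right]; positivity
  have hwlim : Tendsto (fun k => τ • v (σ k)) atTop (𝓝 (τ • u)) := hstrong.const_smul τ
  have hinl : Tendsto (fun k => ⟪h, τ • v (σ k)⟫) atTop (𝓝 ⟪h, τ • u⟫) :=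
    tendsto_const_nhds.inner hwlim
  obtain ⟨N, hN⟩ := eventually_atTop.1 (hinl.eventually (lt_mem_nhds hposh))
  refine ⟨g, p, τ • u, fun k => τ • v (σ (k + N)), fun k => κ (σ (k + N)),
    fun k => t (σ (k + N)) * ⟪h, τ • v (σ (k + N))⟫, hg, hg1', hp, hp0, hup,
    hwlim.comp (tendsto_add_atTop_nat N), fun k => by rw [norm_smul, hτ1, hv, one_mul],
    fun k => ⟨(hhalf _).trans (hκl _), hκg _⟩, fun k => mul_pos (ht0 _) (hN _ (by simp)), ?_, ?_⟩
  · have := ((htl.comp hσt).mul hinl).comp (tendsto_add_atTop_nat N)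
    rw [zero_mul] at this
    exact this
  · intro k
    beta_reduce
    rw [map_sub, map_smul, map_smul, ← hh, smul_comm (κ _), ← heig, smul_sub, smul_smul,
      real_inner_smul_right]
    congr 2
    ring

/-- A regular defining function of a bounded domain, equal to `-1` far away. -/
structure DefFn (F : Eu n → ℝ) : Prop where
  isTest : IsTest univ fun x => F x + 1
  regular : ∀ x, F x = 0 → fderiv ℝ F x ≠ 0

namespace DefFn
variable {F : Eu n → ℝ}

theorem contDiff (hF : DefFn F) : ContDiff ℝ ∞ F := by
  simpa using hF.isTest.contDiff.sub (contDiff_const (c := (1 : ℝ)))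

theorem isCompact (hF : DefFn F) (t : ℝ) (ht : -1 < t) : IsCompact {x | t ≤ F x} :=
  hF.isTest.hasCompactSupport.of_isClosed_subset (isClosed_le continuous_const hF.contDiff.continuous)
    fun x hx => subset_tsupport _ (by
      have : t ≤ F x := hx
      simp only [Function.mem_support]; linarith)

theorem isOpen (hF : DefFn F) : IsOpen {x | 0 < F x} :=
  isOpen_lt continuous_const hF.contDiff.continuous

theorem isBounded (hF : DefFn F) : Bornology.IsBounded {x | 0 < F x} :=
  (hF.isCompact 0 (by norm_num)).isBounded.subset fun x (hx : 0 < F x) =>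
    show 0 ≤ F x from hx.le

theorem exists_shell (hF : DefFn F) :
    ∃ m > 0, ∀ x, 0 ≤ F x → F x ≤ m → m ≤ ∑ i, pd i F x ^ 2 := by
  have hcont : Continuous fun x => F x + ∑ i, pd i F x ^ 2 :=
    hF.contDiff.continuous.add
      (continuous_finsetSum _ fun i _ => (hF.contDiff.pd i).continuous.pow 2)
  rcases ({x | 0 ≤ F x} : Set (Eu n)).eq_empty_or_nonempty with he | hne
  · exact ⟨1, one_pos, fun x hx _ => absurd (show x ∈ {x | 0 ≤ F x} from hx) (by simp [he])⟩
  obtain ⟨x₀, hx₀, hmin⟩ := (hF.isCompact 0 (by norm_num)).exists_isMinOn hne hcont.continuousOn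
  have hx₀' : 0 ≤ F x₀ := hx₀
  have hs : ∀ x, 0 ≤ ∑ i, pd i F x ^ 2 := fun x => Finset.sum_nonneg fun i _ => sq_nonneg _
  have hpos : 0 < F x₀ + ∑ i, pd i F x₀ ^ 2 := by
    rcases hx₀'.eq_or_lt with h | h
    · refine lt_of_le_of_ne (add_nonneg hx₀' (hs _)) fun h0 => hF.regular x₀ h.symm ?_
      rw [← h, zero_add, eq_comm, Finset.sum_eq_zero_iff_of_nonneg fun i _ => sq_nonneg _] at h0
      ext y
      rw [fderiv_eq_sum_pd]
      simp only [zero_apply]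
      exact Finset.sum_eq_zero fun i hi => by rw [pow_eq_zero_iff two_ne_zero |>.1 (h0 i hi), mul_zero]
    · linarith [hs x₀]
  refine ⟨(F x₀ + ∑ i, pd i F x₀ ^ 2) / 2, by positivity, fun x hx hxm => ?_⟩
  have : F x₀ + ∑ i, pd i F x₀ ^ 2 ≤ F x + ∑ i, pd i F x ^ 2 := hmin hx
  linarith

theorem laplacian_exp (hF : DefFn F) (L : ℝ) (x : Eu n) :
    laplacian (fun y => exp (L * F y)) x =
      exp (L * F x) * (L ^ 2 * ∑ i, pd i F x ^ 2 + L * laplacian F x) := by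
  have hd : deriv (fun t : ℝ => exp (L * t)) = fun t => exp (L * t) * L := by
    funext t
    have := ((hasDerivAt_id t).const_mul L).exp
    simpa using this.deriv
  have hd2 : ∀ t, deriv (fun t : ℝ => exp (L * t) * L) t = exp (L * t) * L * L := by
    intro t
    have := (((hasDerivAt_id t).const_mul L).exp).mul_const L
    simpa using this.deriv
  rw [laplacian_comp (β := fun t => exp (L * t))
    (contDiff_exp.comp (contDiff_const.mul contDiff_id)) hF.contDiff.contDiffAt, hd, hd2]
  ring

theorem contDiff_exp_mul (hF : DefFn F) (L : ℝ) : ContDiff ℝ ∞ fun y => exp (L * F y) :=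
  contDiff_exp.comp (contDiff_const.mul hF.contDiff)

theorem laplacian_super (hF : DefFn F) (L : ℝ) (x : Eu n) :
    laplacian (fun y => 1 - exp (-L * F y)) x =
      -(exp (-L * F x) * (L ^ 2 * ∑ i, pd i F x ^ 2 - L * laplacian F x)) := by
  have h := laplacian_add (x := x) (contDiff_const (c := (1 : ℝ))).contDiffAt
    ((contDiff_const (c := (-1 : ℝ))).mul (hF.contDiff_exp_mul (-L))).contDiffAt
  rw [laplacian_const_mul (hF.contDiff_exp_mul (-L)).contDiffAt, laplacian_const,
    hF.laplacian_exp] at h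
  have e : (fun y => 1 - exp (-L * F y)) = fun y => 1 + -1 * exp (-L * F y) := by
    funext y; ring
  rw [e, h]; ring

theorem laplacian_sub (hF : DefFn F) (L : ℝ) (x : Eu n) :
    laplacian (fun y => exp (L * F y) - 1) x =
      exp (L * F x) * (L ^ 2 * ∑ i, pd i F x ^ 2 + L * laplacian F x) := by
  have h := laplacian_add (x := x) (hF.contDiff_exp_mul L).contDiffAt
    (contDiff_const (c := (-1 : ℝ))).contDiffAt
  rw [laplacian_const, hF.laplacian_exp, add_zero] at h
  exact h

theorem exists_barriers (hF : DefFn F) : ∃ L > 0, ∃ b > 0, ∃ m > 0,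
    (∀ x, 0 < F x → 1 / 2 ≤ -laplacian (fun y => 1 - exp (-L * F y)) x + (1 - exp (-L * F x))) ∧
    (∀ x, 0 < F x → F x ≤ m → b ≤ -laplacian (fun y => 1 - exp (-L * F y)) x) ∧
    ∀ x, 0 < F x → F x ≤ m →
      -laplacian (fun y => exp (L * F y) - 1) x + (exp (L * F x) - 1) ≤ 0 := by
  obtain ⟨m, hm, hshell⟩ := hF.exists_shell
  obtain ⟨M, hM⟩ := (hF.isCompact 0 (by norm_num)).exists_bound_of_continuousOn
    hF.contDiff.laplacian.continuous.continuousOn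
  have hM0 : ∀ x, 0 < F x → |laplacian F x| ≤ |M| := fun x hx =>
    (hM x (le_of_lt hx)).trans (le_abs_self M)
  have hmx : Tendsto (fun L : ℝ => m * L) atTop atTop := tendsto_id.const_mul_atTop hm
  have t1 : Tendsto (fun L : ℝ => (m * L) * exp (-(m * L)) * (|M| / m)) atTop (𝓝 0) := by
    have := ((tendsto_pow_mul_exp_neg_atTop_nhds_zero 1).comp hmx).mul_const (|M| / m)
    simpa [Function.comp_def] using this
  have t2 : Tendsto (fun L : ℝ => exp (-(m * L))) atTop (𝓝 0) := by
    exact (tendsto_exp_neg_atTop_nhds_zero).comp hmx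
  obtain ⟨L, h1, h2, h3, h4⟩ := ((t1.eventually (gt_mem_nhds (show (0 : ℝ) < 1 / 4 by norm_num))).and
    ((t2.eventually (gt_mem_nhds (show (0 : ℝ) < 1 / 4 by norm_num))).and
    ((eventually_ge_atTop (1 : ℝ)).and (hmx.eventually_ge_atTop (|M| + 1))))).exists
  have hL : 0 < L := by linarith
  have h1' : L * exp (-(m * L)) * |M| < 1 / 4 := by
    have e : L * exp (-(m * L)) * |M| = m * L * exp (-(m * L)) * (|M| / m) := by
      field_simp
    rw [e]; exact h1
  have key : ∀ x, 0 < F x → F x ≤ m → L ≤ L ^ 2 * ∑ i, pd i F x ^ 2 - L * |laplacian F x| := by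
    intro x hx hxm
    have a1 := hshell x hx.le hxm
    have a2 := hM0 x hx
    have a3 : L * m ≤ L * ∑ i, pd i F x ^ 2 := mul_le_mul_of_nonneg_left a1 hL.le
    nlinarith
  refine ⟨L, hL, exp (-L * m) * L, by positivity, m, hm, fun x hx => ?_, fun x hx hxm => ?_,
    fun x hx hxm => ?_⟩
  · rw [hF.laplacian_super]
    have hE := exp_pos (-L * F x)
    rcases le_or_gt (F x) m with hxm | hxm
    · have := key x hx hxm
      have h5 : L ≤ L ^ 2 * ∑ i, pd i F x ^ 2 - L * laplacian F x := by
        nlinarith [le_abs_self (laplacian F x)]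
      nlinarith [mul_le_mul_of_nonneg_left h5 hE.le]
    · have h5 : exp (-L * F x) ≤ exp (-(m * L)) := exp_le_exp.2 (by nlinarith)
      have h6 : -(L * |M|) ≤ L ^ 2 * ∑ i, pd i F x ^ 2 - L * laplacian F x := by
        have : 0 ≤ L ^ 2 * ∑ i, pd i F x ^ 2 := by positivity
        nlinarith [le_abs_self (laplacian F x), hM0 x hx]
      have h7 : exp (-L * F x) * (L * |M|) ≤ exp (-(m * L)) * (L * |M|) :=
        mul_le_mul_of_nonneg_right h5 (by positivity)
      nlinarith [mul_le_mul_of_nonneg_left h6 hE.le]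
  · rw [hF.laplacian_super, neg_neg]
    have := key x hx hxm
    have h5 : L ≤ L ^ 2 * ∑ i, pd i F x ^ 2 - L * laplacian F x := by
      nlinarith [le_abs_self (laplacian F x)]
    exact mul_le_mul (exp_le_exp.2 (by nlinarith)) h5 hL.le (exp_pos _).le
  · rw [hF.laplacian_sub]
    have := key x hx hxm
    have h5 : 1 ≤ L ^ 2 * ∑ i, pd i F x ^ 2 + L * laplacian F x := by
      nlinarith [neg_abs_le (laplacian F x)]
    nlinarith [mul_le_mul_of_nonneg_left h5 (exp_pos (L * F x)).le]

end DefFn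

theorem green_cutL2_of_eq {Ω : Set (Eu n)} {B : Eu n → ℝ} (hΩ : Ω = {x | 0 < B x})
    (hm : MeasurableSet Ω) (hb : Bornology.IsBounded Ω) (hB : ContDiff ℝ ∞ B)
    (hΘ : Continuous fun x => -laplacian B x + B x) :
    green Ω (cutL2 hm hb hΘ) = cutL2 hm hb hB.continuous := by
  subst hΩ
  exact green_cutL2 hB hm hb hΘ

theorem ContDiff.continuous_helm {B : Eu n → ℝ} (hB : ContDiff ℝ ∞ B) :
    Continuous fun x => -_root_.laplacian B x + B x := hB.laplacian.continuous.neg.add hB.continuous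

namespace DefFn
variable {F : Eu n → ℝ}

/-- The solution of `-Δh + h = 1` is bounded by a multiple of the defining function. -/
theorem exists_green_one_le (hF : DefFn F) : ∃ C > 0, ∀ᵐ x, 0 < F x →
    green {x | 0 < F x} (oneL2 hF.isOpen.measurableSet hF.isBounded) x ≤ C * F x := by
  obtain ⟨L, hL, b, -, m, -, h1, -, -⟩ := hF.exists_barriers
  have hB : ContDiff ℝ ∞ fun y => 1 - exp (-L * F y) :=
    contDiff_const.sub (hF.contDiff_exp_mul (-L))
  have hΩ : {x | 0 < F x} = {x | 0 < 1 - exp (-L * F x)} := by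
    ext x
    simp only [mem_ofPred_eq, sub_pos, exp_lt_one_iff]
    constructor <;> intro h <;> nlinarith
  have hg := green_cutL2_of_eq hΩ hF.isOpen.measurableSet hF.isBounded hB hB.continuous_helm
  have hmono := green_mono (U := {x | 0 < F x})
    (g := oneL2 hF.isOpen.measurableSet hF.isBounded)
    (h := (2 : ℝ) • cutL2 hF.isOpen.measurableSet hF.isBounded hB.continuous_helm) (by
      filter_upwards [coeFn_oneL2 hF.isOpen.measurableSet hF.isBounded,
        coeFn_cutL2 hF.isOpen.measurableSet hF.isBounded hB.continuous_helm,
        Lp.coeFn_smul (2 : ℝ) (cutL2 hF.isOpen.measurableSet hF.isBounded hB.continuous_helm)]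
        with x e1 e2 e3 hx
      replace hx : x ∈ {x | 0 < F x} := hx
      rw [e3, Pi.smul_apply, e1, e2, indicator_of_mem hx, indicator_of_mem hx, smul_eq_mul]
      linarith [h1 x hx])
  rw [map_smul, hg] at hmono
  refine ⟨2 * L, by positivity, ?_⟩
  filter_upwards [hmono, coeFn_cutL2 hF.isOpen.measurableSet hF.isBounded hB.continuous,
    Lp.coeFn_smul (2 : ℝ) (cutL2 hF.isOpen.measurableSet hF.isBounded hB.continuous)]
    with x h e1 e2 hx
  rw [e2, Pi.smul_apply, e1, indicator_of_mem (show x ∈ {x | 0 < F x} from hx), smul_eq_mul] at h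
  linarith [add_one_le_exp (-L * F x)]

theorem measurableSet_core (hF : DefFn F) (δ : ℝ) : MeasurableSet {x | δ < F x} :=
  (isOpen_lt continuous_const hF.contDiff.continuous).measurableSet

theorem isBounded_core (hF : DefFn F) {δ : ℝ} (hδ : 0 < δ) : Bornology.IsBounded {x | δ < F x} :=
  hF.isBounded.subset fun x (hx : δ < F x) => show 0 < F x from hδ.trans hx

/-- The Green potential of an inner core bounds the defining function. -/
theorem exists_le_green_core (hF : DefFn F) : ∃ m > 0, ∀ δ (hδ : 0 < δ), δ ≤ m → ∃ C > 0,
    ∀ᵐ x, 0 < F x →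
      F x ≤ C * green {x | 0 < F x} (oneL2 (hF.measurableSet_core δ) (hF.isBounded_core hδ)) x := by
  obtain ⟨L, hL, b, -, m, hm, -, -, h1⟩ := hF.exists_barriers
  refine ⟨m, hm, fun δ hδ hδm => ?_⟩
  have hB : ContDiff ℝ ∞ fun y => exp (L * F y) - 1 :=
    (hF.contDiff_exp_mul L).sub contDiff_const
  have hΩ : {x | 0 < F x} = {x | 0 < exp (L * F x) - 1} := by
    ext x
    simp only [mem_ofPred_eq, sub_pos, one_lt_exp_iff]
    constructor <;> intro h
    · positivity
    · exact pos_of_mul_pos_right h hL.le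
  have hg := green_cutL2_of_eq hΩ hF.isOpen.measurableSet hF.isBounded hB hB.continuous_helm
  obtain ⟨A, hA⟩ := (hF.isCompact 0 (by norm_num)).exists_bound_of_continuousOn
    hB.continuous_helm.continuousOn
  set core := oneL2 (hF.measurableSet_core δ) (hF.isBounded_core hδ)
  have hmono := green_mono (U := {x | 0 < F x})
    (g := cutL2 hF.isOpen.measurableSet hF.isBounded hB.continuous_helm)
    (h := (|A| + 1) • core) (by
      filter_upwards [coeFn_oneL2 (hF.measurableSet_core δ) (hF.isBounded_core hδ),
        coeFn_cutL2 hF.isOpen.measurableSet hF.isBounded hB.continuous_helm,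
        Lp.coeFn_smul (|A| + 1) core] with x e1 e2 e3 hx
      replace hx : x ∈ {x | 0 < F x} := hx
      rw [e3, Pi.smul_apply, e1, e2, indicator_of_mem hx, smul_eq_mul]
      by_cases hxδ : δ < F x
      · rw [indicator_of_mem (show x ∈ {x | δ < F x} from hxδ), mul_one]
        have := (le_abs_self _).trans (hA x (le_of_lt hx : 0 ≤ F x))
        linarith [le_abs_self A]
      · rw [indicator_of_notMem (show x ∉ {x | δ < F x} from hxδ), mul_zero]
        exact h1 x hx ((not_lt.1 hxδ).trans hδm))
  rw [map_smul, hg] at hmono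
  refine ⟨(|A| + 1) / L, by positivity, ?_⟩
  filter_upwards [hmono, coeFn_cutL2 hF.isOpen.measurableSet hF.isBounded hB.continuous,
    Lp.coeFn_smul (|A| + 1) (green {x | 0 < F x} core)] with x h e1 e2 hx
  rw [e2, Pi.smul_apply, e1, indicator_of_mem (show x ∈ {x | 0 < F x} from hx), smul_eq_mul] at h
  rw [div_mul_eq_mul_div, le_div_iff₀ hL]
  linarith [add_one_le_exp (L * F x)]

end DefFn

/-- A maximum principle for the Green operator in thin shells. -/
theorem green_shell_nonpos {Ω S : Set (Eu n)} (hm : MeasurableSet Ω) (hb : Bornology.IsBounded Ω)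
    (hS : MeasurableSet S) (hSΩ : S ⊆ Ω) {z q : L2 n} {κ t : ℝ} (ht : t < κ)
    (hz : κ • z = green Ω q) (hh : ∀ᵐ x, x ∈ S → green Ω (oneL2 hm hb) x ≤ t)
    (hqS : ∀ᵐ x, x ∈ S → q x ≤ max (z x) 0) (hqc : ∀ᵐ x, x ∈ Ω → x ∉ S → q x ≤ 0) :
    ∀ᵐ x, x ∈ S → z x ≤ 0 := by
  have hmem : MemLp (S.indicator fun x => max (z x) 0) 2 := by
    have : MemLp (fun x => max (z x) 0) 2 := by
      refine (Lp.memLp z).mono ((Lp.aestronglyMeasurable z).sup aestronglyMeasurable_const)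
        (ae_of_all _ fun x => ?_)
      simp only [norm_eq_abs]
      rw [abs_of_nonneg (le_max_right _ _)]
      exact max_le (le_abs_self _) (abs_nonneg _)
    exact this.indicator hS
  set u : L2 n := hmem.toLp _
  have hu : u =ᵐ[volume] S.indicator fun x => max (z x) 0 := hmem.coeFn_toLp
  have hu0 : ∀ᵐ x, 0 ≤ u x := hu.mono fun x hx => by
    rw [hx]; exact indicator_nonneg (fun y _ => le_max_right _ _) x
  have hG0 : ∀ᵐ x, 0 ≤ green Ω u x := green_nonneg (hu0.mono fun _ h _ => h)
  have hGq := green_mono (U := Ω) (g := q) (h := u) (by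
    filter_upwards [hu, hqS, hqc] with x e h1 h2 hx
    rw [e]
    by_cases hxS : x ∈ S
    · simpa [hxS] using h1 hxS
    · simpa [hxS] using h2 hx hxS)
  rw [← hz] at hGq
  have hle : ∀ᵐ x, κ * u x ≤ green Ω u x := by
    filter_upwards [hGq, hG0, hu, Lp.coeFn_smul κ z] with x h1 h2 e1 e2
    rw [e2, Pi.smul_apply, smul_eq_mul] at h1
    rw [e1]
    by_cases hxS : x ∈ S
    · rw [indicator_of_mem hxS]
      rcases le_total (z x) 0 with h | h
      · rw [max_eq_right h, mul_zero]; exact h2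
      · rw [max_eq_left h]; exact h1
    · rw [indicator_of_notMem hxS, mul_zero]; exact h2
  have hone : ∀ᵐ x, 0 ≤ oneL2 hm hb x := (coeFn_oneL2 hm hb).mono fun x hx => by
    rw [hx]; exact indicator_nonneg (fun y _ => zero_le_one) x
  have i1 : 0 ≤ ⟪oneL2 hm hb, green Ω u - κ • u⟫ := L2.inner_nonneg hone (by
    filter_upwards [hle, Lp.coeFn_sub (green Ω u) (κ • u), Lp.coeFn_smul κ u] with x h e1 e2
    rw [e1, Pi.sub_apply, e2, Pi.smul_apply, smul_eq_mul]; linarith)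
  have hGone : ∀ᵐ x, 0 ≤ green Ω (oneL2 hm hb) x := green_nonneg (hone.mono fun _ h _ => h)
  have i2 : ⟪green Ω (oneL2 hm hb), u⟫ ≤ ⟪t • oneL2 hm hb, u⟫ := by
    rw [L2.inner_eq, L2.inner_eq]
    refine integral_mono_ae (L2.integrable_mul _ _) (L2.integrable_mul _ _) ?_
    filter_upwards [hh, hu, coeFn_oneL2 hm hb, Lp.coeFn_smul t (oneL2 hm hb)] with x h e1 e2 e3
    rw [e3, Pi.smul_apply, e2, e1, smul_eq_mul]
    by_cases hxS : x ∈ S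
    · rw [indicator_of_mem hxS, indicator_of_mem (hSΩ hxS), mul_one]
      exact mul_le_mul_of_nonneg_right (h hxS) (le_max_right _ _)
    · simp [hxS]
  rw [inner_sub_right, real_inner_smul_right, ← inner_green_symm] at i1
  rw [real_inner_smul_left] at i2
  have hz0 : u = 0 := by
    by_contra hne
    have := inner_oneL2_pos hm hb (hu0.mono fun _ h _ => h) (hu.mono fun x hx hxΩ => by
      rw [hx, indicator_of_notMem fun h => hxΩ (hSΩ h)]) hne
    nlinarith
  rw [hz0] at hu
  filter_upwards [hu, Lp.coeFn_zero ℝ 2 (volume : Measure (Eu n))] with x e e0 hxS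
  rw [e0, indicator_of_mem hxS] at e
  exact (le_max_left _ _).trans e.symm.le

theorem le_of_ae_le_of_isOpen {U : Set (Eu n)} {f g : Eu n → ℝ} (hU : IsOpen U)
    (hf : ContinuousOn f U) (hg : ContinuousOn g U) (h : ∀ᵐ x, x ∈ U → f x ≤ g x) :
    ∀ x ∈ U, f x ≤ g x := by
  have ho : IsOpen (U ∩ (fun x => f x - g x) ⁻¹' Ioi 0) := (hf.sub hg).isOpen_inter_preimage hU isOpen_Ioi
  have h0 : volume (U ∩ (fun x => f x - g x) ⁻¹' Ioi 0) = 0 := by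
    rw [measure_eq_zero_iff_ae_notMem]
    filter_upwards [h] with x hx hx'
    have h1 := hx hx'.1
    have h2 : 0 < f x - g x := hx'.2
    linarith
  replace h0 := (ho.measure_eq_zero_iff volume).1 h0
  intro x hx
  by_contra hlt
  have : x ∈ U ∩ (fun x => f x - g x) ⁻¹' Ioi 0 := ⟨hx, sub_pos.2 (not_le.1 hlt)⟩
  rw [h0] at this
  exact this

/-- Uniform interior bounds in terms of the `L²` norm. -/
theorem exists_interior_bound (n : ℕ) (M : ℝ) {r : ℝ} (hr : 0 < r) (hr1 : r ≤ 1) :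
    ∃ A > 0, ∀ (μ : ℝ) (Ω : Set (Eu n)) (f : Eu n → ℝ) (w : L2 n) (a : ℝ), Helm μ Ω f → μ ≤ M →
      ‖w‖ = 1 → |a| ≤ 1 → (∀ᵐ x, x ∈ Ω → w x = f x + a) → ∀ x, Metric.closedBall x r ⊆ Ω →
        |f x| ≤ A ∧ ∀ e, |fderiv ℝ f x e| ≤ A * ‖e‖ := by
  obtain ⟨C, hC, hest⟩ := exists_helm_estimate n M
  set V := (volume : Measure (Eu n)).real (Metric.closedBall 0 1)
  have hV : 0 ≤ V := measureReal_nonneg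
  set I : ℝ := 1 + 2 * (r ^ n * V)
  have hI : 0 < I := by positivity
  refine ⟨C / r ^ n * I + C / r ^ (n + 1) * I, by positivity,
    fun μ Ω f w a hf hμ hw ha hwf x hx => ?_⟩
  have hintg : ∫ z in Metric.closedBall x r, |f z| ≤ I := by
    have i1 : IntegrableOn (fun z => |f z|) (Metric.closedBall x r) :=
      ((hf.continuousOn.mono hx).abs).integrableOn_compact (isCompact_closedBall _ _)
    have i2 : IntegrableOn (fun _ => (2 : ℝ)) (Metric.closedBall x r) volume :=
      integrableOn_const measure_closedBall_lt_top.ne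
    have i3 : IntegrableOn (fun z => w z ^ 2 + 2) (Metric.closedBall x r) :=
      (L2.integrable_sq w).integrableOn.add i2
    calc ∫ z in Metric.closedBall x r, |f z| ≤ ∫ z in Metric.closedBall x r, (w z ^ 2 + 2) := by
          refine setIntegral_mono_on_ae i1 i3 measurableSet_closedBall ?_
          filter_upwards [hwf] with z hz hzx
          have e : f z = w z - a := by rw [hz (hx hzx)]; ring
          rw [e]
          refine (abs_sub _ _).trans ?_
          nlinarith [sq_nonneg (|w z| - 1), sq_abs (w z), abs_nonneg (w z)]
      _ = (∫ z in Metric.closedBall x r, w z ^ 2) + 2 * (r ^ n * V) := by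
          rw [integral_add (L2.integrable_sq w).integrableOn i2, setIntegral_const,
            Measure.addHaar_real_closedBall' volume x hr.le, finrank_euclideanSpace,
            Fintype.card_fin, smul_eq_mul]
          ring
      _ ≤ (∫ z, w z ^ 2) + 2 * (r ^ n * V) := by
          exact add_le_add (setIntegral_le_integral (L2.integrable_sq w)
            (ae_of_all _ fun z => sq_nonneg _)) le_rfl
      _ = I := by rw [← L2.norm_sq_eq, hw]; norm_num [I]
  obtain ⟨h1, h2⟩ := hest μ Ω f hf hμ x r hr hr1 hx
  have e1 : 0 ≤ C / r ^ n * I := by positivity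
  have e2 : 0 ≤ C / r ^ (n + 1) * I := by positivity
  refine ⟨h1.trans ?_, fun e => (h2 0 e).trans ?_⟩
  · have : C / r ^ n * (∫ z in Metric.closedBall x r, |f z|) ≤ C / r ^ n * I := by gcongr
    linarith
  · simp only [sub_zero]
    have : C / r ^ (n + 1) * ‖e‖ * (∫ z in Metric.closedBall x r, |f z|) ≤
        C / r ^ (n + 1) * ‖e‖ * I := by gcongr
    nlinarith [norm_nonneg e]

theorem abs_sub_le_of_fderiv_le {U : Set (Eu n)} {f : Eu n → ℝ} {A : ℝ} (hU : IsOpen U)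
    (hf : ContDiffOn ℝ ∞ f U) {s : Set (Eu n)} (hs : Convex ℝ s) (hsU : s ⊆ U) (hA : 0 ≤ A)
    (h : ∀ x ∈ s, ∀ e, |fderiv ℝ f x e| ≤ A * ‖e‖) {x y : Eu n} (hx : x ∈ s) (hy : y ∈ s) :
    |f y - f x| ≤ A * ‖y - x‖ := by
  rw [← norm_eq_abs]
  refine hs.norm_image_sub_le_of_norm_fderiv_le (𝕜 := ℝ) (fun z hz =>
    (hf.contDiffAt_of_isOpen hU (hsU hz)).differentiableAt (by simp)) (fun z hz => ?_) hx hy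
  exact ContinuousLinearMap.opNorm_le_bound _ hA fun e => by rw [norm_eq_abs]; exact h z hz e

/-- Convergence in `L²` together with Lipschitz bounds gives pointwise lower bounds. -/
theorem half_le_of_close {U : Set (Eu n)} {f p : Eu n → ℝ} {w φ : L2 n} {A P r a : ℝ} (hU : IsOpen U)
    (hf : ContDiffOn ℝ ∞ f U) (hp : ContDiffOn ℝ ∞ p U) (hA : 0 ≤ A) (hP : 0 < P) {x : Eu n}
    (hx : Metric.closedBall x r ⊆ U) (hr : 0 < r) (hAr : A * r ≤ P / 8)
    (hfA : ∀ y ∈ Metric.closedBall x r, ∀ e, |fderiv ℝ f y e| ≤ A * ‖e‖)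
    (hpA : ∀ y ∈ Metric.closedBall x r, ∀ e, |fderiv ℝ p y e| ≤ A * ‖e‖)
    (hw : ∀ᵐ x, x ∈ U → w x = f x + a) (hφ : ∀ᵐ x, x ∈ U → φ x = p x) (hpP : P ≤ p x)
    (hclose : ‖w - φ‖ ^ 2 < (P / 4) ^ 2 * (volume : Measure (Eu n)).real (Metric.closedBall x r)) :
    P / 2 ≤ f x + a := by
  by_contra! hlt
  have hxb : x ∈ Metric.closedBall x r := Metric.mem_closedBall_self hr.le
  have hest : ∀ y ∈ Metric.closedBall x r, P / 4 ≤ p y - (f y + a) := by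
    intro y hy
    have h1 := abs_sub_le_of_fderiv_le hU hf (convex_closedBall x r) hx hA hfA hxb hy
    have h2 := abs_sub_le_of_fderiv_le hU hp (convex_closedBall x r) hx hA hpA hxb hy
    have h3 : A * ‖y - x‖ ≤ A * r := by
      gcongr; exact mem_closedBall_iff_norm.1 hy
    have := (abs_le.1 h1).2
    have := (abs_le.1 h2).1
    linarith
  have h1 : ∫ z in Metric.closedBall x r, (P / 4) ^ 2 ≤
      ∫ z in Metric.closedBall x r, (w - φ : L2 n) z ^ 2 := by
    refine setIntegral_mono_on_ae (integrableOn_const measure_closedBall_lt_top.ne)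
      (L2.integrable_sq _).integrableOn measurableSet_closedBall ?_
    filter_upwards [hw, hφ, Lp.coeFn_sub w φ] with z h1 h2 h3 hz
    rw [h3, Pi.sub_apply, h1 (hx hz), h2 (hx hz)]
    nlinarith [hest z hz]
  have h2 : ∫ z in Metric.closedBall x r, (w - φ : L2 n) z ^ 2 ≤ ‖w - φ‖ ^ 2 := by
    rw [L2.norm_sq_eq]
    exact setIntegral_le_integral (L2.integrable_sq _) (ae_of_all _ fun z => sq_nonneg _)
  rw [setIntegral_const, smul_eq_mul] at h1
  linarith

namespace DefFn
variable {F : Eu n → ℝ}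

/-- Two-sided bounds near the boundary for solutions of `κ w = G (w - s)`. -/
theorem shell_bounds (hF : DefFn F) {w : L2 n} {g κ s δ E : ℝ} (hg : 0 < g)
    (hκ : g / 2 ≤ κ) (hs : 0 < s)
    (hh : ∀ᵐ x, 0 < F x → F x ≤ δ →
      green {x | 0 < F x} (oneL2 hF.isOpen.measurableSet hF.isBounded) x ≤ g / 8)
    (hw : green {x | 0 < F x} (w - s • oneL2 hF.isOpen.measurableSet hF.isBounded) = κ • w)
    (hE : 0 ≤ E) (hup : ∀ᵐ x, δ < F x → w x ≤ E) (hlow : ∀ᵐ x, δ < F x → 0 ≤ w x) :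
    ∀ᵐ x, 0 < F x → F x ≤ δ →
      w x ≤ 2 * E / g * green {x | 0 < F x} (oneL2 hF.isOpen.measurableSet hF.isBounded) x ∧
      -(s / 2) ≤ w x := by
  set Ω := {x | 0 < F x}
  set one := oneL2 hF.isOpen.measurableSet hF.isBounded
  set h := green Ω one
  have hS : MeasurableSet {x | 0 < F x ∧ F x ≤ δ} :=
    hF.isOpen.measurableSet.inter
      (measurableSet_le hF.contDiff.continuous.measurable measurable_const)
  have hSΩ : {x | 0 < F x ∧ F x ≤ δ} ⊆ Ω := fun x hx => hx.1
  have hone : ∀ᵐ x, x ∈ Ω → one x = 1 :=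
    (coeFn_oneL2 hF.isOpen.measurableSet hF.isBounded).mono fun x hx hxΩ => by
      rw [hx, indicator_of_mem hxΩ]
  have hh' : ∀ᵐ x, x ∈ {x | 0 < F x ∧ F x ≤ δ} → h x ≤ g / 8 := hh.mono fun x hx hxS => hx hxS.1 hxS.2
  have u1 := green_shell_nonpos hF.isOpen.measurableSet hF.isBounded hS hSΩ
    (z := w - (2 * E / g) • h) (q := w - s • one - (κ * (2 * E / g)) • one) (κ := κ) (t := g / 8)
    (by linarith) (by
      rw [map_sub, hw, map_smul, smul_sub, smul_smul]) hh' (by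
      filter_upwards [hh', hone, Lp.coeFn_sub w ((2 * E / g) • h),
        Lp.coeFn_sub (w - s • one) ((κ * (2 * E / g)) • one), Lp.coeFn_sub w (s • one),
        Lp.coeFn_smul (2 * E / g) h, Lp.coeFn_smul (κ * (2 * E / g)) one, Lp.coeFn_smul s one]
        with x h1 h2 e1 e2 e3 e4 e5 e6 hx
      simp only [e1, e2, e3, e4, e5, e6, Pi.sub_apply, Pi.smul_apply, smul_eq_mul, h2 (hSΩ hx)]
      refine le_max_of_le_left ?_
      have h3 : 2 * E / g * h x ≤ 2 * E / g * κ :=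
        mul_le_mul_of_nonneg_left (by linarith [h1 hx]) (by positivity)
      linarith) (by
      filter_upwards [hup, hone, Lp.coeFn_sub (w - s • one) ((κ * (2 * E / g)) • one),
        Lp.coeFn_sub w (s • one), Lp.coeFn_smul (κ * (2 * E / g)) one, Lp.coeFn_smul s one]
        with x h1 h2 e2 e3 e5 e6 hx hxS
      simp only [e2, e3, e5, e6, Pi.sub_apply, Pi.smul_apply, smul_eq_mul, h2 hx]
      have h3 := h1 (by by_contra hlt; exact hxS ⟨hx, not_lt.1 hlt⟩)
      have h4 : E = g / 2 * (2 * E / g) := by field_simp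
      have h5 : g / 2 * (2 * E / g) ≤ κ * (2 * E / g) :=
        mul_le_mul_of_nonneg_right hκ (by positivity)
      linarith)
  have u2 := green_shell_nonpos hF.isOpen.measurableSet hF.isBounded hS hSΩ
    (z := (-1 : ℝ) • w - (4 / g * s) • h)
    (q := (-1 : ℝ) • (w - s • one) - (κ * (4 / g * s)) • one) (κ := κ) (t := g / 8)
    (by linarith) (by
      rw [map_sub, map_smul, hw, map_smul, smul_sub, smul_smul, smul_smul, smul_smul,
        mul_comm κ (-1)]) hh' (by
      filter_upwards [hh', hone, Lp.coeFn_sub ((-1 : ℝ) • w) ((4 / g * s) • h),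
        Lp.coeFn_sub ((-1 : ℝ) • (w - s • one)) ((κ * (4 / g * s)) • one),
        Lp.coeFn_sub w (s • one), Lp.coeFn_smul (-1 : ℝ) w, Lp.coeFn_smul (-1 : ℝ) (w - s • one),
        Lp.coeFn_smul (4 / g * s) h, Lp.coeFn_smul (κ * (4 / g * s)) one, Lp.coeFn_smul s one]
        with x h1 h2 e1 e2 e3 e7 e8 e4 e5 e6 hx
      simp only [e1, e2, e3, e4, e5, e6, e7, e8, Pi.sub_apply, Pi.smul_apply, smul_eq_mul,
        h2 (hSΩ hx)]
      refine le_max_of_le_left ?_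
      have h3 : 4 / g * s * (g / 4) ≤ 4 / g * s * (κ - h x) :=
        mul_le_mul_of_nonneg_left (by linarith [h1 hx]) (by positivity)
      have h4 : 4 / g * s * (g / 4) = s := by field_simp
      linarith) (by
      filter_upwards [hlow, hone, Lp.coeFn_sub ((-1 : ℝ) • (w - s • one)) ((κ * (4 / g * s)) • one),
        Lp.coeFn_sub w (s • one), Lp.coeFn_smul (-1 : ℝ) (w - s • one),
        Lp.coeFn_smul (κ * (4 / g * s)) one, Lp.coeFn_smul s one]
        with x h1 h2 e2 e3 e8 e5 e6 hx hxS
      simp only [e2, e3, e5, e6, e8, Pi.sub_apply, Pi.smul_apply, smul_eq_mul, h2 hx]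
      have h3 := h1 (by by_contra hlt; exact hxS ⟨hx, not_lt.1 hlt⟩)
      have h4 : g / 2 * (4 / g * s) = 2 * s := by field_simp; norm_num
      have h5 : g / 2 * (4 / g * s) ≤ κ * (4 / g * s) :=
        mul_le_mul_of_nonneg_right hκ (by positivity)
      linarith)
  filter_upwards [u1, u2, hh', Lp.coeFn_sub w ((2 * E / g) • h), Lp.coeFn_smul (2 * E / g) h,
    Lp.coeFn_sub ((-1 : ℝ) • w) ((4 / g * s) • h), Lp.coeFn_smul (-1 : ℝ) w,
    Lp.coeFn_smul (4 / g * s) h] with x h1 h2 h3 e1 e2 e3 e4 e5 hx hxδ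
  replace h1 := h1 ⟨hx, hxδ⟩
  replace h2 := h2 ⟨hx, hxδ⟩
  simp only [e1, e2, e3, e4, e5, Pi.sub_apply, Pi.smul_apply, smul_eq_mul] at h1 h2
  have h4 : 4 / g * s * h x ≤ 4 / g * s * (g / 8) :=
    mul_le_mul_of_nonneg_left (h3 ⟨hx, hxδ⟩) (by positivity)
  have h5 : 4 / g * s * (g / 8) = s / 2 := by field_simp; norm_num
  exact ⟨by linarith, by linarith⟩

theorem exists_ball_subset (hF : DefFn F) {δ : ℝ} (hδ : 0 < δ) :
    ∃ r > 0, r ≤ 1 ∧ ∀ x, δ ≤ F x → ∀ y ∈ Metric.closedBall x r,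
      Metric.closedBall y r ⊆ {x | 0 < F x} := by
  obtain ⟨ρ, hρ, hsub⟩ := (hF.isCompact δ (by linarith)).exists_cthickening_subset_open hF.isOpen
    (fun x (hx : δ ≤ F x) => show 0 < F x from hδ.trans_le hx)
  refine ⟨min (ρ / 2) 1, by positivity, min_le_right _ _, fun x hx y hy z hz => hsub ?_⟩
  refine Metric.mem_cthickening_of_dist_le z x ρ _ hx ?_
  have h1 := Metric.mem_closedBall.1 hy
  have h2 := Metric.mem_closedBall.1 hz
  have := dist_triangle z y x
  linarith [min_le_left (ρ / 2) 1]

set_option maxHeartbeats 1000000 in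
/-- Almost resonant solutions comparable to the defining function, up to a small constant. -/
theorem exists_resonant [NeZero n] (hF : DefFn F) (hc : IsPreconnected {x | 0 < F x})
    (hne : {x | 0 < F x}.Nonempty) :
    ∃ M > 0, ∃ c₁ > 0, ∃ c₂ > 0, ∀ ε > 0, ∃ (μ a : ℝ) (f : Eu n → ℝ), 0 < μ ∧ μ ≤ M ∧ 0 < a ∧
      a < ε ∧ Helm μ {x | 0 < F x} f ∧
      ∀ x, 0 < F x → c₁ * F x ≤ f x + a ∧ f x + a ≤ c₂ * F x := by
  obtain ⟨g, p, φ, w, κ, s, hg, hg1, hp, hp0, hφp, hwφ, hw1, hκ, hs, hs0, heq⟩ :=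
    exists_near_resonant hF.isOpen hF.isBounded hc hne
  obtain ⟨C₀, hC₀, hone⟩ := hF.exists_green_one_le
  obtain ⟨m, hm, hcore⟩ := hF.exists_le_green_core
  set Ω := {x | 0 < F x}
  set one := oneL2 hF.isOpen.measurableSet hF.isBounded
  set δ := min m (g / (8 * C₀))
  have hδ : 0 < δ := by positivity
  obtain ⟨C₁, hC₁, hcore⟩ := hcore δ hδ (min_le_left _ _)
  set core := oneL2 (hF.measurableSet_core δ) (hF.isBounded_core hδ)
  have hh : ∀ᵐ x, 0 < F x → F x ≤ δ → green Ω one x ≤ g / 8 := hone.mono fun x hx h0 hxδ => by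
    have h1 : C₀ * F x ≤ C₀ * (g / (8 * C₀)) := by
      gcongr; exact hxδ.trans (min_le_right _ _)
    have h2 : C₀ * (g / (8 * C₀)) = g / 8 := by field_simp
    linarith [hx h0]
  obtain ⟨r, hr, hr1, hball⟩ := hF.exists_ball_subset hδ
  obtain ⟨A, hA, hbd⟩ := exists_interior_bound n (2 / g) hr hr1
  obtain ⟨P, hP, hpP⟩ := (hF.isCompact δ (by linarith)).exists_forall_le'
    (hp.continuousOn.mono fun x (hx : δ ≤ F x) => show 0 < F x from hδ.trans_le hx) (a := 0)
    fun x hx => hp0 x (hδ.trans_le hx)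
  have hμle : ∀ t, g / 2 ≤ t → 1 / t - 1 ≤ 2 / g := fun t ht => by
    have : 1 / t ≤ 1 / (g / 2) := one_div_le_one_div_of_le (by positivity) ht
    rw [one_div_div] at this; linarith
  set r₁ := min r (P / (8 * A))
  have hr₁ : 0 < r₁ := by positivity
  have hAr : A * r₁ ≤ P / 8 := by
    have h1 : A * r₁ ≤ A * (P / (8 * A)) := by gcongr; exact min_le_right _ _
    have h2 : A * (P / (8 * A)) = P / 8 := by field_simp
    linarith
  set V := (volume : Measure (Eu n)).real (Metric.closedBall 0 r₁)
  have hV : 0 < V := ENNReal.toReal_pos (Metric.measure_closedBall_pos _ _ hr₁).ne'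
      measure_closedBall_lt_top.ne
  have hVx : ∀ x : Eu n, (volume : Measure (Eu n)).real (Metric.closedBall x r₁) = V := fun x => by
    simp only [V]
    rw [Measure.addHaar_real_closedBall' _ _ hr₁.le, Measure.addHaar_real_closedBall' _ _ hr₁.le]
  have hφ1 : ‖φ‖ = 1 := tendsto_nhds_unique hwφ.norm (by simp [hw1])
  have hpA : ∀ x, δ ≤ F x → ∀ y ∈ Metric.closedBall x r₁, ∀ e, |fderiv ℝ p y e| ≤ A * ‖e‖ :=
    fun x hx y hy => (hbd _ Ω p φ 0 hp (hμle g (by linarith)) hφ1 (by simp)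
      (hφp.mono fun x hx hxΩ => by rw [hx hxΩ, add_zero]) y
      (hball x hx y (Metric.closedBall_subset_closedBall (min_le_left _ _) hy))).2
  refine ⟨2 / g, by positivity, P / (4 * C₁), by positivity,
    2 * (A + 1) / g * C₀ + (A + 1) / δ, by positivity, fun ε hε => ?_⟩
  have hclose : ∀ᶠ k in atTop, ‖w k - φ‖ ^ 2 < (P / 4) ^ 2 * V := by
    have : Tendsto (fun k => ‖w k - φ‖ ^ 2) atTop (𝓝 0) := by
      simpa using ((tendsto_iff_norm_sub_tendsto_zero.1 hwφ).pow 2)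
    exact this.eventually (gt_mem_nhds (by positivity))
  obtain ⟨k, hk, hk1, hk2⟩ := (hclose.and ((hs0.eventually (gt_mem_nhds
    (show 0 < min ε 1 * (1 - g) from mul_pos (by positivity) (by linarith)))).and
    (hs0.eventually (gt_mem_nhds (show 0 < P / (8 * C₁ * C₀) by positivity))))).exists
  obtain ⟨hκl, hκu⟩ := hκ k
  have hκ0 : 0 < κ k := by linarith
  have hκ1 : κ k < 1 := by linarith
  set a := s k / (1 - κ k)
  have ha0 : 0 < a := div_pos (hs k) (by linarith)
  have hale : a < min ε 1 := by
    rw [div_lt_iff₀ (by linarith)]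
    refine hk1.trans_le (mul_le_mul_of_nonneg_left (by linarith) (by positivity))
  have hone1 : ∀ᵐ x, x ∈ Ω → one x = 1 :=
    (coeFn_oneL2 hF.isOpen.measurableSet hF.isBounded).mono fun x hx hxΩ => by
      rw [hx, indicator_of_mem hxΩ]
  obtain ⟨f, hf, hwf⟩ := exists_helm_of_green_eq hF.isOpen hκ0 hκ1.le (c := s k • one) (s := s k)
    (a := a) (by
      filter_upwards [hone1, Lp.coeFn_smul (s k) one] with x h1 h2 hx
      rw [h2, Pi.smul_apply, h1 hx, smul_eq_mul, mul_one])
    (by simp only [a]; field_simp [(by linarith : (1 - κ k) ≠ 0)]) (heq k)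
  have ha1 : |a| ≤ 1 := by
    rw [abs_of_pos ha0]; exact hale.le.trans (min_le_right _ _)
  have hfA := hbd _ Ω f (w k) a hf (hμle _ hκl) (hw1 k) ha1 hwf
  have hlowf : ∀ x, δ ≤ F x → P / 2 ≤ f x + a := fun x hx =>
    half_le_of_close hF.isOpen hf.contDiffOn hp.contDiffOn hA.le hP
      ((Metric.closedBall_subset_closedBall (min_le_left _ _)).trans
        (hball x hx x (Metric.mem_closedBall_self hr.le))) hr₁ hAr
      (fun y hy => (hfA y (hball x hx y
        (Metric.closedBall_subset_closedBall (min_le_left _ _) hy))).2)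
      (hpA x hx) hwf hφp (hpP x hx) (by rw [hVx]; exact hk)
  have hupf : ∀ x, δ ≤ F x → f x + a ≤ A + 1 := fun x hx => by
    have h1 := (hfA x (hball x hx x (Metric.mem_closedBall_self hr.le))).1
    linarith [le_abs_self (f x), le_abs_self a]
  have hmemΩ : ∀ x, δ < F x → x ∈ Ω := fun x hx => hδ.trans hx
  have hshell := hF.shell_bounds hg hκl (hs k) hh (heq k) (E := A + 1) (by positivity)
    (hwf.mono fun x hx hxδ => by rw [hx (hmemΩ x hxδ)]; exact hupf x hxδ.le)
    (hwf.mono fun x hx hxδ => by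
      rw [hx (hmemΩ x hxδ)]; linarith [hlowf x hxδ.le])
  have hmono := green_mono (U := Ω) (g := (P / 2) • core - (2 * s k) • one) (h := w k - s k • one) (by
    filter_upwards [hwf, hshell, hone1, coeFn_oneL2 (hF.measurableSet_core δ) (hF.isBounded_core hδ),
      Lp.coeFn_sub ((P / 2) • core) ((2 * s k) • one), Lp.coeFn_sub (w k) (s k • one),
      Lp.coeFn_smul (P / 2) core, Lp.coeFn_smul (2 * s k) one, Lp.coeFn_smul (s k) one]
      with x h1 h2 h3 e0 e1 e2 e3 e4 e5 hx
    simp only [e1, e2, e3, e4, e5, Pi.sub_apply, Pi.smul_apply, smul_eq_mul, h3 hx, core, e0]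
    have := hs k
    by_cases hxδ : δ < F x
    · rw [indicator_of_mem (show x ∈ {x | δ < F x} from hxδ), h1 hx]
      linarith [hlowf x hxδ.le]
    · rw [indicator_of_notMem (show x ∉ {x | δ < F x} from hxδ)]
      linarith [(h2 hx (not_lt.1 hxδ)).2])
  rw [heq k, map_sub, map_smul, map_smul] at hmono
  have hWcont : ContinuousOn (fun x => f x + a) Ω := hf.continuousOn.add continuousOn_const
  have hFc := hF.contDiff.continuous
  refine ⟨1 / κ k - 1, a, f, ?_, hμle _ hκl, ha0, hale.trans_le (min_le_left _ _), hf, ?_⟩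
  · rw [sub_pos, lt_div_iff₀ hκ0]; linarith
  have h1 : ∀ x ∈ Ω, P / (4 * C₁) * F x ≤ f x + a := by
    refine le_of_ae_le_of_isOpen hF.isOpen (continuous_const.mul hFc).continuousOn hWcont ?_
    filter_upwards [hmono, hone, hcore, hwf,
      Lp.coeFn_sub ((P / 2) • green Ω core) ((2 * s k) • green Ω one),
      Lp.coeFn_smul (P / 2) (green Ω core), Lp.coeFn_smul (2 * s k) (green Ω one),
      Lp.coeFn_smul (κ k) (w k)] with x h1 h2 h3 h4 e1 e2 e3 e4 hx
    rw [e1, e4, Pi.sub_apply, e2, e3] at h1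
    simp only [Pi.smul_apply, smul_eq_mul] at h1
    have hFx : 0 < F x := hx
    have h5 : F x / C₁ ≤ green Ω core x := by
      rw [div_le_iff₀ hC₁]; linarith [h3 hx]
    have h6 : P / 2 * (F x / C₁) ≤ P / 2 * green Ω core x := by gcongr
    have h7 : 2 * s k * green Ω one x ≤ 2 * (P / (8 * C₁ * C₀)) * (C₀ * F x) := by
      have h8 : 2 * s k * green Ω one x ≤ 2 * s k * (C₀ * F x) :=
        mul_le_mul_of_nonneg_left (h2 hx) (by linarith [hs k])
      have h9 : 2 * s k * (C₀ * F x) ≤ 2 * (P / (8 * C₁ * C₀)) * (C₀ * F x) :=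
        mul_le_mul_of_nonneg_right (by linarith) (by positivity)
      linarith
    have h8 : P / 2 * (F x / C₁) - 2 * (P / (8 * C₁ * C₀)) * (C₀ * F x) = P / (4 * C₁) * F x := by
      field_simp; ring
    have h9 : P / (4 * C₁) * F x ≤ κ k * w k x := by linarith
    rw [← h4 hx]
    have h10 : 0 < P / (4 * C₁) * F x := by positivity
    have h11 : 0 < w k x := pos_of_mul_pos_right (h10.trans_le h9) hκ0.le
    exact h9.trans (mul_le_of_le_one_left h11.le hκ1.le)
  have h2 : ∀ x ∈ Ω, f x + a ≤ (2 * (A + 1) / g * C₀ + (A + 1) / δ) * F x := by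
    refine le_of_ae_le_of_isOpen hF.isOpen hWcont (continuous_const.mul hFc).continuousOn ?_
    filter_upwards [hshell, hone, hwf] with x h1 h2 h3 hx
    have hFx : 0 < F x := hx
    have i1 : 0 ≤ 2 * (A + 1) / g * C₀ * F x := by positivity
    have i2 : 0 ≤ (A + 1) / δ * F x := by positivity
    rcases le_or_gt (F x) δ with hxδ | hxδ
    · rw [← h3 hx]
      have h4 : 2 * (A + 1) / g * green Ω one x ≤ 2 * (A + 1) / g * (C₀ * F x) :=
        mul_le_mul_of_nonneg_left (h2 hx) (by positivity)
      linarith [(h1 hx hxδ).1]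
    · have h4 : (A + 1) / δ * δ ≤ (A + 1) / δ * F x := by gcongr
      rw [div_mul_cancel₀ _ hδ.ne'] at h4
      linarith [hupf x hxδ.le]
  exact fun x hx => ⟨h1 x hx, h2 x hx⟩

end DefFn

theorem deriv_deriv_nonneg_of_isLocalMin {g : ℝ → ℝ} {t : ℝ} (hmin : IsLocalMin g t)
    (hg : ContinuousAt g t) : 0 ≤ deriv (deriv g) t := by
  by_contra! hlt
  have hmax := isLocalMax_of_deriv_deriv_neg hlt hmin.deriv_eq_zero hg
  have hc : g =ᶠ[𝓝 t] fun _ => g t := by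
    filter_upwards [hmin, hmax] with s h1 h2 using le_antisymm h2 h1
  have h1 : deriv g =ᶠ[𝓝 t] fun _ => 0 := by
    have := hc.deriv
    simpa using this
  rw [h1.deriv_eq] at hlt
  simp at hlt

theorem laplacian_nonneg_of_isLocalMin {u : Eu n → ℝ} {x : Eu n} (hu : ContDiffAt ℝ ∞ u x)
    (hmin : IsLocalMin u x) : 0 ≤ laplacian u x := by
  rw [laplacian_eq_sum_pd]
  refine Finset.sum_nonneg fun i _ => ?_
  set e : Eu n := EuclideanSpace.single i 1
  have hline : ∀ t : ℝ, HasDerivAt (fun t : ℝ => x + t • e) e t := fun t => by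
    simpa using ((hasDerivAt_id t).smul_const e).const_add x
  have hcont : Tendsto (fun t : ℝ => x + t • e) (𝓝 0) (𝓝 x) := by
    have := (hline 0).continuousAt.tendsto
    simpa using this
  have hd : deriv (fun t : ℝ => u (x + t • e)) =ᶠ[𝓝 0] fun t => pd i u (x + t • e) := by
    filter_upwards [hcont.eventually hu.eventually_differentiableAt] with t ht
    exact (ht.hasFDerivAt.comp_hasDerivAt t (hline t)).deriv
  have hpd : DifferentiableAt ℝ (pd i u) x := (hu.pd i).differentiableAt (by simp)
  have hd2 : deriv (deriv fun t : ℝ => u (x + t • e)) 0 = pd i (pd i u) x := by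
    rw [hd.deriv_eq]
    have hx : DifferentiableAt ℝ (pd i u) (x + (0 : ℝ) • e) := by simpa using hpd
    have := (hx.hasFDerivAt.comp_hasDerivAt (0 : ℝ) (hline 0)).deriv
    simp only [Function.comp_def, zero_smul, add_zero] at this
    exact this
  rw [← hd2]
  refine deriv_deriv_nonneg_of_isLocalMin ?_ ?_
  · have := hcont.eventually hmin
    filter_upwards [this] with t ht
    simpa using ht
  · have hx : ContinuousAt u (x + (0 : ℝ) • e) := by simpa using hu.continuousAt
    exact ContinuousAt.comp (f := fun t : ℝ => x + t • e) hx (hline 0).continuousAt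

/-- The maximum principle for `Δ + μ` in the presence of a positive strict supersolution. -/
theorem nonneg_of_supersolution {D K : Set (Eu n)} {u ζ : Eu n → ℝ} {μ : ℝ} (hD : IsOpen D)
    (hu : ContDiffOn ℝ ∞ u D) (hζ : ContDiff ℝ ∞ ζ)
    (hsup : ∀ x ∈ D, laplacian u x + μ * u x ≤ 0) (hζ0 : ∀ x ∈ D, 0 < ζ x)
    (hζs : ∀ x ∈ D, laplacian ζ x + μ * ζ x < 0) (hK : IsCompact K) (hKD : K ⊆ D)
    (hout : ∀ x ∈ D, x ∉ K → 0 ≤ u x) : ∀ x ∈ D, 0 ≤ u x := by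
  by_contra! hex
  obtain ⟨x₁, hx₁, hlt⟩ := hex
  have hx₁K : x₁ ∈ K := by
    by_contra h; exact hlt.not_ge (hout x₁ hx₁ h)
  obtain ⟨x₀, hx₀, hmin⟩ := hK.exists_isMinOn (f := fun x => u x / ζ x) ⟨x₁, hx₁K⟩
    ((hu.continuousOn.mono hKD).div hζ.continuous.continuousOn fun x hx => (hζ0 x (hKD hx)).ne')
  have hneg : u x₀ / ζ x₀ < 0 := (show u x₀ / ζ x₀ ≤ u x₁ / ζ x₁ from hmin hx₁K).trans_lt
    (div_neg_of_neg_of_pos hlt (hζ0 x₁ hx₁))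
  set t := -(u x₀ / ζ x₀)
  have ht : 0 < t := neg_pos.2 hneg
  have hx₀D := hKD hx₀
  have hu0 := hu.contDiffAt_of_isOpen hD hx₀D
  have hz : u x₀ + t * ζ x₀ = 0 := by
    simp only [t]; field_simp [(hζ0 x₀ hx₀D).ne']; ring
  have hge : ∀ x ∈ D, 0 ≤ u x + t * ζ x := fun x hx => by
    by_cases hxK : x ∈ K
    · have h1 : u x₀ / ζ x₀ ≤ u x / ζ x := hmin hxK
      rw [le_div_iff₀ (hζ0 x hx)] at h1
      simp only [t]; linarith
    · have := hout x hx hxK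
      have := mul_pos ht (hζ0 x hx)
      linarith
  have hloc : IsLocalMin (fun x => u x + t * ζ x) x₀ := by
    filter_upwards [hD.mem_nhds hx₀D] with x hx
    rw [hz]; exact hge x hx
  have htζ : ContDiffAt ℝ ∞ (fun x => t * ζ x) x₀ := (contDiff_const.mul hζ).contDiffAt
  have := laplacian_nonneg_of_isLocalMin (hu0.add htζ) hloc
  rw [laplacian_add hu0 htζ, laplacian_const_mul hζ.contDiffAt] at this
  have h1 := hsup x₀ hx₀D
  have h2 := mul_lt_mul_of_pos_left (hζs x₀ hx₀D) ht
  have h3 : μ * (u x₀ + t * ζ x₀) = 0 := by rw [hz, mul_zero]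
  linarith

theorem laplacian_comp_add (f : Eu n → ℝ) (w x : Eu n) :
    laplacian (fun y => f (y + w)) x = laplacian f (x + w) := by
  simp only [laplacian, fderiv_comp_add_right]
  refine Finset.sum_congr rfl fun i _ => ?_
  rw [fderiv_comp_add_right (f := fun y => fderiv ℝ f y (EuclideanSpace.single i 1))]

theorem laplacian_norm_sub_sq (p x : Eu n) : laplacian (fun y => ‖y - p‖ ^ 2) x = 2 * n := by
  have h1 : ∀ (y : Eu n) (i : Fin n), pd i (fun y => ‖y - p‖ ^ 2) y = 2 * (y i - p i) := by
    intro y i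
    have := ((hasFDerivAt_id y).sub_const p).norm_sq.fderiv
    simp only [pd, id] at this ⊢
    rw [this]
    simp [EuclideanSpace.inner_single_right]
  rw [laplacian_eq_sum_pd]
  have h2 : ∀ i : Fin n, pd i (pd i fun y => ‖y - p‖ ^ 2) x = 2 := by
    intro i
    have e : pd i (fun y => ‖y - p‖ ^ 2) = fun y => 2 * (y i - p i) := funext fun y => h1 y i
    have hd : HasFDerivAt (fun y : Eu n => y i) (EuclideanSpace.proj i : Eu n →L[ℝ] ℝ) x :=
      (EuclideanSpace.proj i : Eu n →L[ℝ] ℝ).hasFDerivAt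
    rw [e, pd, ((hd.sub_const (p i)).const_mul 2).fderiv]
    simp
  simp [h2, mul_comm]

theorem mul_le_sub_of_le_fderiv {U : Set (Eu n)} {f : Eu n → ℝ} (hU : IsOpen U)
    (hf : ContDiffOn ℝ ∞ f U) {x e : Eu n} {A h : ℝ} (hh : 0 ≤ h)
    (hxU : ∀ t ∈ Icc 0 h, x + t • e ∈ U) (hA : ∀ t ∈ Icc 0 h, A ≤ fderiv ℝ f (x + t • e) e) :
    A * h ≤ f (x + h • e) - f x := by
  have hd : ∀ t ∈ Icc 0 h, HasDerivAt (fun t : ℝ => f (x + t • e)) (fderiv ℝ f (x + t • e) e) t := by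
    intro t ht
    have h1 := ((hf.contDiffAt_of_isOpen hU (hxU t ht)).differentiableAt (by simp)).hasFDerivAt
    have h2 : HasDerivAt (fun t : ℝ => x + t • e) e t := by
      simpa using ((hasDerivAt_id t).smul_const e).const_add x
    exact h1.comp_hasDerivAt t h2
  have := (convex_Icc 0 h).mul_sub_le_image_sub_of_le_deriv
    (f := fun t : ℝ => f (x + t • e)) (C := A)
    (fun t ht => (hd t ht).continuousAt.continuousWithinAt)
    (fun t ht => (hd t (interior_subset ht)).differentiableAt.differentiableWithinAt)
    (fun t ht => by rw [(hd t (interior_subset ht)).deriv]; exact hA t (interior_subset ht))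
    0 (left_mem_Icc.2 hh) h (right_mem_Icc.2 hh) hh
  simpa using this

theorem fderiv_gradient_self (F : Eu n → ℝ) (p : Eu n) :
    fderiv ℝ F p (gradient F p) = ‖gradient F p‖ ^ 2 := by
  rw [← real_inner_self_eq_norm_sq, ← InnerProductSpace.toDual_apply_apply (𝕜 := ℝ)]
  simp [gradient]

theorem norm_gradient (F : Eu n → ℝ) (p : Eu n) : ‖gradient F p‖ = ‖fderiv ℝ F p‖ := by
  simp [gradient]

theorem norm_gradient_sq (F : Eu n → ℝ) (p : Eu n) :
    ‖gradient F p‖ ^ 2 = ∑ i, pd i F p ^ 2 := by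
  rw [EuclideanSpace.real_norm_sq_eq]
  refine Finset.sum_congr rfl fun i _ => ?_
  have : pd i F p = inner ℝ (gradient F p) (EuclideanSpace.single i 1) := by
    rw [← InnerProductSpace.toDual_apply_apply (𝕜 := ℝ)]
    simp [gradient, pd]
  rw [this, EuclideanSpace.inner_single_right]; simp

theorem ContDiff.gradient_infty {F : Eu n → ℝ} (hF : ContDiff ℝ ∞ F) :
    ContDiff ℝ ∞ (gradient F) :=
  (InnerProductSpace.toDual ℝ (Eu n)).symm.contDiff.comp (hF.fderiv_right (by simp))

namespace DefFn
variable {F : Eu n → ℝ}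

theorem exists_lipschitz (hF : DefFn F) : ∃ Λ : ℝ, 0 < Λ ∧ (∀ x, |F x| ≤ Λ) ∧
    (∀ x y, |F y - F x| ≤ Λ * ‖y - x‖) ∧
    (∀ x y, ‖fderiv ℝ F y - fderiv ℝ F x‖ ≤ Λ * ‖y - x‖) ∧ ∀ x, ‖gradient F x‖ ≤ Λ := by
  obtain ⟨A, hA⟩ := hF.isTest.contDiff.continuous.bounded_above_of_compact_support
    hF.isTest.hasCompactSupport
  obtain ⟨B, hB⟩ := hF.isTest.contDiff.lipschitzWith_of_hasCompactSupport
    hF.isTest.hasCompactSupport (by simp)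
  have hfd : (fderiv ℝ fun x => F x + 1) = fderiv ℝ F := by
    funext x; exact fderiv_add_const 1
  have hcs : HasCompactSupport (fderiv ℝ F) := by
    rw [← hfd]; exact hF.isTest.hasCompactSupport.fderiv ℝ
  obtain ⟨C, hC⟩ := (hF.contDiff.fderiv_right (m := ∞) (by simp)).lipschitzWith_of_hasCompactSupport
    hcs (by simp)
  have hL : ∀ x y, |F y - F x| ≤ B * ‖y - x‖ := fun x y => by
    have := hB.norm_sub_le y x
    simpa using this
  refine ⟨|A| + 1 + B + C, by positivity, fun x => ?_, fun x y => ?_, fun x y => ?_, fun x => ?_⟩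
  · have h1 := hA x
    rw [norm_eq_abs] at h1
    have h2 : |F x| ≤ |F x + 1| + 1 := by
      have := abs_sub (F x + 1) 1
      simpa using this
    have := le_abs_self A
    have := B.2; have := C.2
    linarith
  · refine (hL x y).trans (mul_le_mul_of_nonneg_right ?_ (norm_nonneg _))
    have := abs_nonneg A
    have := C.2
    linarith
  · refine (hC.norm_sub_le y x).trans (mul_le_mul_of_nonneg_right ?_ (norm_nonneg _))
    have := abs_nonneg A
    have := B.2
    linarith
  · rw [norm_gradient]
    have := norm_fderiv_le_of_lipschitz ℝ hB (x₀ := x)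
    rw [hfd] at this
    have := abs_nonneg A
    have := C.2
    linarith

theorem exists_fderiv_le (hF : DefFn F) (M c₁ c₂ : ℝ) (hc₁ : 0 < c₁) (hc₂ : 0 < c₂) :
    ∃ A > 0, ∀ μ a f, μ ≤ M → Helm μ {x | 0 < F x} f →
      (∀ x, 0 < F x → c₁ * F x ≤ f x + a ∧ f x + a ≤ c₂ * F x) →
      ∀ x, 0 < F x → ∀ e, |fderiv ℝ f x e| ≤ A * ‖e‖ := by
  obtain ⟨Λ, hΛ, hb, hl, -, -⟩ := hF.exists_lipschitz
  obtain ⟨C, hC, hgrad⟩ := exists_helm_gradient_estimate n M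
  refine ⟨3 * C * Λ * c₂, by positivity, fun μ a f hμ hf hfb x hx e => ?_⟩
  have hr : 0 < F x / (2 * Λ) := by positivity
  have hnear : ∀ z ∈ Metric.closedBall x (F x / (2 * Λ)), F x / 2 ≤ F z ∧ F z ≤ 3 / 2 * F x := by
    intro z hz
    have h1 := hl x z
    rw [mem_closedBall_iff_norm] at hz
    have h2 : Λ * ‖z - x‖ ≤ F x / 2 := by
      calc _ ≤ Λ * (F x / (2 * Λ)) := mul_le_mul_of_nonneg_left hz hΛ.le
        _ = F x / 2 := by field_simp
    have := abs_le.1 (h1.trans h2)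
    constructor <;> linarith
  have := hgrad μ _ f hf hμ x (F x / (2 * Λ)) hr ?_ ?_ (-a) (3 / 2 * c₂ * F x) ?_ e
  · calc _ ≤ _ := this
      _ = _ := by field_simp
  · rw [div_le_one (by positivity)]
    have := (le_abs_self (F x)).trans (hb x)
    linarith
  · intro z hz
    have := (hnear z hz).1
    show 0 < F z
    linarith
  · intro z hz
    have h0 := hnear z hz
    have hz0 : 0 < F z := by linarith
    have h1 := hfb z hz0
    rw [sub_neg_eq_add, abs_of_nonneg (by nlinarith)]
    nlinarith

end DefFn

theorem eventually_mul_le (A : ℝ) {B : ℝ} (hB : 0 < B) : ∀ᶠ ρ in 𝓝[>] (0 : ℝ), A * ρ ≤ B := by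
  have : Tendsto (fun ρ : ℝ => A * ρ) (𝓝[>] 0) (𝓝 0) := by
    have := ((continuous_const_mul A).tendsto (0 : ℝ)).mono_left (nhdsWithin_le_nhds (s := Ioi 0))
    simpa using this
  exact this.eventually_le_const hB

namespace DefFn
variable {F : Eu n → ℝ}

theorem le_add_smul_gradient (hF : DefFn F) {Λ : ℝ} (hΛ : 0 < Λ)
    (hl : ∀ x y, ‖fderiv ℝ F y - fderiv ℝ F x‖ ≤ Λ * ‖y - x‖) {p x : Eu n} {h R : ℝ} (hh : 0 ≤ h)
    (hR : 2 * Λ * R ≤ ‖gradient F p‖) (hx : ‖x - p‖ + h * ‖gradient F p‖ ≤ R) :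
    F x + h * ‖gradient F p‖ ^ 2 / 2 ≤ F (x + h • gradient F p) := by
  have := mul_le_sub_of_le_fderiv (A := ‖gradient F p‖ ^ 2 / 2) isOpen_univ hF.contDiff.contDiffOn
    (x := x) (e := gradient F p) hh (fun _ _ => mem_univ _) fun t ht => ?_
  · linarith
  · set e := gradient F p
    have h1 : ‖x + t • e - p‖ ≤ R := by
      calc ‖x + t • e - p‖ = ‖(x - p) + t • e‖ := by congr 1; abel
        _ ≤ ‖x - p‖ + t * ‖e‖ := by
          refine (norm_add_le _ _).trans ?_
          rw [norm_smul, norm_of_nonneg ht.1]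
        _ ≤ R := by
          have := mul_le_mul_of_nonneg_right ht.2 (norm_nonneg e)
          linarith
    have h2 : |(fderiv ℝ F (x + t • e) - fderiv ℝ F p) e| ≤ Λ * R * ‖e‖ := by
      refine (ContinuousLinearMap.le_opNorm (fderiv ℝ F (x + t • e) - fderiv ℝ F p) e).trans
        (mul_le_mul_of_nonneg_right ?_ (norm_nonneg _))
      exact (hl _ _).trans (mul_le_mul_of_nonneg_left h1 hΛ.le)
    rw [_root_.sub_apply, fderiv_gradient_self] at h2
    have h3 := (abs_le.1 h2).1
    have h4 := mul_le_mul_of_nonneg_right hR (norm_nonneg e)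
    show ‖e‖ ^ 2 / 2 ≤ _
    nlinarith

set_option maxHeartbeats 2000000 in
theorem exists_boundary_slope [NeZero n] (hF : DefFn F) (M c₁ c₂ : ℝ) (hM : 0 < M) (hc₁ : 0 < c₁)
    (hc₂ : 0 < c₂) : ∃ c₄ > 0, ∃ C > 0, ∃ τ₀ > 0, ∀ μ a f, μ ≤ M → Helm μ {x | 0 < F x} f →
      (∀ x, 0 < F x → c₁ * F x ≤ f x + a ∧ f x + a ≤ c₂ * F x) →
      ∀ p, F p = 0 → ∀ τ, 0 < τ → τ ≤ τ₀ → c₄ * τ ≤ F (p + τ • gradient F p) ∧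
        c₄ * τ ≤ f (p + τ • gradient F p) + a ∧ f (p + τ • gradient F p) + a ≤ C * τ ∧
        c₄ ≤ fderiv ℝ f (p + τ • gradient F p) (gradient F p) := by
  obtain ⟨Λ, hΛ, hb, hl, hl2, hgΛ⟩ := hF.exists_lipschitz
  obtain ⟨s, hs, hshell⟩ := hF.exists_shell
  obtain ⟨L, hL, b, hb0, m, hm, -, hbar, -⟩ := hF.exists_barriers
  obtain ⟨C₅, hC₅, hgrad⟩ := hF.exists_fderiv_le M c₁ c₂ hc₁ hc₂
  obtain ⟨ρ, ⟨e1, e2, e3, e4, e5⟩, hρ⟩ := ((eventually_mul_le Λ hm).and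
    ((eventually_mul_le (2 * M * L * Λ) hb0).and
    ((eventually_mul_le (2 * M) one_pos).and ((eventually_mul_le (4 * Λ ^ 2) hs).and
    (eventually_mul_le 1 one_pos))))).and self_mem_nhdsWithin |>.exists
  have hρ : 0 < ρ := hρ
  set c₃ := c₁ * s / 4 with hc₃
  have hc₃0 : 0 < c₃ := by positivity
  set V := C₅ * Λ with hV
  have hV0 : 0 < V := by positivity
  set A := (V + c₃) * (4 / ρ ^ 2) with hA
  have hA0 : 0 < A := by positivity
  set L' := 2 * A * (2 * n + M * ρ ^ 2) / b with hL'
  have hL'0 : 0 < L' := by positivity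
  set K := A * Λ ^ 2 + L' * L * Λ ^ 2 with hK
  have hK0 : 0 < K := by positivity
  have hn : (1 : ℝ) ≤ n := by exact_mod_cast NeZero.one_le
  obtain ⟨τ₀, ⟨t1, t2, t3⟩, hτ₀⟩ := ((eventually_mul_le (2 * Λ) hρ).and
    ((eventually_mul_le (2 * K) hc₃0).and (eventually_mul_le 1 one_pos))).and
    self_mem_nhdsWithin |>.exists
  have hτ₀ : 0 < τ₀ := hτ₀
  refine ⟨min (c₃ / 2) (min (s / 2) (c₁ * (s / 2))), by positivity, c₂ * Λ ^ 2, by positivity, τ₀, hτ₀,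
    fun μ a f hμ hf hfb p hp τ hτ hττ => ?_⟩
  set e := gradient F p with he
  have hes : s ≤ ‖e‖ ^ 2 := by
    rw [he, norm_gradient_sq]; exact hshell p hp.ge (by rw [hp]; exact hs.le)
  have heΛ : ‖e‖ ≤ Λ := hgΛ p
  have he0 : 0 < ‖e‖ := by
    by_contra h0
    have : ‖e‖ = 0 := le_antisymm (not_lt.1 h0) (norm_nonneg _)
    rw [this] at hes; norm_num at hes; linarith
  have hR : 2 * Λ * (2 * ρ) ≤ ‖e‖ := by
    have : 4 * Λ ^ 2 * ρ ≤ Λ * ‖e‖ := e4.trans (hes.trans (by nlinarith))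
    refine le_of_mul_le_mul_left ?_ hΛ
    linarith
  have hgrow : ∀ x h, 0 ≤ h → ‖x - p‖ + h * ‖e‖ ≤ 2 * ρ → F x + h * s / 2 ≤ F (x + h • e) := by
    intro x h hh hx
    have := hF.le_add_smul_gradient hΛ hl2 hh hR hx
    have h2 := mul_le_mul_of_nonneg_left hes hh
    linarith
  set x₁ := p + τ • e with hx₁
  have hx₁p : x₁ - p = τ • e := by simp [x₁]
  have hnx₁ : ‖x₁ - p‖ = τ * ‖e‖ := by rw [hx₁p, norm_smul, norm_of_nonneg hτ.le]
  have hτe : τ * ‖e‖ ≤ ρ / 2 := by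
    have := mul_le_mul hττ heΛ (norm_nonneg _) hτ₀.le
    linarith
  have hFx₁ : τ * s / 2 ≤ F x₁ := by
    have := hgrow p τ hτ.le (by simp; linarith)
    rw [hp] at this; linarith
  have hFx₁' : F x₁ ≤ Λ * (τ * ‖e‖) := by
    have := (le_abs_self _).trans (hl p x₁)
    rw [hp, hnx₁] at this; linarith
  have hFx₁0 : 0 < F x₁ := lt_of_lt_of_le (by positivity) hFx₁
  have hΩo := hF.isOpen
  set D := {x | 0 < F x} ∩ Metric.ball p ρ with hD
  have hDo : IsOpen D := hΩo.inter Metric.isOpen_ball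
  have hx₁D : x₁ ∈ D := ⟨hFx₁0, by rw [mem_ball_iff_norm, hnx₁]; linarith⟩
  -- the barrier function
  set B : Eu n → ℝ := fun y => 1 - exp (-L * F y) with hB
  have hBs : ContDiff ℝ ∞ B := contDiff_const.sub (hF.contDiff_exp_mul (-L))
  have hq : ContDiff ℝ ∞ fun y : Eu n => ‖y - p‖ ^ 2 := (contDiff_id.sub contDiff_const).norm_sq ℝ
  set Q : Eu n → ℝ := fun y => c₃ + (-A * ‖y - p‖ ^ 2 + -L' * B y) with hQ
  have hQ2 : ContDiff ℝ ∞ fun y => -A * ‖y - p‖ ^ 2 + -L' * B y :=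
    (contDiff_const.mul hq).add (contDiff_const.mul hBs)
  have hQs : ContDiff ℝ ∞ Q := contDiff_const.add hQ2
  have hB0 : ∀ x, 0 ≤ F x → 0 ≤ B x ∧ B x ≤ L * F x := by
    intro x hx
    have h1 : exp (-L * F x) ≤ 1 := exp_le_one_iff.2 (by nlinarith)
    have h2 := add_one_le_exp (-L * F x)
    simp only [B]
    constructor <;> linarith
  have hFD : ∀ x ∈ D, F x ≤ Λ * ρ := by
    intro x hx
    have h1 := (le_abs_self _).trans (hl p x)
    have h2 : ‖x - p‖ < ρ := mem_ball_iff_norm.1 hx.2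
    rw [hp] at h1
    linarith [mul_le_mul_of_nonneg_left h2.le hΛ.le]
  have hlapQ : ∀ x, laplacian Q x = -A * (2 * n) + -L' * laplacian B x := by
    intro x
    have h1 := (contDiff_const (c := -A)).mul hq
    have h2 := (contDiff_const (c := -L')).mul hBs
    have := laplacian_add (x := x) (contDiff_const (c := c₃)).contDiffAt hQ2.contDiffAt
    rw [laplacian_const, laplacian_add (x := x) h1.contDiffAt h2.contDiffAt,
      laplacian_const_mul hq.contDiffAt, laplacian_const_mul hBs.contDiffAt,
      laplacian_norm_sub_sq, zero_add] at this
    exact this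
  have hQsub : ∀ x ∈ D, 0 ≤ laplacian Q x + μ * Q x := by
    intro x hx
    have hxF : 0 < F x := hx.1
    have h1 := hbar x hxF ((hFD x hx).trans e1)
    have h2 := hB0 x hxF.le
    have h3 : ‖x - p‖ ^ 2 ≤ ρ ^ 2 := by
      have : ‖x - p‖ < ρ := mem_ball_iff_norm.1 hx.2
      exact pow_le_pow_left₀ (norm_nonneg _) this.le 2
    have h4 : L' * b ≤ -L' * laplacian B x := by
      have := mul_le_mul_of_nonneg_left h1 hL'0.le
      linarith
    have h5 : μ * (A * ‖x - p‖ ^ 2 + L' * B x) ≤ M * (A * ρ ^ 2 + L' * (L * (Λ * ρ))) := by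
      refine mul_le_mul hμ (add_le_add (mul_le_mul_of_nonneg_left h3 hA0.le)
        (mul_le_mul_of_nonneg_left (h2.2.trans (mul_le_mul_of_nonneg_left (hFD x hx) hL.le)) hL'0.le))
        ?_ hM.le
      have := h2.1
      positivity
    have h6 : M * (L' * (L * (Λ * ρ))) ≤ L' * (b / 2) := by
      have := mul_le_mul_of_nonneg_left e2 hL'0.le
      linarith
    have h7 : L' * b = 2 * A * (2 * n + M * ρ ^ 2) := by rw [hL']; field_simp
    have h8 : 0 ≤ μ * c₃ := mul_nonneg hf.nonneg hc₃0.le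
    have h9 : μ * Q x = μ * c₃ - μ * (A * ‖x - p‖ ^ 2 + L' * B x) := by simp only [Q]; ring
    rw [hlapQ, h9]
    linarith
  -- comparison of difference quotients with the barrier
  have hcomp : ∀ h, 0 < h → h * ‖e‖ ≤ ρ → Q x₁ ≤ h⁻¹ * (f (x₁ + h • e) - f x₁) := by
    intro h hh hhe
    have hshift : ∀ x ∈ D, ∀ t ∈ Icc 0 h, F x + t * s / 2 ≤ F (x + t • e) := by
      intro x hx t ht
      refine hgrow x t ht.1 ?_
      have h1 : ‖x - p‖ < ρ := mem_ball_iff_norm.1 hx.2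
      have := mul_le_mul_of_nonneg_right ht.2 he0.le
      linarith
    have hshift0 : ∀ x ∈ D, ∀ t ∈ Icc 0 h, 0 < F (x + t • e) := by
      intro x hx t ht
      have h1 : 0 < F x := hx.1
      have := mul_nonneg ht.1 hs.le
      linarith [hshift x hx t ht]
    have hfs : ContDiffOn ℝ ∞ (fun x => f (x + h • e)) D :=
      hf.contDiffOn.comp (contDiff_id.add contDiff_const).contDiffOn fun x hx =>
        hshift0 x hx h (right_mem_Icc.2 hh.le)
    have hfD : ContDiffOn ℝ ∞ f D := hf.contDiffOn.mono inter_subset_left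
    set u : Eu n → ℝ := fun x => h⁻¹ * f (x + h • e) + (-h⁻¹ * f x + -1 * Q x) with hu
    have hus : ContDiffOn ℝ ∞ u D :=
      (contDiffOn_const.mul hfs).add ((contDiffOn_const.mul hfD).add
        (contDiffOn_const.mul hQs.contDiffOn))
    have hη : ∀ x ∈ D, F x ≤ h * c₁ * s / (4 * c₂) → c₃ ≤ h⁻¹ * (f (x + h • e) - f x) := by
      intro x hx hxη
      have h1 := (hfb _ (hshift0 x hx h (right_mem_Icc.2 hh.le))).1
      have h2 := (hfb x hx.1).2
      have h3 := hshift x hx h (right_mem_Icc.2 hh.le)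
      have h4 : c₂ * F x ≤ h * c₁ * s / 4 := by
        calc _ ≤ c₂ * (h * c₁ * s / (4 * c₂)) := mul_le_mul_of_nonneg_left hxη hc₂.le
          _ = _ := by field_simp
      have h5 : c₁ * (h * s / 2) ≤ c₁ * F (x + h • e) :=
        mul_le_mul_of_nonneg_left (by have : 0 < F x := hx.1; linarith) hc₁.le
      rw [le_inv_mul_iff₀ hh]
      have : h * c₃ = h * c₁ * s / 4 := by rw [hc₃]; ring
      linarith
    have hV' : ∀ x ∈ D, -V ≤ h⁻¹ * (f (x + h • e) - f x) := by
      intro x hx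
      rw [le_inv_mul_iff₀ hh]
      have := mul_le_sub_of_le_fderiv (A := -V) hΩo hf.contDiffOn hh.le (x := x) (e := e)
        (fun t ht => hshift0 x hx t ht) fun t ht => ?_
      · linarith
      · have := (abs_le.1 (hgrad μ a f hμ hf hfb _ (hshift0 x hx t ht) e)).1
        have := mul_le_mul_of_nonneg_left heΛ hC₅.le
        linarith
    have := nonneg_of_supersolution (K := {x | h * c₁ * s / (4 * c₂) ≤ F x} ∩
      Metric.closedBall p (ρ / 2)) (ζ := fun x => 2 * ρ ^ 2 + -1 * ‖x - p‖ ^ 2) (μ := μ) hDo hus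
      (contDiff_const.add (contDiff_const.mul hq)) ?_ ?_ ?_ ?_ ?_ ?_ x₁ hx₁D
    · simp only [u] at this
      linarith
    · intro x hx
      have k1 := hfs.contDiffAt_of_isOpen hDo hx
      have k2 := hfD.contDiffAt_of_isOpen hDo hx
      have k3 := hQs.contDiffAt (x := x)
      have k4 := (contDiffAt_const (c := -h⁻¹)).mul k2
      have k5 := (contDiffAt_const (c := (-1 : ℝ))).mul k3
      have k6 := (contDiffAt_const (c := h⁻¹)).mul k1
      have E : laplacian u x = h⁻¹ * laplacian f (x + h • e) + (-h⁻¹ * laplacian f x +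
          -1 * laplacian Q x) := by
        have := laplacian_add k6 (k4.add k5)
        rw [laplacian_const_mul k1, laplacian_comp_add] at this
        refine this.trans ?_
        have := laplacian_add k4 k5
        rw [laplacian_const_mul k2, laplacian_const_mul k3] at this
        rw [← this]
      have q1 := hf.eq_zero x hx.1
      have q2 := hf.eq_zero (x + h • e) (hshift0 x hx h (right_mem_Icc.2 hh.le))
      have q3 := hQsub x hx
      rw [E]
      have : h⁻¹ * laplacian f (x + h • e) + (-h⁻¹ * laplacian f x + -1 * laplacian Q x) + μ * u x
        = h⁻¹ * (laplacian f (x + h • e) + μ * f (x + h • e)) - h⁻¹ * (laplacian f x + μ * f x)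
          - (laplacian Q x + μ * Q x) := by simp only [u]; ring
      rw [this, q1, q2]
      linarith
    · intro x hx
      have h1 : ‖x - p‖ < ρ := mem_ball_iff_norm.1 hx.2
      have := pow_lt_pow_left₀ h1 (norm_nonneg _) two_ne_zero
      have := pow_pos hρ 2
      show 0 < 2 * ρ ^ 2 + -1 * ‖x - p‖ ^ 2
      linarith
    · intro x hx
      have := laplacian_add (x := x) (contDiff_const (c := 2 * ρ ^ 2)).contDiffAt
        ((contDiff_const (c := (-1 : ℝ))).mul hq).contDiffAt
      rw [laplacian_const, laplacian_const_mul hq.contDiffAt, laplacian_norm_sub_sq] at this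
      rw [this]
      have h3 : μ * (2 * ρ ^ 2 + -1 * ‖x - p‖ ^ 2) ≤ M * (2 * ρ ^ 2) := by
        refine (mul_le_mul_of_nonneg_left ?_ hf.nonneg).trans
          (mul_le_mul_of_nonneg_right hμ (by positivity))
        have := sq_nonneg ‖x - p‖
        linarith
      have h4 : M * (2 * ρ ^ 2) ≤ 1 := by
        have := mul_le_mul e3 (show ρ ≤ 1 by linarith) hρ.le zero_le_one
        linarith
      linarith
    · exact ((hF.isCompact _ (by
        have : 0 < h * c₁ * s / (4 * c₂) := by positivity
        linarith)).inter_right Metric.isClosed_closedBall)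
    · rintro x ⟨hx, hx'⟩
      have h0 : 0 < h * c₁ * s / (4 * c₂) := by positivity
      refine ⟨h0.trans_le hx, Metric.closedBall_subset_ball (by linarith) hx'⟩
    · intro x hx hxK
      have h2 := hB0 x (le_of_lt hx.1)
      have h3 := mul_nonneg hL'0.le h2.1
      have key : Q x ≤ h⁻¹ * (f (x + h • e) - f x) := by
        by_cases hxF : F x ≤ h * c₁ * s / (4 * c₂)
        · refine le_trans ?_ (hη x hx hxF)
          have := mul_nonneg hA0.le (sq_nonneg ‖x - p‖)
          simp only [Q]; linarith
        · refine le_trans ?_ (hV' x hx)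
          have h4 : ρ / 2 < ‖x - p‖ := by
            by_contra! hle
            exact hxK ⟨(not_le.1 hxF).le, mem_closedBall_iff_norm.2 hle⟩
          have h5 : A * (ρ / 2) ^ 2 ≤ A * ‖x - p‖ ^ 2 :=
            mul_le_mul_of_nonneg_left (pow_le_pow_left₀ (by positivity) h4.le 2) hA0.le
          have h6 : A * (ρ / 2) ^ 2 = V + c₃ := by rw [hA]; field_simp; ring
          simp only [Q]; linarith
      simp only [u]; linarith
  have hQx₁ : c₃ / 2 ≤ Q x₁ := by
    have h1 := (hB0 x₁ hFx₁0.le).2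
    have h2 : τ * ‖e‖ ≤ τ * Λ := mul_le_mul_of_nonneg_left heΛ hτ.le
    have h3 : B x₁ ≤ L * (Λ * (τ * Λ)) := h1.trans (mul_le_mul_of_nonneg_left
      (hFx₁'.trans (mul_le_mul_of_nonneg_left h2 hΛ.le)) hL.le)
    have h4 : ‖x₁ - p‖ ^ 2 ≤ τ * Λ ^ 2 := by
      rw [hnx₁]
      calc (τ * ‖e‖) ^ 2 ≤ (τ * Λ) ^ 2 := pow_le_pow_left₀ (by positivity) h2 2
        _ = τ * (τ * Λ ^ 2) := by ring
        _ ≤ 1 * (τ * Λ ^ 2) := mul_le_mul_of_nonneg_right (by linarith) (by positivity)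
        _ = _ := one_mul _
    have h5 := mul_le_mul_of_nonneg_left h4 hA0.le
    have h6 := mul_le_mul_of_nonneg_left h3 hL'0.le
    have h7 : K * τ ≤ c₃ / 2 := by
      have := mul_le_mul_of_nonneg_left hττ hK0.le
      linarith
    have h8 : K * τ = A * (τ * Λ ^ 2) + L' * (L * (Λ * (τ * Λ))) := by rw [hK]; ring
    simp only [Q]; linarith
  have hder : c₃ / 2 ≤ fderiv ℝ f x₁ e := by
    have h1 := ((hf.contDiffOn.contDiffAt_of_isOpen hΩo hFx₁0).differentiableAt (by simp)).hasFDerivAt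
    have h2 : HasDerivAt (fun t : ℝ => f (x₁ + t • e)) (fderiv ℝ f x₁ e) 0 := by
      have h3 : HasDerivAt (fun t : ℝ => x₁ + t • e) e 0 := by
        simpa using ((hasDerivAt_id (0 : ℝ)).smul_const e).const_add x₁
      have h1' : HasFDerivAt f (fderiv ℝ f x₁) (x₁ + (0 : ℝ) • e) := by simpa using h1
      exact h1'.comp_hasDerivAt 0 h3
    have h3 := h2.tendsto_slope_zero_right
    refine ge_of_tendsto h3 ?_
    filter_upwards [eventually_mul_le ‖e‖ hρ, self_mem_nhdsWithin] with h hh (hh0 : 0 < h)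
    have := hcomp h hh0 (by linarith)
    simp only [zero_add, zero_smul, add_zero, smul_eq_mul]
    exact hQx₁.trans this
  have hfx := hfb x₁ hFx₁0
  refine ⟨?_, ?_, ?_, (min_le_left _ _).trans hder⟩
  · refine (mul_le_mul_of_nonneg_right ((min_le_right _ _).trans (min_le_left _ _)) hτ.le).trans ?_
    linarith
  · refine (mul_le_mul_of_nonneg_right ((min_le_right _ _).trans (min_le_right _ _)) hτ.le).trans ?_
    have := mul_le_mul_of_nonneg_left hFx₁ hc₁.le
    linarith
  · refine hfx.2.trans ?_
    have h1 : Λ * (τ * ‖e‖) ≤ Λ * (τ * Λ) :=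
      mul_le_mul_of_nonneg_left (mul_le_mul_of_nonneg_left heΛ hτ.le) hΛ.le
    have := mul_le_mul_of_nonneg_left (hFx₁'.trans h1) hc₂.le
    linarith

end DefFn

theorem exists_sign_section {X ι : Type*} [TopologicalSpace X] [SimplyConnectedSpace X]
    [LocallyPathConnectedSpace X] (U : ι → Set X) (hU : ∀ i, IsOpen (U i)) (hcov : ∀ x, ∃ i, x ∈ U i)
    (ε : ι → ι → X → ℤˣ) (hself : ∀ i, ∀ x ∈ U i, ε i i x = 1)
    (hloc : ∀ i j, ∀ x ∈ U i ∩ U j, ∀ᶠ y in 𝓝 x, ε i j y = ε i j x)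
    (hcomp : ∀ i j k, ∀ x ∈ U i ∩ U j ∩ U k, ε j k x * ε i j x = ε i k x) :
    ∃ s : ι → X → ℤˣ, (∀ i, ∀ x ∈ U i, ∀ᶠ y in 𝓝 x, s i y = s i x) ∧
      ∀ i j, ∀ x ∈ U i ∩ U j, s j x = ε i j x * s i x := by
  classical
  choose idx hidx using hcov
  let Z : FiberBundleCore ι X ℤˣ :=
    { baseSet := U
      isOpen_baseSet := hU
      indexAt := idx
      mem_baseSet_at := hidx
      coordChange := fun i j x v => ε i j x * v
      coordChange_self := fun i x hx v => by rw [hself i x hx, one_mul]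
      continuousOn_coordChange := fun i j => by
        rintro ⟨x, v⟩ ⟨hx, -⟩
        refine ContinuousAt.continuousWithinAt (ContinuousAt.congr (f := fun p : X × ℤˣ =>
          ε i j x * p.2) (continuous_const.mul continuous_snd).continuousAt ?_)
        filter_upwards [continuous_fst.continuousAt.eventually (hloc i j x hx)] with p hp
        rw [hp]
      coordChange_comp := fun i j k x hx v => by rw [← hcomp i j k x hx, mul_assoc] }
  have hcm : IsCoveringMap (Bundle.TotalSpace.proj : Bundle.TotalSpace ℤˣ Z.Fiber → X) :=
    FiberBundle.isCoveringMap
  obtain ⟨x₀⟩ : Nonempty X := inferInstance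
  obtain ⟨f, ⟨-, hf⟩, -⟩ := hcm.existsUnique_continuousMap_lifts (ContinuousMap.id X) x₀
    (⟨x₀, (1 : ℤˣ)⟩ : Bundle.TotalSpace ℤˣ Z.Fiber) rfl
  have hfx : ∀ x, (f x).1 = x := fun x => congrFun hf x
  refine ⟨fun i x => ((Z.localTriv i) (f x)).2, fun i x hx => ?_, fun i j x hx => ?_⟩
  · have h1 : ContinuousAt (fun x => ((Z.localTriv i) (f x)).2) x := by
      refine continuous_snd.continuousAt.comp (ContinuousAt.comp ?_ f.continuous.continuousAt)
      refine (Z.localTriv i).continuousOn.continuousAt ((Z.localTriv i).open_source.mem_nhds ?_)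
      rw [Z.mem_localTriv_source, hfx]
      exact hx
    exact h1.eventually_mem (isOpen_discrete {((Z.localTriv i) (f x)).2} |>.mem_nhds rfl)
  · simp only [Z.localTriv_apply]
    show ε (idx (f x).1) j (f x).1 * _ = ε i j x * (ε (idx (f x).1) i (f x).1 * _)
    rw [hfx, ← hcomp (idx x) i j x ⟨⟨hidx x, hx.1⟩, hx.2⟩]
    exact mul_assoc (ε i j x) (ε (idx x) i x) _

theorem exists_nhds_sides_preconnected {G : Eu n → ℝ} {x : Eu n} (hG : ContDiffAt ℝ ∞ G x)
    (h0 : G x = 0) (hd : fderiv ℝ G x ≠ 0) {V : Set (Eu n)} (hV : V ∈ 𝓝 x) :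
    ∃ W, IsOpen W ∧ x ∈ W ∧ W ⊆ V ∧ IsPreconnected (W ∩ {y | 0 < G y}) ∧
      IsPreconnected (W ∩ {y | G y < 0}) := by
  have hs : HasStrictFDerivAt G (fderiv ℝ G x) x := hG.hasStrictFDerivAt (by simp)
  have hr : (fderiv ℝ G x).range = ⊤ := by
    obtain ⟨e, he⟩ : ∃ e, fderiv ℝ G x e ≠ 0 := by
      by_contra! h; exact hd (ContinuousLinearMap.ext h)
    exact LinearMap.range_eq_top.2 (LinearMap.surjective (f := (fderiv ℝ G x).toLinearMap) (by
      intro h; exact he (congrArg (fun l : Eu n →ₗ[ℝ] ℝ => l e) h)))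
  set Θ := hs.implicitToOpenPartialHomeomorph G _ hr with hΘ
  have hxs : x ∈ Θ.source := hs.mem_implicitToOpenPartialHomeomorph_source hr
  have hΘx : Θ x = (0, 0) := by rw [hΘ, hs.implicitToOpenPartialHomeomorph_self hr, h0]
  have hfst : ∀ y, (Θ y).1 = G y := hs.implicitToOpenPartialHomeomorph_fst hr
  have hmem : Θ.target ∩ Θ.symm ⁻¹' V ∈ 𝓝 (Θ x) := by
    refine inter_mem (Θ.open_target.mem_nhds (Θ.map_source hxs)) ?_
    exact (Θ.continuousAt_symm (Θ.map_source hxs)) (by rwa [Θ.left_inv hxs])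
  obtain ⟨r, hr0, hball⟩ := Metric.mem_nhds_iff.1 hmem
  have key : ∀ S : Set ℝ, Convex ℝ S →
      IsPreconnected (Θ.source ∩ Θ ⁻¹' Metric.ball (Θ x) r ∩ {y | G y ∈ S}) := by
    intro S hS
    have e : Θ.source ∩ Θ ⁻¹' Metric.ball (Θ x) r ∩ {y | G y ∈ S} =
        Θ.symm '' (Metric.ball (Θ x) r ∩ Prod.fst ⁻¹' S) := by
      ext y
      constructor
      · rintro ⟨⟨hy, hy'⟩, hyS⟩
        exact ⟨Θ y, ⟨hy', by show (Θ y).1 ∈ S; rw [hfst]; exact hyS⟩, Θ.left_inv hy⟩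
      · rintro ⟨z, ⟨hz, hzS⟩, rfl⟩
        have hzt := (hball hz).1
        refine ⟨⟨Θ.map_target hzt, by show Θ (Θ.symm z) ∈ Metric.ball (Θ x) r; rwa [Θ.right_inv hzt]⟩, ?_⟩
        show G (Θ.symm z) ∈ S
        rw [← hfst, Θ.right_inv hzt]; exact hzS
    rw [e]
    refine IsPreconnected.image ?_ _ (Θ.continuousOn_symm.mono fun z hz => (hball hz.1).1)
    exact ((convex_ball _ _).inter (hS.linear_preimage (LinearMap.fst ℝ ℝ _))).isPreconnected
  refine ⟨Θ.source ∩ Θ ⁻¹' Metric.ball (Θ x) r, Θ.isOpen_inter_preimage Metric.isOpen_ball,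
    ⟨hxs, Metric.mem_ball_self hr0⟩, ?_, key (Ioi 0) (convex_Ioi 0), key (Iio 0) (convex_Iio 0)⟩
  rintro y ⟨hy, hy'⟩
  have := (hball hy').2
  rwa [mem_preimage, Θ.left_inv hy] at this

theorem frequently_pos_of_fderiv_ne_zero {G : Eu n → ℝ} {x : Eu n} (h0 : G x = 0)
    (hd : fderiv ℝ G x ≠ 0) : ∃ᶠ y in 𝓝 x, 0 < G y := by
  intro h
  refine hd (IsLocalMax.fderiv_eq_zero ?_)
  filter_upwards [h] with y hy
  rw [h0]; exact not_lt.1 hy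

theorem frequently_neg_of_fderiv_ne_zero {G : Eu n → ℝ} {x : Eu n} (h0 : G x = 0)
    (hd : fderiv ℝ G x ≠ 0) : ∃ᶠ y in 𝓝 x, G y < 0 := by
  intro h
  refine hd (IsLocalMin.fderiv_eq_zero ?_)
  filter_upwards [h] with y hy
  rw [h0]; exact not_lt.1 hy

theorem IsPreconnected.sign_const {S : Set (Eu n)} (hS : IsPreconnected S) {H : Eu n → ℝ}
    (hc : ContinuousOn H S) (hne : ∀ y ∈ S, H y ≠ 0) : (∀ y ∈ S, 0 < H y) ∨ ∀ y ∈ S, H y < 0 := by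
  by_contra! h
  obtain ⟨⟨y, hy, hy0⟩, z, hz, hz0⟩ := h
  obtain ⟨w, hw, hw0⟩ := hS.intermediate_value hy hz hc ⟨hy0, hz0⟩
  exact hne w hw hw0

/-- Two regular defining functions of the same hypersurface have locally constant sign ratio. -/
theorem sign_dichotomy {G H : Eu n → ℝ} {x : Eu n} (hG : ContDiffAt ℝ ∞ G x) (hG0 : G x = 0)
    (hGd : fderiv ℝ G x ≠ 0) (hH : ContDiffAt ℝ ∞ H x) (hHd : fderiv ℝ H x ≠ 0)
    (hGH : ∀ᶠ y in 𝓝 x, G y = 0 ↔ H y = 0) :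
    (∀ᶠ y in 𝓝 x, G y ≠ 0 → 0 < G y * H y) ∨ ∀ᶠ y in 𝓝 x, G y ≠ 0 → G y * H y < 0 := by
  have hcont : ∀ᶠ y in 𝓝 x, ContinuousAt H y := by
    filter_upwards [hH.eventually_differentiableAt] with y hy using hy.continuousAt
  obtain ⟨W, hWo, hxW, hWV, hp, hm⟩ := exists_nhds_sides_preconnected hG hG0 hGd (hGH.and hcont)
  have hW : ∀ᶠ y in 𝓝 x, y ∈ W := hWo.mem_nhds hxW
  have hH0 : H x = 0 := (hGH.self_of_nhds).1 hG0
  have s1 := hp.sign_const (H := H) (fun y hy => (hWV hy.1).2.continuousWithinAt)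
    fun y hy h => (show 0 < G y from hy.2).ne' ((hWV hy.1).1.2 h)
  have s2 := hm.sign_const (H := H) (fun y hy => (hWV hy.1).2.continuousWithinAt)
    fun y hy h => (show G y < 0 from hy.2).ne ((hWV hy.1).1.2 h)
  rcases s1 with s1 | s1 <;> rcases s2 with s2 | s2
  · refine absurd hW (fun hW => frequently_neg_of_fderiv_ne_zero hH0 hHd ?_)
    filter_upwards [hW] with y hy
    rcases lt_trichotomy (G y) 0 with h | h | h
    · exact (s2 y ⟨hy, h⟩).not_gt
    · exact ((hWV hy).1.1 h).not_lt
    · exact (s1 y ⟨hy, h⟩).not_gt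
  · left
    filter_upwards [hW] with y hy hne
    rcases hne.lt_or_gt with h | h
    · exact mul_pos_of_neg_of_neg h (s2 y ⟨hy, h⟩)
    · exact mul_pos h (s1 y ⟨hy, h⟩)
  · right
    filter_upwards [hW] with y hy hne
    rcases hne.lt_or_gt with h | h
    · exact mul_neg_of_neg_of_pos h (s2 y ⟨hy, h⟩)
    · exact mul_neg_of_pos_of_neg h (s1 y ⟨hy, h⟩)
  · refine absurd hW (fun hW => frequently_pos_of_fderiv_ne_zero hH0 hHd ?_)
    filter_upwards [hW] with y hy
    rcases lt_trichotomy (G y) 0 with h | h | h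
    · exact (s2 y ⟨hy, h⟩).not_gt
    · exact ((hWV hy).1.1 h).not_gt
    · exact (s1 y ⟨hy, h⟩).not_gt

theorem units_int_mul_self_real (u : ℤˣ) : ((u : ℤ) : ℝ) * ((u : ℤ) : ℝ) = 1 := by
  rw [← Int.cast_mul, ← Units.val_mul, Int.units_mul_self]; simp

/-- A sign function on the complement of `c` that changes across `c`. -/
structure SideSign (c : Set (Eu n)) (σ : Eu n → ℤˣ) : Prop where
  eventually_eq : ∀ x, x ∉ c → ∀ᶠ y in 𝓝 x, σ y = σ x
  exists_chart : ∀ p ∈ c, ∃ (U : Set (Eu n)) (G : Eu n → ℝ), IsOpen U ∧ p ∈ U ∧ ContDiffOn ℝ ∞ G U ∧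
    (∀ y ∈ U, fderiv ℝ G y ≠ 0) ∧ (∀ y ∈ U, y ∈ c → G y = 0) ∧
    ∀ y ∈ U, y ∉ c → 0 < ((σ y : ℤ) : ℝ) * G y

theorem fderiv_const_mul_ne_zero {G : Eu n → ℝ} {y : Eu n} {a : ℝ} (ha : a ≠ 0)
    (h : fderiv ℝ G y ≠ 0) : fderiv ℝ (fun z => a * G z) y ≠ 0 := by
  have hd : DifferentiableAt ℝ G y := by
    by_contra hn; exact h (fderiv_zero_of_not_differentiableAt hn)
  rw [fderiv_const_mul hd]
  exact smul_ne_zero ha h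

theorem SideSign.neg {c : Set (Eu n)} {σ : Eu n → ℤˣ} (h : SideSign c σ) :
    SideSign c fun x => -σ x := by
  refine ⟨fun x hx => (h.eventually_eq x hx).mono fun y hy => by rw [hy], fun p hp => ?_⟩
  obtain ⟨U, G, h1, h2, h3, h4, h5, h6⟩ := h.exists_chart p hp
  refine ⟨U, fun y => -1 * G y, h1, h2, contDiffOn_const.mul h3, fun y hy => ?_, fun y hy hyc => ?_,
    fun y hy hyc => ?_⟩
  · exact fderiv_const_mul_ne_zero (by norm_num) (h4 y hy)
  · simp only [h5 y hy hyc, mul_zero]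
  · have := h6 y hy hyc
    push_cast
    linarith

theorem IsSmoothHypersurface.exists_sideSign {c : Set (Eu n)} (hc : IsClosed c)
    (h : IsSmoothHypersurface c) : ∃ σ, SideSign c σ := by
  classical
  choose! U F hU hxU hF hd hcU using h
  let B : Option c → Set (Eu n) := fun i => i.elim cᶜ fun p => U p
  let H : Option c → Eu n → ℝ := fun i => i.elim (fun _ => 1) fun p => F p
  have hB : ∀ i, IsOpen (B i) := by
    rintro (_ | p)
    · exact hc.isOpen_compl
    · exact hU p p.2
  have hH : ∀ i, ContDiffOn ℝ ∞ (H i) (B i) := by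
    rintro (_ | p)
    · exact contDiffOn_const
    · exact hF p p.2
  have hiff : ∀ p : c, ∀ y ∈ U p, F p y = 0 ↔ y ∈ c := by
    intro p y hy
    have := Set.ext_iff.1 (hcU p p.2) y
    simp only [mem_inter_iff, mem_ofPred_eq] at this
    tauto
  have hne : ∀ i, ∀ y ∈ B i, y ∉ c → H i y ≠ 0 := by
    rintro (_ | p) y hy hyc
    · exact one_ne_zero
    · exact fun h0 => hyc ((hiff p y hy).1 h0)
  have hfreq : ∀ x, ∃ᶠ y in 𝓝 x, y ∉ c := by
    intro x
    by_cases hx : x ∈ c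
    · have h1 := frequently_pos_of_fderiv_ne_zero ((hiff ⟨x, hx⟩ x (hxU x hx)).2 hx)
        (hd x hx x (hxU x hx))
      refine (h1.and_eventually ((hU x hx).mem_nhds (hxU x hx))).mono fun y hy hyc => ?_
      exact hy.1.ne' ((hiff ⟨x, hx⟩ y hy.2).2 hyc)
    · exact (show ∀ᶠ y in 𝓝 x, y ∈ cᶜ from hc.isOpen_compl.mem_nhds hx).frequently
  have hdich : ∀ i j, ∀ x ∈ B i ∩ B j, (∀ᶠ y in 𝓝 x, y ∉ c → 0 < H i y * H j y) ∨
      ∀ᶠ y in 𝓝 x, y ∉ c → H i y * H j y < 0 := by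
    intro i j x hx
    by_cases hxc : x ∈ c
    · rcases i with _ | p
      · exact absurd hxc hx.1
      rcases j with _ | q
      · exact absurd hxc hx.2
      have e1 : ∀ᶠ y in 𝓝 x, y ∈ U p := (hU p p.2).mem_nhds hx.1
      have e2 : ∀ᶠ y in 𝓝 x, y ∈ U q := (hU q q.2).mem_nhds hx.2
      have := sign_dichotomy ((hF p p.2).contDiffAt_of_isOpen (hU p p.2) hx.1)
        ((hiff p x hx.1).2 hxc) (hd p p.2 x hx.1)
        ((hF q q.2).contDiffAt_of_isOpen (hU q q.2) hx.2) (hd q q.2 x hx.2)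
        (by filter_upwards [e1, e2] with y h1 h2; rw [hiff p y h1, hiff q y h2])
      refine this.imp (fun h => ?_) fun h => ?_ <;>
      · filter_upwards [h, e1] with y h h1 hyc
        exact h fun h0 => hyc ((hiff p y h1).1 h0)
    · have hcont : ContinuousAt (fun y => H i y * H j y) x :=
        ((hH i).continuousOn.continuousAt ((hB i).mem_nhds hx.1)).mul
        ((hH j).continuousOn.continuousAt ((hB j).mem_nhds hx.2))
      rcases (mul_ne_zero (hne i x hx.1 hxc) (hne j x hx.2 hxc)).lt_or_gt with h | h
      · exact Or.inr ((hcont.eventually_lt_const h).mono fun _ h _ => h)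
      · exact Or.inl ((hcont.eventually_const_lt h).mono fun _ h _ => h)
  let ε : Option c → Option c → Eu n → ℤˣ := fun i j x =>
    if ∀ᶠ y in 𝓝 x, y ∉ c → 0 < H i y * H j y then 1 else -1
  have hε : ∀ i j, ∀ x ∈ B i ∩ B j, ∀ᶠ y in 𝓝 x, y ∉ c →
      0 < (((ε i j x : ℤˣ) : ℤ) : ℝ) * (H i y * H j y) := by
    intro i j x hx
    by_cases h : ∀ᶠ y in 𝓝 x, y ∉ c → 0 < H i y * H j y
    · simp only [ε, if_pos h]; simpa using h
    · simp only [ε, if_neg h]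
      filter_upwards [(hdich i j x hx).resolve_left h] with y hy hyc
      have := hy hyc
      push_cast; linarith
  have huniq : ∀ i j, ∀ x ∈ B i ∩ B j, ∀ u : ℤˣ,
      (∀ᶠ y in 𝓝 x, y ∉ c → 0 < ((u : ℤ) : ℝ) * (H i y * H j y)) → u = ε i j x := by
    intro i j x hx u hu
    obtain ⟨y, hyc, h1, h2⟩ := ((hfreq x).and_eventually (hu.and (hε i j x hx))).exists
    have h1 := h1 hyc
    have h2 := h2 hyc
    rcases Int.units_eq_one_or u with e1 | e1 <;> rcases Int.units_eq_one_or (ε i j x) with e2 | e2 <;>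
      rw [e1] at h1 ⊢ <;> rw [e2] at h2 ⊢ <;> push_cast at h1 h2 <;> linarith
  have e1 : ∀ i, ∀ x ∈ B i, ε i i x = 1 := by
    intro i x hx
    refine (huniq i i x ⟨hx, hx⟩ 1 ?_).symm
    filter_upwards [(hB i).mem_nhds hx] with y hy hyc
    have := mul_self_pos.2 (hne i y hy hyc)
    simpa using this
  have e2 : ∀ i j, ∀ x ∈ B i ∩ B j, ∀ᶠ y in 𝓝 x, ε i j y = ε i j x := by
    intro i j x hx
    filter_upwards [(hε i j x hx).eventually_nhds, (hB i).mem_nhds hx.1, (hB j).mem_nhds hx.2]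
      with y hy h1 h2
    exact (huniq i j y ⟨h1, h2⟩ _ hy).symm
  have e3 : ∀ i j k, ∀ x ∈ B i ∩ B j ∩ B k, ε j k x * ε i j x = ε i k x := by
    intro i j k x hx
    refine huniq i k x ⟨hx.1.1, hx.2⟩ _ ?_
    filter_upwards [hε i j x hx.1, hε j k x ⟨hx.1.2, hx.2⟩, (hB j).mem_nhds hx.1.2]
      with y h1 h2 h3 hyc
    have h4 := mul_pos (h1 hyc) (h2 hyc)
    have h5 := mul_self_pos.2 (hne j y h3 hyc)
    push_cast
    refine pos_of_mul_pos_left (lt_of_lt_of_eq h4 ?_) h5.le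
    ring
  obtain ⟨s, hs1, hs2⟩ := exists_sign_section B hB (fun x => by
    by_cases hx : x ∈ c
    · exact ⟨some ⟨x, hx⟩, hxU x hx⟩
    · exact ⟨none, hx⟩) ε e1 e2 e3
  refine ⟨s none, fun x hx => hs1 none x hx, fun p hp => ?_⟩
  have hp1 := hs1 (some ⟨p, hp⟩) p (hxU p hp)
  obtain ⟨V, hV, hVo, hpV⟩ := eventually_nhds_iff.1 hp1
  set u := s (some ⟨p, hp⟩) p with hu
  have hune : ((u : ℤ) : ℝ) ≠ 0 := by
    intro h0; have := units_int_mul_self_real u; rw [h0] at this; norm_num at this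
  refine ⟨U p ∩ V, fun y => ((u : ℤ) : ℝ) * F p y, (hU p hp).inter hVo, ⟨hxU p hp, hpV⟩,
    contDiffOn_const.mul ((hF p hp).mono inter_subset_left), fun y hy => ?_,
    fun y hy hyc => ?_, fun y hy hyc => ?_⟩
  · exact fderiv_const_mul_ne_zero hune (hd p hp y hy.1)
  · show ((u : ℤ) : ℝ) * F p y = 0
    rw [(hiff ⟨p, hp⟩ y hy.1).2 hyc, mul_zero]
  · have hyB : y ∈ B none ∩ B (some ⟨p, hp⟩) := ⟨hyc, hy.1⟩
    have h1 := (hε _ _ y hyB).self_of_nhds hyc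
    have h2 : u = ε none (some ⟨p, hp⟩) y * s none y := by
      rw [← hs2 none (some ⟨p, hp⟩) y hyB]; exact (hV y hy.2).symm
    have h3 := units_int_mul_self_real (s none y)
    rw [h2]
    have h1 : 0 < (((ε none (some ⟨p, hp⟩) y : ℤˣ) : ℤ) : ℝ) * (1 * F p y) := h1
    push_cast
    calc 0 < _ := h1
      _ = (((s none y : ℤˣ) : ℤ) : ℝ) * (((s none y : ℤˣ) : ℤ) : ℝ) *
        ((((ε none (some ⟨p, hp⟩) y : ℤˣ) : ℤ) : ℝ) * (1 * F p y)) := by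
          rw [h3]; ring
      _ = _ := by ring

theorem isPreconnected_lt_norm (hn : 2 ≤ n) {R : ℝ} (hR : 0 < R) :
    IsPreconnected {x : Eu n | R < ‖x‖} := by
  have h1 : 1 < Module.rank ℝ (Eu n) := by
    apply Module.one_lt_rank_of_one_lt_finrank
    rw [finrank_euclideanSpace_fin]; omega
  have h2 := (isConnected_compl_singleton_of_one_lt_rank h1 (0 : Eu n)).isPreconnected
  have h3 : ContinuousOn (fun x : Eu n => (R / ‖x‖ + 1) • x) {0}ᶜ := by
    refine ContinuousOn.fun_smul ?_ continuousOn_id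
    refine (continuousOn_const.div continuous_norm.continuousOn fun x hx => ?_).add continuousOn_const
    exact norm_ne_zero_iff.2 hx
  convert h2.image _ h3 using 1
  ext x
  simp only [mem_ofPred_eq, mem_image, mem_compl_iff, mem_singleton_iff]
  constructor
  · intro hx
    have hx0 : 0 < ‖x‖ := hR.trans hx
    have hd : 0 < ‖x‖ - R := sub_pos.2 hx
    refine ⟨((‖x‖ - R) / ‖x‖) • x, ?_, ?_⟩
    · exact smul_ne_zero (div_pos hd hx0).ne' (norm_pos_iff.1 hx0)
    · rw [norm_smul, smul_smul, Real.norm_of_nonneg (div_pos hd hx0).le, div_mul_cancel₀ _ hx0.ne']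
      have : (R / (‖x‖ - R) + 1) * ((‖x‖ - R) / ‖x‖) = 1 := by field_simp; ring
      rw [this, one_smul]
  · rintro ⟨y, hy, rfl⟩
    have hy0 : 0 < ‖y‖ := norm_pos_iff.2 hy
    rw [norm_smul, Real.norm_of_nonneg (by positivity), add_mul, div_mul_cancel₀ _ hy0.ne']
    linarith

theorem SideSign.const_on {c S : Set (Eu n)} {σ : Eu n → ℤˣ} (h : SideSign c σ)
    (hS : IsPreconnected S) (hSc : ∀ x ∈ S, x ∉ c) {x y : Eu n} (hx : x ∈ S) (hy : y ∈ S) :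
    σ x = σ y := by
  have : ContinuousOn (fun x => ((σ x : ℤˣ) : ℤ)) S := fun z hz =>
    ((continuousAt_const (y := ((σ z : ℤˣ) : ℤ))).congr
      ((h.eventually_eq z (hSc z hz)).mono fun w hw => by simp only [hw])).continuousWithinAt
  exact Units.ext (hS.constant this hx hy)

theorem SideSign.exists_neg_at_infinity (hn : 2 ≤ n) {c : Set (Eu n)} (hc : IsCompact c)
    {σ₀ : Eu n → ℤˣ} (h₀ : SideSign c σ₀) :
    ∃ σ, SideSign c σ ∧ ∃ R > 0, ∀ x, R < ‖x‖ → x ∉ c ∧ σ x = -1 := by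
  obtain ⟨R, hR, hcR⟩ := hc.isBounded.exists_pos_norm_le
  have hout : ∀ x, R < ‖x‖ → x ∉ c := fun x hx hxc => (hcR x hxc).not_gt hx
  have hconst : ∀ x y, R < ‖x‖ → R < ‖y‖ → σ₀ x = σ₀ y := fun x y hx hy =>
    h₀.const_on (isPreconnected_lt_norm hn hR) hout hx hy
  by_cases hex : ∃ x, R < ‖x‖ ∧ σ₀ x = 1
  · obtain ⟨x, hx, hx1⟩ := hex
    refine ⟨_, h₀.neg, R, hR, fun y hy => ⟨hout y hy, ?_⟩⟩
    simp only [hconst y x hy hx, hx1]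
  · push Not at hex
    exact ⟨σ₀, h₀, R, hR, fun y hy => ⟨hout y hy, (Int.units_eq_one_or _).resolve_left (hex y hy)⟩⟩

theorem IsTest.sum {ι : Type*} {U : Set (Eu n)} (t : Finset ι) {ψ : ι → Eu n → ℝ}
    (h : ∀ i ∈ t, IsTest U (ψ i)) : IsTest U fun x => ∑ i ∈ t, ψ i x := by
  classical
  induction t using Finset.induction_on with
  | empty =>
    have h0 : (fun x => ∑ i ∈ ∅, ψ i x) = 0 := by funext x; simp
    rw [h0]
    refine ⟨contDiff_const, HasCompactSupport.zero, ?_⟩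
    rw [tsupport_eq_empty_iff.2 rfl]; exact empty_subset _
  | insert a s ha ih =>
    simp only [Finset.sum_insert ha]
    exact (h a (Finset.mem_insert_self a s)).add
      (ih fun i hi => h i (Finset.mem_insert_of_mem hi))

theorem IsSmoothHypersurface.exists_defFn (hn : 2 ≤ n) {c : Set (Eu n)} (hc : IsCompact c)
    (h : IsSmoothHypersurface c) : ∃ F : Eu n → ℝ, DefFn F ∧ ∀ x, F x = 0 ↔ x ∈ c := by
  obtain ⟨σ₀, h₀⟩ := h.exists_sideSign hc.isClosed
  obtain ⟨σ, hσ, R, hR, hRσ⟩ := h₀.exists_neg_at_infinity hn hc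
  choose! U G hU hpU hG hd hG0 hGpos using hσ.exists_chart
  have hcut : ∀ p ∈ c, ∃ (χ : Eu n → ℝ) (V : Set (Eu n)), IsTest (U p) χ ∧ (∀ x, 0 ≤ χ x) ∧
      IsOpen V ∧ p ∈ V ∧ V ⊆ U p ∧ ∀ x ∈ V, χ x = 1 := by
    intro p hp
    obtain ⟨χ, h1, h2, -, V, h4, h5, h6, h7⟩ := exists_cutoff (isCompact_singleton (x := p))
      (hU p hp) (singleton_subset_iff.2 (hpU p hp))
    exact ⟨χ, V, h1, h2, h4, singleton_subset_iff.1 h5, h6, h7⟩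
  choose! χ V hχ hχ0 hV hpV hVU hχ1 using hcut
  obtain ⟨t, htc, hct⟩ := hc.elim_nhds_subcover V fun p hp => (hV p hp).mem_nhds (hpV p hp)
  have hWo : IsOpen (⋃ p ∈ t, V p) := isOpen_biUnion fun p hp => hV p (htc p hp)
  obtain ⟨η, hη, -, hη1, W, hWo, hcW, -, hηW⟩ := exists_cutoff hc hWo hct
  have hηV : ∀ x, η x = 0 ∨ ∃ p ∈ t, x ∈ V p := by
    intro x
    by_cases hx : η x = 0
    · exact Or.inl hx
    · have := hη.tsupport_subset (subset_tsupport η hx)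
      exact Or.inr (by simpa using this)
  let S : Eu n → ℝ := fun x => ∑ p ∈ t, χ p x * G p x
  have hS : IsTest univ S := (IsTest.sum t fun p hp =>
    ((hχ p (htc p hp)).mul_contDiffOn (hU p (htc p hp)) (hG p (htc p hp))).mono (subset_univ _))
  let E : Eu n → ℝ := fun x => (1 - η x) * ((σ x : ℤ) : ℝ) + 1
  have hE : ContDiff ℝ ∞ E := by
    refine contDiff_iff_contDiffAt.2 fun x => ?_
    by_cases hx : x ∈ c
    · refine (contDiffAt_const (c := (1 : ℝ))).congr_of_eventuallyEq ?_
      filter_upwards [hWo.mem_nhds (hcW hx)] with y hy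
      simp only [E, hηW y hy]; ring
    · have : ContDiffAt ℝ ∞ (fun y => (1 - η y) * ((σ x : ℤ) : ℝ) + 1) x :=
        ((contDiffAt_const.sub hη.contDiff.contDiffAt).mul contDiffAt_const).add contDiffAt_const
      refine this.congr_of_eventuallyEq ?_
      filter_upwards [hσ.eventually_eq x hx] with y hy
      simp only [E, hy]
  have hEs : HasCompactSupport E := by
    refine HasCompactSupport.intro
      ((isCompact_closedBall (0 : Eu n) R).union hη.hasCompactSupport) fun x hx => ?_
    rw [mem_union, not_or, mem_closedBall_zero_iff, not_le] at hx
    have h1 : η x = 0 := image_eq_zero_of_notMem_tsupport hx.2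
    simp only [E, h1, (hRσ x hx.1).2]; push_cast; ring
  have hterm : ∀ x, x ∉ c → ∀ p ∈ t, 0 ≤ ((σ x : ℤ) : ℝ) * (χ p x * G p x) := by
    intro x hx p hp
    by_cases hxU : x ∈ U p
    · have := mul_nonneg (hχ0 p (htc p hp) x) (hGpos p (htc p hp) x hxU hx).le
      linarith
    · have : χ p x = 0 := image_eq_zero_of_notMem_tsupport
        fun hh => hxU ((hχ p (htc p hp)).tsupport_subset hh)
      rw [this]; simp
  have hmul : ∀ x, ((σ x : ℤ) : ℝ) * (S x + (E x - 1)) =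
      ∑ p ∈ t, ((σ x : ℤ) : ℝ) * (χ p x * G p x) + (1 - η x) := by
    intro x
    have := units_int_mul_self_real (σ x)
    simp only [S, E]
    rw [mul_add, Finset.mul_sum]
    linear_combination (1 - η x) * this
  have hge : ∀ x, x ∉ c → ∀ p ∈ t, x ∈ V p →
      ((σ x : ℤ) : ℝ) * G p x ≤ ((σ x : ℤ) : ℝ) * (S x + (E x - 1)) := by
    intro x hx p hp hxV
    rw [hmul]
    have h1 := Finset.single_le_sum (f := fun p => ((σ x : ℤ) : ℝ) * (χ p x * G p x))
      (hterm x hx) hp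
    simp only [hχ1 p (htc p hp) x hxV, one_mul] at h1
    linarith [hη1 x]
  have hpos : ∀ x, x ∉ c → 0 < ((σ x : ℤ) : ℝ) * (S x + (E x - 1)) := by
    intro x hx
    rcases hηV x with h0 | ⟨p, hp, hxV⟩
    · rw [hmul, h0]
      linarith [Finset.sum_nonneg (hterm x hx)]
    · exact (hGpos p (htc p hp) x (hVU p (htc p hp) hxV) hx).trans_le (hge x hx p hp hxV)
  have hzero : ∀ x ∈ c, S x + (E x - 1) = 0 := by
    intro x hx
    have h1 : S x = 0 := Finset.sum_eq_zero fun p hp => by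
      by_cases hxU : x ∈ U p
      · rw [hG0 p (htc p hp) x hxU hx, mul_zero]
      · rw [image_eq_zero_of_notMem_tsupport
          fun hh => hxU ((hχ p (htc p hp)).tsupport_subset hh), zero_mul]
    have h2 : E x = 1 := by simp only [E, hηW x (hcW hx)]; ring
    rw [h1, h2]; ring
  have hiff : ∀ x, S x + (E x - 1) = 0 ↔ x ∈ c := fun x =>
    ⟨fun h0 => by_contra fun hx => by have := hpos x hx; rw [h0, mul_zero] at this; exact this.false,
      hzero x⟩
  refine ⟨fun x => S x + (E x - 1), ⟨?_, fun x hx hdx => ?_⟩, hiff⟩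
  · have : (fun x => S x + (E x - 1) + 1) = fun x => S x + E x := by funext x; ring
    rw [this]
    exact hS.add ⟨hE, hEs, subset_univ _⟩
  · have hxc := (hiff x).1 hx
    obtain ⟨p, hp, hxV⟩ : ∃ p ∈ t, x ∈ V p := by simpa using hct hxc
    have hpc := htc p hp
    have hxU := hVU p hpc hxV
    refine hd p hpc x hxU (HasFDerivAt.fderiv ?_)
    have hF : HasFDerivAt (fun x => S x + (E x - 1)) (0 : Eu n →L[ℝ] ℝ) x := by
      rw [← hdx]
      exact ((hS.contDiff.add (hE.sub contDiff_const)).differentiable (by simp) x).hasFDerivAt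
    rw [hasFDerivAt_iff_isLittleO] at hF ⊢
    refine Asymptotics.IsBigO.trans_isLittleO (Asymptotics.IsBigO.of_bound 1 ?_) hF
    filter_upwards [(hV p hpc).mem_nhds hxV] with y hy
    simp only [hzero x hxc, hG0 p hpc x hxU hxc, sub_zero, _root_.zero_apply, one_mul]
    by_cases hyc : y ∈ c
    · rw [hG0 p hpc y (hVU p hpc hy) hyc]; simp
    · have h1 := hge y hyc p hp hy
      have h2 := hGpos p hpc y (hVU p hpc hy) hyc
      have h3 : ∀ r : ℝ, ‖((σ y : ℤ) : ℝ) * r‖ = ‖r‖ := by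
        intro r
        rcases Int.units_eq_one_or (σ y) with e | e <;> rw [e] <;> simp
      rw [← h3, ← h3 (S y + (E y - 1)), Real.norm_of_nonneg h2.le,
        Real.norm_of_nonneg (h2.le.trans h1)]
      exact h1

/-- The positive side of a connected regular hypersurface is connected. -/
theorem isPreconnected_pos_of_zero {G : Eu n → ℝ} (hG : ContDiff ℝ ∞ G)
    (hd : ∀ x, G x = 0 → fderiv ℝ G x ≠ 0) (hc : IsPreconnected {x | G x = 0}) :
    IsPreconnected {x | 0 < G x} := by
  have hPo : IsOpen {x | 0 < G x} := isOpen_lt continuous_const hG.continuous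
  have key : ∀ A B : Set (Eu n), IsOpen A → IsOpen B → {x | 0 < G x} ⊆ A ∪ B →
      ({x | 0 < G x} ∩ A).Nonempty → ({x | 0 < G x} ∩ B).Nonempty →
      ¬ ({x | 0 < G x} ∩ (A ∩ B)).Nonempty →
      ¬ ∀ x, G x = 0 → ∃ W, IsOpen W ∧ x ∈ W ∧ W ∩ {y | 0 < G y} ⊆ A := by
    intro A B hA hB hAB ⟨a, haP, haA⟩ hBn hn hall
    have hcl : IsClopen ({x | 0 < G x} ∩ B) := by
      refine ⟨isClosed_of_closure_subset fun x hx => ?_, hPo.inter hB⟩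
      have hx := _root_.mem_closure_iff.1 hx
      rcases lt_trichotomy (G x) 0 with h0 | h0 | h0
      · obtain ⟨y, hy, hyP, -⟩ := hx {y | G y < 0} (isOpen_lt hG.continuous continuous_const) h0
        exact absurd (show 0 < G y from hyP) (not_lt.2 (le_of_lt hy))
      · obtain ⟨W, hW, hxW, hWA⟩ := hall x h0
        obtain ⟨y, hy, hyP, hyB⟩ := hx W hW hxW
        exact absurd ⟨y, hyP, hWA ⟨hy, hyP⟩, hyB⟩ hn
      · refine ⟨h0, (hAB h0).resolve_left fun hxA => ?_⟩
        obtain ⟨y, hy, hyP, hyB⟩ := hx A hA hxA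
        exact hn ⟨y, hyP, hy, hyB⟩
    have : a ∈ {x | 0 < G x} ∩ B := by rw [hcl.eq_univ hBn]; trivial
    exact hn ⟨a, haP, haA, this.2⟩
  intro A B hA hB hAB hAn hBn
  by_contra hn
  let O : Set (Eu n) → Set (Eu n) := fun A => ⋃₀ {W | IsOpen W ∧ W ∩ {y | 0 < G y} ⊆ A}
  have hO : ∀ A, IsOpen (O A) := fun A => isOpen_sUnion fun W hW => hW.1
  have hcov : {x | G x = 0} ⊆ O A ∪ O B := by
    intro x hx
    obtain ⟨W, hW, hxW, -, hWp, -⟩ := exists_nhds_sides_preconnected hG.contDiffAt hx (hd x hx)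
      univ_mem
    have hsub : W ∩ {y | 0 < G y} ⊆ A ∪ B := inter_subset_right.trans hAB
    rcases isPreconnected_iff_subset_of_disjoint.1 hWp A B hA hB hsub
      (by
        rw [eq_empty_iff_forall_notMem]
        exact fun y hy => hn ⟨y, hy.1.2, hy.2⟩) with h | h
    · exact Or.inl ⟨W, ⟨hW, h⟩, hxW⟩
    · exact Or.inr ⟨W, ⟨hW, h⟩, hxW⟩
  have hdis : {x | G x = 0} ∩ (O A ∩ O B) = ∅ := by
    rw [eq_empty_iff_forall_notMem]
    rintro x ⟨hx, ⟨W, ⟨hW, hWA⟩, hxW⟩, W', ⟨hW', hWB⟩, hxW'⟩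
    obtain ⟨y, hy, hy1, hy2⟩ := ((frequently_pos_of_fderiv_ne_zero hx (hd x hx)).and_eventually
      ((hW.eventually_mem hxW).and (hW'.eventually_mem hxW'))).exists
    exact hn ⟨y, hy, hWA ⟨hy1, hy⟩, hWB ⟨hy2, hy⟩⟩
  rcases isPreconnected_iff_subset_of_disjoint.1 hc _ _ (hO A) (hO B) hcov hdis with h | h
  · refine key A B hA hB hAB hAn hBn hn fun x hx => ?_
    obtain ⟨W, hW, hxW⟩ := h hx
    exact ⟨W, hW.1, hxW, hW.2⟩
  · refine key B A hB hA (by rwa [union_comm]) hBn hAn (by rwa [inter_comm B A]) fun x hx => ?_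
    obtain ⟨W, hW, hxW⟩ := h hx
    exact ⟨W, hW.1, hxW, hW.2⟩

namespace DefFn
variable {F : Eu n → ℝ}

theorem isPreconnected_pos (hF : DefFn F) (hc : IsPreconnected {x | F x = 0}) :
    IsPreconnected {x | 0 < F x} :=
  isPreconnected_pos_of_zero hF.contDiff hF.regular hc

theorem isPreconnected_nonpos (hF : DefFn F) (hc : IsPreconnected {x | F x = 0}) :
    IsPreconnected {x | F x ≤ 0} := by
  have h1 : IsPreconnected {x | 0 < -F x} := by
    refine isPreconnected_pos_of_zero hF.contDiff.neg (fun x hx => ?_) (by simpa using hc)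
    rw [fderiv_fun_neg]
    exact neg_ne_zero.2 (hF.regular x (by linarith))
  refine h1.subset_closure (fun x (hx : 0 < -F x) => show F x ≤ 0 by linarith) fun x hx => ?_
  rcases lt_or_eq_of_le (show F x ≤ 0 from hx) with h | h
  · exact subset_closure (show 0 < -F x by linarith)
  · rw [mem_closure_iff_frequently]
    exact (frequently_neg_of_fderiv_ne_zero h (hF.regular x h)).mono fun y hy =>
      show 0 < -F y by linarith

theorem isPreconnected_lt (hF : DefFn F) (hc : IsPreconnected {x | F x = 0}) {m θ : ℝ}
    (hm : 0 < m) (hshell : ∀ x, 0 ≤ F x → F x ≤ m → m ≤ ∑ i, pd i F x ^ 2) (hθ : 0 < θ)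
    (hθm : θ ≤ m) : IsPreconnected {x | F x < θ} := by
  have key : ∀ A B : Set (Eu n), IsOpen A → IsOpen B → {x | F x < θ} ⊆ A ∪ B →
      ({x | F x < θ} ∩ B).Nonempty → ¬ ({x | F x < θ} ∩ (A ∩ B)).Nonempty →
      ¬ {x | F x ≤ 0} ⊆ A := by
    intro A B hA hB hAB ⟨y₀, hy₀, hyB⟩ hn hsub
    have hcont := hF.contDiff.continuous
    have hK : IsCompact ({x | F x ≤ F y₀} ∩ Aᶜ) := by
      refine (hF.isCompact 0 (by norm_num)).of_isClosed_subset
        ((isClosed_le hcont continuous_const).inter hA.isClosed_compl) fun x hx => ?_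
      by_contra h
      exact hx.2 (hsub (show F x ≤ 0 from le_of_lt (not_le.1 h)))
    obtain ⟨z, hz, hmin⟩ := hK.exists_isMinOn
      ⟨y₀, le_refl (F y₀), fun h => hn ⟨y₀, hy₀, h, hyB⟩⟩ hcont.continuousOn
    have hy₀θ : F y₀ < θ := hy₀
    have hzle : F z ≤ F y₀ := hz.1
    have hzθ : F z < θ := hzle.trans_lt hy₀θ
    have hzB : z ∈ B := (hAB (show F z < θ from hzθ)).resolve_left hz.2
    have hloc : IsLocalMin F z := by
      filter_upwards [hB.mem_nhds hzB, (isOpen_lt hcont continuous_const).mem_nhds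
        (show z ∈ {x | F x < θ} from hzθ)] with y hy1 hy2
      rcases le_total (F y) (F y₀) with h | h
      · exact hmin ⟨h, fun hyA => hn ⟨y, hy2, hyA, hy1⟩⟩
      · exact hzle.trans h
    have h0 : 0 ≤ F z := by
      by_contra h
      exact hz.2 (hsub (show F z ≤ 0 from le_of_lt (not_le.1 h)))
    have := hshell z h0 (hzθ.le.trans hθm)
    rw [show (∑ i, pd i F z ^ 2) = 0 from Finset.sum_eq_zero fun i _ => by
      rw [pd, hloc.fderiv_eq_zero]; simp] at this
    linarith
  intro A B hA hB hAB hAn hBn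
  by_contra hn
  have hsub : {x | F x ≤ 0} ⊆ {x | F x < θ} := fun x (hx : F x ≤ 0) => hx.trans_lt hθ
  rcases isPreconnected_iff_subset_of_disjoint.1 (hF.isPreconnected_nonpos hc) A B hA hB
    (hsub.trans hAB) (by
      rw [eq_empty_iff_forall_notMem]
      exact fun y hy => hn ⟨y, hsub hy.1, hy.2⟩) with h | h
  · exact key A B hA hB hAB hBn hn h
  · exact key B A hB hA (by rwa [union_comm]) hAn (by rwa [inter_comm B A]) h

end DefFn

section SmoothInverse
variable {E : Type*} [NormedAddCommGroup E] [NormedSpace ℝ E] [FiniteDimensional ℝ E]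

theorem mem_range_equiv_of_ker {L : E →L[ℝ] E} (h : ∀ v, L v = 0 → v = 0) :
    L ∈ range ((↑) : (E ≃L[ℝ] E) → E →L[ℝ] E) := by
  have hinj : Function.Injective L.toLinearMap := by
    rw [← LinearMap.ker_eq_bot, LinearMap.ker_eq_bot']
    exact h
  exact ⟨(LinearEquiv.ofInjectiveEndo L.toLinearMap hinj).toContinuousLinearEquiv, by ext; rfl⟩

theorem exists_smooth_inverse {H : E → E} {W : Set E} (hW : IsOpen W) (hH : ContDiffOn ℝ ∞ H W)
    (hinj : InjOn H W) (hd : ∀ x ∈ W, ∀ v, fderiv ℝ H x v = 0 → v = 0) :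
    IsOpen (H '' W) ∧ ∃ I : E → E, ContDiffOn ℝ ∞ I (H '' W) ∧ ∀ x ∈ W, I (H x) = x := by
  have hI : ∀ x ∈ W, Function.invFunOn H W (H x) = x := fun x hx => hinj.leftInvOn_invFunOn hx
  have key : ∀ x ∈ W, H '' W ∈ 𝓝 (H x) ∧ ContDiffAt ℝ ∞ (Function.invFunOn H W) (H x) := by
    intro x hx
    obtain ⟨L, hL⟩ := mem_range_equiv_of_ker (hd x hx)
    have hHx : ContDiffAt ℝ ∞ H x := (hH x hx).contDiffAt (hW.mem_nhds hx)
    have hf : HasFDerivAt H (L : E →L[ℝ] E) x := by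
      rw [hL]; exact (hHx.differentiableAt (by simp)).hasFDerivAt
    have hs := hHx.hasStrictFDerivAt' hf (by simp)
    have hmem : H '' W ∈ 𝓝 (H x) := by
      rw [← hs.map_nhds_eq_of_equiv]
      exact image_mem_map (hW.mem_nhds hx)
    refine ⟨hmem, (hHx.to_localInverse hf (by simp)).congr_of_eventuallyEq ?_⟩
    have hc : ContinuousAt (hHx.localInverse hf (by simp)) (H x) :=
      (hHx.to_localInverse hf (by simp)).continuousAt
    have h1 : ∀ᶠ y in 𝓝 (H x), hHx.localInverse hf (by simp) y ∈ W := by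
      apply hc
      rw [hHx.localInverse_apply_image]
      exact hW.mem_nhds hx
    filter_upwards [h1, hs.eventually_right_inverse] with y hy1 hy2
    have hy2 : H (hHx.localInverse hf (by simp) y) = y := hy2
    conv_lhs => rw [← hy2]
    exact hI _ hy1
  refine ⟨isOpen_iff_mem_nhds.2 ?_, _, ?_, hI⟩
  · rintro _ ⟨x, hx, rfl⟩; exact (key x hx).1
  · rintro _ ⟨x, hx, rfl⟩; exact (key x hx).2.contDiffWithinAt

theorem exists_isOpen_injOn {H : E → E} (hH : ContDiff ℝ ∞ H) {s : Set E} (hs : IsCompact s)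
    (hinj : InjOn H s) (hd : ∀ x ∈ s, ∀ v, fderiv ℝ H x v = 0 → v = 0) :
    ∃ W, IsOpen W ∧ s ⊆ W ∧ InjOn H W ∧ ∀ x ∈ W, ∀ v, fderiv ℝ H x v = 0 → v = 0 := by
  obtain ⟨W, hW, hsW, hWi⟩ := hinj.exists_isOpen_superset hs
    (fun x _ => hH.continuous.continuousAt) fun x hx => by
      obtain ⟨L, hL⟩ := mem_range_equiv_of_ker (hd x hx)
      have hf : HasFDerivAt H (L : E →L[ℝ] E) x := by
        rw [hL]; exact (hH.differentiable (by simp) x).hasFDerivAt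
      let Θ := hH.contDiffAt.toOpenPartialHomeomorph H hf (by simp)
      exact ⟨Θ.source, Θ.open_source.mem_nhds
        (hH.contDiffAt.mem_toOpenPartialHomeomorph_source hf (by simp)), Θ.injOn⟩
  refine ⟨W ∩ fderiv ℝ H ⁻¹' range ((↑) : (E ≃L[ℝ] E) → E →L[ℝ] E),
    hW.inter (ContinuousLinearEquiv.isOpen.preimage (hH.continuous_fderiv (by simp))),
    fun x hx => ⟨hsW hx, mem_range_equiv_of_ker (hd x hx)⟩, hWi.mono inter_subset_left, ?_⟩
  rintro x ⟨-, L, hL⟩ v hv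
  rw [← hL] at hv
  exact L.map_eq_zero_iff.1 hv

end SmoothInverse

/-- A tubular neighbourhood of `{F = 0}` along the gradient of `F`. -/
structure Collar (F : Eu n → ℝ) (N : Set (Eu n)) (b : Eu n → Eu n) (t : Eu n → ℝ) (δ : ℝ) :
    Prop where
  isOpen : IsOpen N
  pos : 0 < δ
  base_contDiffOn : ContDiffOn ℝ ∞ b N
  height_contDiffOn : ContDiffOn ℝ ∞ t N
  base_zero : ∀ y ∈ N, F (b y) = 0
  abs_height_lt : ∀ y ∈ N, |t y| < δ
  eq : ∀ y ∈ N, b y + t y • gradient F (b y) = y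
  mem : ∀ p s, F p = 0 → |s| < δ → p + s • gradient F p ∈ N
  base_eq : ∀ p s, F p = 0 → |s| < δ → b (p + s • gradient F p) = p
  height_eq : ∀ p s, F p = 0 → |s| < δ → t (p + s • gradient F p) = s

theorem DefFn.exists_collar {F : Eu n → ℝ} (hF : DefFn F) : ∃ N b t δ, Collar F N b t δ := by
  have he := hF.contDiff.gradient_infty
  let H : Eu n × ℝ → Eu n × ℝ := fun z => (z.1 + z.2 • gradient F z.1, F z.1)
  have hH : ContDiff ℝ ∞ H := (contDiff_fst.add (contDiff_snd.smul (he.comp contDiff_fst))).prodMk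
    (hF.contDiff.comp contDiff_fst)
  have hc : IsCompact {x | F x = 0} :=
    (hF.isCompact 0 (by norm_num)).of_isClosed_subset
      (isClosed_eq hF.contDiff.continuous continuous_const) fun x (hx : F x = 0) => hx.ge
  have hder : ∀ p v s, fderiv ℝ H (p, (0 : ℝ)) (v, s) = (v + s • gradient F p, fderiv ℝ F p v) := by
    intro p v s
    have h1 : HasFDerivAt (fun z : Eu n × ℝ => gradient F z.1)
        ((fderiv ℝ (gradient F) p).comp (ContinuousLinearMap.fst ℝ (Eu n) ℝ)) (p, (0 : ℝ)) :=
      HasFDerivAt.comp (g := gradient F) (f := Prod.fst) (p, (0 : ℝ))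
        (he.differentiable (by simp) p).hasFDerivAt hasFDerivAt_fst
    have h2 : HasFDerivAt (fun z : Eu n × ℝ => F z.1)
        ((fderiv ℝ F p).comp (ContinuousLinearMap.fst ℝ (Eu n) ℝ)) (p, (0 : ℝ)) :=
      HasFDerivAt.comp (p, (0 : ℝ)) (hF.contDiff.differentiable (by simp) p).hasFDerivAt
        hasFDerivAt_fst
    have h3 : HasFDerivAt H _ (p, (0 : ℝ)) :=
      (hasFDerivAt_fst.add (hasFDerivAt_snd.smul h1)).prodMk h2
    rw [h3.fderiv]
    simp
  obtain ⟨W, hW, hsW, hWi, hWd⟩ := exists_isOpen_injOn hH (hc.prod (isCompact_singleton (x := (0 : ℝ))))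
    (by
      rintro ⟨p, s⟩ ⟨-, hs⟩ ⟨q, r⟩ ⟨-, hr⟩ hpq
      have hs : s = 0 := hs
      have hr : r = 0 := hr
      subst hs hr
      have : p + (0 : ℝ) • gradient F p = q + (0 : ℝ) • gradient F q := congrArg Prod.fst hpq
      simpa using this)
    (by
      rintro ⟨p, s⟩ ⟨hp, hs⟩ ⟨v, r⟩ hv
      have hs : s = 0 := hs
      have hp : F p = 0 := hp
      subst hs
      rw [hder, Prod.mk_eq_zero] at hv
      have hvr : v = -(r • gradient F p) := eq_neg_of_add_eq_zero_left hv.1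
      have h2 := hv.2
      rw [hvr, map_neg, map_smul, fderiv_gradient_self, norm_gradient, smul_eq_mul, neg_eq_zero,
        mul_eq_zero] at h2
      have hr : r = 0 := h2.resolve_right
        (pow_ne_zero 2 (norm_ne_zero_iff.2 (hF.regular p hp)))
      rw [hvr, hr]; simp)
  obtain ⟨hHW, I, hI, hIH⟩ := exists_smooth_inverse hW hH.contDiffOn hWi hWd
  obtain ⟨u, v, hu, hv, hcu, h0v, huv⟩ := generalized_tube_lemma hc isCompact_singleton hW hsW
  obtain ⟨δ, hδ, hδv⟩ := Metric.isOpen_iff.1 hv 0 (h0v rfl)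
  have hT : ∀ p s, F p = 0 → |s| < δ → (p, s) ∈ W := fun p s hp hs =>
    huv ⟨hcu hp, hδv (by simpa using hs)⟩
  have hHT : ∀ p s, F p = 0 → H (p, s) = (p + s • gradient F p, 0) := fun p s hp => by
    simp only [H, hp]
  let j : Eu n → Eu n × ℝ := fun y => (y, 0)
  have hj : ContDiff ℝ ∞ j := contDiff_id.prodMk contDiff_const
  have hIj : ContDiffOn ℝ ∞ (fun y => I (j y)) (j ⁻¹' (H '' W)) :=
    hI.comp hj.contDiffOn fun y hy => hy
  have hO : IsOpen (j ⁻¹' (H '' W)) := hHW.preimage hj.continuous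
  have hIT : ∀ p s, F p = 0 → |s| < δ → I (j (p + s • gradient F p)) = (p, s) := by
    intro p s hp hs
    have := hIH _ (hT p s hp hs)
    rwa [hHT p s hp] at this
  have hmem : ∀ p s, F p = 0 → |s| < δ → j (p + s • gradient F p) ∈ H '' W := fun p s hp hs =>
    ⟨(p, s), hT p s hp hs, hHT p s hp⟩
  have heq : ∀ y, j y ∈ H '' W → F (I (j y)).1 = 0 ∧
      (I (j y)).1 + (I (j y)).2 • gradient F (I (j y)).1 = y := by
    rintro y ⟨z, hz, hzy⟩
    rw [← hzy, hIH z hz]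
    exact ⟨congrArg Prod.snd hzy, congrArg Prod.fst hzy⟩
  refine ⟨j ⁻¹' (H '' W) ∩ {y | |(I (j y)).2| < δ}, fun y => (I (j y)).1,
    fun y => (I (j y)).2, δ, ?_, hδ, ?_, ?_, fun y hy => (heq y hy.1).1, fun y hy => hy.2,
    fun y hy => (heq y hy.1).2, fun p s hp hs => ⟨hmem p s hp hs, ?_⟩,
    fun p s hp hs => ?_, fun p s hp hs => ?_⟩
  · have : ContinuousOn (fun y => |(I (j y)).2|) (j ⁻¹' (H '' W)) :=
      (continuous_abs.comp continuous_snd).comp_continuousOn hIj.continuousOn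
    exact this.isOpen_inter_preimage hO (isOpen_Iio (a := δ))
  · exact (contDiff_fst.comp_contDiffOn hIj).mono inter_subset_left
  · exact (contDiff_snd.comp_contDiffOn hIj).mono inter_subset_left
  · show |(I (j (p + s • gradient F p))).2| < δ
    rw [hIT p s hp hs]; exact hs
  · simp only [hIT p s hp hs]
  · simp only [hIT p s hp hs]

/-- A compactly supported family of diffeomorphisms of the line moving `0` to `S`. -/
theorem exists_fiber_push {δ : ℝ} (hδ : 0 < δ) : ∃ (χ : ℝ → ℝ) (κ : ℝ) (θ : ℝ → ℝ → ℝ),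
    0 < κ ∧ κ ≤ δ / 2 ∧ ContDiff ℝ ∞ χ ∧ χ 0 = 1 ∧ (∀ s, |χ s| ≤ 1) ∧
    (∀ s, δ / 2 ≤ |s| → χ s = 0) ∧
    ContDiffOn ℝ ∞ (fun z : ℝ × ℝ => θ z.1 z.2) {z | |z.2| < κ} ∧
    ∀ S, |S| < κ → ∀ s, θ (s + χ s * S) S = s ∧ θ s S + χ (θ s S) * S = s := by
  let χ : ContDiffBump (0 : ℝ) := ⟨δ / 4, δ / 2, by positivity, by linarith⟩
  have hχ : ContDiff ℝ ∞ (χ : ℝ → ℝ) := χ.contDiff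
  have hχ1 : ∀ s, |χ s| ≤ 1 := fun s => by rw [abs_of_nonneg χ.nonneg]; exact χ.le_one
  obtain ⟨B, hB⟩ := (χ.hasCompactSupport.deriv (𝕜 := ℝ)).exists_bound_of_continuous
    (hχ.continuous_deriv (by simp))
  have hB0 : 0 ≤ B := (norm_nonneg _).trans (hB 0)
  have hlip : ∀ s r, |χ s - χ r| ≤ B * |s - r| := fun s r => by
    simpa using Convex.norm_image_sub_le_of_norm_deriv_le (f := χ) (s := univ) (x := r) (y := s)
      (fun x _ => hχ.differentiable (by simp) x) (fun x _ => hB x) convex_univ trivial trivial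
  set κ : ℝ := min (δ / 2) (1 / (B + 1)) with hκ
  have hκ0 : 0 < κ := by positivity
  have hκB : ∀ S, |S| < κ → B * |S| < 1 := by
    intro S hS
    have h1 : |S| < 1 / (B + 1) := hS.trans_le (min_le_right _ _)
    rw [lt_div_iff₀ (by positivity)] at h1
    nlinarith [abs_nonneg S]
  let W : Set (ℝ × ℝ) := {z | |z.2| < κ}
  have hW : IsOpen W := isOpen_lt (continuous_abs.comp continuous_snd) continuous_const
  let H : ℝ × ℝ → ℝ × ℝ := fun z => (z.1 + χ z.1 * z.2, z.2)
  have hH : ContDiff ℝ ∞ H :=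
    (contDiff_fst.add ((hχ.comp contDiff_fst).mul contDiff_snd)).prodMk contDiff_snd
  have hinj : InjOn H W := by
    rintro ⟨s, S⟩ hS ⟨r, R⟩ hR h
    obtain rfl : S = R := congrArg Prod.snd h
    have h1 : s + χ s * S = r + χ r * S := congrArg Prod.fst h
    have h2 : s - r = -((χ s - χ r) * S) := by linarith
    have h3 : |s - r| ≤ (B * |S|) * |s - r| := by
      conv_lhs => rw [h2, abs_neg, abs_mul]
      calc |χ s - χ r| * |S| ≤ B * |s - r| * |S| := by gcongr; exact hlip s r
        _ = _ := by ring
    have h4 : |s - r| = 0 := by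
      by_contra hne
      have : 0 < |s - r| := lt_of_le_of_ne (abs_nonneg _) (Ne.symm hne)
      nlinarith [hκB S hS]
    rw [sub_eq_zero.1 (abs_eq_zero.1 h4)]
  have hder : ∀ z ∈ W, ∀ v, fderiv ℝ H z v = 0 → v = 0 := by
    rintro ⟨s, S⟩ hS ⟨v, r⟩ hv
    have h1 : HasFDerivAt (fun z : ℝ × ℝ => χ z.1)
        ((ContinuousLinearMap.toSpanSingleton ℝ (deriv χ s)).comp (ContinuousLinearMap.fst ℝ ℝ ℝ)) (s, S) :=
      HasFDerivAt.comp (g := χ) (f := Prod.fst) (s, S)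
        (hχ.differentiable (by simp) s).hasDerivAt.hasFDerivAt hasFDerivAt_fst
    have h2 : HasFDerivAt H _ (s, S) :=
      (hasFDerivAt_fst.add (h1.mul hasFDerivAt_snd)).prodMk hasFDerivAt_snd
    rw [h2.fderiv] at hv
    simp at hv
    obtain ⟨h3, rfl⟩ := hv
    have h4 : v * (1 + S * deriv χ s) = 0 := by linear_combination h3
    have h5 : |S * deriv χ s| < 1 := by
      rw [abs_mul, mul_comm]
      refine lt_of_le_of_lt ?_ (hκB S hS)
      exact mul_le_mul_of_nonneg_right (hB s) (abs_nonneg _)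
    have h6 := (mul_eq_zero.1 h4).resolve_right (by have := (abs_lt.1 h5).1; linarith)
    rw [h6]; rfl
  obtain ⟨-, I, hI, hIH⟩ := exists_smooth_inverse hW hH.contDiffOn hinj hder
  have hsurj : ∀ z ∈ W, z ∈ H '' W := by
    rintro ⟨y, S⟩ hS
    have hcont : Continuous fun s => s + χ s * S := continuous_id.add (hχ.continuous.mul continuous_const)
    have hb : ∀ s, |χ s * S| ≤ |S| := fun s => by
      rw [abs_mul]; exact mul_le_of_le_one_left (abs_nonneg _) (hχ1 s)
    obtain ⟨s, -, hs⟩ := intermediate_value_Icc (show y - |S| ≤ y + |S| by linarith [abs_nonneg S])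
      hcont.continuousOn (show y ∈ Icc _ _ from
        ⟨by linarith [(abs_le.1 (hb (y - |S|))).2], by linarith [(abs_le.1 (hb (y + |S|))).1]⟩)
    exact ⟨(s, S), hS, Prod.ext hs rfl⟩
  refine ⟨χ, κ, fun y S => (I (y, S)).1, hκ0, min_le_left _ _, hχ, ?_, hχ1, fun s hs => ?_, ?_,
    fun S hS s => ⟨?_, ?_⟩⟩
  · exact χ.one_of_mem_closedBall (by simp; positivity)
  · exact χ.zero_of_le_dist (by simpa using hs)
  · exact contDiff_fst.comp_contDiffOn (hI.mono hsurj)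
  · exact congrArg Prod.fst (hIH (s, S) hS)
  · obtain ⟨⟨r, R⟩, hz, hzy⟩ := hsurj (s, S) hS
    obtain rfl : R = S := congrArg Prod.snd hzy
    have h1 : r + χ r * R = s := congrArg Prod.fst hzy
    show (I (s, R)).1 + χ (I (s, R)).1 * R = s
    rw [← hzy, hIH _ hz]
    exact h1

theorem contDiff_of_eq_self_off {K N : Set (Eu n)} {f : Eu n → Eu n} (hK : IsClosed K)
    (hN : IsOpen N) (hKN : K ⊆ N) (hf : ContDiffOn ℝ ∞ f N) (hfK : ∀ x, x ∉ K → f x = x) :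
    ContDiff ℝ ∞ f := by
  refine contDiff_iff_contDiffAt.2 fun x => ?_
  by_cases hx : x ∈ K
  · exact (hf x (hKN hx)).contDiffAt (hN.mem_nhds (hKN hx))
  · refine contDiffAt_id.congr_of_eventuallyEq ?_
    filter_upwards [hK.isOpen_compl.mem_nhds hx] with y hy
    exact hfK y hy

theorem Collar.exists_diffeo {F : Eu n → ℝ} (hF : DefFn F) {N : Set (Eu n)} {b : Eu n → Eu n}
    {t : Eu n → ℝ} {δ : ℝ} (h : Collar F N b t δ) : ∃ κ : ℝ, 0 < κ ∧ ∀ S : Eu n → ℝ,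
    ContDiffOn ℝ ∞ S N → (∀ y ∈ N, |S y| < κ) →
    (∀ p s, F p = 0 → |s| < δ → S (p + s • gradient F p) = S p) →
    ∃ Ψ Φ : Eu n → Eu n, ContDiff ℝ ∞ Ψ ∧ ContDiff ℝ ∞ Φ ∧ Function.LeftInverse Φ Ψ ∧
      Function.RightInverse Φ Ψ ∧ ∀ p, F p = 0 → Ψ p = p + S p • gradient F p := by
  classical
  obtain ⟨χ, κ, θ, hκ, hκδ, hχ, hχ0, hχ1, hχδ, hθ, hθχ⟩ := exists_fiber_push h.pos
  refine ⟨κ, hκ, fun S hS hSκ hSb => ?_⟩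
  have hδ := h.pos
  have he := hF.contDiff.gradient_infty
  have heb : ContDiffOn ℝ ∞ (fun y => gradient F (b y)) N := he.comp_contDiffOn h.base_contDiffOn
  have hpush : ∀ u v : ℝ, |v| < κ → |u| < δ → |u + χ u * v| < δ := by
    intro u v hv hu
    by_cases h2 : δ / 2 ≤ |u|
    · rw [hχδ u h2]; simpa using hu
    · have h3 : |χ u * v| ≤ |v| := by
        rw [abs_mul]; exact mul_le_of_le_one_left (abs_nonneg _) (hχ1 u)
      linarith [abs_add_le u (χ u * v)]
  have hpull : ∀ u v : ℝ, |v| < κ → |u| < δ → |θ u v| < δ := by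
    intro u v hv hu
    by_cases h2 : δ / 2 ≤ |θ u v|
    · have := (hθχ v hv u).2
      rw [hχδ _ h2, zero_mul, add_zero] at this
      rwa [this]
    · linarith
  let K : Set (Eu n) := (fun z : Eu n × ℝ => z.1 + z.2 • gradient F z.1) ''
    ({p | F p = 0} ×ˢ Icc (-(δ / 2)) (δ / 2))
  have hc : IsCompact {x | F x = 0} :=
    (hF.isCompact 0 (by norm_num)).of_isClosed_subset
      (isClosed_eq hF.contDiff.continuous continuous_const) fun x (hx : F x = 0) => hx.ge
  have hK : IsClosed K := ((hc.prod isCompact_Icc).image (continuous_fst.add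
    (continuous_snd.smul (he.continuous.comp continuous_fst)))).isClosed
  have hKN : K ⊆ N := by
    rintro _ ⟨⟨p, s⟩, ⟨hp, hs⟩, rfl⟩
    refine h.mem p s hp ?_
    have := abs_le.2 hs
    linarith
  have hoff : ∀ y ∈ N, y ∉ K → δ / 2 ≤ |t y| := by
    intro y hy hyK
    by_contra hlt
    have := abs_lt.1 (not_le.1 hlt)
    exact hyK ⟨(b y, t y), ⟨h.base_zero y hy, this.1.le, this.2.le⟩, h.eq y hy⟩
  let A : (ℝ → ℝ → ℝ) → Eu n → Eu n := fun g y =>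
    if y ∈ N then b y + g (t y) (S y) • gradient F (b y) else y
  have hAsmooth : ∀ g : ℝ → ℝ → ℝ, ContDiffOn ℝ ∞ (fun z : ℝ × ℝ => g z.1 z.2) {z | |z.2| < κ} →
      (∀ u v, |v| < κ → δ / 2 ≤ |u| → g u v = u) → ContDiff ℝ ∞ (A g) := by
    intro g hg hgo
    refine contDiff_of_eq_self_off hK h.isOpen hKN ?_ fun y hy => ?_
    · have h1 : ContDiffOn ℝ ∞ (fun y => g (t y) (S y)) N :=
        hg.comp (h.height_contDiffOn.prodMk hS) fun y hy => hSκ y hy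
      refine (h.base_contDiffOn.add (h1.smul heb)).congr fun y hy => ?_
      simp only [A, if_pos hy]; rfl
    · by_cases hyN : y ∈ N
      · simp only [A, if_pos hyN]
        rw [hgo _ _ (hSκ y hyN) (hoff y hyN hy), h.eq y hyN]
      · simp only [A, if_neg hyN]
  have hAcomp : ∀ g g' : ℝ → ℝ → ℝ, (∀ u v, |v| < κ → |u| < δ → |g u v| < δ) →
      (∀ u v, |v| < κ → g' (g u v) v = u) → ∀ y, A g' (A g y) = y := by
    intro g g' h1 h2 y
    by_cases hy : y ∈ N
    · have hb := h.base_zero y hy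
      have hg := h1 (t y) (S y) (hSκ y hy) (h.abs_height_lt y hy)
      have hSy : S (b y + g (t y) (S y) • gradient F (b y)) = S y := by
        rw [hSb _ _ hb hg]
        conv_rhs => rw [← h.eq y hy]
        exact (hSb _ _ hb (h.abs_height_lt y hy)).symm
      have e1 : A g y = b y + g (t y) (S y) • gradient F (b y) := by simp only [A, if_pos hy]
      have e2 := h.mem _ _ hb hg
      rw [e1]
      simp only [A, if_pos e2]
      rw [h.base_eq _ _ hb hg, h.height_eq _ _ hb hg, hSy, h2 _ _ (hSκ y hy), h.eq y hy]
    · simp only [A, if_neg hy]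
  let g₀ : ℝ → ℝ → ℝ := fun u v => u + χ u * v
  refine ⟨A g₀, A θ, hAsmooth g₀ ?_ ?_, hAsmooth θ hθ ?_, hAcomp g₀ θ hpush ?_,
    hAcomp θ g₀ hpull ?_, fun p hp => ?_⟩
  · exact (contDiff_fst.add ((hχ.comp contDiff_fst).mul contDiff_snd)).contDiffOn
  · intro u v _ hu; simp only [g₀]; rw [hχδ u hu, zero_mul, add_zero]
  · intro u v hv hu
    have := (hθχ v hv u).1
    rwa [hχδ u hu, zero_mul, add_zero] at this
  · exact fun u v hv => (hθχ v hv u).1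
  · exact fun u v hv => (hθχ v hv u).2
  · have h0 : |(0 : ℝ)| < δ := by simpa using hδ
    have e0 : p + (0 : ℝ) • gradient F p = p := by simp
    have e1 := h.mem p 0 hp h0
    have e2 := h.base_eq p 0 hp h0
    have e3 := h.height_eq p 0 hp h0
    rw [e0] at e1 e2 e3
    simp only [A, g₀, if_pos e1]
    rw [e2, e3, hχ0]; simp

theorem hasDerivAt_line {v : Eu n → ℝ} (hv : ContDiff ℝ ∞ v) (p e : Eu n) (s : ℝ) :
    HasDerivAt (fun s : ℝ => v (p + s • e)) (fderiv ℝ v (p + s • e) e) s := by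
  have h1 : HasDerivAt (fun s : ℝ => p + s • e) e s := by
    simpa using ((hasDerivAt_id s).smul_const e).const_add p
  exact (hv.differentiable (by simp) (p + s • e)).hasFDerivAt.comp_hasDerivAt s h1

/-- A function that increases across a collar vanishes there along a smooth graph. -/
theorem Collar.exists_graph {F : Eu n → ℝ} (hF : DefFn F) {N : Set (Eu n)} {b : Eu n → Eu n}
    {t : Eu n → ℝ} {δ : ℝ} (h : Collar F N b t δ) {v : Eu n → ℝ} (hv : ContDiff ℝ ∞ v) {τ₁ τ₂ : ℝ}
    (hτ : τ₁ < τ₂) (hneg : ∀ p, F p = 0 → v (p + τ₁ • gradient F p) < 0)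
    (hpos : ∀ p, F p = 0 → 0 < v (p + τ₂ • gradient F p))
    (hder : ∀ p τ, F p = 0 → τ ∈ Icc τ₁ τ₂ →
      0 < fderiv ℝ v (p + τ • gradient F p) (gradient F p)) :
    ∃ S : Eu n → ℝ, ContDiffOn ℝ ∞ S N ∧ (∀ y ∈ N, S y ∈ Ioo τ₁ τ₂) ∧
      (∀ p s, F p = 0 → |s| < δ → S (p + s • gradient F p) = S p) ∧
      (∀ p, F p = 0 → v (p + S p • gradient F p) = 0) ∧
      ∀ p τ, F p = 0 → τ ∈ Icc τ₁ τ₂ → v (p + τ • gradient F p) = 0 → τ = S p := by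
  have he := hF.contDiff.gradient_infty
  have hmono : ∀ p, F p = 0 → StrictMonoOn (fun s : ℝ => v (p + s • gradient F p)) (Icc τ₁ τ₂) := by
    intro p hp
    refine strictMonoOn_of_deriv_pos (convex_Icc _ _)
      (fun s _ => (hasDerivAt_line hv p _ s).continuousAt.continuousWithinAt) fun s hs => ?_
    rw [(hasDerivAt_line hv p _ s).deriv]
    exact hder p s hp (interior_subset hs)
  have hex : ∀ p, F p = 0 → ∃ s ∈ Ioo τ₁ τ₂, v (p + s • gradient F p) = 0 := by
    intro p hp
    have := intermediate_value_Ioo hτ.le (f := fun s : ℝ => v (p + s • gradient F p))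
      (fun s _ => (hasDerivAt_line hv p _ s).continuousAt.continuousWithinAt)
    obtain ⟨s, hs, hs0⟩ := this ⟨hneg p hp, hpos p hp⟩
    exact ⟨s, hs, hs0⟩
  choose! s₀ hs₀ hvs₀ using hex
  have h00 : |(0 : ℝ)| < δ := by simpa using h.pos
  have hb : ∀ p, F p = 0 → b p = p := fun p hp => by simpa using h.base_eq p 0 hp h00
  refine ⟨fun y => s₀ (b y), ?_, fun y hy => hs₀ _ (h.base_zero y hy), fun p s hp hs => ?_,
    fun p hp => ?_, fun p τ hp hτ h0 => ?_⟩
  · let W : Set (Eu n × ℝ) := N ×ˢ Ioo τ₁ τ₂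
    have hW : IsOpen W := h.isOpen.prod isOpen_Ioo
    let H : Eu n × ℝ → Eu n × ℝ := fun z => (z.1, v (b z.1 + z.2 • gradient F (b z.1)))
    have hb1 : ContDiffOn ℝ ∞ (fun z : Eu n × ℝ => b z.1) W :=
      h.base_contDiffOn.comp contDiff_fst.contDiffOn fun z hz => hz.1
    have hH : ContDiffOn ℝ ∞ H W := contDiff_fst.contDiffOn.prodMk
      (hv.comp_contDiffOn (hb1.add (contDiff_snd.contDiffOn.smul (he.comp_contDiffOn hb1))))
    have hinj : InjOn H W := by
      rintro ⟨x, s⟩ ⟨hx, hs⟩ ⟨y, r⟩ ⟨hy, hr⟩ hxy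
      obtain rfl : x = y := congrArg Prod.fst hxy
      have := (hmono _ (h.base_zero x hx)).injOn (Ioo_subset_Icc_self hs) (Ioo_subset_Icc_self hr)
        (congrArg Prod.snd hxy)
      exact Prod.ext rfl this
    have hd : ∀ z ∈ W, ∀ w, fderiv ℝ H z w = 0 → w = 0 := by
      rintro ⟨x, s⟩ ⟨hx, hs⟩ ⟨w, r⟩ hw
      have hx : x ∈ N := hx
      have hs : s ∈ Ioo τ₁ τ₂ := hs
      have e1 : DifferentiableAt ℝ b x :=
        ((h.base_contDiffOn x hx).contDiffAt (h.isOpen.mem_nhds hx)).differentiableAt (by simp)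
      have e2 : HasFDerivAt (fun z : Eu n × ℝ => b z.1)
          ((fderiv ℝ b x).comp (ContinuousLinearMap.fst ℝ (Eu n) ℝ)) (x, s) :=
        HasFDerivAt.comp (g := b) (f := Prod.fst) (x, s) e1.hasFDerivAt hasFDerivAt_fst
      have e3 : HasFDerivAt (fun z : Eu n × ℝ => gradient F (b z.1))
          ((fderiv ℝ (gradient F) (b x)).comp ((fderiv ℝ b x).comp
            (ContinuousLinearMap.fst ℝ (Eu n) ℝ))) (x, s) :=
        HasFDerivAt.comp (g := gradient F) (f := fun z : Eu n × ℝ => b z.1) (x, s)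
          (he.differentiable (by simp) _).hasFDerivAt e2
      have e4 := e2.add (hasFDerivAt_snd.smul e3)
      have e5 : HasFDerivAt (fun z : Eu n × ℝ => v (b z.1 + z.2 • gradient F (b z.1))) _ (x, s) :=
        HasFDerivAt.comp (g := v) (x, s) (hv.differentiable (by simp) _).hasFDerivAt e4
      have e6 : HasFDerivAt H _ (x, s) := hasFDerivAt_fst.prodMk e5
      rw [e6.fderiv] at hw
      have hw1 : w = 0 := congrArg Prod.fst hw
      have hw2 := congrArg Prod.snd hw
      subst hw1
      simp at hw2
      have := hw2.resolve_right (hder _ s (h.base_zero x hx) (Ioo_subset_Icc_self hs)).ne'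
      rw [this]; rfl
    obtain ⟨-, I, hI, hIH⟩ := exists_smooth_inverse hW hH hinj hd
    have key : ∀ y ∈ N, (y, (0 : ℝ)) ∈ H '' W ∧ I (y, 0) = (y, s₀ (b y)) := by
      intro y hy
      have h1 : (y, s₀ (b y)) ∈ W := ⟨hy, hs₀ _ (h.base_zero y hy)⟩
      have h2 : H (y, s₀ (b y)) = (y, 0) := Prod.ext rfl (hvs₀ _ (h.base_zero y hy))
      exact ⟨⟨_, h1, h2⟩, by rw [← h2, hIH _ h1]⟩
    refine (contDiff_snd.comp_contDiffOn (hI.comp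
      (contDiff_id.prodMk contDiff_const).contDiffOn fun y hy => (key y hy).1)).congr fun y hy => ?_
    exact (congrArg Prod.snd (key y hy).2).symm
  · simp only [h.base_eq p s hp hs, hb p hp]
  · simp only [hb p hp]; exact hvs₀ p hp
  · simp only [hb p hp]
    exact (hmono p hp).injOn hτ (Ioo_subset_Icc_self (hs₀ p hp)) (h0.trans (hvs₀ p hp).symm)

theorem eq_connectedComponentIn_of_isOpen {X : Type*} [TopologicalSpace X] {C Z O : Set X} {x : X}
    (hC : IsPreconnected C) (hcl : IsClosed C) (hO : IsOpen O) (hCO : C = Z ∩ O) (hx : x ∈ C) :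
    C = connectedComponentIn Z x := by
  have hCZ : C ⊆ Z := by rw [hCO]; exact inter_subset_left
  refine (hC.subset_connectedComponentIn hx hCZ).antisymm ?_
  have hD := connectedComponentIn_subset Z x
  rcases isPreconnected_iff_subset_of_disjoint.1 (isPreconnected_connectedComponentIn (F := Z) (x := x))
    O Cᶜ hO hcl.isOpen_compl (fun y hy => by
      by_cases hyC : y ∈ C
      · rw [hCO] at hyC; exact Or.inl hyC.2
      · exact Or.inr hyC) (by
      rw [eq_empty_iff_forall_notMem]
      rintro y ⟨hy, hyO, hyC⟩
      exact hyC (by rw [hCO]; exact ⟨hD hy, hyO⟩)) with h | h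
  · rw [hCO]; exact fun y hy => ⟨hD hy, h hy⟩
  · exact absurd hx (h (mem_connectedComponentIn (hCZ hx)))

theorem exists_helm_zero_component (hn : 2 ≤ n) {c : Set (Eu n)} (hc : IsCompact c)
    (hconn : IsConnected c) (hs : IsSmoothHypersurface c) :
    ∃ (μ : ℝ) (v : Eu n → ℝ) (Ψ Φ : Eu n → Eu n), 0 < μ ∧ Helm μ univ v ∧ ContDiff ℝ ∞ Ψ ∧
      ContDiff ℝ ∞ Φ ∧ Function.LeftInverse Φ Ψ ∧ Function.RightInverse Φ Ψ ∧
      (∃ x₀ ∈ v ⁻¹' {0}, Ψ '' c = connectedComponentIn (v ⁻¹' {0}) x₀) ∧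
      ∀ y ∈ Ψ '' c, fderiv ℝ v y ≠ 0 := by
  have : NeZero n := ⟨by omega⟩
  obtain ⟨F, hF, hFc⟩ := hs.exists_defFn hn hc
  obtain rfl : {x | F x = 0} = c := ext hFc
  obtain ⟨p₀, hp₀⟩ := hconn.nonempty
  have hp₀ : F p₀ = 0 := hp₀
  have hpre := hconn.isPreconnected
  obtain ⟨m, hm, hshell⟩ := hF.exists_shell
  obtain ⟨Λ, hΛ, -, hlip, -, hgrad⟩ := hF.exists_lipschitz
  obtain ⟨M, hM, c₁, hc₁, c₂, hc₂, hres⟩ := hF.exists_resonant (hF.isPreconnected_pos hpre)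
    (frequently_pos_of_fderiv_ne_zero hp₀ (hF.regular p₀ hp₀)).exists
  obtain ⟨c₄, hc₄, C, hC, τ₀, hτ₀, hslope⟩ := hF.exists_boundary_slope M c₁ c₂ hM hc₁ hc₂
  obtain ⟨N, b, t, δ, hcol⟩ := hF.exists_collar
  obtain ⟨κ, hκ, hdiffeo⟩ := hcol.exists_diffeo hF
  have hδ := hcol.pos
  set T : ℝ := min τ₀ (min δ κ) with hT
  have hT0 : 0 < T := by positivity
  obtain ⟨μ, a, f, hμ, hμM, ha, haε, hf, hfb⟩ := hres (min (c₄ * T / 2) (4 * C * m / c₄))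
    (by positivity)
  have haT : a < c₄ * T / 2 := haε.trans_le (min_le_left _ _)
  have ham : a < 4 * C * m / c₄ := haε.trans_le (min_le_right _ _)
  have hsl := hslope μ a f hμM hf hfb
  have hc₄C : c₄ ≤ C := by
    obtain ⟨-, h1, h2, -⟩ := hsl p₀ hp₀ τ₀ hτ₀ le_rfl
    exact le_of_mul_le_mul_right (h1.trans h2) hτ₀
  set τ₁ : ℝ := a / (2 * C) with hτ₁
  set τ₂ : ℝ := 2 * a / c₄ with hτ₂
  have hτ₁0 : 0 < τ₁ := by positivity
  have hCτ₁ : C * τ₁ = a / 2 := by rw [hτ₁]; field_simp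
  have hcτ₂ : c₄ * τ₂ = 2 * a := by rw [hτ₂]; field_simp
  have hτ₂T : τ₂ < T := by
    have : c₄ * τ₂ < c₄ * T := by linarith
    exact lt_of_mul_lt_mul_left this hc₄.le
  have hτ₁₂ : τ₁ < τ₂ := by
    have h1 : c₄ * τ₁ ≤ C * τ₁ := by gcongr
    have : c₄ * τ₁ < c₄ * τ₂ := by linarith
    exact lt_of_mul_lt_mul_left this hc₄.le
  have hτ₂0 : 0 < τ₂ := hτ₁0.trans hτ₁₂
  have hT1 : T ≤ τ₀ := min_le_left _ _
  have hT2 : T ≤ δ := (min_le_right _ _).trans (min_le_left _ _)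
  have hT3 : T ≤ κ := (min_le_right _ _).trans (min_le_right _ _)
  set θ : ℝ := c₄ * τ₁ / 2 with hθ
  have hθ0 : 0 < θ := by positivity
  have hθm : θ ≤ m := by
    have h1 : θ = a * c₄ / (4 * C) := by rw [hθ, hτ₁]; field_simp; norm_num
    rw [h1, div_le_iff₀ (by positivity)]
    rw [lt_div_iff₀ hc₄] at ham
    linarith
  have hK := hF.isCompact θ (by linarith)
  obtain ⟨v, hv, hvf⟩ := exists_global_approx_fderiv (0 : Fin n) hf hK
    (fun x (hx : θ ≤ F x) => show 0 < F x by linarith)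
    (by
      have : {x | θ ≤ F x}ᶜ = {x | F x < θ} := by
        ext x; simp only [mem_compl_iff, mem_ofPred_eq, not_le]
      rw [this]
      exact hF.isPreconnected_lt hpre hm hshell hθ0 hθm)
    (show 0 < θ / Λ by positivity) (K' := {x | 2 * θ ≤ F x})
    (fun x (hx : 2 * θ ≤ F x) y hy => by
      have h1 := hlip x y
      rw [mem_closedBall_iff_norm, le_div_iff₀ hΛ] at hy
      have h2 := (abs_le.1 h1).1
      show θ ≤ F y
      linarith)
    (show 0 < min (a / 4) (c₄ / (2 * Λ)) by positivity)
  have hvs : ContDiff ℝ ∞ v := contDiffOn_univ.1 hv.contDiffOn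
  have hmem : ∀ p τ, F p = 0 → τ₁ ≤ τ → τ ≤ τ₂ → 2 * θ ≤ F (p + τ • gradient F p) := by
    intro p τ hp h1 h2
    have h3 := (hsl p hp τ (hτ₁0.trans_le h1) (h2.trans (hτ₂T.le.trans hT1))).1
    have h4 : c₄ * τ₁ ≤ c₄ * τ := by gcongr
    linarith
  have hderpos : ∀ p τ, F p = 0 → τ ∈ Icc τ₁ τ₂ →
      0 < fderiv ℝ v (p + τ • gradient F p) (gradient F p) := by
    intro p τ hp hτ
    have h1 := (hsl p hp τ (hτ₁0.trans_le hτ.1) (hτ.2.trans (hτ₂T.le.trans hT1))).2.2.2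
    have h2 := (hvf _ (hmem p τ hp hτ.1 hτ.2)).2
    have h3 : ‖fderiv ℝ f (p + τ • gradient F p) - fderiv ℝ v (p + τ • gradient F p)‖ ≤
      c₄ / (2 * Λ) := h2.trans (min_le_right _ _)
    have h4 := ContinuousLinearMap.le_of_opNorm_le_of_le _ h3 (hgrad p)
    have h5 : c₄ / (2 * Λ) * Λ = c₄ / 2 := by field_simp
    rw [h5, _root_.sub_apply, Real.norm_eq_abs] at h4
    linarith [(abs_le.1 h4).2]
  obtain ⟨S, hS, hSmem, hSb, hS0, hSu⟩ := hcol.exists_graph hF hvs hτ₁₂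
    (fun p hp => by
      have h1 := (hsl p hp τ₁ hτ₁0 (hτ₁₂.le.trans (hτ₂T.le.trans hT1))).2.2.1
      have h2 := (hvf _ (hmem p τ₁ hp le_rfl hτ₁₂.le)).1.trans (min_le_left _ _)
      linarith [(abs_le.1 h2).1])
    (fun p hp => by
      have h1 := (hsl p hp τ₂ hτ₂0 (hτ₂T.le.trans hT1)).2.1
      have h2 := (hvf _ (hmem p τ₂ hp hτ₁₂.le le_rfl)).1.trans (min_le_left _ _)
      linarith [(abs_le.1 h2).2])
    hderpos
  have hSpos : ∀ y ∈ N, |S y| < T := fun y hy => by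
    rw [abs_of_pos (hτ₁0.trans (hSmem y hy).1)]; exact (hSmem y hy).2.trans hτ₂T
  obtain ⟨Ψ, Φ, hΨ, hΦ, hl, hr, hΨc⟩ := hdiffeo S hS (fun y hy => (hSpos y hy).trans_le hT3) hSb
  have hcN : ∀ p, F p = 0 → p ∈ N := fun p hp => by
    simpa using hcol.mem p 0 hp (by simpa using hδ)
  have hSδ : ∀ p, F p = 0 → |S p| < δ := fun p hp => (hSpos p (hcN p hp)).trans_le hT2
  have hOo : IsOpen (N ∩ t ⁻¹' Ioo τ₁ τ₂) :=
    hcol.height_contDiffOn.continuousOn.isOpen_inter_preimage hcol.isOpen isOpen_Ioo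
  have hCO : Ψ '' {x | F x = 0} = v ⁻¹' {0} ∩ (N ∩ t ⁻¹' Ioo τ₁ τ₂) := by
    ext y
    constructor
    · rintro ⟨p, hp, rfl⟩
      have hp : F p = 0 := hp
      rw [hΨc p hp]
      refine ⟨hS0 p hp, hcol.mem p _ hp (hSδ p hp), ?_⟩
      rw [mem_preimage, hcol.height_eq p _ hp (hSδ p hp)]
      exact hSmem p (hcN p hp)
    · rintro ⟨hy0, hyN, hyt⟩
      have hb := hcol.base_zero y hyN
      refine ⟨b y, hb, ?_⟩
      have h1 := hSu (b y) (t y) hb (Ioo_subset_Icc_self hyt) (by rw [hcol.eq y hyN]; exact hy0)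
      rw [hΨc _ hb, ← h1, hcol.eq y hyN]
  refine ⟨μ, v, Ψ, Φ, hμ, hv, hΨ, hΦ, hl, hr, ⟨Ψ p₀, ?_, ?_⟩, ?_⟩
  · rw [hΨc p₀ hp₀]; exact hS0 p₀ hp₀
  · exact eq_connectedComponentIn_of_isOpen (hpre.image _ hΨ.continuous.continuousOn)
      (hc.image hΨ.continuous).isClosed hOo hCO (mem_image_of_mem Ψ hp₀)
  · rintro _ ⟨p, hp, rfl⟩ h0
    have hp : F p = 0 := hp
    have h1 := hderpos p (S p) hp (Ioo_subset_Icc_self (hSmem p (hcN p hp)))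
    rw [← hΨc p hp, h0] at h1
    exact h1.false

theorem laplacian_comp_smul {v : Eu n → ℝ} (a : ℝ) (x : Eu n) :
    laplacian (fun y => v (a • y)) x = a ^ 2 * laplacian v (a • x) := by
  simp only [laplacian, Finset.mul_sum]
  refine Finset.sum_congr rfl fun i _ => ?_
  have h : ∀ y, fderiv ℝ (fun y => v (a • y)) y (EuclideanSpace.single i 1) =
      a • fderiv ℝ v (a • y) (EuclideanSpace.single i 1) := fun y => by
    rw [fderiv_comp_smul]; rfl
  simp only [h]
  have h2 := fderiv_comp_smul (𝕜 := ℝ) (f := fun z => fderiv ℝ v z (EuclideanSpace.single i 1))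
    (x := x) a
  change fderiv ℝ (a • fun y => fderiv ℝ v (a • y) (EuclideanSpace.single i 1)) x _ = _
  rw [fderiv_const_smul_field, Pi.smul_apply, h2]
  simp only [_root_.smul_apply, smul_eq_mul]
  ring
end

theorem stmt12 (n : ℕ) (hn : 2 ≤ n) (c : Set (EuclideanSpace ℝ (Fin n)))
    (hc : IsCompact c) (hconn : IsConnected c) (hhyp : IsSmoothHypersurface c) :
    ∃ lam : ℝ, 0 < lam ∧
      ∃ f : EuclideanSpace ℝ (Fin n) → ℝ, ContDiff ℝ (⊤ : ℕ∞) f ∧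
        (∀ x : EuclideanSpace ℝ (Fin n), laplacian f x + f x = 0) ∧
        ∃ Ψ Φ : EuclideanSpace ℝ (Fin n) → EuclideanSpace ℝ (Fin n),
          ContDiff ℝ (⊤ : ℕ∞) Ψ ∧ ContDiff ℝ (⊤ : ℕ∞) Φ ∧
          Function.LeftInverse Φ Ψ ∧ Function.RightInverse Φ Ψ ∧
          (∃ x₀ ∈ f ⁻¹' {0},
            Ψ '' ((fun y => lam • y) '' c) = connectedComponentIn (f ⁻¹' {0}) x₀) ∧
          ∀ y ∈ Ψ '' ((fun y => lam • y) '' c), fderiv ℝ f y ≠ 0 := by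
  obtain ⟨μ, v, Ψ, Φ, hμ, hv, hΨ, hΦ, hl, hr, ⟨x₀, hx₀, hcomp⟩, hne⟩ :=
    exists_helm_zero_component hn hc hconn hhyp
  have hk : 0 < √μ := Real.sqrt_pos.2 hμ
  set k := √μ with hkdef
  have hkμ : k ^ 2 = μ := Real.sq_sqrt hμ.le
  have hvs := contDiffOn_univ.1 hv.contDiffOn
  have himg : (fun y => k • Ψ y) '' c = (fun y => k • y) '' (Ψ '' c) := by
    rw [Set.image_image]
  have hpre : (fun y => k • y) '' (v ⁻¹' {0}) = (fun x => v (k⁻¹ • x)) ⁻¹' {0} := by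
    ext x
    constructor
    · rintro ⟨y, hy, rfl⟩
      simpa [inv_smul_smul₀ hk.ne'] using hy
    · exact fun hx => ⟨k⁻¹ • x, hx, smul_inv_smul₀ hk.ne' x⟩
  refine ⟨1, one_pos, fun x => v (k⁻¹ • x), hvs.comp (contDiff_const_smul _), fun x => ?_,
    fun x => k • Ψ x, fun y => Φ (k⁻¹ • y), contDiff_const_smul k |>.comp hΨ,
    hΦ.comp (contDiff_const_smul _), fun x => ?_, fun y => ?_, ⟨k • x₀, ?_, ?_⟩, ?_⟩
  · rw [laplacian_comp_smul]
    have h := hv.eq_zero (k⁻¹ • x) (Set.mem_univ _)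
    have h1 : laplacian v (k⁻¹ • x) = -(k ^ 2 * v (k⁻¹ • x)) := by rw [hkμ]; linarith
    rw [h1]
    field_simp
    ring
  · simp only [inv_smul_smul₀ hk.ne', hl x]
  · simp only [hr _, smul_inv_smul₀ hk.ne']
  · rw [← hpre]; exact ⟨x₀, hx₀, rfl⟩
  · simp only [one_smul, Set.image_id']
    rw [himg, hcomp, ← hpre]
    exact (Homeomorph.smulOfNeZero k hk.ne').image_connectedComponentIn hx₀
  · simp only [one_smul, Set.image_id']
    rw [himg]
    rintro _ ⟨z, hz, rfl⟩
    rw [fderiv_comp_smul, inv_smul_smul₀ hk.ne']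
    exact smul_ne_zero (inv_ne_zero hk.ne') (hne z hz)
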